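/- For fixed σ with 0 < σ < 1/2 one has ∫₁^T |G(σ+it)|² dt ≪ T^{2−2σ} log T. -/

import Mathlib

open Complex Real MeasureTheory Set Filter

noncomputable section

/-- The multiplicity of `ρ` as a zero of the Riemann zeta function
(the order of vanishing, i.e. the least `n` with `ζ⁽ⁿ⁾(ρ) ≠ 0`). -/
def zetaMult (ρ : ℂ) : ℕ := sInf {n : ℕ | iteratedDeriv n riemannZeta ρ ≠ 0}

/-- `ρ` is a nontrivial zero of the Riemann zeta function. -/
def IsNontrivialZero (ρ : ℂ) : Prop := riemannZeta ρ = 0 ∧ 0 < ρ.re ∧ ρ.re < 1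

/-- Gaussian smoothing inequality. -/
theorem lintegral_mul_mul_le_of_even_weight {a : ℝ → ENNReal} {w : ℝ → ENNReal} (ha : AEMeasurable a)
    (hw : Measurable w) :
    ∫⁻ u, ∫⁻ v, a u * a v * w (u - v) ≤ (∫⁻ x, w x) * ∫⁻ u, a u ^ 2 := by
  have key : ∀ x y : ENNReal, x * y ≤ 2⁻¹ * (x ^ 2 + y ^ 2) := by
    intro x y
    have h2 : 2 * (x * y) ≤ x ^ 2 + y ^ 2 := by
      rcases le_total x y with h | h <;>
      · by_cases hx : x = ⊤
        · subst hx; simp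
        by_cases hy : y = ⊤
        · subst hy; simp
        lift x to NNReal using hx
        lift y to NNReal using hy
        norm_cast
        rw [← NNReal.coe_le_coe]; push_cast
        nlinarith [sq_nonneg ((x:ℝ) - y)]
    calc x * y = 2⁻¹ * (2 * (x * y)) := by
          rw [← mul_assoc, ENNReal.inv_mul_cancel] <;> simp
      _ ≤ _ := by gcongr
  have e1 : ∫⁻ u, ∫⁻ v, a u ^ 2 * w (u - v) = (∫⁻ x, w x) * ∫⁻ u, a u ^ 2 := by
    have : ∀ u, ∫⁻ v, a u ^ 2 * w (u - v) = a u ^ 2 * ∫⁻ x, w x := by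
      intro u
      rw [lintegral_const_mul _ (by fun_prop), lintegral_sub_left_eq_self]
    simp_rw [this]
    rw [lintegral_mul_const'' _ (by fun_prop), mul_comm]
  have hm : AEMeasurable (fun p : ℝ × ℝ => a p.2 ^ 2 * w (p.1 - p.2)) (volume.prod volume) := by
    refine AEMeasurable.mul ?_ (hw.comp (by fun_prop)).aemeasurable
    exact (ha.pow_const 2).comp_snd
  have e2 : ∫⁻ u, ∫⁻ v, a v ^ 2 * w (u - v) = (∫⁻ x, w x) * ∫⁻ u, a u ^ 2 := by
    rw [lintegral_lintegral_swap hm]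
    have : ∀ v, ∫⁻ u, a v ^ 2 * w (u - v) = a v ^ 2 * ∫⁻ x, w x := by
      intro u
      rw [lintegral_const_mul _ (by fun_prop), lintegral_sub_right_eq_self]
    simp_rw [this]
    rw [lintegral_mul_const'' _ (by fun_prop), mul_comm]
  calc ∫⁻ u, ∫⁻ v, a u * a v * w (u - v) 
      ≤ ∫⁻ u, ∫⁻ v, (2⁻¹ * (a u ^ 2 * w (u - v)) + 2⁻¹ * (a v ^ 2 * w (u - v))) := by
        gcongr with u v
        calc _ ≤ 2⁻¹ * (a u ^ 2 + a v ^ 2) * w (u - v) := mul_le_mul_left (key _ _) _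
          _ = _ := by ring
    _ = ∫⁻ u, (2⁻¹ * (∫⁻ v, a u ^ 2 * w (u - v)) + 2⁻¹ * ∫⁻ v, (a v ^ 2 * w (u - v))) := by
        congr 1; ext u
        rw [lintegral_add_left (by fun_prop), lintegral_const_mul' 2⁻¹ _ (by simp),
          lintegral_const_mul' 2⁻¹ (fun v => a v ^ 2 * w (u - v)) (by simp)]
    _ = 2⁻¹ * (∫⁻ u, ∫⁻ v, a u ^ 2 * w (u - v)) + 2⁻¹ * ∫⁻ u, ∫⁻ v, (a v ^ 2 * w (u - v)) := by
        rw [lintegral_add_right' _ (hm.lintegral_prod_right'.const_mul _),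
          lintegral_const_mul' _ _ (by simp), lintegral_const_mul' _ _ (by simp)]
    _ = _ := by
        rw [e1, e2, ← add_mul, ENNReal.inv_two_add_inv_two, one_mul]

theorem lintegral_gaussian_weight {b : ℝ} (hb : 0 < b) :
    ∫⁻ x : ℝ, ENNReal.ofReal (√(π / b) * rexp (-x ^ 2 / (4 * b))) = ENNReal.ofReal (2 * π) := by
  have h4 : (0:ℝ) < 1 / (4 * b) := by positivity
  have e : ∀ x : ℝ, rexp (-x ^ 2 / (4 * b)) = rexp (-(1 / (4 * b)) * x ^ 2) := by
    intro x; congr 1; ring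
  rw [← ofReal_integral_eq_lintegral_ofReal]
  · congr 1
    simp_rw [e]
    rw [integral_const_mul, integral_gaussian, ← Real.sqrt_mul (by positivity)]
    rw [show π / b * (π / (1 / (4 * b))) = (2 * π) ^ 2 by field_simp; ring]
    rw [Real.sqrt_sq (by positivity)]
  · simp_rw [e]
    exact (integrable_exp_neg_mul_sq h4).const_mul _
  · exact ae_of_all _ fun x => by positivity

theorem lintegral_gaussian_mul_fourier_sq_le {g : ℝ → ℂ} (hg : Integrable g) {b : ℝ} (hb : 0 < b) :
    ∫⁻ t : ℝ, ENNReal.ofReal (rexp (-b * t ^ 2)) * ‖∫ u : ℝ, g u * cexp (-(I * t * u))‖ₑ ^ 2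
      ≤ ENNReal.ofReal (2 * π) * ∫⁻ u, ‖g u‖ₑ ^ 2 := by
  set gh : ℝ → ℂ := fun t => ∫ u : ℝ, g u * cexp (-(I * t * u)) with hgh
  set W : ℝ → ℝ := fun x => √(π / b) * rexp (-x ^ 2 / (4 * b)) with hW
  have hgauss : Integrable (fun t : ℝ => rexp (-b * t ^ 2)) := integrable_exp_neg_mul_sq hb
  set K : ℝ × (ℝ × ℝ) → ℂ := fun p => (rexp (-b * p.1 ^ 2) : ℂ) * (g p.2.1 * (starRingEnd ℂ) (g p.2.2))
     * cexp (-(I * p.1 * (p.2.1 - p.2.2))) with hK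
  have hgg : Integrable (fun p : ℝ × ℝ => g p.1 * (starRingEnd ℂ) (g p.2)) (volume.prod volume) := by
    refine hg.mul_prod (g := fun x => (starRingEnd ℂ) (g x)) ?_
    exact (LinearIsometryEquiv.integrable_comp_iff (Complex.conjLIE)).2 hg
  have hnorm : ∀ t x : ℝ, ‖cexp (-(I * t * x))‖ = 1 := by
    intro t x
    rw [show -(I * t * x) = ((-(t * x) : ℝ) : ℂ) * I by push_cast; ring]
    exact norm_exp_ofReal_mul_I _
  have hKint : Integrable K (volume.prod (volume.prod volume)) := by
    have h1 : Integrable (fun p : ℝ × (ℝ × ℝ) => (rexp (-b * p.1 ^ 2) : ℂ) * (g p.2.1 * (starRingEnd ℂ) (g p.2.2)))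
       (volume.prod (volume.prod volume)) := hgauss.ofReal.mul_prod hgg
    refine h1.mul_bdd (c := 1) (by fun_prop) (ae_of_all _ fun p => ?_)
    have := hnorm p.1 (p.2.1 - p.2.2)
    push_cast at this
    exact this.le
  have inner1 : ∀ t : ℝ, ∫ p : ℝ × ℝ, K (t, p) ∂(volume.prod volume)
      = ((rexp (-b * t ^ 2) * ‖gh t‖ ^ 2 : ℝ) : ℂ) := by
    intro t
    have : ∀ p : ℝ × ℝ, K (t, p) = (rexp (-b * t ^ 2) : ℂ) *
      ((g p.1 * cexp (-(I * t * p.1))) * ((starRingEnd ℂ) (g p.2 * cexp (-(I * t * p.2))))) := by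
      intro p
      simp only [hK, map_mul, ← Complex.exp_conj, map_neg, conj_I, conj_ofReal]
      rw [show -(I * (t:ℂ) * (p.1 - p.2)) = -(I * t * p.1) + (-(-I * t * p.2)) by ring, Complex.exp_add]
      ring
    simp_rw [this]
    rw [integral_const_mul, integral_prod_mul (fun x : ℝ => g x * cexp (-(I * t * x)))
      (fun x : ℝ => (starRingEnd ℂ) (g x * cexp (-(I * t * x)))), integral_conj, Complex.mul_conj,
      Complex.normSq_eq_norm_sq]
    push_cast
    rfl
  have inner2 : ∀ p : ℝ × ℝ, ∫ t : ℝ, K (t, p) = (g p.1 * (starRingEnd ℂ) (g p.2)) * (W (p.1 - p.2) : ℂ) := by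
    intro p
    have h := fourierIntegral_gaussian (b := (b:ℂ)) (by simpa using hb) (-((p.1 - p.2 : ℝ) : ℂ))
    have h3 : (W (p.1 - p.2) : ℂ) = (π / (b:ℂ)) ^ (1 / 2 : ℂ) * cexp (-(-((p.1 - p.2 : ℝ) : ℂ)) ^ 2 / (4 * b)) := by
      simp only [hW]
      push_cast
      rw [Real.sqrt_eq_rpow, Complex.ofReal_cpow (by positivity)]
      push_cast
      ring_nf
    rw [h3, ← h, ← integral_const_mul]
    congr 1; ext t
    simp only [hK]
    push_cast
    rw [show I * -((p.1 : ℂ) - p.2) * t = -(I * t * (p.1 - p.2)) by ring]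
    ring
  have hswap : ∫ t : ℝ, ((rexp (-b * t ^ 2) * ‖gh t‖ ^ 2 : ℝ) : ℂ) =
      ∫ p : ℝ × ℝ, (g p.1 * (starRingEnd ℂ) (g p.2)) * (W (p.1 - p.2) : ℂ) ∂(volume.prod volume) := by
    simp_rw [← inner1, ← inner2]
    exact integral_integral_swap (f := fun t p => K (t, p)) hKint
  have hint : Integrable (fun t : ℝ => rexp (-b * t ^ 2) * ‖gh t‖ ^ 2) := by
    have := hKint.integral_prod_left
    simp_rw [inner1] at this
    refine this.re.congr (ae_of_all _ fun t => ?_)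
    exact Complex.ofReal_re _
  have hL : ∫⁻ t : ℝ, ENNReal.ofReal (rexp (-b * t ^ 2)) * ‖gh t‖ₑ ^ 2 =
      ENNReal.ofReal (∫ t : ℝ, rexp (-b * t ^ 2) * ‖gh t‖ ^ 2) := by
    rw [ofReal_integral_eq_lintegral_ofReal hint (ae_of_all _ fun t => by positivity)]
    congr 1; ext t
    rw [ENNReal.ofReal_mul (by positivity), ENNReal.ofReal_pow (by positivity), ofReal_norm]
  have hWm : Measurable (fun x => ENNReal.ofReal (W x)) := by simp only [hW]; fun_prop
  calc _ = ENNReal.ofReal (∫ t : ℝ, rexp (-b * t ^ 2) * ‖gh t‖ ^ 2) := hL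
    _ ≤ ‖∫ t : ℝ, ((rexp (-b * t ^ 2) * ‖gh t‖ ^ 2 : ℝ) : ℂ)‖ₑ := by
        rw [integral_complex_ofReal, ← ofReal_norm]
        apply ENNReal.ofReal_le_ofReal
        rw [Complex.norm_real]; exact le_abs_self _
    _ ≤ ∫⁻ p : ℝ × ℝ, ‖(g p.1 * (starRingEnd ℂ) (g p.2)) * (W (p.1 - p.2) : ℂ)‖ₑ ∂(volume.prod volume) := by
        rw [hswap]; exact enorm_integral_le_lintegral_enorm _
    _ = ∫⁻ p : ℝ × ℝ, ‖g p.1‖ₑ * ‖g p.2‖ₑ * ENNReal.ofReal (W (p.1 - p.2)) ∂(volume.prod volume) := by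
        congr 1; ext p
        have hWn : 0 ≤ W (p.1 - p.2) := by simp only [hW]; positivity
        rw [enorm_mul, enorm_mul, ← ofReal_norm (W _ : ℂ), Complex.norm_real, Real.norm_of_nonneg hWn,
          ← ofReal_norm ((starRingEnd ℂ) _), RCLike.norm_conj, ofReal_norm]
    _ = ∫⁻ u, ∫⁻ v, ‖g u‖ₑ * ‖g v‖ₑ * ENNReal.ofReal (W (u - v)) := by
        rw [lintegral_prod]
        refine AEMeasurable.mul (AEMeasurable.mul ?_ ?_) (hWm.comp (measurable_fst.sub measurable_snd)).aemeasurable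
        · exact hg.aestronglyMeasurable.enorm.comp_fst
        · exact hg.aestronglyMeasurable.enorm.comp_snd
    _ ≤ (∫⁻ x, ENNReal.ofReal (W x)) * ∫⁻ u, ‖g u‖ₑ ^ 2 :=
        lintegral_mul_mul_le_of_even_weight (w := fun x => ENNReal.ofReal (W x)) hg.aestronglyMeasurable.enorm hWm
    _ = _ := by rw [lintegral_gaussian_weight hb]

theorem integral_Ioi_eq_integral_exp {E : Type*} [NormedAddCommGroup E] [NormedSpace ℝ E] (F : ℝ → E) :
    ∫ x in Ioi (0:ℝ), F x = ∫ u : ℝ, rexp u • F (rexp u) := by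
  rw [← Real.range_exp, ← image_univ, integral_image_eq_integral_abs_deriv_smul MeasurableSet.univ
    (fun x _ => (Real.hasDerivAt_exp x).hasDerivWithinAt) Real.exp_injective.injOn]
  simp [abs_of_pos (Real.exp_pos _)]

theorem integrableOn_Ioi_iff_exp {E : Type*} [NormedAddCommGroup E] [NormedSpace ℝ E] (F : ℝ → E) :
    IntegrableOn F (Ioi (0:ℝ)) ↔ Integrable (fun u : ℝ => rexp u • F (rexp u)) := by
  rw [← Real.range_exp, ← image_univ, integrableOn_image_iff_integrableOn_abs_deriv_smul MeasurableSet.univ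
    (fun x _ => (Real.hasDerivAt_exp x).hasDerivWithinAt) Real.exp_injective.injOn]
  simp [abs_of_pos (Real.exp_pos _)]

theorem lintegral_Ioi_eq_lintegral_exp (F : ℝ → ENNReal) :
    ∫⁻ x in Ioi (0:ℝ), F x = ∫⁻ u : ℝ, ENNReal.ofReal (rexp u) * F (rexp u) := by
  rw [← Real.range_exp, ← image_univ, lintegral_image_eq_lintegral_abs_deriv_mul MeasurableSet.univ
    (fun x _ => (Real.hasDerivAt_exp x).hasDerivWithinAt) Real.exp_injective.injOn]
  simp [abs_of_pos (Real.exp_pos _)]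

theorem norm_sq_le_norm_exp_sub_one_sq {z : ℂ} (h0 : 0 ≤ z.re) (h1 : |z.im| ≤ 1) :
    ‖z‖ ^ 2 ≤ (5 / 2) * ‖cexp z - 1‖ ^ 2 := by
  have hx : z.re ≤ rexp z.re - 1 := by linarith [Real.add_one_le_exp z.re]
  have hy : Real.cos z.im ≤ 1 - 2 / π ^ 2 * z.im ^ 2 :=
    Real.cos_le_one_sub_mul_cos_sq (h1.trans (by linarith [Real.pi_gt_three]))
  have e1 : ‖cexp z - 1‖ ^ 2 = (rexp z.re - 1) ^ 2 + 2 * rexp z.re * (1 - Real.cos z.im) := by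
    rw [← Complex.normSq_eq_norm_sq, Complex.normSq_apply]
    simp only [Complex.sub_re, Complex.sub_im, Complex.exp_re, Complex.exp_im, one_re, one_im]
    nlinarith [Real.sin_sq_add_cos_sq z.im]
  have e2 : ‖z‖ ^ 2 = z.re ^ 2 + z.im ^ 2 := by
    rw [← Complex.normSq_eq_norm_sq, Complex.normSq_apply]; ring
  have hpi : (2/5 : ℝ) ≤ 4 / π ^ 2 := by
    rw [div_le_div_iff₀ (by norm_num) (by positivity)]
    nlinarith [Real.pi_lt_d2, Real.pi_pos]
  have h3 : (rexp z.re - 1) ^ 2 ≥ z.re ^ 2 := by gcongr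
  have h4 : 2 * rexp z.re * (1 - Real.cos z.im) ≥ 2 / 5 * z.im ^ 2 := by
    have h5 : 1 - Real.cos z.im ≥ 2 / π ^ 2 * z.im ^ 2 := by linarith
    have h6 : (1:ℝ) ≤ rexp z.re := Real.one_le_exp h0
    have h7 : 0 ≤ 1 - Real.cos z.im := by linarith [Real.cos_le_one z.im]
    calc 2 / 5 * z.im ^ 2 ≤ 4 / π ^ 2 * z.im ^ 2 := by gcongr
      _ = 2 * 1 * (2 / π ^ 2 * z.im ^ 2) := by ring
      _ ≤ _ := by gcongr
  rw [e1, e2]; nlinarith [sq_nonneg z.re]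

/-- Mean square of a Mellin transform through multiplicative differences. -/
theorem lintegral_mellin_sq_le_difference {f : ℝ → ℂ} {σ T : ℝ} (hσ : 0 ≤ σ) (hT : 0 < T)
    (hf : IntegrableOn (fun x : ℝ => ‖f x‖ * x ^ (-σ - 1)) (Ioi 0))
    (hfm : Measurable f) :
    ∫⁻ t in Icc (-T) T, ‖((σ : ℂ) + t * I) * ∫ x in Ioi (0:ℝ), f x * (x : ℂ) ^ (-((σ : ℂ) + t * I) - 1)‖ₑ ^ 2
      ≤ ENNReal.ofReal (50 * T ^ 2) *
        ∫⁻ x in Ioi (0:ℝ), ‖f (rexp (1 / T) * x) - f x‖ₑ ^ 2 * ENNReal.ofReal (x ^ (-2 * σ - 1)) := by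
  have hfm' : AEStronglyMeasurable (fun u => f (rexp u)) volume :=
    (hfm.comp Real.measurable_exp).aestronglyMeasurable
  set p : ℝ → ℂ := fun u => f (rexp u) * (rexp (-σ * u) : ℂ) with hp
  have hpint : Integrable p := by
    rw [integrableOn_Ioi_iff_exp] at hf
    refine (integrable_norm_iff (f := p) (by fun_prop)).1 ?_
    refine hf.congr (ae_of_all _ fun u => ?_)
    simp only [hp, norm_mul, Complex.norm_real, smul_eq_mul, Real.norm_eq_abs, Real.abs_exp]
    rw [← Real.exp_mul, mul_left_comm, ← Real.exp_add]
    ring_nf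
  set g : ℝ → ℂ := fun u => (f (rexp (1 / T) * rexp u) - f (rexp u)) * (rexp (-σ * u) : ℂ) with hg
  have hgp : ∀ u, g u = (rexp (σ / T) : ℂ) * p (u + 1 / T) - p u := by
    intro u
    simp only [hg, hp]
    have : (rexp (-σ * u) : ℂ) = (rexp (σ / T) : ℂ) * (rexp (-σ * (u + 1 / T)) : ℂ) := by
      rw [← Complex.ofReal_mul, ← Real.exp_add]; congr 2; field_simp; ring
    rw [← Real.exp_add, add_comm (1 / T) u]
    linear_combination f (rexp (u + 1 / T)) * this
  have hpint' : Integrable (fun u => p (u + 1 / T)) := hpint.comp_add_right _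
  have hgint : Integrable g := by
    have := (hpint'.const_mul (rexp (σ / T) : ℂ)).sub hpint
    exact this.congr (ae_of_all _ fun u => (hgp u).symm)
  have hbdd : ∀ (t : ℝ) {q : ℝ → ℂ}, Integrable q → Integrable (fun u : ℝ => q u * cexp (-(I * t * u))) := by
    intro t q hq
    refine hq.mul_bdd (c := 1) (by fun_prop) (ae_of_all _ fun u => ?_)
    rw [show -(I * t * u) = ((-(t * u) : ℝ) : ℂ) * I by push_cast; ring]
    exact (norm_exp_ofReal_mul_I _).le
  have hF : ∀ t : ℝ, ∫ x in Ioi (0:ℝ), f x * (x : ℂ) ^ (-((σ : ℂ) + t * I) - 1) =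
      ∫ u : ℝ, p u * cexp (-(I * t * u)) := by
    intro t
    rw [integral_Ioi_eq_integral_exp]
    congr 1; ext u
    simp only [hp]
    rw [Complex.cpow_def_of_ne_zero (by simp), ← Complex.ofReal_log (Real.exp_pos u).le, Real.log_exp,
      Complex.real_smul, mul_left_comm, mul_assoc]
    push_cast
    rw [← Complex.exp_add, ← Complex.exp_add]
    congr 2; ring
  have hG : ∀ t : ℝ, ∫ u : ℝ, g u * cexp (-(I * t * u)) =
      (cexp (((σ : ℂ) + t * I) / T) - 1) * ∫ u : ℝ, p u * cexp (-(I * t * u)) := by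
    intro t
    have h1 : ∀ u : ℝ, g u * cexp (-(I * t * u)) = cexp (((σ : ℂ) + t * I) / T) *
        (p (u + 1 / T) * cexp (-(I * t * ((u + 1 / T : ℝ) : ℂ)))) - p u * cexp (-(I * t * u)) := by
      intro u
      rw [hgp, sub_mul]
      congr 1
      have : (rexp (σ / T) : ℂ) * cexp (-(I * t * u)) =
          cexp (((σ : ℂ) + t * I) / T) * cexp (-(I * t * ((u + 1 / T : ℝ) : ℂ))) := by
        push_cast
        rw [← Complex.exp_add, ← Complex.exp_add]
        congr 1
        have : (T : ℂ) ≠ 0 := by exact_mod_cast hT.ne'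
        field_simp; ring
      linear_combination p (u + 1 / T) * this
    simp_rw [h1]
    rw [integral_sub, integral_const_mul, integral_add_right_eq_self (fun u : ℝ => p u * cexp (-(I * t * u)))]
    · ring
    · exact ((hbdd t hpint).comp_add_right (1 / T)).const_mul _
    · exact hbdd t hpint
  have hR : ∫⁻ x in Ioi (0:ℝ), ‖f (rexp (1 / T) * x) - f x‖ₑ ^ 2 * ENNReal.ofReal (x ^ (-2 * σ - 1)) =
      ∫⁻ u, ‖g u‖ₑ ^ 2 := by
    rw [lintegral_Ioi_eq_lintegral_exp]
    congr 1; ext u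
    simp only [hg]
    rw [enorm_mul, mul_pow, ← ofReal_norm (rexp _ : ℂ), Complex.norm_real, Real.norm_eq_abs, Real.abs_exp,
      mul_left_comm, ← ENNReal.ofReal_mul (Real.exp_pos _).le, ← ENNReal.ofReal_pow (Real.exp_pos _).le,
      ← Real.exp_mul, ← Real.exp_nat_mul, ← Real.exp_add]
    congr 3
    rw [← Real.exp_add]
    congr 1; push_cast; ring
  have hpl := lintegral_gaussian_mul_fourier_sq_le hgint (b := 1 / T ^ 2) (by positivity)
  rw [hR]
  calc _ ≤ ∫⁻ t in Icc (-T) T, ENNReal.ofReal (5 / 2 * 2.72 * T ^ 2) * (ENNReal.ofReal (rexp (-(1 / T ^ 2) * t ^ 2)) *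
            ‖∫ u : ℝ, g u * cexp (-(I * t * u))‖ₑ ^ 2) := by
        refine setLIntegral_mono' measurableSet_Icc fun t ht => ?_
        rw [hF, hG]
        simp only [← ofReal_norm]
        rw [← ENNReal.ofReal_pow (by positivity), ← ENNReal.ofReal_pow (by positivity),
          ← ENNReal.ofReal_mul (by positivity), ← ENNReal.ofReal_mul (by positivity)]
        apply ENNReal.ofReal_le_ofReal
        rw [norm_mul, norm_mul, mul_pow, mul_pow]
        have h1 := norm_sq_le_norm_exp_sub_one_sq (z := ((σ : ℂ) + t * I) / T)
          (by rw [Complex.div_ofReal_re]; simp; positivity)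
          (by
            rw [Complex.div_ofReal_im, abs_div, abs_of_pos hT, div_le_one hT]
            simpa using abs_le.2 ht)
        have h2 : ‖((σ : ℂ) + t * I) / T‖ ^ 2 * T ^ 2 = ‖((σ : ℂ) + t * I)‖ ^ 2 := by
          rw [norm_div, div_pow, Complex.norm_real, Real.norm_of_nonneg hT.le]; field_simp
        have h3 : 1 ≤ 2.72 * rexp (-(1 / T ^ 2) * t ^ 2) := by
          have : rexp (-1) ≤ rexp (-(1 / T ^ 2) * t ^ 2) := by
            apply Real.exp_le_exp.2
            have : t ^ 2 ≤ T ^ 2 := sq_le_sq' ht.1 ht.2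
            have : t ^ 2 / T ^ 2 ≤ 1 := (div_le_one (by positivity)).2 this
            have e : -(1 / T ^ 2) * t ^ 2 = - (t ^ 2 / T ^ 2) := by ring
            linarith
          have h4 : rexp 1 * rexp (-1) = 1 := by rw [← Real.exp_add]; simp
          nlinarith [Real.exp_one_lt_d9, Real.exp_pos (-1)]
        rw [← h2]
        set A := ‖∫ u : ℝ, p u * cexp (-(I * t * u))‖ ^ 2
        set B := ‖cexp (((σ : ℂ) + t * I) / T) - 1‖ ^ 2
        calc _ ≤ (5 / 2 * B) * T ^ 2 * A * 1 := by rw [mul_one]; gcongr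
          _ ≤ (5 / 2 * B) * T ^ 2 * A * (2.72 * rexp (-(1 / T ^ 2) * t ^ 2)) := by gcongr
          _ = _ := by ring
    _ ≤ ∫⁻ t, ENNReal.ofReal (5 / 2 * 2.72 * T ^ 2) * (ENNReal.ofReal (rexp (-(1 / T ^ 2) * t ^ 2)) *
            ‖∫ u : ℝ, g u * cexp (-(I * t * u))‖ₑ ^ 2) := setLIntegral_le_lintegral _ _
    _ ≤ ENNReal.ofReal (5 / 2 * 2.72 * T ^ 2) * (ENNReal.ofReal (2 * π) * ∫⁻ u, ‖g u‖ₑ ^ 2) := by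
        rw [lintegral_const_mul' _ _ (by simp)]
        gcongr
    _ ≤ _ := by
        rw [← mul_assoc, ← ENNReal.ofReal_mul (by positivity)]
        refine mul_le_mul_left (ENNReal.ofReal_le_ofReal ?_) _
        have : 5 / 2 * 2.72 * (2 * π) ≤ 50 := by linarith [Real.pi_lt_d2]
        calc _ = 5 / 2 * 2.72 * (2 * π) * T ^ 2 := by ring
          _ ≤ _ := by gcongr

theorem norm_mul_cpow_neg_sub_one {z : ℂ} {x : ℝ} (hx : 0 < x) (s : ℂ) :
    ‖z * (x : ℂ) ^ (-s - 1)‖ = ‖z‖ * x ^ (-s.re - 1) := by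
  rw [norm_mul, Complex.norm_cpow_eq_rpow_re_of_pos hx]; simp

theorem measurable_cpow_const_ofReal (s : ℂ) : Measurable (fun x : ℝ => (x : ℂ) ^ s) := by
  fun_prop

theorem integrableOn_Ioi_mul_cpow {f : ℝ → ℂ} (hf : Measurable f) {a c B : ℝ} (hc : 0 < c)
    (hb : ∀ x, c < x → ‖f x‖ ≤ B * x ^ a) {s : ℂ} (hs : a < s.re) :
    IntegrableOn (fun x : ℝ => f x * (x : ℂ) ^ (-s - 1)) (Ioi c) := by
  have h1 : IntegrableOn (fun x : ℝ => B * x ^ (a - s.re - 1)) (Ioi c) :=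
    (integrableOn_Ioi_rpow_of_lt (by linarith) hc).const_mul B
  refine Integrable.mono' h1 (by fun_prop) ?_
  filter_upwards [ae_restrict_mem measurableSet_Ioi] with x hx
  have hx0 : 0 < x := hc.trans hx
  rw [norm_mul_cpow_neg_sub_one hx0, show a - s.re - 1 = a + (-s.re - 1) by ring, Real.rpow_add hx0,
    ← mul_assoc]
  exact mul_le_mul_of_nonneg_right (hb x hx) (by positivity)

theorem differentiableAt_integral_Ioi_mul_cpow {f : ℝ → ℂ} (hf : Measurable f) {a c B : ℝ} (hc : 0 < c)
    (hb : ∀ x, c < x → ‖f x‖ ≤ B * x ^ a) {s : ℂ} (hs : a < s.re) :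
    DifferentiableAt ℂ (fun s : ℂ => ∫ x in Ioi c, f x * (x : ℂ) ^ (-s - 1)) s := by
  set h : ℝ → ℂ := (Ioi c).indicator f with hh
  have e : (fun s : ℂ => ∫ x in Ioi c, f x * (x : ℂ) ^ (-s - 1)) = fun s => mellin h (-s) := by
    ext s
    rw [mellin, hh]
    have : ∀ x : ℝ, (x : ℂ) ^ (-s - 1) • (Ioi c).indicator f x =
        (Ioi c).indicator (fun x : ℝ => f x * (x : ℂ) ^ (-s - 1)) x := by
      intro x
      by_cases hx : x ∈ Ioi c <;> simp [hx, mul_comm]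
    simp_rw [this]
    rw [setIntegral_indicator measurableSet_Ioi]
    congr 2
    rw [inter_eq_right.2]; exact Ioi_subset_Ioi hc.le
  rw [e]
  have hd : DifferentiableAt ℂ (mellin h) (-s) := by
    apply mellin_differentiableAt_of_isBigO_rpow (a := -a) (b := -s.re - 1)
    · have hB : 0 ≤ B := by
        have := (norm_nonneg _).trans (hb (c + 1) (by linarith))
        exact nonneg_of_mul_nonneg_left this (by positivity)
      have hcont : ContinuousOn (fun x : ℝ => B * x ^ a) (Ioi 0) := fun x hx =>
        (continuousAt_const.mul (Real.continuousAt_rpow_const x a (Or.inl (ne_of_gt hx)))).continuousWithinAt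
      refine fun x hx => ?_
      obtain ⟨t, ht, hi⟩ := hcont.locallyIntegrableOn (μ := volume) measurableSet_Ioi x hx
      refine ⟨t ∩ Ioi 0, inter_mem ht self_mem_nhdsWithin, ?_⟩
      have hi' := hi.mono_set (inter_subset_left (t := Ioi (0:ℝ)))
      refine Integrable.mono' hi' (hf.indicator measurableSet_Ioi).aestronglyMeasurable ?_
      have hae : ∀ᵐ y ∂(volume.restrict (t ∩ Ioi 0)), y ∈ Ioi (0:ℝ) :=
        ae_mono (Measure.restrict_mono inter_subset_right le_rfl) (ae_restrict_mem measurableSet_Ioi)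
      filter_upwards [hae] with y hy
      by_cases hyc : y ∈ Ioi c
      · rw [hh, indicator_of_mem hyc]; exact hb y hyc
      · have : (0:ℝ) < y := hy
        rw [hh, indicator_of_notMem hyc, norm_zero]; positivity
    · rw [neg_neg]
      refine Asymptotics.IsBigO.of_bound B ?_
      filter_upwards [eventually_gt_atTop c] with x hx
      have hx0 : 0 < x := hc.trans hx
      rw [hh, indicator_of_mem (by exact hx), Real.norm_of_nonneg (by positivity)]
      exact hb x hx
    · simpa using hs
    · refine Asymptotics.IsBigO.of_bound 1 ?_
      filter_upwards [mem_nhdsWithin_of_mem_nhds (Iio_mem_nhds hc)] with x hx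
      rw [hh, indicator_of_notMem (by simpa using (show x < c from hx).le)]
      simp
    · simp
  exact hd.comp s differentiableAt_id.neg

theorem riemannZeta_eq_integral_fract_of_one_lt_re {s : ℂ} (hs : 1 < s.re) :
    riemannZeta s = s / (s - 1) - s * ∫ x in Ioi (1:ℝ), ((Int.fract x : ℝ) : ℂ) * (x : ℂ) ^ (-s - 1) := by
  have hs1 : s - 1 ≠ 0 := by
    intro h; rw [sub_eq_zero] at h; rw [h] at hs; simp at hs
  have h1 : LSeries 1 s = s * ∫ t in Ioi (1 : ℝ), (∑ k ∈ Finset.Icc 1 ⌊t⌋₊, (1 : ℕ → ℂ) k) * t ^ (-(s + 1)) := by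
    refine LSeries_eq_mul_integral' 1 zero_le_one hs ?_
    refine Asymptotics.IsBigO.of_bound 1 (Eventually.of_forall fun n => ?_)
    simp
  rw [← LSeries_one_eq_riemannZeta hs, h1]
  have h2 : ∫ x in Ioi (1:ℝ), (x : ℂ) * (x : ℂ) ^ (-s - 1) = 1 / (s - 1) := by
    have : ∀ x ∈ Ioi (1:ℝ), (x : ℂ) * (x : ℂ) ^ (-s - 1) = (x:ℂ) ^ (-s) := by
      intro x hx
      have : (x : ℂ) ≠ 0 := by
        have : (0:ℝ) < x := zero_lt_one.trans hx
        exact_mod_cast this.ne'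
      rw [Complex.cpow_sub _ _ this, Complex.cpow_one]; field_simp
    rw [setIntegral_congr_fun measurableSet_Ioi this, integral_Ioi_cpow_of_lt (by simpa using hs) one_pos]
    simp only [ofReal_one, one_cpow]
    rw [show -s + 1 = -(s - 1) by ring, neg_div_neg_eq]
  have i1 : IntegrableOn (fun x : ℝ => (x : ℂ) * (x : ℂ) ^ (-s - 1)) (Ioi 1) :=
    integrableOn_Ioi_mul_cpow (f := fun x => (x : ℂ)) (a := 1) (B := 1) (by fun_prop) one_pos
      (fun x hx => by simp [abs_of_pos (zero_lt_one.trans hx)]) hs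
  have i2 : IntegrableOn (fun x : ℝ => ((Int.fract x : ℝ) : ℂ) * (x : ℂ) ^ (-s - 1)) (Ioi 1) :=
    integrableOn_Ioi_mul_cpow (f := fun x => ((Int.fract x : ℝ) : ℂ)) (a := 0) (B := 1)
      (Complex.measurable_ofReal.comp measurable_fract) one_pos
      (fun x hx => by simp [abs_of_nonneg (Int.fract_nonneg x), (Int.fract_lt_one x).le]) (by linarith)
  have h3 : ∫ t in Ioi (1 : ℝ), (∑ k ∈ Finset.Icc 1 ⌊t⌋₊, (1 : ℕ → ℂ) k) * t ^ (-(s + 1)) =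
      1 / (s - 1) - ∫ x in Ioi (1:ℝ), ((Int.fract x : ℝ) : ℂ) * (x : ℂ) ^ (-s - 1) := by
    rw [← h2, ← integral_sub i1 i2]
    refine setIntegral_congr_fun measurableSet_Ioi fun x hx => ?_
    have hx0 : (0:ℝ) ≤ x := zero_le_one.trans (le_of_lt hx)
    have : (∑ k ∈ Finset.Icc 1 ⌊x⌋₊, (1 : ℕ → ℂ) k) = (x : ℂ) - ((Int.fract x : ℝ) : ℂ) := by
      simp only [Pi.one_apply, Finset.sum_const, Nat.card_Icc, add_tsub_cancel_right, nsmul_eq_mul, mul_one]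
      rw [← Complex.ofReal_sub, Int.self_sub_fract, ← natCast_floor_eq_intCast_floor hx0]
      simp
    rw [this, show -(s + 1) = -s - 1 by ring]; ring
  rw [h3]; ring

theorem riemannZeta_eq_integral_fract {s : ℂ} (hs : 0 < s.re) (hs1 : s ≠ 1) :
    riemannZeta s = s / (s - 1) - s * ∫ x in Ioi (1:ℝ), ((Int.fract x : ℝ) : ℂ) * (x : ℂ) ^ (-s - 1) := by
  set J : ℂ → ℂ := fun s => ∫ x in Ioi (1:ℝ), ((Int.fract x : ℝ) : ℂ) * (x : ℂ) ^ (-s - 1) with hJ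
  have hU : IsOpen {s : ℂ | 0 < s.re} := isOpen_lt continuous_const Complex.continuous_re
  have hJd : DifferentiableOn ℂ J {s | 0 < s.re} := fun s hs =>
    (differentiableAt_integral_Ioi_mul_cpow (f := fun x => ((Int.fract x : ℝ) : ℂ)) (a := 0) (B := 1)
      (Complex.measurable_ofReal.comp measurable_fract) one_pos
      (fun x hx => by simp [abs_of_nonneg (Int.fract_nonneg x), (Int.fract_lt_one x).le])
      (by simpa using hs)).differentiableWithinAt
  have hR : DifferentiableOn ℂ (fun s => s - s * (s - 1) * J s) {s | 0 < s.re} := by fun_prop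
  have hL : DifferentiableOn ℂ riemannZeta₁ {s | 0 < s.re} := differentiable_riemannZeta₁.differentiableOn
  have heq : EqOn riemannZeta₁ (fun s => s - s * (s - 1) * J s) {s | 0 < s.re} := by
    refine (hL.analyticOnNhd hU).eqOn_of_preconnected_of_eventuallyEq (hR.analyticOnNhd hU)
      (convex_halfSpace_re_gt 0).isPreconnected (z₀ := 2) (by simp) ?_
    have : {s : ℂ | 1 < s.re} ∈ nhds (2:ℂ) :=
      (isOpen_lt continuous_const Complex.continuous_re).mem_nhds (by simp)
    filter_upwards [this] with s hs
    have hs1 : s ≠ 1 := by rintro rfl; simp at hs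
    have h1 := riemannZeta_eq_integral_fract_of_one_lt_re hs
    rw [riemannZeta_eq_inv_sub_mul hs1] at h1
    have : s - 1 ≠ 0 := sub_ne_zero.2 hs1
    simp only [hJ]
    field_simp at h1
    linear_combination h1
  have h1 := heq hs
  simp only at h1
  have : s - 1 ≠ 0 := sub_ne_zero.2 hs1
  rw [riemannZeta_eq_inv_sub_mul hs1, h1]
  simp only [hJ]
  field_simp

theorem measurable_ofReal_fract : Measurable (fun x : ℝ => ((Int.fract x : ℝ) : ℂ)) :=
  Complex.measurable_ofReal.comp measurable_fract

theorem norm_ofReal_fract_le_one (x : ℝ) : ‖((Int.fract x : ℝ) : ℂ)‖ ≤ 1 := by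
  simp [abs_of_nonneg (Int.fract_nonneg x), (Int.fract_lt_one x).le]

theorem integrableOn_Ioi_one_fract_cpow {s : ℂ} (hs : 0 < s.re) :
    IntegrableOn (fun x : ℝ => ((Int.fract x : ℝ) : ℂ) * (x : ℂ) ^ (-s - 1)) (Ioi 1) :=
  integrableOn_Ioi_mul_cpow (f := fun x => ((Int.fract x : ℝ) : ℂ)) (a := 0) (B := 1)
    measurable_ofReal_fract one_pos (fun x _ => by simpa using norm_ofReal_fract_le_one x) hs

theorem norm_riemannZeta_le {s : ℂ} (hs : 0 < s.re) (hs1 : s ≠ 1) :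
    ‖riemannZeta s‖ ≤ ‖s‖ / ‖s - 1‖ + ‖s‖ / s.re := by
  rw [riemannZeta_eq_integral_fract hs hs1]
  refine (norm_sub_le _ _).trans ?_
  rw [norm_div, norm_mul]
  gcongr
  rw [div_eq_mul_inv]
  gcongr
  calc _ ≤ ∫ x in Ioi (1:ℝ), x ^ (-s.re - 1) := by
        refine norm_integral_le_of_norm_le (integrableOn_Ioi_rpow_of_lt (by linarith) one_pos) ?_
        filter_upwards [ae_restrict_mem measurableSet_Ioi] with x hx
        have hx0 : (0:ℝ) < x := zero_lt_one.trans hx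
        rw [norm_mul_cpow_neg_sub_one hx0]
        exact mul_le_of_le_one_left (by positivity) (norm_ofReal_fract_le_one x)
    _ = _ := by
        rw [integral_Ioi_rpow_of_lt (by linarith) one_pos]
        simp

theorem integrableOn_Ioi_zero_fract_rpow {σ : ℝ} (h0 : 0 < σ) (h1 : σ < 1) :
    IntegrableOn (fun x : ℝ => ‖((Int.fract x : ℝ) : ℂ)‖ * x ^ (-σ - 1)) (Ioi 0) := by
  rw [← Ioc_union_Ioi_eq_Ioi zero_le_one]
  refine IntegrableOn.union ?_ ?_
  · have : IntegrableOn (fun x : ℝ => x ^ (-σ)) (Ioc 0 1) :=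
      (intervalIntegrable_iff_integrableOn_Ioc_of_le zero_le_one).1
        (intervalIntegral.intervalIntegrable_rpow' (by linarith))
    refine Integrable.mono' this ?_ ?_
    · exact (measurable_ofReal_fract.norm.mul (by fun_prop)).aestronglyMeasurable
    · filter_upwards [ae_restrict_mem measurableSet_Ioc] with x hx
      rw [Real.norm_of_nonneg (mul_nonneg (norm_nonneg _) (Real.rpow_nonneg hx.1.le _))]
      calc _ ≤ x * x ^ (-σ - 1) := by
            gcongr
            · exact Real.rpow_nonneg hx.1.le _
            · rw [Complex.norm_real, Real.norm_of_nonneg (Int.fract_nonneg x)]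
              exact (sub_le_self _ (by exact_mod_cast Int.floor_nonneg.2 hx.1.le))
        _ = _ := by
            have := hx.1.ne'
            rw [Real.rpow_sub_one this]; field_simp
  · refine (integrableOn_Ioi_one_fract_cpow (s := σ) (by simpa using h0)).norm.congr ?_
    filter_upwards [ae_restrict_mem measurableSet_Ioi] with x hx
    rw [norm_mul_cpow_neg_sub_one (zero_lt_one.trans hx)]; simp

theorem riemannZeta_eq_integral_fract_of_re_lt_one {s : ℂ} (h0 : 0 < s.re) (h1 : s.re < 1) :
    riemannZeta s = -(s * ∫ x in Ioi (0:ℝ), ((Int.fract x : ℝ) : ℂ) * (x : ℂ) ^ (-s - 1)) := by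
  have hs1 : s ≠ 1 := by rintro rfl; simp at h1
  have hint : IntegrableOn (fun x : ℝ => ((Int.fract x : ℝ) : ℂ) * (x : ℂ) ^ (-s - 1)) (Ioi 0) := by
    refine Integrable.mono' (integrableOn_Ioi_zero_fract_rpow h0 h1) ?_ ?_
    · exact (measurable_ofReal_fract.mul (by fun_prop)).aestronglyMeasurable
    · filter_upwards [ae_restrict_mem measurableSet_Ioi] with x hx
      rw [norm_mul_cpow_neg_sub_one hx]
  rw [riemannZeta_eq_integral_fract h0 hs1, ← Ioc_union_Ioi_eq_Ioi zero_le_one,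
    setIntegral_union (Ioc_disjoint_Ioi le_rfl) measurableSet_Ioi
      (hint.mono_set Ioc_subset_Ioi_self) (hint.mono_set (Ioi_subset_Ioi zero_le_one))]
  have : ∫ x in Ioc (0:ℝ) 1, ((Int.fract x : ℝ) : ℂ) * (x : ℂ) ^ (-s - 1) = 1 / (1 - s) := by
    rw [← intervalIntegral.integral_of_le zero_le_one]
    have e : ∫ x in (0:ℝ)..1, ((Int.fract x : ℝ) : ℂ) * (x : ℂ) ^ (-s - 1) = ∫ x in (0:ℝ)..1, (x : ℂ) ^ (-s) := by
      refine intervalIntegral.integral_congr_ae ?_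
      have : ∀ᵐ x : ℝ, x ≠ 1 := by simp [ae_iff, measure_singleton]
      filter_upwards [this] with x hx1 hx
      rw [uIoc_of_le zero_le_one] at hx
      have hx0 : (x : ℂ) ≠ 0 := by exact_mod_cast hx.1.ne'
      rw [Int.fract_eq_self.2 ⟨hx.1.le, lt_of_le_of_ne hx.2 hx1⟩, Complex.cpow_sub _ _ hx0, Complex.cpow_one]
      field_simp
    rw [e, integral_cpow (Or.inl (by simpa using h1))]
    have : -s + 1 ≠ 0 := by
      intro h; apply hs1; linear_combination -h
    simp only [ofReal_one, one_cpow, ofReal_zero, Complex.zero_cpow this, sub_zero]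
    congr 1; ring
  rw [this]
  have e1 : s - 1 ≠ 0 := sub_ne_zero.2 hs1
  have e2 : 1 - s ≠ 0 := by rw [← neg_sub]; exact neg_ne_zero.2 e1
  field_simp
  ring

theorem exp_inv_sub_one_le {T : ℝ} (hT : 2 ≤ T) : rexp (1 / T) - 1 ≤ 2 / T := by
  have h1 : 1 / T ≤ 1 / 2 := by gcongr
  have h0 : 0 < 1 / T := by positivity
  have h := Real.exp_bound_div_one_sub_of_interval h0.le (by linarith)
  have : 1 / (1 - 1 / T) ≤ 1 + 2 * (1 / T) := by
    rw [div_le_iff₀ (by linarith)]; nlinarith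
  have e : 2 * (1 / T) = 2 / T := by ring
  linarith

theorem exp_inv_le_two {T : ℝ} (hT : 2 ≤ T) : rexp (1 / T) ≤ 2 := by
  have := exp_inv_sub_one_le hT
  have : 2 / T ≤ 1 := by rw [div_le_one (by linarith)]; exact hT
  linarith

theorem one_lt_exp_inv {T : ℝ} (hT : 2 ≤ T) : 1 < rexp (1 / T) := by
  rw [Real.one_lt_exp_iff]; positivity

theorem exp_inv_mul_le {T x : ℝ} (hT : 2 ≤ T) (hx : 0 ≤ x) : rexp (1 / T) * x ≤ x + 2 / T * x := by
  have := exp_inv_sub_one_le hT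
  nlinarith

/-- Summatory function. -/
noncomputable def summatory (a : ℕ → ℝ) (x : ℝ) : ℝ := ∑ n ∈ Finset.Icc 1 ⌊x⌋₊, a n

theorem summatory_sub (a : ℕ → ℝ) {x y : ℝ} (h : x ≤ y) :
    summatory a y - summatory a x = ∑ n ∈ Finset.Ioc ⌊x⌋₊ ⌊y⌋₊, a n := by
  have hf : ⌊x⌋₊ ≤ ⌊y⌋₊ := Nat.floor_le_floor h
  have e : ∀ m, Finset.Icc 1 m = Finset.Ioc 0 m := fun m => by ext; simp [Nat.succ_le_iff]
  simp only [summatory, e]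
  rw [sub_eq_iff_eq_add, add_comm, Finset.sum_Ioc_consecutive _ (Nat.zero_le _) hf]

theorem measurable_summatory (a : ℕ → ℝ) : Measurable (summatory a) := by
  have : summatory a = (fun n : ℕ => ∑ k ∈ Finset.Icc 1 n, a k) ∘ (fun x : ℝ => ⌊x⌋₊) := rfl
  rw [this]
  exact measurable_from_nat.comp Nat.measurable_floor

theorem lintegral_Ico_rpow_le {σ T : ℝ} (hT : 2 ≤ T) (h0 : 0 ≤ σ) (h1 : σ ≤ 3 / 2) (n : ℕ) :
    ∫⁻ x in Ico (n / rexp (1 / T)) n, ENNReal.ofReal (x ^ (-2 * σ - 1)) ≤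
      ENNReal.ofReal (10 / T * (n : ℝ) ^ (-2 * σ)) := by
  rcases Nat.eq_zero_or_pos n with rfl | hn
  · simp
  have hn0 : (0:ℝ) < n := by exact_mod_cast hn
  set L := rexp (1 / T) with hL
  have hL0 : 0 < L := Real.exp_pos _
  have hL1 : 1 < L := one_lt_exp_inv hT
  calc _ ≤ ∫⁻ x in Ico (n / L) n, ENNReal.ofReal ((n / L) ^ (-2 * σ - 1)) := by
        refine setLIntegral_mono' measurableSet_Ico fun x hx => ?_
        apply ENNReal.ofReal_le_ofReal
        exact Real.rpow_le_rpow_of_nonpos (by positivity) hx.1 (by linarith)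
    _ = ENNReal.ofReal ((n / L) ^ (-2 * σ - 1)) * ENNReal.ofReal (n - n / L) := by
        rw [setLIntegral_const, Real.volume_Ico]
    _ ≤ _ := by
        rw [← ENNReal.ofReal_mul (by positivity)]
        apply ENNReal.ofReal_le_ofReal
        have e1 : (n / L) ^ (-2 * σ - 1) * (n - n / L) = (L - 1) * L ^ (2 * σ) * (n:ℝ) ^ (-2 * σ) := by
          rw [Real.div_rpow hn0.le hL0.le, Real.rpow_sub_one hn0.ne', Real.rpow_sub_one hL0.ne',
            show -2 * σ = -(2 * σ) by ring, Real.rpow_neg hL0.le]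
          have : L ^ (2 * σ) ≠ 0 := by positivity
          field_simp
        rw [e1]
        gcongr
        have h2 : L - 1 ≤ 2 / T := exp_inv_sub_one_le hT
        have h3 : L ^ (2 * σ) ≤ 5 := by
          rw [hL, ← Real.exp_mul]
          calc rexp (1 / T * (2 * σ)) ≤ rexp (1 / 2 * (2 * (3 / 2))) := by gcongr
            _ = rexp 1 * rexp (1 / 2) := by rw [← Real.exp_add]; norm_num
            _ ≤ 2.7182818286 * 1.7 := by
              gcongr
              · exact Real.exp_one_lt_d9.le
              · have h5 : rexp (1 / 2) ^ 2 = rexp 1 := by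
                  rw [← Real.exp_nat_mul]; norm_num
                nlinarith [Real.exp_one_lt_d9, Real.exp_pos (1 / 2)]
            _ ≤ 5 := by norm_num
        calc _ ≤ 2 / T * 5 := by gcongr
          _ = _ := by ring

theorem summatory_window_sq_le (a : ℕ → ℝ) {T x : ℝ} (hT : 2 ≤ T) (hx0 : 0 < x) (hx : x ≤ T / 2) :
    (summatory a (rexp (1 / T) * x) - summatory a x) ^ 2 ≤
      ∑ n ∈ Finset.Icc 1 ⌊T⌋₊, (Ico (n / rexp (1 / T)) (n:ℝ)).indicator (fun _ => a n ^ 2) x := by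
  set L := rexp (1 / T) with hL
  have hL0 : 0 < L := Real.exp_pos _
  have hL1 : 1 < L := one_lt_exp_inv hT
  have hxL : x ≤ L * x := by nlinarith
  have hLx : L * x ≤ x + 1 := by
    have h1 := exp_inv_mul_le hT hx0.le
    have : 2 / T * x ≤ 1 := by rw [div_mul_eq_mul_div, div_le_one (by linarith)]; linarith
    linarith
  have hLT : L * x ≤ T := by
    have := exp_inv_le_two hT
    nlinarith
  have hnn : ∀ n ∈ Finset.Icc 1 ⌊T⌋₊, 0 ≤ (Ico (n / L) (n:ℝ)).indicator (fun _ => a n ^ 2) x :=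
    fun n _ => indicator_nonneg (fun _ _ => sq_nonneg _) x
  rw [summatory_sub a hxL]
  have hfl : ⌊L * x⌋₊ ≤ ⌊x⌋₊ + 1 := by
    rw [← Nat.floor_add_one hx0.le]; exact Nat.floor_le_floor hLx
  rcases Nat.lt_or_ge ⌊x⌋₊ ⌊L * x⌋₊ with h | h
  · have e : ⌊L * x⌋₊ = ⌊x⌋₊ + 1 := by omega
    rw [e, Nat.Ioc_succ_singleton, Finset.sum_singleton]
    have hmem : ⌊x⌋₊ + 1 ∈ Finset.Icc 1 ⌊T⌋₊ := by
      rw [Finset.mem_Icc]; exact ⟨by omega, e ▸ Nat.floor_le_floor hLT⟩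
    refine le_trans ?_ (Finset.single_le_sum hnn hmem)
    rw [indicator_of_mem]
    constructor
    · rw [div_le_iff₀ hL0, ← e, mul_comm x]
      exact Nat.floor_le (by positivity)
    · push_cast; exact Nat.lt_floor_add_one x
  · rw [Finset.Ioc_eq_empty_of_le h]
    simpa using Finset.sum_nonneg hnn

theorem lintegral_summatory_window_le (a : ℕ → ℝ) {σ T : ℝ} (hT : 2 ≤ T) (h0 : 0 ≤ σ) (h1 : σ ≤ 3 / 2) :
    ∫⁻ x in Ioc 0 (T / 2), ENNReal.ofReal ((summatory a (rexp (1 / T) * x) - summatory a x) ^ 2) *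
        ENNReal.ofReal (x ^ (-2 * σ - 1)) ≤
      ENNReal.ofReal (10 / T * ∑ n ∈ Finset.Icc 1 ⌊T⌋₊, a n ^ 2 * (n : ℝ) ^ (-2 * σ)) := by
  set L := rexp (1 / T) with hL
  calc _ ≤ ∫⁻ x in Ioc 0 (T / 2), ∑ n ∈ Finset.Icc 1 ⌊T⌋₊, ENNReal.ofReal (a n ^ 2) *
        (Ico (n / L) (n:ℝ)).indicator (fun x => ENNReal.ofReal (x ^ (-2 * σ - 1))) x := by
        refine setLIntegral_mono' measurableSet_Ioc fun x hx => ?_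
        rw [← ENNReal.ofReal_mul (sq_nonneg _)]
        have hp : 0 ≤ x ^ (-2 * σ - 1) := Real.rpow_nonneg hx.1.le _
        calc _ ≤ ENNReal.ofReal ((∑ n ∈ Finset.Icc 1 ⌊T⌋₊, (Ico (n / L) (n:ℝ)).indicator (fun _ => a n ^ 2) x)
              * x ^ (-2 * σ - 1)) := by
              apply ENNReal.ofReal_le_ofReal
              exact mul_le_mul_of_nonneg_right (summatory_window_sq_le a hT hx.1 hx.2) hp
          _ = _ := by
              rw [Finset.sum_mul, ENNReal.ofReal_sum_of_nonneg]
              · refine Finset.sum_congr rfl fun n _ => ?_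
                by_cases hm : x ∈ Ico (n / L) (n:ℝ)
                · rw [indicator_of_mem hm, indicator_of_mem hm, ENNReal.ofReal_mul (sq_nonneg _)]
                · rw [indicator_of_notMem hm, indicator_of_notMem hm]; simp
              · intro n _
                exact mul_nonneg (indicator_nonneg (fun _ _ => sq_nonneg _) x) hp
    _ ≤ ∫⁻ x, ∑ n ∈ Finset.Icc 1 ⌊T⌋₊, ENNReal.ofReal (a n ^ 2) *
        (Ico (n / L) (n:ℝ)).indicator (fun x => ENNReal.ofReal (x ^ (-2 * σ - 1))) x :=
        setLIntegral_le_lintegral _ _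
    _ = ∑ n ∈ Finset.Icc 1 ⌊T⌋₊, ENNReal.ofReal (a n ^ 2) *
        ∫⁻ x in Ico (n / L) (n:ℝ), ENNReal.ofReal (x ^ (-2 * σ - 1)) := by
        rw [lintegral_finsetSum]
        · refine Finset.sum_congr rfl fun n _ => ?_
          rw [lintegral_const_mul' _ _ (by simp), lintegral_indicator measurableSet_Ico]
        · intro n _
          exact Measurable.const_mul (Measurable.indicator (by fun_prop) measurableSet_Ico) _
    _ ≤ ∑ n ∈ Finset.Icc 1 ⌊T⌋₊, ENNReal.ofReal (a n ^ 2) * ENNReal.ofReal (10 / T * (n : ℝ) ^ (-2 * σ)) := by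
        gcongr with n _
        exact lintegral_Ico_rpow_le hT h0 h1 n
    _ = _ := by
        rw [Finset.mul_sum, ENNReal.ofReal_sum_of_nonneg]
        · refine Finset.sum_congr rfl fun n _ => ?_
          rw [← ENNReal.ofReal_mul (sq_nonneg _)]; congr 1; ring
        · intro n _; positivity

theorem sum_Icc_rpow_le {σ κ T : ℝ} (hT : 1 ≤ T) (hκ : 0 ≤ κ) (h : 1 / 2 - κ ≤ σ) :
    ∑ n ∈ Finset.Icc 1 ⌊T⌋₊, (n : ℝ) ^ (-2 * σ) ≤ T ^ (2 * κ) * (1 + Real.log T) := by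
  have hh : ∑ n ∈ Finset.Icc 1 ⌊T⌋₊, ((n : ℝ))⁻¹ ≤ 1 + Real.log T := by
    have := harmonic_floor_le_one_add_log T hT
    rw [harmonic_eq_sum_Icc] at this
    push_cast at this
    exact this
  calc _ ≤ ∑ n ∈ Finset.Icc 1 ⌊T⌋₊, T ^ (2 * κ) * ((n : ℝ))⁻¹ := by
        refine Finset.sum_le_sum fun n hn => ?_
        rw [Finset.mem_Icc] at hn
        have hn1 : (1:ℝ) ≤ n := by exact_mod_cast hn.1
        have hnT : (n:ℝ) ≤ T := (Nat.le_floor_iff (by linarith)).1 hn.2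
        calc (n : ℝ) ^ (-2 * σ) ≤ (n : ℝ) ^ (2 * κ + -1) := by
              apply Real.rpow_le_rpow_of_exponent_le hn1; linarith
          _ = (n : ℝ) ^ (2 * κ) * ((n : ℝ))⁻¹ := by
              rw [Real.rpow_add (by linarith), Real.rpow_neg_one]
          _ ≤ _ := by gcongr
    _ ≤ _ := by rw [← Finset.mul_sum]; gcongr

theorem enorm_sq_ofReal (x : ℝ) : ‖(x : ℂ)‖ₑ ^ 2 = ENNReal.ofReal (x ^ 2) := by
  rw [← ofReal_norm, ← ENNReal.ofReal_pow (norm_nonneg _), Complex.norm_real, Real.norm_eq_abs, sq_abs]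

theorem integrableOn_of_bounded_of_support {f : ℝ → ℝ} (hf : Measurable f) {B σ c : ℝ} (hc : 0 < c) (hσ : 0 < σ)
    (hb : ∀ x, |f x| ≤ B) (hs : ∀ x, x < c → f x = 0) :
    IntegrableOn (fun x : ℝ => ‖(f x : ℂ)‖ * x ^ (-σ - 1)) (Ioi 0) := by
  have hc2 : 0 < c / 2 := by positivity
  have h := integrableOn_Ioi_mul_cpow (f := fun x => (f x : ℂ)) (a := 0) (c := c / 2) (B := B)
    (Complex.measurable_ofReal.comp hf) hc2 (fun x _ => by simpa using hb x) (s := σ) (by simpa using hσ)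
  rw [← Ioc_union_Ioi_eq_Ioi hc2.le]
  refine IntegrableOn.union ?_ ?_
  · refine (integrableOn_zero (s := Ioc 0 (c / 2)) (ε' := ℝ)).congr_fun (fun x hx => ?_) measurableSet_Ioc
    simp [hs x (by linarith [hx.2])]
  · refine h.norm.congr ?_
    filter_upwards [ae_restrict_mem measurableSet_Ioi] with x hx
    rw [norm_mul_cpow_neg_sub_one (hc2.trans hx)]; simp

theorem sum_mul_cpow_eq_integral_summatory (a : ℕ → ℝ) {y : ℕ} (ha : ∀ n, y < n → a n = 0) {s : ℂ} (hs : 0 < s.re) :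
    ∑ n ∈ Finset.Icc 1 y, (a n : ℂ) * (n : ℂ) ^ (-s) =
      s * ∫ x in Ioi (0:ℝ), (summatory a x : ℂ) * (x : ℂ) ^ (-s - 1) := by
  have hs0 : s ≠ 0 := by rintro rfl; simp at hs
  have e : ∀ x ∈ Ioi (0:ℝ), (summatory a x : ℂ) * (x : ℂ) ^ (-s - 1) =
      ∑ n ∈ Finset.Icc 1 y, (Ici (n:ℝ)).indicator (fun x : ℝ => (a n : ℂ) * (x : ℂ) ^ (-s - 1)) x := by
    intro x hx
    have : summatory a x = ∑ n ∈ Finset.Icc 1 y, (Ici (n:ℝ)).indicator (fun _ => a n) x := by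
      rw [summatory, ← Finset.sum_filter_add_sum_filter_not (Finset.Icc 1 ⌊x⌋₊) (fun n => n ≤ y),
        ← Finset.sum_filter_add_sum_filter_not (Finset.Icc 1 y) (fun n => n ≤ ⌊x⌋₊)]
      congr 1
      · refine Finset.sum_congr_of_eq_on_inter ?_ ?_ ?_
        · intro n hn hn'; exfalso; apply hn'; simp at hn ⊢; omega
        · intro n hn hn'; exfalso; apply hn'; simp at hn ⊢; omega
        · intro n hn _
          rw [indicator_of_mem]
          simp only [Finset.mem_filter, Finset.mem_Icc] at hn
          exact (Nat.le_floor_iff (le_of_lt hx)).1 hn.1.2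
      · rw [Finset.sum_eq_zero, Finset.sum_eq_zero]
        · intro n hn
          rw [indicator_of_notMem]
          simp only [Finset.mem_filter, Finset.mem_Icc] at hn
          intro h; exact hn.2 ((Nat.le_floor_iff (le_of_lt hx)).2 h)
        · intro n hn
          simp only [Finset.mem_filter] at hn
          exact ha n (by omega)
    rw [this]; push_cast
    rw [Finset.sum_mul]
    refine Finset.sum_congr rfl fun n _ => ?_
    by_cases h : x ∈ Ici (n:ℝ) <;> simp [indicator, h]
  have hint : ∀ n ∈ Finset.Icc 1 y, IntegrableOn (fun x : ℝ => (a n : ℂ) * (x : ℂ) ^ (-s - 1)) (Ioi (n:ℝ)) := by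
    intro n hn
    have : (0:ℝ) < n := by exact_mod_cast (Finset.mem_Icc.1 hn).1
    exact (integrableOn_Ioi_cpow_of_lt (by simp; linarith) this).const_mul _
  rw [setIntegral_congr_fun measurableSet_Ioi e, integral_finset_sum, Finset.mul_sum]
  · refine Finset.sum_congr rfl fun n hn => ?_
    have hn0 : (0:ℝ) < n := by exact_mod_cast (Finset.mem_Icc.1 hn).1
    rw [setIntegral_indicator measurableSet_Ici, inter_eq_right.2 (Ici_subset_Ioi.2 hn0),
      integral_Ici_eq_integral_Ioi, integral_const_mul, integral_Ioi_cpow_of_lt (by simp; linarith) hn0]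
    simp only [sub_add_cancel, ofReal_natCast]
    field_simp
  · intro n hn
    have hn0 : (0:ℝ) < n := by exact_mod_cast (Finset.mem_Icc.1 hn).1
    refine Integrable.mono_measure ?_ Measure.restrict_le_self
    rw [integrable_indicator_iff measurableSet_Ici, integrableOn_Ici_iff_integrableOn_Ioi]
    exact hint n hn

theorem lintegral_dirichlet_poly_sq_le (a : ℕ → ℝ) {y : ℕ} (ha : ∀ n, y < n → a n = 0) (ha1 : ∀ n, |a n| ≤ 1)
    {σ T : ℝ} (hT : 2 ≤ T) (hy : y ≤ T / 2) (h0 : 1 / 2 ≤ σ) (h1 : σ ≤ 3 / 2) :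
    ∫⁻ t in Icc (-T) T, ‖∑ n ∈ Finset.Icc 1 y, (a n : ℂ) * (n : ℂ) ^ (-((σ : ℂ) + t * I))‖ₑ ^ 2 ≤
      ENNReal.ofReal (500 * T * (1 + Real.log T)) := by
  have hsc : ∀ x : ℝ, (y:ℝ) ≤ x → summatory a x = summatory a y := by
    intro x hx
    rw [← sub_eq_zero, summatory_sub a hx]
    refine Finset.sum_eq_zero fun n hn => ha n ?_
    simpa using (Finset.mem_Ioc.1 hn).1
  have hbd : ∀ x, |summatory a x| ≤ y := by
    have h2 : ∀ x, |summatory a x| ≤ ⌊x⌋₊ := by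
      intro x
      refine (Finset.abs_sum_le_sum_abs _ _).trans ((Finset.sum_le_sum fun n _ => ha1 n).trans ?_)
      simp
    intro x
    rcases le_total (y:ℝ) x with h | h
    · rw [hsc x h]; simpa using h2 y
    · exact (h2 x).trans (by exact_mod_cast (Nat.floor_le_floor h).trans (by simp))
  have hint := integrableOn_of_bounded_of_support (measurable_summatory a) one_pos (by linarith : 0 < σ) hbd
    (fun x hx => by rw [summatory, Nat.floor_eq_zero.2 hx]; simp)
  have hP := lintegral_mellin_sq_le_difference (f := fun x => (summatory a x : ℂ)) (by linarith : 0 ≤ σ)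
    (by linarith : 0 < T) hint (Complex.measurable_ofReal.comp (measurable_summatory a))
  have e : ∀ t : ℝ, ∑ n ∈ Finset.Icc 1 y, (a n : ℂ) * (n : ℂ) ^ (-((σ : ℂ) + t * I)) =
      ((σ : ℂ) + t * I) * ∫ x in Ioi (0:ℝ), (summatory a x : ℂ) * (x : ℂ) ^ (-((σ : ℂ) + t * I) - 1) :=
    fun t => sum_mul_cpow_eq_integral_summatory a ha (by simp; linarith)
  simp_rw [e]
  refine hP.trans ?_
  have hlow := lintegral_summatory_window_le a hT (by linarith : 0 ≤ σ) h1
  have hsplit : ∫⁻ x in Ioi (0:ℝ), ‖(summatory a (rexp (1 / T) * x) : ℂ) - (summatory a x : ℂ)‖ₑ ^ 2 *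
      ENNReal.ofReal (x ^ (-2 * σ - 1)) ≤ ENNReal.ofReal (10 / T * (1 + Real.log T)) := by
    rw [← Ioc_union_Ioi_eq_Ioi (by linarith : 0 ≤ T / 2), lintegral_union measurableSet_Ioi (Ioc_disjoint_Ioi le_rfl)]
    have hz : ∫⁻ x in Ioi (T / 2), ‖(summatory a (rexp (1 / T) * x) : ℂ) - (summatory a x : ℂ)‖ₑ ^ 2 *
      ENNReal.ofReal (x ^ (-2 * σ - 1)) = 0 := by
      rw [setLIntegral_congr_fun (g := fun _ => 0) measurableSet_Ioi]
      · simp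
      · intro x hx
        have hx' : T / 2 < x := hx
        have := one_lt_exp_inv hT
        beta_reduce
        rw [hsc x (by linarith), hsc _ (by nlinarith)]; simp
    rw [hz, add_zero]
    simp_rw [← Complex.ofReal_sub, enorm_sq_ofReal]
    refine hlow.trans (ENNReal.ofReal_le_ofReal ?_)
    gcongr
    have := sum_Icc_rpow_le (σ := σ) (κ := 0) (T := T) (by linarith) le_rfl (by linarith)
    simp only [mul_zero, Real.rpow_zero, one_mul] at this
    refine le_trans (Finset.sum_le_sum fun n _ => ?_) this
    have h3 : a n ^ 2 ≤ 1 := by rw [sq_le_one_iff_abs_le_one]; exact ha1 n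
    exact mul_le_of_le_one_left (by positivity) h3
  calc _ ≤ ENNReal.ofReal (50 * T ^ 2) * ENNReal.ofReal (10 / T * (1 + Real.log T)) := by gcongr
    _ = _ := by
      rw [← ENNReal.ofReal_mul (by positivity)]
      congr 1
      field_simp; ring

/-- The bounded function whose Mellin transform gives `ζ` to the right of `0`. -/
noncomputable def zetaKernel (x : ℝ) : ℝ := summatory (fun _ => 1) x - max (x - 1) 0

theorem zetaKernel_of_lt {x : ℝ} (hx : x < 1) : zetaKernel x = 0 := by
  rw [zetaKernel, summatory, Nat.floor_eq_zero.2 hx, max_eq_right (by linarith)]; simp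

theorem zetaKernel_of_le {x : ℝ} (hx : 1 ≤ x) : zetaKernel x = 1 - Int.fract x := by
  rw [zetaKernel, summatory, max_eq_left (by linarith)]
  simp only [Finset.sum_const, Nat.card_Icc, add_tsub_cancel_right, nsmul_eq_mul, mul_one]
  have := Int.self_sub_fract x
  rw [← natCast_floor_eq_intCast_floor (by linarith)] at this
  linarith

theorem zetaKernel_mem (x : ℝ) : 0 ≤ zetaKernel x ∧ zetaKernel x ≤ 1 := by
  rcases lt_or_ge x 1 with h | h
  · rw [zetaKernel_of_lt h]; simp
  · rw [zetaKernel_of_le h]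
    constructor <;> linarith [Int.fract_nonneg x, Int.fract_lt_one x]

theorem measurable_zetaKernel : Measurable zetaKernel :=
  (measurable_summatory _).sub (by fun_prop)

theorem riemannZeta_eq_integral_zetaKernel {s : ℂ} (hs : 0 < s.re) (hs1 : s ≠ 1) :
    riemannZeta s = 1 / (s - 1) + s * ∫ x in Ioi (0:ℝ), (zetaKernel x : ℂ) * (x : ℂ) ^ (-s - 1) := by
  have hs0 : s ≠ 0 := by rintro rfl; simp at hs
  have h1 : ∫ x in Ioi (0:ℝ), (zetaKernel x : ℂ) * (x : ℂ) ^ (-s - 1) =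
      ∫ x in Ioi (1:ℝ), ((x : ℂ) ^ (-s - 1) - ((Int.fract x : ℝ) : ℂ) * (x : ℂ) ^ (-s - 1)) := by
    rw [← integral_Ici_eq_integral_Ioi (x := (1:ℝ))]
    rw [setIntegral_eq_of_subset_of_forall_diff_eq_zero measurableSet_Ioi (s := Ici (1:ℝ))
      (fun x (hx : 1 ≤ x) => show (0:ℝ) < x by linarith)]
    · refine setIntegral_congr_fun measurableSet_Ici fun x hx => ?_
      rw [zetaKernel_of_le hx]; push_cast; ring
    · intro x hx
      have : x < 1 := by simpa using hx.2
      rw [zetaKernel_of_lt this]; simp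
  rw [h1, integral_sub (integrableOn_Ioi_cpow_of_lt (by simp; linarith) one_pos) (integrableOn_Ioi_one_fract_cpow hs),
    integral_Ioi_cpow_of_lt (by simp; linarith) one_pos, riemannZeta_eq_integral_fract hs hs1]
  have : s - 1 ≠ 0 := sub_ne_zero.2 hs1
  simp only [ofReal_one, one_cpow, sub_add_cancel]
  field_simp
  ring

theorem abs_max_sub_one_window_le {T x : ℝ} (hT : 2 ≤ T) (hx : 0 < x) :
    |max (rexp (1 / T) * x - 1) 0 - max (x - 1) 0| ≤ if 1 / 2 < x then 2 / T * x else 0 := by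
  have h1 := one_lt_exp_inv hT
  have h2 := exp_inv_mul_le hT hx.le
  have h3 := exp_inv_le_two hT
  have h4 : x ≤ rexp (1 / T) * x := by nlinarith
  split_ifs with h
  · refine (abs_max_sub_max_le_abs _ _ _).trans ?_
    rw [abs_of_nonneg (by linarith)]; linarith
  · rw [max_eq_right (by nlinarith), max_eq_right (by linarith)]; simp

theorem lintegral_zetaKernel_difference_le {σ κ T : ℝ} (hT : 2 ≤ T) (hκ : 0 ≤ κ) (h0 : 1 / 4 ≤ σ)
    (h : 1 / 2 - κ ≤ σ) (h1 : σ ≤ 3 / 2) :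
    ∫⁻ x in Ioi (0:ℝ), ‖(zetaKernel (rexp (1 / T) * x) : ℂ) - (zetaKernel x : ℂ)‖ₑ ^ 2 *
      ENNReal.ofReal (x ^ (-2 * σ - 1)) ≤ ENNReal.ofReal (52 * (1 + Real.log T) * (T ^ (2 * κ) / T)) := by
  have hT0 : 0 < T := by linarith
  have hlog : 0 ≤ Real.log T := Real.log_nonneg (by linarith)
  have hTκ : 1 ≤ T ^ (2 * κ) := Real.one_le_rpow (by linarith) (by linarith)
  simp_rw [← Complex.ofReal_sub, enorm_sq_ofReal]
  rw [← Ioc_union_Ioi_eq_Ioi (by linarith : 0 ≤ T / 2), lintegral_union measurableSet_Ioi (Ioc_disjoint_Ioi le_rfl)]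
  have hhigh : ∫⁻ x in Ioi (T / 2), ENNReal.ofReal ((zetaKernel (rexp (1 / T) * x) - zetaKernel x) ^ 2) *
      ENNReal.ofReal (x ^ (-2 * σ - 1)) ≤ ENNReal.ofReal (16 * (T ^ (2 * κ) / T)) := by
    calc _ ≤ ∫⁻ x in Ioi (T / 2), ENNReal.ofReal (x ^ (-2 * σ - 1)) := by
          refine setLIntegral_mono' measurableSet_Ioi fun x _ => ?_
          refine mul_le_of_le_one_left (zero_le) ?_
          rw [ENNReal.ofReal_le_one]
          have a1 := zetaKernel_mem (rexp (1 / T) * x)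
          have a2 := zetaKernel_mem x
          rw [sq_le_one_iff_abs_le_one, abs_le]
          constructor <;> linarith [a1.1, a1.2, a2.1, a2.2]
      _ = ENNReal.ofReal (∫ x in Ioi (T / 2), x ^ (-2 * σ - 1)) := by
          rw [ofReal_integral_eq_lintegral_ofReal (integrableOn_Ioi_rpow_of_lt (by linarith) (by linarith))]
          filter_upwards [ae_restrict_mem measurableSet_Ioi] with x hx
          have : T / 2 < x := hx
          exact Real.rpow_nonneg (by linarith) _
      _ ≤ _ := by
          apply ENNReal.ofReal_le_ofReal
          rw [integral_Ioi_rpow_of_lt (by linarith) (by linarith)]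
          have e1 : -(T / 2) ^ (-2 * σ - 1 + 1) / (-2 * σ - 1 + 1) = (2 ^ (2 * σ) / (2 * σ)) * T ^ (-(2 * σ)) := by
            rw [show -2 * σ - 1 + 1 = -(2 * σ) by ring, Real.div_rpow hT0.le (by norm_num),
              Real.rpow_neg (by norm_num : (0:ℝ) ≤ 2)]
            have : (2:ℝ) ^ (2 * σ) ≠ 0 := by positivity
            field_simp
          rw [e1]
          have e2 : (2:ℝ) ^ (2 * σ) ≤ 8 := by
            calc (2:ℝ) ^ (2 * σ) ≤ 2 ^ (3:ℝ) := by
                  apply Real.rpow_le_rpow_of_exponent_le (by norm_num); linarith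
              _ = 8 := by norm_num
          have e3 : (2:ℝ) ^ (2 * σ) / (2 * σ) ≤ 16 := by
            rw [div_le_iff₀ (by linarith)]; linarith
          have e4 : T ^ (-(2 * σ)) ≤ T ^ (2 * κ) / T := by
            rw [← Real.rpow_sub_one hT0.ne']
            apply Real.rpow_le_rpow_of_exponent_le <;> linarith
          gcongr
  have hlow : ∫⁻ x in Ioc 0 (T / 2), ENNReal.ofReal ((zetaKernel (rexp (1 / T) * x) - zetaKernel x) ^ 2) *
      ENNReal.ofReal (x ^ (-2 * σ - 1)) ≤ ENNReal.ofReal ((20 * (1 + Real.log T) + 16) * (T ^ (2 * κ) / T)) := by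
    set S := summatory (fun _ => 1) with hS
    calc _ ≤ ∫⁻ x in Ioc 0 (T / 2), (2 * (ENNReal.ofReal ((S (rexp (1 / T) * x) - S x) ^ 2) *
                ENNReal.ofReal (x ^ (-2 * σ - 1))) + ENNReal.ofReal (32 * (T ^ (2 * κ) / T ^ 2))) := by
          refine setLIntegral_mono' measurableSet_Ioc fun x hx => ?_
          have hx0 : 0 < x := hx.1
          have hp : 0 ≤ x ^ (-2 * σ - 1) := Real.rpow_nonneg hx0.le _
          rw [← ENNReal.ofReal_mul (sq_nonneg _), ← ENNReal.ofReal_mul (sq_nonneg _),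
            show (2:ENNReal) = ENNReal.ofReal 2 by simp, ← ENNReal.ofReal_mul (by norm_num), 
            ← ENNReal.ofReal_add (by positivity) (by positivity)]
          apply ENNReal.ofReal_le_ofReal
          set A := S (rexp (1 / T) * x) - S x
          set B := max (rexp (1 / T) * x - 1) 0 - max (x - 1) 0 with hB
          have e : zetaKernel (rexp (1 / T) * x) - zetaKernel x = A - B := by
            simp only [zetaKernel, A, B, S]; ring
          have hBb := abs_max_sub_one_window_le hT hx0
          rw [← hB] at hBb
          have hBB : 2 * B ^ 2 * x ^ (-2 * σ - 1) ≤ 32 * (T ^ (2 * κ) / T ^ 2) := by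
            split_ifs at hBb with h2
            · have q1 : B ^ 2 ≤ (2 / T * x) ^ 2 := by rw [← sq_abs B]; gcongr
              have q2 : x ^ (1 - 2 * σ) ≤ 4 * T ^ (2 * κ) := by
                rcases le_total 1 x with hx1 | hx1
                · calc x ^ (1 - 2 * σ) ≤ x ^ (2 * κ) := by
                        apply Real.rpow_le_rpow_of_exponent_le hx1; linarith
                    _ ≤ T ^ (2 * κ) := by
                        apply Real.rpow_le_rpow hx0.le (by linarith [hx.2]) (by linarith)
                    _ ≤ _ := by linarith
                · calc x ^ (1 - 2 * σ) ≤ x ^ (-2 : ℝ) := by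
                        apply Real.rpow_le_rpow_of_exponent_ge hx0 hx1; linarith
                    _ ≤ (1 / 2) ^ (-2 : ℝ) := by
                        apply Real.rpow_le_rpow_of_nonpos (by norm_num) h2.le (by norm_num)
                    _ = 4 := by rw [Real.rpow_neg (by norm_num)]; norm_num
                    _ ≤ _ := by linarith
              calc 2 * B ^ 2 * x ^ (-2 * σ - 1) ≤ 2 * (2 / T * x) ^ 2 * x ^ (-2 * σ - 1) := by gcongr
                _ = 8 / T ^ 2 * x ^ (1 - 2 * σ) := by
                    rw [show 1 - 2 * σ = 2 + (-2 * σ - 1) by ring, Real.rpow_add hx0, Real.rpow_two]; ring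
                _ ≤ 8 / T ^ 2 * (4 * T ^ (2 * κ)) := by gcongr
                _ = _ := by ring
            · have : B = 0 := by
                rw [← abs_eq_zero]; exact le_antisymm hBb (abs_nonneg _)
              rw [this]; simp; positivity
          rw [e]
          have : (A - B) ^ 2 ≤ 2 * A ^ 2 + 2 * B ^ 2 := by nlinarith [sq_nonneg (A + B)]
          calc (A - B) ^ 2 * x ^ (-2 * σ - 1) ≤ (2 * A ^ 2 + 2 * B ^ 2) * x ^ (-2 * σ - 1) := by gcongr
            _ = 2 * (A ^ 2 * x ^ (-2 * σ - 1)) + 2 * B ^ 2 * x ^ (-2 * σ - 1) := by ring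
            _ ≤ _ := by gcongr
      _ = 2 * (∫⁻ x in Ioc 0 (T / 2), ENNReal.ofReal ((S (rexp (1 / T) * x) - S x) ^ 2) *
                ENNReal.ofReal (x ^ (-2 * σ - 1))) + ENNReal.ofReal (32 * (T ^ (2 * κ) / T ^ 2)) * ENNReal.ofReal (T / 2) := by
          rw [lintegral_add_right _ measurable_const, lintegral_const_mul' _ _ (by simp), setLIntegral_const,
            Real.volume_Ioc, sub_zero]
      _ ≤ 2 * ENNReal.ofReal (10 / T * (T ^ (2 * κ) * (1 + Real.log T))) +
            ENNReal.ofReal (32 * (T ^ (2 * κ) / T ^ 2)) * ENNReal.ofReal (T / 2) := by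
          gcongr
          refine (lintegral_summatory_window_le _ hT (by linarith) h1).trans (ENNReal.ofReal_le_ofReal ?_)
          gcongr
          simpa using sum_Icc_rpow_le (by linarith : 1 ≤ T) hκ h
      _ = _ := by
          rw [show (2:ENNReal) = ENNReal.ofReal 2 by simp, ← ENNReal.ofReal_mul (by norm_num),
            ← ENNReal.ofReal_mul (by positivity), ← ENNReal.ofReal_add (by positivity) (by positivity)]
          congr 1
          field_simp; ring
  refine (add_le_add hlow hhigh).trans ?_
  rw [← ENNReal.ofReal_add (by positivity) (by positivity)]
  apply ENNReal.ofReal_le_ofReal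
  rw [← add_mul]
  gcongr
  linarith

theorem lintegral_riemannZeta_sq_le {σ κ T : ℝ} (hT : 2 ≤ T) (hκ : 0 ≤ κ) (h0 : 1 / 4 ≤ σ)
    (h : 1 / 2 - κ ≤ σ) (h1 : σ ≤ 3 / 2) :
    ∫⁻ t in Icc 1 T, ‖riemannZeta ((σ : ℂ) + t * I)‖ₑ ^ 2 ≤
      ENNReal.ofReal (5300 * (1 + Real.log T) * (T * T ^ (2 * κ))) := by
  have hT0 : 0 < T := by linarith
  have hlog : 0 ≤ Real.log T := Real.log_nonneg (by linarith)
  have hTκ : 1 ≤ T ^ (2 * κ) := Real.one_le_rpow (by linarith) (by linarith)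
  have hP := lintegral_mellin_sq_le_difference (f := fun x => (zetaKernel x : ℂ)) (by linarith : 0 ≤ σ) hT0
    (integrableOn_of_bounded_of_support measurable_zetaKernel one_pos (by linarith : 0 < σ) (B := 1)
      (fun x => by rw [abs_of_nonneg (zetaKernel_mem x).1]; exact (zetaKernel_mem x).2) (fun x hx => zetaKernel_of_lt hx))
    (Complex.measurable_ofReal.comp measurable_zetaKernel)
  have hP2 := hP.trans (mul_le_mul_right (lintegral_zetaKernel_difference_le hT hκ h0 h h1) _)
  set F : ℝ → ℂ := fun t => ((σ : ℂ) + t * I) * ∫ x in Ioi (0:ℝ), (zetaKernel x : ℂ) * (x : ℂ) ^ (-((σ : ℂ) + t * I) - 1)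
    with hF
  calc _ ≤ ∫⁻ t in Icc 1 T, (ENNReal.ofReal 2 + ENNReal.ofReal 2 * ‖F t‖ₑ ^ 2) := by
        refine setLIntegral_mono' measurableSet_Icc fun t ht => ?_
        have hs1 : ((σ : ℂ) + t * I) ≠ 1 := by
          intro h; have := congrArg Complex.im h; simp at this; linarith [ht.1]
        rw [riemannZeta_eq_integral_zetaKernel (by simp; linarith) hs1]
        have hn : ‖(1:ℂ) / ((σ : ℂ) + t * I - 1)‖ ≤ 1 := by
          rw [norm_div, norm_one]
          have : 1 ≤ ‖(σ : ℂ) + t * I - 1‖ := by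
            refine le_trans ?_ (Complex.abs_im_le_norm _)
            simp only [Complex.sub_im, Complex.add_im, ofReal_im, mul_im, ofReal_re, I_im, I_re, one_im]
            simp; exact ht.1.trans (le_abs_self t)
          rw [div_le_one (by linarith)]; exact this
        change ‖_ + F t‖ₑ ^ 2 ≤ _
        rw [← ofReal_norm, ← ofReal_norm, ← ENNReal.ofReal_pow (norm_nonneg _), ← ENNReal.ofReal_pow (norm_nonneg _),
          ← ENNReal.ofReal_mul (by norm_num), ← ENNReal.ofReal_add (by norm_num) (by positivity)]
        apply ENNReal.ofReal_le_ofReal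
        have h3 := norm_add_le ((1:ℂ) / ((σ : ℂ) + t * I - 1)) (F t)
        have h4 : ‖(1:ℂ) / ((σ : ℂ) + t * I - 1) + F t‖ ≤ 1 + ‖F t‖ := by linarith
        calc _ ≤ (1 + ‖F t‖) ^ 2 := by gcongr
          _ ≤ _ := by nlinarith [sq_nonneg (1 - ‖F t‖)]
    _ = ENNReal.ofReal 2 * ENNReal.ofReal (T - 1) + ENNReal.ofReal 2 * ∫⁻ t in Icc 1 T, ‖F t‖ₑ ^ 2 := by
        rw [lintegral_add_left measurable_const, lintegral_const_mul' _ _ (by simp), setLIntegral_const, Real.volume_Icc]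
    _ ≤ ENNReal.ofReal 2 * ENNReal.ofReal (T - 1) + ENNReal.ofReal 2 *
          (ENNReal.ofReal (50 * T ^ 2) * ENNReal.ofReal (52 * (1 + Real.log T) * (T ^ (2 * κ) / T))) := by
        gcongr
        refine le_trans ?_ hP2
        exact lintegral_mono_set (Icc_subset_Icc_left (by linarith))
    _ ≤ _ := by
        rw [← ENNReal.ofReal_mul (by norm_num), ← ENNReal.ofReal_mul (by positivity),
          ← ENNReal.ofReal_mul (by norm_num), ← ENNReal.ofReal_add (by linarith) (by positivity)]
        apply ENNReal.ofReal_le_ofReal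
        have e : 2 * (50 * T ^ 2 * (52 * (1 + Real.log T) * (T ^ (2 * κ) / T))) =
          5200 * (1 + Real.log T) * (T * T ^ (2 * κ)) := by field_simp; ring
        rw [e]
        have : T ≤ (1 + Real.log T) * (T * T ^ (2 * κ)) := by
          have : T * 1 ≤ T * T ^ (2 * κ) := by gcongr
          nlinarith
        linarith

/-- Discrepancy of the count of multiples of `d` in `(n, n + H]`. -/
noncomputable def multDiscrepancy (H d n : ℕ) : ℝ := (((n + H) / d : ℕ) : ℝ) - ((n / d : ℕ) : ℝ) - (H : ℝ) / d

theorem natCast_div_eq_sub_fract {d : ℕ} (hd : 0 < d) (n : ℕ) :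
    ((n / d : ℕ) : ℝ) = (n : ℝ) / d - ((n % d : ℕ) : ℝ) / d := by
  have hd' : (d : ℝ) ≠ 0 := by positivity
  have h : (n : ℝ) = d * ((n / d : ℕ) : ℝ) + ((n % d : ℕ) : ℝ) := by exact_mod_cast (Nat.div_add_mod n d).symm
  rw [eq_comm, ← sub_div, div_eq_iff hd']
  linarith

theorem multDiscrepancy_eq {d : ℕ} (hd : 0 < d) (H n : ℕ) :
    multDiscrepancy H d n = ((n % d : ℕ) : ℝ) / d - (((n + H) % d : ℕ) : ℝ) / d := by
  rw [multDiscrepancy, natCast_div_eq_sub_fract hd, natCast_div_eq_sub_fract hd]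
  push_cast; ring

theorem abs_multDiscrepancy_le {d : ℕ} (hd : 0 < d) (H n : ℕ) : |multDiscrepancy H d n| ≤ 1 := by
  have h : ∀ k : ℕ, 0 ≤ ((k % d : ℕ) : ℝ) / d ∧ ((k % d : ℕ) : ℝ) / d ≤ 1 := fun k =>
    ⟨by positivity, div_le_one_of_le₀ (by exact_mod_cast (Nat.mod_lt k hd).le) (by positivity)⟩
  rw [multDiscrepancy_eq hd, abs_le]
  constructor <;> linarith [(h n).1, (h n).2, (h (n + H)).1, (h (n + H)).2]

theorem multDiscrepancy_add {d : ℕ} (hd : 0 < d) {L : ℕ} (hL : d ∣ L) (H n : ℕ) :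
    multDiscrepancy H d (n + L) = multDiscrepancy H d n := by
  obtain ⟨k, rfl⟩ := hL
  rw [multDiscrepancy_eq hd, multDiscrepancy_eq hd, Nat.add_mul_mod_self_left,
    show n + d * k + H = n + H + d * k by ring, Nat.add_mul_mod_self_left]

theorem sum_range_shift_of_periodic {F : ℕ → ℝ} {L : ℕ} (hF : ∀ n, F (n + L) = F n) (m : ℕ) :
    ∑ n ∈ Finset.range L, F (n + m) = ∑ n ∈ Finset.range L, F n := by
  induction m with
  | zero => simp
  | succ m ih =>
    rw [← ih]
    have h1 := Finset.sum_range_succ (fun n => F (n + m)) L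
    have h2 := Finset.sum_range_succ' (fun n => F (n + m)) L
    have h3 : F (L + m) = F (0 + m) := by rw [add_comm L m, hF, zero_add]
    have h4 : ∑ n ∈ Finset.range L, F (n + (m + 1)) = ∑ n ∈ Finset.range L, F (n + 1 + m) :=
      Finset.sum_congr rfl fun n _ => by congr 1; ring
    rw [h4]; linarith

theorem abs_sum_range_le_of_periodic {F : ℕ → ℝ} {L : ℕ} (hL : 0 < L) (hF : ∀ n, F (n + L) = F n)
    (h1 : ∀ n, |F n| ≤ 1) {B : ℝ} (hB : |∑ n ∈ Finset.range L, F n| ≤ B) (V m : ℕ) :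
    |∑ n ∈ Finset.range V, F (n + m)| ≤ (V : ℝ) / L * B + L := by
  have hB0 : 0 ≤ B := (abs_nonneg _).trans hB
  have hL' : (0:ℝ) < L := by exact_mod_cast hL
  induction V using Nat.strong_induction_on generalizing m with
  | _ V ih =>
    rcases lt_or_ge V L with h | h
    · calc |∑ n ∈ Finset.range V, F (n + m)| ≤ ∑ n ∈ Finset.range V, |F (n + m)| := Finset.abs_sum_le_sum_abs _ _
        _ ≤ ∑ n ∈ Finset.range V, (1:ℝ) := Finset.sum_le_sum fun n _ => h1 _
        _ = V := by simp
        _ ≤ L := by exact_mod_cast h.le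
        _ ≤ _ := by have : 0 ≤ (V : ℝ) / L * B := by positivity
                    linarith
    · obtain ⟨W, rfl⟩ := Nat.exists_eq_add_of_le h
      rw [Finset.sum_range_add]
      have h2 := ih W (by omega) (L + m)
      have h3 := sum_range_shift_of_periodic hF m
      have h4 : ∑ n ∈ Finset.range W, F (L + n + m) = ∑ n ∈ Finset.range W, F (n + (L + m)) :=
        Finset.sum_congr rfl fun n _ => by congr 1; ring
      rw [h4, h3]
      refine (abs_add_le _ _).trans ?_
      have h5 : ((L + W : ℕ) : ℝ) / L * B = B + (W:ℝ) / L * B := by push_cast; field_simp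
      rw [h5]; linarith

theorem sum_range_multDiscrepancy {d L : ℕ} (hd : 0 < d) (hL : d ∣ L) (H : ℕ) :
    ∑ n ∈ Finset.range L, multDiscrepancy H d n = 0 := by
  have h := sum_range_shift_of_periodic (F := fun n => ((n % d : ℕ) : ℝ) / d) (L := L) (fun n => by
    obtain ⟨k, rfl⟩ := hL; simp only [Nat.add_mul_mod_self_left]) H
  simp_rw [multDiscrepancy_eq hd, Finset.sum_sub_distrib]
  linarith

theorem natCast_div_sub_div_eq_sum (d H n : ℕ) :
    (((n + H) / d : ℕ) : ℝ) - ((n / d : ℕ) : ℝ) = ∑ i ∈ Finset.Icc 1 H, if d ∣ n + i then (1:ℝ) else 0 := by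
  induction H with
  | zero => simp
  | succ H ih =>
    rw [Finset.sum_Icc_succ_top (by omega), ← ih, ← add_assoc, Nat.succ_div]
    split_ifs <;> push_cast <;> ring

theorem sum_range_lcm_dvd_dvd {d e : ℕ} (hd : 0 < d) (he : 0 < e) (i j : ℕ) :
    ∑ n ∈ Finset.range (Nat.lcm d e), ((if d ∣ n + i then (1:ℝ) else 0) * (if e ∣ n + j then (1:ℝ) else 0)) =
      if Nat.gcd d e ∣ (Nat.gcd d e - 1) * i + j then (1:ℝ) else 0 := by
  have hg : 0 < Nat.gcd d e := Nat.gcd_pos_of_pos_left _ hd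
  have key : Nat.gcd d e ∣ (Nat.gcd d e - 1) * i + j ↔ ((Nat.gcd d e : ℕ) : ℤ) ∣ (j : ℤ) - i := by
    rw [← Int.natCast_dvd_natCast]
    push_cast [Nat.cast_sub (show 1 ≤ Nat.gcd d e from hg)]
    rw [show (((Nat.gcd d e : ℕ) : ℤ) - 1) * i + j = ((Nat.gcd d e : ℕ) : ℤ) * i + ((j:ℤ) - i) by ring]
    exact dvd_add_right (dvd_mul_right _ _)
  have hgd : ((Nat.gcd d e : ℕ) : ℤ) ∣ d := by exact_mod_cast Nat.gcd_dvd_left d e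
  have hge : ((Nat.gcd d e : ℕ) : ℤ) ∣ e := by exact_mod_cast Nat.gcd_dvd_right d e
  have hcast : ∀ a n k : ℕ, a ∣ n + k ↔ (a : ℤ) ∣ (n:ℤ) + k := fun a n k => by
    rw [← Int.natCast_dvd_natCast]; push_cast; rfl
  have hprod : ∀ n, ((if d ∣ n + i then (1:ℝ) else 0) * (if e ∣ n + j then (1:ℝ) else 0)) =
      if d ∣ n + i ∧ e ∣ n + j then 1 else 0 := fun n => by
    by_cases h1 : d ∣ n + i <;> by_cases h2 : e ∣ n + j <;> simp [h1, h2]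
  simp_rw [hprod, Finset.sum_boole]
  split_ifs with h
  · rw [key] at h
    have hmod : (d - 1) * i ≡ (e - 1) * j [MOD Nat.gcd d e] := by
      rw [Nat.modEq_iff_dvd]
      push_cast [Nat.cast_sub (show 1 ≤ d from hd), Nat.cast_sub (show 1 ≤ e from he)]
      rw [show ((e:ℤ) - 1) * j - (d - 1) * i = (e * j - d * i) - (j - i) by ring]
      exact dvd_sub (dvd_sub (hge.mul_right _) (hgd.mul_right _)) h
    obtain ⟨n, hn1, hn2⟩ := Nat.chineseRemainder' hmod
    set L := Nat.lcm d e
    have hL : 0 < L := Nat.lcm_pos hd he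
    have : (Finset.range L).filter (fun n => d ∣ n + i ∧ e ∣ n + j) = {n % L} := by
      have hnd : d ∣ n + i := by
        have := Nat.ModEq.add_right i hn1
        rw [show (d - 1) * i + i = d * i by
          obtain ⟨d, rfl⟩ := Nat.exists_eq_add_of_lt hd; simp; ring] at this
        exact (Nat.modEq_zero_iff_dvd).1 (this.trans ((Nat.modEq_zero_iff_dvd).2 (dvd_mul_right _ _)))
      have hne : e ∣ n + j := by
        have := Nat.ModEq.add_right j hn2
        rw [show (e - 1) * j + j = e * j by
          obtain ⟨e, rfl⟩ := Nat.exists_eq_add_of_lt he; simp; ring] at this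
        exact (Nat.modEq_zero_iff_dvd).1 (this.trans ((Nat.modEq_zero_iff_dvd).2 (dvd_mul_right _ _)))
      ext k
      simp only [Finset.mem_filter, Finset.mem_range, Finset.mem_singleton]
      constructor
      · rintro ⟨hk, h1, h2⟩
        have : n ≡ k [MOD L] := by
          rw [Nat.modEq_iff_dvd]
          rw [hcast] at h1 h2 hnd hne
          have : ((L:ℕ):ℤ) ∣ (k:ℤ) - n ↔ L ∣ ((k:ℤ) - n).natAbs := Int.natCast_dvd
          rw [this]
          refine Nat.lcm_dvd (Int.natCast_dvd.1 ?_) (Int.natCast_dvd.1 ?_)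
          · have := dvd_sub h1 hnd; simpa using this
          · have := dvd_sub h2 hne; simpa using this
        exact (Nat.mod_eq_of_lt hk).symm.trans this.symm
      · rintro rfl
        have hdL : d ∣ L := Nat.dvd_lcm_left _ _
        have heL : e ∣ L := Nat.dvd_lcm_right _ _
        refine ⟨Nat.mod_lt _ hL, ?_, ?_⟩
        · have h3 : n % L ≡ n [MOD d] := (Nat.mod_modEq n L).of_dvd hdL
          exact ((h3.add_right i).dvd_iff dvd_rfl).2 hnd
        · have h3 : n % L ≡ n [MOD e] := (Nat.mod_modEq n L).of_dvd heL
          exact ((h3.add_right j).dvd_iff dvd_rfl).2 hne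
    rw [this]; simp
  · rw [Nat.cast_eq_zero, Finset.card_eq_zero, Finset.filter_eq_empty_iff]
    rintro n - ⟨h1, h2⟩
    rw [hcast] at h1 h2
    refine h (key.2 ?_)
    have := dvd_sub (hge.trans h2) (hgd.trans h1)
    simpa using this

theorem abs_sum_multDiscrepancy_mul_le {d e : ℕ} (hd : 0 < d) (he : 0 < e) (H : ℕ) :
    |∑ n ∈ Finset.range (Nat.lcm d e), multDiscrepancy H d n * multDiscrepancy H e n| ≤ H := by
  have hg : 0 < Nat.gcd d e := Nat.gcd_pos_of_pos_left _ hd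
  set g := Nat.gcd d e with hgdef
  set L := Nat.lcm d e with hLdef
  have hdL : d ∣ L := Nat.dvd_lcm_left _ _
  have heL : e ∣ L := Nat.dvd_lcm_right _ _
  let c : ℕ → ℕ → ℝ := fun d n => (((n + H) / d : ℕ) : ℝ) - ((n / d : ℕ) : ℝ)
  have hu : ∀ d n, multDiscrepancy H d n = c d n - (H:ℝ) / d := fun _ _ => rfl
  have hsd := sum_range_multDiscrepancy hd hdL H
  have hse := sum_range_multDiscrepancy he heL H
  have hcd : ∑ n ∈ Finset.range L, c d n = L * ((H:ℝ) / d) := by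
    simp_rw [hu, Finset.sum_sub_distrib] at hsd
    simp at hsd; linarith
  have h1 : ∑ n ∈ Finset.range L, multDiscrepancy H d n * multDiscrepancy H e n =
      ∑ n ∈ Finset.range L, c d n * c e n - L * ((H:ℝ) / d) * ((H:ℝ) / e) := by
    have : ∀ n, multDiscrepancy H d n * multDiscrepancy H e n =
        c d n * c e n - c d n * ((H:ℝ) / e) - ((H:ℝ) / d) * multDiscrepancy H e n := by
      intro n; rw [hu, hu]; ring
    simp_rw [this, Finset.sum_sub_distrib, ← Finset.mul_sum, ← Finset.sum_mul]
    rw [hse, hcd]; ring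
  have h2 : ∑ n ∈ Finset.range L, c d n * c e n =
      ∑ i ∈ Finset.Icc 1 H, (multDiscrepancy H g ((g - 1) * i) + (H:ℝ) / g) := by
    have : ∀ n, c d n * c e n = ∑ i ∈ Finset.Icc 1 H, ∑ j ∈ Finset.Icc 1 H,
        ((if d ∣ n + i then (1:ℝ) else 0) * (if e ∣ n + j then (1:ℝ) else 0)) := by
      intro n
      simp only [c]
      rw [natCast_div_sub_div_eq_sum, natCast_div_sub_div_eq_sum, Finset.sum_mul_sum]
    simp_rw [this]
    rw [Finset.sum_comm]
    refine Finset.sum_congr rfl fun i _ => ?_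
    rw [Finset.sum_comm]
    simp_rw [hLdef, sum_range_lcm_dvd_dvd hd he]
    rw [← hgdef, multDiscrepancy, natCast_div_sub_div_eq_sum]; ring
  have h3 : (L:ℝ) * ((H:ℝ) / d) * ((H:ℝ) / e) = H * ((H:ℝ) / g) := by
    have : (g:ℝ) * L = d * e := by exact_mod_cast Nat.gcd_mul_lcm d e
    have hd' : (d:ℝ) ≠ 0 := by positivity
    have he' : (e:ℝ) ≠ 0 := by positivity
    have hg' : (g:ℝ) ≠ 0 := by positivity
    field_simp
    linear_combination (H:ℝ)^2 * this
  rw [h1, h2, h3, Finset.sum_add_distrib]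
  simp only [Finset.sum_const, Nat.card_Icc, add_tsub_cancel_right, nsmul_eq_mul, add_sub_cancel_right]
  refine (Finset.abs_sum_le_sum_abs _ _).trans ((Finset.sum_le_sum fun i _ => abs_multDiscrepancy_le hg H _).trans ?_)
  simp

theorem sum_sq_sum_multDiscrepancy_le (a : ℕ → ℝ) (ha : ∀ n, |a n| ≤ 1) (y H V m : ℕ) :
    ∑ n ∈ Finset.range V, (∑ d ∈ Finset.Icc 1 y, a d * multDiscrepancy H d (n + m)) ^ 2 ≤
      V * H * ∑ d ∈ Finset.Icc 1 y, ∑ e ∈ Finset.Icc 1 y, (1:ℝ) / Nat.lcm d e + (y:ℝ) ^ 4 := by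
  have h1 : ∑ n ∈ Finset.range V, (∑ d ∈ Finset.Icc 1 y, a d * multDiscrepancy H d (n + m)) ^ 2 =
      ∑ d ∈ Finset.Icc 1 y, ∑ e ∈ Finset.Icc 1 y, a d * a e *
        ∑ n ∈ Finset.range V, multDiscrepancy H d (n + m) * multDiscrepancy H e (n + m) := by
    simp_rw [sq, Finset.sum_mul_sum, Finset.mul_sum]
    rw [Finset.sum_comm]
    refine Finset.sum_congr rfl fun d _ => ?_
    rw [Finset.sum_comm]
    refine Finset.sum_congr rfl fun e _ => Finset.sum_congr rfl fun n _ => by ring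
  rw [h1]
  have h2 : ∀ d ∈ Finset.Icc 1 y, ∀ e ∈ Finset.Icc 1 y, a d * a e *
        ∑ n ∈ Finset.range V, multDiscrepancy H d (n + m) * multDiscrepancy H e (n + m) ≤
        V * H * ((1:ℝ) / Nat.lcm d e) + (y:ℝ) ^ 2 := by
    intro d hd e he
    rw [Finset.mem_Icc] at hd he
    have hd0 : 0 < d := by omega
    have he0 : 0 < e := by omega
    have hL : 0 < Nat.lcm d e := Nat.lcm_pos hd0 he0
    have h3 := abs_sum_range_le_of_periodic (F := fun n => multDiscrepancy H d n * multDiscrepancy H e n) hL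
      (fun n => by rw [multDiscrepancy_add hd0 (Nat.dvd_lcm_left _ _), multDiscrepancy_add he0 (Nat.dvd_lcm_right _ _)])
      (fun n => by
        rw [abs_mul]
        exact mul_le_one₀ (abs_multDiscrepancy_le hd0 H n) (abs_nonneg _) (abs_multDiscrepancy_le he0 H n))
      (abs_sum_multDiscrepancy_mul_le hd0 he0 H) V m
    have h4 : (Nat.lcm d e : ℝ) ≤ (y:ℝ) ^ 2 := by
      have : Nat.lcm d e ≤ y ^ 2 := (Nat.le_of_dvd (by positivity) (Nat.lcm_dvd_mul d e)).trans (by nlinarith)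
      exact_mod_cast this
    refine (le_abs_self _).trans ?_
    rw [abs_mul, abs_mul]
    calc _ ≤ 1 * |∑ n ∈ Finset.range V, multDiscrepancy H d (n + m) * multDiscrepancy H e (n + m)| := by
          gcongr
          exact mul_le_one₀ (ha d) (abs_nonneg _) (ha e)
      _ ≤ _ := by
          rw [one_mul]
          refine h3.trans ?_
          have : (V:ℝ) / (Nat.lcm d e : ℝ) * H = V * H * (1 / (Nat.lcm d e : ℝ)) := by ring
          rw [this]; linarith
  refine (Finset.sum_le_sum fun d hd => Finset.sum_le_sum fun e he => h2 d hd e he).trans ?_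
  simp only [Finset.sum_add_distrib, ← Finset.mul_sum]
  simp
  ring_nf; rfl

theorem sum_Icc_inv_le {y : ℕ} (hy : 1 ≤ y) : ∑ n ∈ Finset.Icc 1 y, (1:ℝ) / n ≤ 1 + Real.log y := by
  have := sum_Icc_rpow_le (σ := 1 / 2) (κ := 0) (T := y) (by exact_mod_cast hy) le_rfl (by norm_num)
  simpa [Real.rpow_neg_one] using this

theorem sum_Icc_filter_dvd_inv_le {k y : ℕ} (hk : 0 < k) (hy : 1 ≤ y) :
    ∑ d ∈ Finset.Icc 1 y, (if k ∣ d then (1:ℝ) / d else 0) ≤ 1 / k * (1 + Real.log y) := by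
  rw [← Finset.sum_filter]
  have : (Finset.Icc 1 y).filter (k ∣ ·) ⊆ (Finset.Icc 1 y).image (k * ·) := by
    intro d hd
    simp only [Finset.mem_filter, Finset.mem_Icc] at hd
    obtain ⟨⟨h1, h2⟩, j, rfl⟩ := hd
    have hj : 0 < j := Nat.pos_of_ne_zero (by rintro rfl; simp at h1)
    exact Finset.mem_image.2 ⟨j, Finset.mem_Icc.2 ⟨hj, le_trans (Nat.le_mul_of_pos_left j hk) h2⟩, rfl⟩
  calc _ ≤ ∑ d ∈ (Finset.Icc 1 y).image (k * ·), (1:ℝ) / d :=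
        Finset.sum_le_sum_of_subset_of_nonneg this fun _ _ _ => by positivity
    _ = ∑ d ∈ Finset.Icc 1 y, 1 / k * ((1:ℝ) / d) := by
        rw [Finset.sum_image (fun a _ b _ h => Nat.eq_of_mul_eq_mul_left hk h)]
        refine Finset.sum_congr rfl fun d _ => ?_
        push_cast; rw [div_mul_div_comm, one_mul]
    _ = 1 / k * ∑ d ∈ Finset.Icc 1 y, ((1:ℝ) / d) := by rw [Finset.mul_sum]
    _ ≤ _ := by
        gcongr
        exact sum_Icc_inv_le hy

theorem sum_inv_lcm_le {y : ℕ} (hy : 1 ≤ y) :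
    ∑ d ∈ Finset.Icc 1 y, ∑ e ∈ Finset.Icc 1 y, (1:ℝ) / Nat.lcm d e ≤ (1 + Real.log y) ^ 3 := by
  have hlog : 0 ≤ Real.log y := Real.log_natCast_nonneg y
  have h1 : ∀ d ∈ Finset.Icc 1 y, ∀ e ∈ Finset.Icc 1 y, (1:ℝ) / Nat.lcm d e ≤
      ∑ k ∈ Finset.Icc 1 y, (k:ℝ) * ((if k ∣ d then (1:ℝ) / d else 0) * (if k ∣ e then (1:ℝ) / e else 0)) := by
    intro d hd e he
    rw [Finset.mem_Icc] at hd he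
    have hg : 0 < Nat.gcd d e := Nat.gcd_pos_of_pos_left _ (by omega)
    have hL : 0 < Nat.lcm d e := Nat.lcm_pos (by omega) (by omega)
    have hd' : (0:ℝ) < d := by exact_mod_cast (by omega : 0 < d)
    have he' : (0:ℝ) < e := by exact_mod_cast (by omega : 0 < e)
    have hmem : Nat.gcd d e ∈ Finset.Icc 1 y :=
      Finset.mem_Icc.2 ⟨hg, (Nat.gcd_le_left e (by omega)).trans hd.2⟩
    refine le_trans ?_ (Finset.single_le_sum (f := fun k : ℕ => (k:ℝ) * ((if k ∣ d then (1:ℝ) / d else 0) *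
      (if k ∣ e then (1:ℝ) / e else 0))) (fun k _ => by positivity) hmem)
    beta_reduce
    rw [if_pos (Nat.gcd_dvd_left d e), if_pos (Nat.gcd_dvd_right d e)]
    have : ((Nat.gcd d e : ℕ):ℝ) * (Nat.lcm d e : ℕ) = d * e := by exact_mod_cast Nat.gcd_mul_lcm d e
    have hL' : (0:ℝ) < (Nat.lcm d e : ℕ) := by exact_mod_cast hL
    rw [div_le_iff₀ hL', mul_assoc, mul_comm, mul_assoc, mul_comm ((Nat.lcm d e : ℕ):ℝ), this]
    field_simp; rfl
  calc _ ≤ ∑ d ∈ Finset.Icc 1 y, ∑ e ∈ Finset.Icc 1 y, ∑ k ∈ Finset.Icc 1 y,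
        (k:ℝ) * ((if k ∣ d then (1:ℝ) / d else 0) * (if k ∣ e then (1:ℝ) / e else 0)) :=
        Finset.sum_le_sum fun d hd => Finset.sum_le_sum fun e he => h1 d hd e he
    _ = ∑ k ∈ Finset.Icc 1 y, (k:ℝ) * (∑ d ∈ Finset.Icc 1 y, (if k ∣ d then (1:ℝ) / d else 0)) ^ 2 := by
        simp_rw [sq, Finset.sum_mul_sum, Finset.mul_sum]
        rw [Finset.sum_congr rfl fun d _ => Finset.sum_comm, Finset.sum_comm]
    _ ≤ ∑ k ∈ Finset.Icc 1 y, (k:ℝ) * (1 / k * (1 + Real.log y)) ^ 2 := by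
        refine Finset.sum_le_sum fun k hk => ?_
        have := sum_Icc_filter_dvd_inv_le (k := k) (by rw [Finset.mem_Icc] at hk; omega) hy
        gcongr
    _ = (∑ k ∈ Finset.Icc 1 y, (1:ℝ) / k) * (1 + Real.log y) ^ 2 := by
        rw [Finset.sum_mul]
        refine Finset.sum_congr rfl fun k hk => ?_
        have : (k:ℝ) ≠ 0 := by
          rw [Finset.mem_Icc] at hk
          exact_mod_cast (by omega : k ≠ 0)
        field_simp
    _ ≤ (1 + Real.log y) * (1 + Real.log y) ^ 2 := by
        gcongr
        exact sum_Icc_inv_le hy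
    _ = _ := by ring

theorem sum_sq_divisor_sum_div_le (a : ℕ → ℝ) (ha : ∀ n, |a n| ≤ 1) {y N : ℕ} (hN : 1 ≤ N) :
    ∑ n ∈ Finset.Icc 1 N, (∑ d ∈ Finset.Icc 1 y, if d ∣ n then a d else 0) ^ 2 / (n:ℝ) ≤
      (1 + Real.log N) * ∑ d ∈ Finset.Icc 1 y, ∑ e ∈ Finset.Icc 1 y, (1:ℝ) / Nat.lcm d e := by
  have h1 : ∑ n ∈ Finset.Icc 1 N, (∑ d ∈ Finset.Icc 1 y, if d ∣ n then a d else 0) ^ 2 / (n:ℝ) =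
      ∑ d ∈ Finset.Icc 1 y, ∑ e ∈ Finset.Icc 1 y, a d * a e *
        ∑ n ∈ Finset.Icc 1 N, (if Nat.lcm d e ∣ n then (1:ℝ) / n else 0) := by
    simp_rw [sq, Finset.sum_mul_sum, Finset.sum_div, Finset.mul_sum]
    rw [Finset.sum_comm]
    refine Finset.sum_congr rfl fun d _ => ?_
    rw [Finset.sum_comm]
    refine Finset.sum_congr rfl fun e _ => Finset.sum_congr rfl fun n _ => ?_
    simp only [Nat.lcm_dvd_iff]
    by_cases h1 : d ∣ n <;> by_cases h2 : e ∣ n <;> simp [h1, h2, div_eq_mul_inv]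
  rw [h1, Finset.mul_sum]
  refine Finset.sum_le_sum fun d hd => ?_
  rw [Finset.mul_sum]
  refine Finset.sum_le_sum fun e he => ?_
  rw [Finset.mem_Icc] at hd he
  have h2 := sum_Icc_filter_dvd_inv_le (k := Nat.lcm d e) (Nat.lcm_pos (by omega) (by omega)) hN
  have h3 : 0 ≤ ∑ n ∈ Finset.Icc 1 N, (if Nat.lcm d e ∣ n then (1:ℝ) / n else 0) :=
    Finset.sum_nonneg fun n _ => by positivity
  have h4 : a d * a e ≤ 1 := (le_abs_self _).trans (by
    rw [abs_mul]; exact mul_le_one₀ (ha d) (abs_nonneg _) (ha e))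
  calc _ ≤ 1 * ∑ n ∈ Finset.Icc 1 N, (if Nat.lcm d e ∣ n then (1:ℝ) / n else 0) := by gcongr
    _ ≤ _ := by linarith

/-- The Möbius function cut off at `y`. -/
noncomputable def mollCoeff (y n : ℕ) : ℝ := if n ≤ y then (ArithmeticFunction.moebius n : ℝ) else 0

theorem abs_mollCoeff_le (y n : ℕ) : |mollCoeff y n| ≤ 1 := by
  unfold mollCoeff
  split_ifs
  · exact_mod_cast ArithmeticFunction.abs_moebius_le_one
  · simp

theorem mollCoeff_of_lt {y n : ℕ} (h : y < n) : mollCoeff y n = 0 := by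
  simp [mollCoeff, h]

/-- The Dirichlet polynomial `∑_{n ≤ y} μ(n) n^{-s}`. -/
noncomputable def mollifier (y : ℕ) (s : ℂ) : ℂ := ∑ n ∈ Finset.Icc 1 y, (mollCoeff y n : ℂ) * (n : ℂ) ^ (-s)

/-- Dirichlet coefficients of `ζ * mollifier - 1`. -/
noncomputable def mollB (y n : ℕ) : ℝ :=
  (∑ d ∈ Finset.Icc 1 y, if d ∣ n then mollCoeff y d else 0) - if n = 1 then 1 else 0

noncomputable def mollMean (y : ℕ) : ℝ := ∑ d ∈ Finset.Icc 1 y, mollCoeff y d / d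

noncomputable def mollKernel (y : ℕ) (x : ℝ) : ℝ := summatory (mollB y) x - mollMean y * x

theorem abs_mollMean_le {y : ℕ} (hy : 1 ≤ y) : |mollMean y| ≤ 1 + Real.log y := by
  refine (Finset.abs_sum_le_sum_abs _ _).trans (le_trans (Finset.sum_le_sum fun d _ => ?_) (sum_Icc_inv_le hy))
  rw [abs_div, Nat.abs_cast]
  gcongr
  exact abs_mollCoeff_le y d

theorem mollB_eq_zero {y n : ℕ} (h0 : 0 < n) (hn : n ≤ y) : mollB y n = 0 := by
  have h1 : ∑ d ∈ Finset.Icc 1 y, (if d ∣ n then mollCoeff y d else 0) =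
      ∑ d ∈ n.divisors, (ArithmeticFunction.moebius d : ℝ) := by
    rw [← Finset.sum_filter]
    have : (Finset.Icc 1 y).filter (· ∣ n) = n.divisors := by
      ext d
      simp only [Finset.mem_filter, Finset.mem_Icc, Nat.mem_divisors]
      constructor
      · rintro ⟨_, h⟩; exact ⟨h, h0.ne'⟩
      · rintro ⟨h, _⟩
        exact ⟨⟨Nat.pos_of_dvd_of_pos h h0, (Nat.le_of_dvd h0 h).trans hn⟩, h⟩
    rw [this]
    refine Finset.sum_congr rfl fun d hd => ?_
    rw [mollCoeff, if_pos ((Nat.divisor_le hd).trans hn)]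
  have h2 : ∑ d ∈ n.divisors, (ArithmeticFunction.moebius d : ℝ) = if n = 1 then 1 else 0 := by
    have := congrArg (fun f => f n) (ArithmeticFunction.moebius_mul_coe_zeta)
    rw [ArithmeticFunction.coe_mul_zeta_apply, ArithmeticFunction.one_apply] at this
    exact_mod_cast this
  rw [mollB, h1, h2, sub_self]

theorem sum_mollB_sq_le {y N : ℕ} (hy : 1 ≤ y) (hN : 1 ≤ N) {σ : ℝ} (hσ : 1 / 2 ≤ σ) :
    ∑ n ∈ Finset.Icc 1 N, mollB y n ^ 2 * (n:ℝ) ^ (-2 * σ) ≤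
      (y:ℝ) ^ (1 - 2 * σ) * ((1 + Real.log N) * (1 + Real.log y) ^ 3) := by
  have hlN : 0 ≤ Real.log N := Real.log_natCast_nonneg N
  calc _ ≤ ∑ n ∈ Finset.Icc 1 N, (y:ℝ) ^ (1 - 2 * σ) *
        ((∑ d ∈ Finset.Icc 1 y, if d ∣ n then mollCoeff y d else 0) ^ 2 / (n:ℝ)) := by
        refine Finset.sum_le_sum fun n hn => ?_
        rw [Finset.mem_Icc] at hn
        rcases le_or_gt n y with h | h
        · rw [mollB_eq_zero (by omega) h, zero_pow two_ne_zero, zero_mul]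
          positivity
        · rw [mollB, if_neg (by omega), sub_zero]
          have hn0 : (0:ℝ) < n := by exact_mod_cast (by omega : 0 < n)
          have hy0 : (0:ℝ) < y := by exact_mod_cast (by omega : 0 < y)
          have h3 : (n:ℝ) ^ (-2 * σ) = (n:ℝ) ^ (1 - 2 * σ) / n := by
            rw [show -2 * σ = 1 - 2 * σ - 1 by ring, Real.rpow_sub_one hn0.ne']
          rw [h3, mul_div_assoc', mul_div_assoc', mul_comm]
          have : (n:ℝ) ^ (1 - 2 * σ) ≤ (y:ℝ) ^ (1 - 2 * σ) :=
            Real.rpow_le_rpow_of_nonpos hy0 (by exact_mod_cast h.le) (by linarith)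
          gcongr
    _ ≤ (y:ℝ) ^ (1 - 2 * σ) * ((1 + Real.log N) * ∑ d ∈ Finset.Icc 1 y, ∑ e ∈ Finset.Icc 1 y, (1:ℝ) / Nat.lcm d e) := by
        rw [← Finset.mul_sum]
        gcongr
        exact sum_sq_divisor_sum_div_le _ (abs_mollCoeff_le y) hN
    _ ≤ _ := by
        gcongr
        exact sum_inv_lcm_le hy

theorem summatory_mollB (y : ℕ) (x : ℝ) :
    summatory (mollB y) x = ∑ d ∈ Finset.Icc 1 y, mollCoeff y d * ((⌊x⌋₊ / d : ℕ) : ℝ) -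
      if 1 ≤ x then 1 else 0 := by
  rw [summatory]
  simp_rw [mollB, Finset.sum_sub_distrib]
  congr 1
  · rw [Finset.sum_comm]
    refine Finset.sum_congr rfl fun d _ => ?_
    have := natCast_div_sub_div_eq_sum d ⌊x⌋₊ 0
    simp only [zero_add, Nat.zero_div, Nat.cast_zero, sub_zero] at this
    rw [this, Finset.mul_sum]
    refine Finset.sum_congr rfl fun n _ => by simp
  · rw [Finset.sum_ite_eq']
    simp only [Finset.mem_Icc, le_refl, true_and, Nat.one_le_floor_iff]

theorem mollKernel_eq (y : ℕ) {x : ℝ} (hx : 0 ≤ x) :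
    mollKernel y x = -(∑ d ∈ Finset.Icc 1 y, mollCoeff y d * Int.fract (x / d)) - if 1 ≤ x then 1 else 0 := by
  rw [mollKernel, summatory_mollB, mollMean, Finset.sum_mul, sub_right_comm, ← Finset.sum_sub_distrib,
    ← Finset.sum_neg_distrib]
  congr 1
  refine Finset.sum_congr rfl fun d _ => ?_
  have : ((⌊x⌋₊ / d : ℕ) : ℝ) = x / d - Int.fract (x / d) := by
    rw [← Nat.floor_div_natCast, natCast_floor_eq_intCast_floor (by positivity), Int.self_sub_fract]
  rw [this]; ring

theorem mollKernel_sub (y : ℕ) {x z : ℝ} (hx : 1 ≤ x) (hz : x ≤ z) :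
    mollKernel y z - mollKernel y x = ∑ d ∈ Finset.Icc 1 y, mollCoeff y d * multDiscrepancy (⌊z⌋₊ - ⌊x⌋₊) d ⌊x⌋₊ +
      mollMean y * (((⌊z⌋₊ - ⌊x⌋₊ : ℕ) : ℝ) - (z - x)) := by
  have hle : ⌊x⌋₊ ≤ ⌊z⌋₊ := Nat.floor_mono hz
  rw [mollKernel, mollKernel, summatory_mollB, summatory_mollB, if_pos hx, if_pos (hx.trans hz)]
  have : ∑ d ∈ Finset.Icc 1 y, mollCoeff y d * multDiscrepancy (⌊z⌋₊ - ⌊x⌋₊) d ⌊x⌋₊ =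
      ∑ d ∈ Finset.Icc 1 y, mollCoeff y d * ((⌊z⌋₊ / d : ℕ) : ℝ) - ∑ d ∈ Finset.Icc 1 y, mollCoeff y d * ((⌊x⌋₊ / d : ℕ) : ℝ)
      - mollMean y * ((⌊z⌋₊ - ⌊x⌋₊ : ℕ) : ℝ) := by
    rw [mollMean, Finset.sum_mul, ← Finset.sum_sub_distrib, ← Finset.sum_sub_distrib]
    refine Finset.sum_congr rfl fun d _ => ?_
    rw [multDiscrepancy, Nat.add_sub_cancel' hle]; ring
  rw [this]; ring

theorem measurable_mollKernel (y : ℕ) : Measurable (mollKernel y) :=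
  (measurable_summatory _).sub (measurable_const.mul measurable_id)

theorem abs_mollKernel_le (y : ℕ) {x : ℝ} (hx : 0 ≤ x) : |mollKernel y x| ≤ y + 1 := by
  rw [mollKernel_eq y hx]
  have h1 : |∑ d ∈ Finset.Icc 1 y, mollCoeff y d * Int.fract (x / d)| ≤ y := by
    refine (Finset.abs_sum_le_sum_abs _ _).trans ((Finset.sum_le_sum (g := fun _ => (1:ℝ)) fun d _ => ?_).trans (by simp))
    rw [abs_mul, abs_of_nonneg (Int.fract_nonneg (x / d))]
    exact mul_le_one₀ (abs_mollCoeff_le y d) (Int.fract_nonneg _) (Int.fract_lt_one _).le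
  have h2 : |(if 1 ≤ x then (1:ℝ) else 0)| ≤ 1 := by split_ifs <;> simp
  rw [abs_le] at h1 h2 ⊢
  constructor <;> linarith [h1.1, h1.2, h2.1, h2.2]

theorem integrableOn_fract_div_cpow {d : ℕ} (hd : 0 < d) {s : ℂ} (hs : 0 < s.re) (hs1 : s.re < 1) :
    IntegrableOn (fun x : ℝ => ((Int.fract (x / d) : ℝ) : ℂ) * (x : ℂ) ^ (-s - 1)) (Ioi 0) ∧
    ∫ x in Ioi (0:ℝ), ((Int.fract (x / d) : ℝ) : ℂ) * (x : ℂ) ^ (-s - 1) =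
      (d : ℂ) ^ (-s) * ∫ x in Ioi (0:ℝ), ((Int.fract x : ℝ) : ℂ) * (x : ℂ) ^ (-s - 1) := by
  have hd0 : (0:ℝ) < d := by exact_mod_cast hd
  have hdC : (d:ℂ) ≠ 0 := by exact_mod_cast hd.ne'
  set g : ℝ → ℂ := fun x => ((Int.fract x : ℝ) : ℂ) * (x : ℂ) ^ (-s - 1) with hg
  have e : ∀ x ∈ Ioi (0:ℝ), ((Int.fract (x / d) : ℝ) : ℂ) * (x : ℂ) ^ (-s - 1) =
      (d:ℂ) ^ (-s - 1) * g ((d:ℝ)⁻¹ * x) := by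
    intro x hx
    have hx0 : (0:ℝ) < x := hx
    have h1 : (x : ℂ) ^ (-s - 1) = (d:ℂ) ^ (-s - 1) * (((d:ℝ)⁻¹ * x : ℝ) : ℂ) ^ (-s - 1) := by
      have := Complex.mul_cpow_ofReal_nonneg hd0.le (by positivity : 0 ≤ (d:ℝ)⁻¹ * x) (-s - 1)
      rw [Complex.ofReal_natCast] at this
      rw [← this]; congr 1; push_cast; field_simp
    rw [hg, h1, div_eq_inv_mul]; ring
  have hgi : IntegrableOn g (Ioi 0) := by
    have hm : Measurable g := measurable_ofReal_fract.mul (by fun_prop)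
    refine (integrableOn_Ioi_zero_fract_rpow hs hs1).mono' hm.aestronglyMeasurable ?_
    refine (ae_restrict_iff' measurableSet_Ioi).2 (Eventually.of_forall fun x hx => ?_)
    rw [hg]; beta_reduce
    rw [norm_mul_cpow_neg_sub_one hx]
  constructor
  · rw [integrableOn_congr_fun e measurableSet_Ioi]
    refine Integrable.const_mul ?_ _
    have := (integrableOn_Ioi_comp_mul_left_iff g 0 (inv_pos.2 hd0)).2 (by simpa using hgi)
    exact this
  · rw [setIntegral_congr_fun measurableSet_Ioi e, integral_const_mul, integral_comp_mul_left_Ioi _ _ (inv_pos.2 hd0)]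
    rw [mul_zero, inv_inv, Complex.cpow_sub _ _ hdC, Complex.cpow_one]
    rw [real_smul, Complex.ofReal_natCast]
    field_simp

theorem integrableOn_mollKernel (y : ℕ) {s : ℂ} (hs : 0 < s.re) (hs1 : s.re < 1) :
    IntegrableOn (fun x : ℝ => (mollKernel y x : ℂ) * (x : ℂ) ^ (-s - 1)) (Ioi 0) ∧
    riemannZeta s * mollifier y s - 1 = s * ∫ x in Ioi (0:ℝ), (mollKernel y x : ℂ) * (x : ℂ) ^ (-s - 1) := by
  have hs0 : s ≠ 0 := by rintro rfl; simp at hs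
  have e : ∀ x ∈ Ioi (0:ℝ), (mollKernel y x : ℂ) * (x : ℂ) ^ (-s - 1) =
      (∑ d ∈ Finset.Icc 1 y, (-(mollCoeff y d : ℂ)) * (((Int.fract (x / d) : ℝ) : ℂ) * (x : ℂ) ^ (-s - 1))) -
        (Ici (1:ℝ)).indicator (fun x : ℝ => (x : ℂ) ^ (-s - 1)) x := by
    intro x hx
    rw [mollKernel_eq y (le_of_lt hx), Complex.ofReal_sub, sub_mul]
    congr 1
    · push_cast
      rw [neg_mul, Finset.sum_mul, ← Finset.sum_neg_distrib]
      exact Finset.sum_congr rfl fun d _ => by ring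
    · by_cases h : 1 ≤ x <;> simp [h, indicator]
  have h1 : ∀ d ∈ Finset.Icc 1 y, IntegrableOn (fun x : ℝ => (-(mollCoeff y d : ℂ)) *
      (((Int.fract (x / d) : ℝ) : ℂ) * (x : ℂ) ^ (-s - 1))) (Ioi 0) := fun d hd =>
    (integrableOn_fract_div_cpow (by rw [Finset.mem_Icc] at hd; omega) hs hs1).1.const_mul _
  have h2 : IntegrableOn ((Ici (1:ℝ)).indicator (fun x : ℝ => (x : ℂ) ^ (-s - 1))) (Ioi 0) := by
    refine IntegrableOn.mono_set (t := univ) ?_ (subset_univ _)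
    rw [integrableOn_univ, integrable_indicator_iff measurableSet_Ici, integrableOn_Ici_iff_integrableOn_Ioi]
    exact integrableOn_Ioi_cpow_of_lt (by rw [sub_re, neg_re, one_re]; linarith) one_pos
  have h3 := integrable_finset_sum _ h1
  constructor
  · rw [integrableOn_congr_fun e measurableSet_Ioi]
    exact h3.sub h2
  · rw [setIntegral_congr_fun measurableSet_Ioi e, integral_sub h3 h2, integral_finset_sum _ h1,
      setIntegral_indicator measurableSet_Ici]
    have h4 : Ioi (0:ℝ) ∩ Ici 1 = Ici 1 := by
      rw [inter_eq_right]; intro x hx; exact lt_of_lt_of_le one_pos (mem_Ici.1 hx)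
    rw [h4, integral_Ici_eq_integral_Ioi, integral_Ioi_cpow_of_lt (by rw [sub_re, neg_re, one_re]; linarith) one_pos]
    simp only [sub_add_cancel, Complex.ofReal_one, Complex.one_cpow]
    rw [mul_sub]
    congr 1
    · rw [mollifier, riemannZeta_eq_integral_fract_of_re_lt_one hs hs1, Finset.mul_sum, Finset.mul_sum]
      refine Finset.sum_congr rfl fun d hd => ?_
      rw [integral_const_mul, (integrableOn_fract_div_cpow (by rw [Finset.mem_Icc] at hd; omega) hs hs1).2]
      ring
    · field_simp

theorem lintegral_Ico_floor (g : ℕ → ENNReal) (a V : ℕ) :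
    ∫⁻ x in Ico (a:ℝ) ((a + V : ℕ) : ℝ), g ⌊x⌋₊ = ∑ n ∈ Finset.range V, g (n + a) := by
  induction V with
  | zero => simp
  | succ V ih =>
    have h1 : ((a + V : ℕ) : ℝ) ≤ ((a + (V + 1) : ℕ) : ℝ) := by push_cast; linarith
    rw [← Ico_union_Ico_eq_Ico (by simp : (a:ℝ) ≤ ((a + V : ℕ) : ℝ)) h1,
      lintegral_union measurableSet_Ico (Ico_disjoint_Ico_same), ih, Finset.sum_range_succ]
    congr 1
    have : ∀ x ∈ Ico ((a + V : ℕ) : ℝ) ((a + (V + 1) : ℕ) : ℝ), g ⌊x⌋₊ = g (V + a) := by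
      intro x hx
      congr 1
      rw [Nat.floor_eq_iff ((Nat.cast_nonneg _).trans hx.1)]
      have h1 := hx.1; have h2 := hx.2
      push_cast at h1 h2 ⊢
      constructor <;> linarith
    rw [setLIntegral_congr_fun measurableSet_Ico this, setLIntegral_const, Real.volume_Ico]
    push_cast
    rw [show (a:ℝ) + (V + 1) - (a + V) = 1 by ring]; simp

theorem mollKernel_diff_sq_le (y : ℕ) {T x δV : ℝ} {h : ℕ} (hT : 2 ≤ T) (hx : 1 ≤ x)
    (hlo : (h : ℝ) ≤ δV) (hhi : δV < h + 1) (h1 : δV ≤ (rexp (1 / T) - 1) * x) (h2 : (rexp (1 / T) - 1) * x ≤ δV + 1) :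
    (mollKernel y (rexp (1 / T) * x) - mollKernel y x) ^ 2 ≤
      2 * ∑ k ∈ Finset.range 3, (∑ d ∈ Finset.Icc 1 y, mollCoeff y d * multDiscrepancy (h + k) d ⌊x⌋₊) ^ 2 +
        2 * mollMean y ^ 2 := by
  have hE := one_lt_exp_inv (T := T) (by linarith)
  have hxz : x ≤ rexp (1 / T) * x := le_mul_of_one_le_left (by linarith) hE.le
  set z := rexp (1 / T) * x with hz
  have hle : ⌊x⌋₊ ≤ ⌊z⌋₊ := Nat.floor_mono hxz
  rw [mollKernel_sub y hx hxz]
  set H := ⌊z⌋₊ - ⌊x⌋₊ with hH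
  have hHr : (H:ℝ) = (⌊z⌋₊ : ℝ) - (⌊x⌋₊ : ℝ) := by rw [hH, Nat.cast_sub hle]
  have f1 := Nat.floor_le (show 0 ≤ x by linarith)
  have f2 := Nat.lt_floor_add_one x
  have f3 := Nat.floor_le (show 0 ≤ z by linarith)
  have f4 := Nat.lt_floor_add_one z
  have hzx : z - x = (rexp (1 / T) - 1) * x := by rw [hz]; ring
  have hd : |(H:ℝ) - (z - x)| ≤ 1 := by rw [hHr, abs_le]; constructor <;> linarith
  have hHlo : h ≤ H := by
    have : (h:ℝ) < H + 1 := by rw [hHr]; linarith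
    have : h < H + 1 := by exact_mod_cast this
    omega
  have hHhi : H < h + 3 := by
    have : (H:ℝ) < h + 3 := by rw [hHr]; linarith
    exact_mod_cast this
  clear_value H
  obtain ⟨k, rfl⟩ : ∃ k, H = h + k := ⟨H - h, by omega⟩
  have hk : k ∈ Finset.range 3 := Finset.mem_range.2 (by omega)
  have h3 := Finset.single_le_sum (f := fun k => (∑ d ∈ Finset.Icc 1 y, mollCoeff y d * multDiscrepancy (h + k) d ⌊x⌋₊) ^ 2)
    (fun _ _ => sq_nonneg _) hk
  beta_reduce at h3
  set F := ∑ d ∈ Finset.Icc 1 y, mollCoeff y d * multDiscrepancy (h + k) d ⌊x⌋₊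
  have h4 : (mollMean y * (((h + k : ℕ):ℝ) - (z - x))) ^ 2 ≤ mollMean y ^ 2 := by
    rw [mul_pow]
    have : (((h + k : ℕ):ℝ) - (z - x)) ^ 2 ≤ 1 := by rw [sq_le_one_iff_abs_le_one]; exact hd
    nlinarith [sq_nonneg (mollMean y)]
  nlinarith [sq_nonneg (F - mollMean y * (((h + k : ℕ):ℝ) - (z - x)))]

theorem lintegral_mollKernel_block_le {y j V : ℕ} {T σ : ℝ} (hT : 2 ≤ T) (hy : 1 ≤ y) (hyT : (y:ℝ) ^ 8 ≤ T)
    (hσ : 1 / 2 ≤ σ) (hj : 1 ≤ j) (hV1 : 1 ≤ V) (hV : (V:ℝ) ≤ T / 2) (hVT : T ≤ 4 * V) :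
    ∫⁻ x in Ico ((j * V : ℕ) : ℝ) ((j * V + V : ℕ) : ℝ),
      ENNReal.ofReal ((mollKernel y (rexp (1 / T) * x) - mollKernel y x) ^ 2) * ENNReal.ofReal (x ^ (-2 * σ - 1)) ≤
      ENNReal.ofReal (44 * (1 + Real.log T) ^ 3 * (V:ℝ) ^ (-2 * σ) * (j:ℝ) ^ (-2 * σ)) := by
  have hV0 : (0:ℝ) < V := by exact_mod_cast hV1
  have hj0 : (0:ℝ) < j := by exact_mod_cast hj
  have hy0 : (1:ℝ) ≤ y := by exact_mod_cast hy
  have hlogT : 0 ≤ Real.log T := Real.log_nonneg (by linarith)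
  have hyle : (y:ℝ) ≤ T := le_trans (le_self_pow₀ hy0 (by norm_num)) hyT
  have hy4 : (y:ℝ) ^ 4 ≤ T := le_trans (pow_le_pow_right₀ hy0 (by norm_num)) hyT
  have hlogy : Real.log y ≤ Real.log T := Real.log_le_log (by linarith) hyle
  have hlogy0 : 0 ≤ Real.log y := Real.log_nonneg hy0
  set Λ := (1 + Real.log T) ^ 3 with hΛ
  have hΛ1 : 1 ≤ Λ := one_le_pow₀ (by linarith)
  set δ := rexp (1 / T) - 1 with hδ
  have hδ0 : 0 < δ := by rw [hδ]; linarith [one_lt_exp_inv (T := T) (by linarith)]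
  have hδV : δ * V ≤ 1 := by
    have := exp_inv_sub_one_le hT
    calc δ * V ≤ 2 / T * (T / 2) := by gcongr
      _ = 1 := by field_simp
  set h := ⌊δ * (j * V)⌋₊ with hh
  have hhj : h ≤ j := by
    rw [hh]
    refine Nat.floor_le_of_le ?_
    calc δ * (j * V) = (δ * V) * j := by ring
      _ ≤ 1 * j := by gcongr
      _ = j := one_mul _
  have hjV1 : (1:ℝ) ≤ (j:ℝ) * V := by exact_mod_cast Nat.mul_pos hj hV1
  set Q : ℕ → ℝ := fun n => 2 * ∑ k ∈ Finset.range 3,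
    (∑ d ∈ Finset.Icc 1 y, mollCoeff y d * multDiscrepancy (h + k) d n) ^ 2 + 2 * mollMean y ^ 2 with hQ
  have hQ0 : ∀ n, 0 ≤ Q n := fun n => by
    rw [hQ]; beta_reduce
    have : 0 ≤ ∑ k ∈ Finset.range 3, (∑ d ∈ Finset.Icc 1 y, mollCoeff y d * multDiscrepancy (h + k) d n) ^ 2 :=
      Finset.sum_nonneg fun _ _ => sq_nonneg _
    positivity
  have hm : mollMean y ^ 2 ≤ Λ := by
    have h1 := abs_mollMean_le hy
    calc mollMean y ^ 2 = |mollMean y| ^ 2 := (sq_abs _).symm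
      _ ≤ (1 + Real.log T) ^ 2 := by gcongr; linarith
      _ ≤ Λ := pow_le_pow_right₀ (by linarith) (by norm_num)
  have hlcm : ∑ d ∈ Finset.Icc 1 y, ∑ e ∈ Finset.Icc 1 y, (1:ℝ) / Nat.lcm d e ≤ Λ :=
    (sum_inv_lcm_le hy).trans (by rw [hΛ]; gcongr)
  have hQs : ∑ n ∈ Finset.range V, Q (n + j * V) ≤ 44 * Λ * (V * j) := by
    simp only [hQ]
    rw [Finset.sum_add_distrib, ← Finset.mul_sum, Finset.sum_comm]
    have h5 : ∀ k ∈ Finset.range 3, ∑ n ∈ Finset.range V,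
        (∑ d ∈ Finset.Icc 1 y, mollCoeff y d * multDiscrepancy (h + k) d (n + j * V)) ^ 2 ≤ 7 * Λ * (V * j) := by
      intro k hk
      rw [Finset.mem_range] at hk
      refine (sum_sq_sum_multDiscrepancy_le _ (abs_mollCoeff_le y) y (h + k) V (j * V)).trans ?_
      have hhk : ((h + k : ℕ) : ℝ) ≤ 3 * j := by
        have : h + k ≤ 3 * j := by omega
        exact_mod_cast this
      have hVj : (V:ℝ) ≤ V * j := le_mul_of_one_le_right hV0.le (by exact_mod_cast hj)
      calc _ ≤ (V:ℝ) * (3 * j) * Λ + 4 * V := by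
            have hnn : (0:ℝ) ≤ ∑ d ∈ Finset.Icc 1 y, ∑ e ∈ Finset.Icc 1 y, (1:ℝ) / Nat.lcm d e :=
              Finset.sum_nonneg fun _ _ => Finset.sum_nonneg fun _ _ => by positivity
            gcongr
            linarith
        _ ≤ _ := by nlinarith [mul_le_mul hVj hΛ1 (by norm_num) (by positivity)]
    have h6 := Finset.sum_le_sum h5
    simp only [Finset.sum_const, Finset.card_range, nsmul_eq_mul] at h6 ⊢
    push_cast at h6
    have hVj : (V:ℝ) ≤ V * j := le_mul_of_one_le_right hV0.le (by exact_mod_cast hj)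
    have h7 : (V:ℝ) * (2 * mollMean y ^ 2) ≤ 2 * Λ * (V * j) := by
      calc (V:ℝ) * (2 * mollMean y ^ 2) ≤ (V * j) * (2 * Λ) := by gcongr
        _ = _ := by ring
    linarith
  calc _ ≤ ∫⁻ x in Ico ((j * V : ℕ) : ℝ) ((j * V + V : ℕ) : ℝ),
        ENNReal.ofReal (Q ⌊x⌋₊) * ENNReal.ofReal ((j * V : ℝ) ^ (-2 * σ - 1)) := by
        refine setLIntegral_mono' measurableSet_Ico fun x hx => ?_
        have hx1 : (j:ℝ) * V ≤ x := by have := hx.1; push_cast at this; exact this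
        have hx2 : x < (j:ℝ) * V + V := by have := hx.2; push_cast at this; exact this
        refine mul_le_mul' (ENNReal.ofReal_le_ofReal ?_) (ENNReal.ofReal_le_ofReal ?_)
        · refine mollKernel_diff_sq_le y (δV := δ * (j * V)) hT (by linarith) (Nat.floor_le (by positivity))
            (Nat.lt_floor_add_one _) ?_ ?_
          · rw [← hδ]; gcongr
          · rw [← hδ]
            calc δ * x ≤ δ * (j * V + V) := by gcongr
              _ ≤ _ := by linarith
        · exact Real.rpow_le_rpow_of_nonpos (by positivity) hx1 (by linarith)
    _ = (∑ n ∈ Finset.range V, ENNReal.ofReal (Q (n + j * V))) * ENNReal.ofReal ((j * V : ℝ) ^ (-2 * σ - 1)) := by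
        rw [lintegral_mul_const' _ _ (by simp), lintegral_Ico_floor (fun n => ENNReal.ofReal (Q n))]
    _ ≤ _ := by
        rw [← ENNReal.ofReal_sum_of_nonneg (fun n _ => hQ0 _), ← ENNReal.ofReal_mul (Finset.sum_nonneg fun n _ => hQ0 _)]
        apply ENNReal.ofReal_le_ofReal
        calc _ ≤ 44 * Λ * (V * j) * (j * V : ℝ) ^ (-2 * σ - 1) := by gcongr
          _ = _ := by
            rw [Real.rpow_sub_one (by positivity), Real.mul_rpow hj0.le hV0.le]
            field_simp

theorem lintegral_mollKernel_blocks_le {y V : ℕ} {T σ : ℝ} (hT : 2 ≤ T) (hy : 1 ≤ y) (hyT : (y:ℝ) ^ 8 ≤ T)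
    (hσ : 1 / 2 ≤ σ) (hV1 : 1 ≤ V) (hV : (V:ℝ) ≤ T / 2) (hVT : T ≤ 4 * V) (J : ℕ) :
    ∫⁻ x in Ico (V : ℝ) (((J + 1) * V : ℕ) : ℝ),
      ENNReal.ofReal ((mollKernel y (rexp (1 / T) * x) - mollKernel y x) ^ 2) * ENNReal.ofReal (x ^ (-2 * σ - 1)) ≤
      ENNReal.ofReal (44 * (1 + Real.log T) ^ 3 * (V:ℝ) ^ (-2 * σ) * ∑ j ∈ Finset.Icc 1 J, (j:ℝ) ^ (-2 * σ)) := by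
  have hlogT : 0 ≤ Real.log T := Real.log_nonneg (by linarith)
  induction J with
  | zero => simp
  | succ J ih =>
    have e : (J + 1 + 1) * V = (J + 1) * V + V := by ring
    rw [e, ← Ico_union_Ico_eq_Ico (b := (((J + 1) * V : ℕ) : ℝ)) (by exact_mod_cast Nat.le_mul_of_pos_left V (by omega))
      (by exact_mod_cast (by omega : (J + 1) * V ≤ (J + 1) * V + V)),
      lintegral_union measurableSet_Ico (Ico_disjoint_Ico_same), Finset.sum_Icc_succ_top (by omega), mul_add,
      ENNReal.ofReal_add (by positivity) (by positivity)]
    exact add_le_add ih (lintegral_mollKernel_block_le hT hy hyT hσ (by omega) hV1 hV hVT)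

theorem lintegral_mollKernel_head_le {y : ℕ} {T σ : ℝ} (hT : 2 ≤ T) (hy : 1 ≤ y) (hyT : (y:ℝ) ^ 8 ≤ T)
    (hσ : 1 / 2 ≤ σ) (hσ1 : σ ≤ 19 / 20) :
    ∫⁻ x in Ioc 0 (T / 2),
      ENNReal.ofReal ((mollKernel y (rexp (1 / T) * x) - mollKernel y x) ^ 2) * ENNReal.ofReal (x ^ (-2 * σ - 1)) ≤
      ENNReal.ofReal (100 * ((y:ℝ) ^ (1 - 2 * σ) / T * (1 + Real.log T) ^ 4)) := by
  have hT0 : 0 < T := by linarith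
  have hy0 : (1:ℝ) ≤ y := by exact_mod_cast hy
  have hlogT : 0 ≤ Real.log T := Real.log_nonneg (by linarith)
  have hyle : (y:ℝ) ≤ T := le_trans (le_self_pow₀ hy0 (by norm_num)) hyT
  have hlogy : Real.log y ≤ Real.log T := Real.log_le_log (by linarith) hyle
  have hlogy0 : 0 ≤ Real.log y := Real.log_nonneg hy0
  set m := mollMean y with hm
  have hm2 : m ^ 2 ≤ (1 + Real.log T) ^ 4 := by
    have h1 := abs_mollMean_le hy
    calc m ^ 2 = |m| ^ 2 := (sq_abs _).symm
      _ ≤ (1 + Real.log T) ^ 2 := by gcongr; linarith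
      _ ≤ _ := pow_le_pow_right₀ (by linarith) (by norm_num)
  set δ := rexp (1 / T) - 1 with hδ
  have hδ0 : 0 < δ := by rw [hδ]; linarith [one_lt_exp_inv (T := T) (by linarith)]
  have hδ2 : δ ≤ 2 / T := exp_inv_sub_one_le hT
  have hint : ∫⁻ x in Ioc 0 (T / 2), ENNReal.ofReal (x ^ (1 - 2 * σ)) ≤ ENNReal.ofReal (10 * T ^ (2 - 2 * σ)) := by
    rw [← ofReal_integral_eq_lintegral_ofReal]
    · apply ENNReal.ofReal_le_ofReal
      rw [← intervalIntegral.integral_of_le (by linarith), integral_rpow (Or.inl (by linarith)),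
        Real.zero_rpow (by linarith), sub_zero, show 1 - 2 * σ + 1 = 2 - 2 * σ by ring, div_le_iff₀ (by linarith)]
      have h1 : (T / 2) ^ (2 - 2 * σ) ≤ T ^ (2 - 2 * σ) := by
        apply Real.rpow_le_rpow (by linarith) (by linarith) (by linarith)
      have h2 : 0 ≤ T ^ (2 - 2 * σ) := by positivity
      nlinarith
    · exact (intervalIntegrable_iff_integrableOn_Ioc_of_le (by linarith)).1
        (intervalIntegral.intervalIntegrable_rpow' (by linarith))
    · refine (ae_restrict_iff' measurableSet_Ioc).2 (Eventually.of_forall fun x hx => ?_)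
      exact Real.rpow_nonneg hx.1.le _
  calc _ ≤ ∫⁻ x in Ioc 0 (T / 2), (ENNReal.ofReal 2 * (ENNReal.ofReal ((summatory (mollB y) (rexp (1 / T) * x) -
          summatory (mollB y) x) ^ 2) * ENNReal.ofReal (x ^ (-2 * σ - 1))) +
          ENNReal.ofReal (2 * m ^ 2 * δ ^ 2) * ENNReal.ofReal (x ^ (1 - 2 * σ))) := by
        refine setLIntegral_mono' measurableSet_Ioc fun x hx => ?_
        have hx0 : 0 < x := hx.1
        have e : ENNReal.ofReal (x ^ (1 - 2 * σ)) = ENNReal.ofReal (x ^ 2) * ENNReal.ofReal (x ^ (-2 * σ - 1)) := by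
          rw [← ENNReal.ofReal_mul (by positivity), ← Real.rpow_natCast x 2, ← Real.rpow_add hx0]
          congr 2; push_cast; ring
        rw [e, ← mul_assoc, ← mul_assoc, ← add_mul, ← ENNReal.ofReal_mul zero_le_two,
          ← ENNReal.ofReal_mul (p := 2 * m ^ 2 * δ ^ 2) (by positivity),
          ← ENNReal.ofReal_add (by positivity) (by positivity)]
        refine mul_le_mul_left (ENNReal.ofReal_le_ofReal ?_) _
        rw [mollKernel, mollKernel]
        set A := summatory (mollB y) (rexp (1 / T) * x) - summatory (mollB y) x with hA
        rw [show summatory (mollB y) (rexp (1 / T) * x) - mollMean y * (rexp (1 / T) * x) -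
          (summatory (mollB y) x - mollMean y * x) = A - m * δ * x by rw [hA, hm, hδ]; ring]
        nlinarith [sq_nonneg (A + m * δ * x)]
    _ = ENNReal.ofReal 2 * (∫⁻ x in Ioc 0 (T / 2), (ENNReal.ofReal ((summatory (mollB y) (rexp (1 / T) * x) -
          summatory (mollB y) x) ^ 2) * ENNReal.ofReal (x ^ (-2 * σ - 1)))) +
          ENNReal.ofReal (2 * m ^ 2 * δ ^ 2) * ∫⁻ x in Ioc 0 (T / 2), ENNReal.ofReal (x ^ (1 - 2 * σ)) := by
        rw [lintegral_add_right _ (by fun_prop), lintegral_const_mul' _ _ (by simp), lintegral_const_mul' _ _ (by simp)]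
    _ ≤ ENNReal.ofReal 2 * ENNReal.ofReal (10 / T * ((y:ℝ) ^ (1 - 2 * σ) * (1 + Real.log T) ^ 4)) +
          ENNReal.ofReal (2 * (1 + Real.log T) ^ 4 * (2 / T) ^ 2) * ENNReal.ofReal (10 * T ^ (2 - 2 * σ)) := by
        gcongr
        refine (lintegral_summatory_window_le _ hT (by linarith) (by linarith)).trans (ENNReal.ofReal_le_ofReal ?_)
        refine mul_le_mul_of_nonneg_left ?_ (by positivity)
        have hN : 1 ≤ ⌊T⌋₊ := Nat.one_le_floor_iff _ |>.2 (by linarith)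
        refine (sum_mollB_sq_le hy hN hσ).trans ?_
        have hlN : Real.log ⌊T⌋₊ ≤ Real.log T := Real.log_le_log (by exact_mod_cast hN) (Nat.floor_le hT0.le)
        have hlN0 : 0 ≤ Real.log ⌊T⌋₊ := Real.log_natCast_nonneg _
        calc _ ≤ (y:ℝ) ^ (1 - 2 * σ) * ((1 + Real.log T) * (1 + Real.log T) ^ 3) := by gcongr
          _ = _ := by ring
    _ ≤ _ := by
        rw [← ENNReal.ofReal_mul (by norm_num), ← ENNReal.ofReal_mul (by positivity),
          ← ENNReal.ofReal_add (by positivity) (by positivity)]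
        apply ENNReal.ofReal_le_ofReal
        have h1 : T ^ (2 - 2 * σ) = T * T ^ (1 - 2 * σ) := by
          rw [show 2 - 2 * σ = 1 + (1 - 2 * σ) by ring, Real.rpow_add hT0, Real.rpow_one]
        have h2 : T ^ (1 - 2 * σ) ≤ (y:ℝ) ^ (1 - 2 * σ) :=
          Real.rpow_le_rpow_of_nonpos (by linarith) hyle (by linarith)
        rw [h1]
        have e : 2 * (1 + Real.log T) ^ 4 * (2 / T) ^ 2 * (10 * (T * T ^ (1 - 2 * σ))) =
          80 * (T ^ (1 - 2 * σ) / T * (1 + Real.log T) ^ 4) := by field_simp; ring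
        rw [e]
        have : T ^ (1 - 2 * σ) / T * (1 + Real.log T) ^ 4 ≤ (y:ℝ) ^ (1 - 2 * σ) / T * (1 + Real.log T) ^ 4 := by gcongr
        have e2 : 2 * (10 / T * ((y:ℝ) ^ (1 - 2 * σ) * (1 + Real.log T) ^ 4)) =
          20 * ((y:ℝ) ^ (1 - 2 * σ) / T * (1 + Real.log T) ^ 4) := by ring
        rw [e2]; linarith

theorem lintegral_mollKernel_tail_le {y : ℕ} {T σ X : ℝ} (hT : 2 ≤ T) (hy : 1 ≤ y)
    (hσ : 1 / 2 ≤ σ) (hσ1 : σ ≤ 19 / 20) (hX : (y:ℝ) ^ 4 * (T / 4) ≤ X) :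
    ∫⁻ x in Ici X,
      ENNReal.ofReal ((mollKernel y (rexp (1 / T) * x) - mollKernel y x) ^ 2) * ENNReal.ofReal (x ^ (-2 * σ - 1)) ≤
      ENNReal.ofReal (256 * T ^ (-2 * σ)) := by
  have hT0 : 0 < T := by linarith
  have hy0 : (1:ℝ) ≤ y := by exact_mod_cast hy
  have hX0 : 0 < X := lt_of_lt_of_le (by positivity) hX
  calc _ ≤ ∫⁻ x in Ici X, ENNReal.ofReal (16 * (y:ℝ) ^ 2) * ENNReal.ofReal (x ^ (-2 * σ - 1)) := by
        refine setLIntegral_mono' measurableSet_Ici fun x hx => ?_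
        have hx0 : 0 < x := lt_of_lt_of_le hX0 hx
        refine mul_le_mul_left (ENNReal.ofReal_le_ofReal ?_) _
        have h1 := abs_le.1 (abs_mollKernel_le y hx0.le)
        have h2 := abs_le.1 (abs_mollKernel_le y (x := rexp (1 / T) * x) (by positivity))
        rw [show 16 * (y:ℝ) ^ 2 = (4 * y) ^ 2 by ring]
        exact sq_le_sq' (by linarith [h1.1, h1.2, h2.1, h2.2]) (by linarith [h1.1, h1.2, h2.1, h2.2])
    _ = ENNReal.ofReal (16 * (y:ℝ) ^ 2) * ENNReal.ofReal (X ^ (-2 * σ) / (2 * σ)) := by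
        rw [lintegral_const_mul' _ _ ENNReal.ofReal_ne_top, setLIntegral_congr Ioi_ae_eq_Ici.symm,
          ← ofReal_integral_eq_lintegral_ofReal (integrableOn_Ioi_rpow_of_lt (by linarith) hX0),
          integral_Ioi_rpow_of_lt (by linarith) hX0]
        · congr 2
          rw [show -2 * σ - 1 + 1 = -(2 * σ) by ring, neg_div_neg_eq]
          congr 2; ring
        · refine (ae_restrict_iff' measurableSet_Ioi).2 (Eventually.of_forall fun x hx => ?_)
          exact Real.rpow_nonneg (hX0.trans hx).le _
    _ ≤ _ := by
        rw [← ENNReal.ofReal_mul (by positivity)]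
        apply ENNReal.ofReal_le_ofReal
        have h1 : X ^ (-2 * σ) ≤ ((y:ℝ) ^ 4 * (T / 4)) ^ (-2 * σ) :=
          Real.rpow_le_rpow_of_nonpos (by positivity) hX (by linarith)
        have h2 : ((y:ℝ) ^ 4 * (T / 4)) ^ (-2 * σ) = ((y:ℝ) ^ 4) ^ (-2 * σ) * (T ^ (-2 * σ) * 4 ^ (2 * σ)) := by
          rw [Real.mul_rpow (by positivity) (by positivity), Real.div_rpow (by positivity) (by norm_num),
            show (-2 * σ) = -(2 * σ) by ring, Real.rpow_neg (by norm_num : (0:ℝ) ≤ 4), div_inv_eq_mul]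
        have h3 : ((y:ℝ) ^ 4) ^ (-2 * σ) ≤ ((y:ℝ) ^ 4)⁻¹ := by
          rw [← Real.rpow_neg_one]
          exact Real.rpow_le_rpow_of_exponent_le (one_le_pow₀ hy0) (by linarith)
        have h4 : (4:ℝ) ^ (2 * σ) ≤ 16 := by
          calc (4:ℝ) ^ (2 * σ) ≤ 4 ^ (2:ℝ) := Real.rpow_le_rpow_of_exponent_le (by norm_num) (by linarith)
            _ = 16 := by norm_num
        calc 16 * (y:ℝ) ^ 2 * (X ^ (-2 * σ) / (2 * σ)) ≤ 16 * (y:ℝ) ^ 2 * (X ^ (-2 * σ) / 1) := by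
              gcongr; linarith
          _ ≤ 16 * (y:ℝ) ^ 2 * (((y:ℝ) ^ 4)⁻¹ * (T ^ (-2 * σ) * 16)) := by
              rw [div_one]
              refine mul_le_mul_of_nonneg_left (h1.trans ?_) (by positivity)
              rw [h2]; gcongr
          _ = 256 * T ^ (-2 * σ) * ((y:ℝ) ^ 2 * ((y:ℝ) ^ 4)⁻¹) := by ring
          _ ≤ 256 * T ^ (-2 * σ) * 1 := by
              gcongr
              rw [mul_inv_le_iff₀ (by positivity), one_mul]
              exact pow_le_pow_right₀ hy0 (by norm_num)
          _ = _ := mul_one _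

theorem lintegral_zeta_mollifier_sq_le {y : ℕ} {T σ : ℝ} (hT : 2 ≤ T) (hy : 1 ≤ y) (hyT : (y:ℝ) ^ 8 ≤ T)
    (hσ : 1 / 2 ≤ σ) (hσ1 : σ ≤ 19 / 20) :
    ∫⁻ t in Icc (-T) T, ‖riemannZeta ((σ:ℂ) + t * I) * mollifier y ((σ:ℂ) + t * I) - 1‖ₑ ^ 2 ≤
      ENNReal.ofReal (53000 * T * (y:ℝ) ^ (1 - 2 * σ) * (1 + Real.log T) ^ 4) := by
  have hT0 : 0 < T := by linarith
  have hy0 : (1:ℝ) ≤ y := by exact_mod_cast hy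
  have hlogT : 0 ≤ Real.log T := Real.log_nonneg (by linarith)
  have hyle : (y:ℝ) ≤ T := le_trans (le_self_pow₀ hy0 (by norm_num)) hyT
  have hre : ∀ t : ℝ, ((σ:ℂ) + t * I).re = σ := fun t => by simp
  have e : ∀ t : ℝ, riemannZeta ((σ:ℂ) + t * I) * mollifier y ((σ:ℂ) + t * I) - 1 =
      ((σ:ℂ) + t * I) * ∫ x in Ioi (0:ℝ), (mollKernel y x : ℂ) * (x : ℂ) ^ (-((σ:ℂ) + t * I) - 1) := fun t =>
    (integrableOn_mollKernel y (by rw [hre]; linarith) (by rw [hre]; linarith)).2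
  simp_rw [e]
  have hf : IntegrableOn (fun x : ℝ => ‖(mollKernel y x : ℂ)‖ * x ^ (-σ - 1)) (Ioi 0) := by
    have := (integrableOn_mollKernel y (s := σ) (by simp; linarith) (by simp; linarith)).1.norm
    refine IntegrableOn.congr_fun this (fun x hx => ?_) measurableSet_Ioi
    beta_reduce
    rw [norm_mul_cpow_neg_sub_one hx, Complex.ofReal_re]
  refine (lintegral_mellin_sq_le_difference (by linarith) hT0 hf
    (Complex.measurable_ofReal.comp (measurable_mollKernel y))).trans ?_
  simp_rw [← Complex.ofReal_sub, enorm_sq_ofReal]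
  set V := ⌊T / 2⌋₊ with hVdef
  have hV1 : 1 ≤ V := Nat.one_le_floor_iff _ |>.2 (by linarith)
  have hV : (V:ℝ) ≤ T / 2 := Nat.floor_le (by linarith)
  have hV1' : (1:ℝ) ≤ V := by exact_mod_cast hV1
  have hVT : T ≤ 4 * V := by have := Nat.lt_floor_add_one (T / 2); rw [← hVdef] at this; linarith
  set J := y ^ 4 with hJ
  have hJ1 : 1 ≤ J := Nat.one_le_pow _ _ hy
  have hX : (y:ℝ) ^ 4 * (T / 4) ≤ (((J + 1) * V : ℕ) : ℝ) := by
    rw [hJ]; push_cast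
    have : (0:ℝ) < (y:ℝ) ^ 4 := by positivity
    nlinarith
  set K := (y:ℝ) ^ (1 - 2 * σ) / T * (1 + Real.log T) ^ 4 with hK
  have hTK : T ^ (-2 * σ) * (1 + Real.log T) ^ 4 ≤ K := by
    have h2 : T ^ (1 - 2 * σ) ≤ (y:ℝ) ^ (1 - 2 * σ) :=
      Real.rpow_le_rpow_of_nonpos (by linarith) hyle (by linarith)
    rw [hK, show -2 * σ = 1 - 2 * σ - 1 by ring, Real.rpow_sub_one hT0.ne']
    gcongr
  have hK0 : 0 ≤ K := by positivity
  have hlog4 : (1:ℝ) ≤ (1 + Real.log T) ^ 4 := one_le_pow₀ (by linarith)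
  have hTp : 0 ≤ T ^ (-2 * σ) := by positivity
  have hsub : Ioi (0:ℝ) ⊆ Ioc 0 (T / 2) ∪ (Ico (V:ℝ) (((J + 1) * V : ℕ) : ℝ) ∪ Ici (((J + 1) * V : ℕ) : ℝ)) := by
    intro x hx
    rcases le_or_gt x (T / 2) with h | h
    · exact Or.inl ⟨hx, h⟩
    · rcases lt_or_ge x (((J + 1) * V : ℕ) : ℝ) with h2 | h2
      · exact Or.inr (Or.inl ⟨hV.trans h.le, h2⟩)
      · exact Or.inr (Or.inr h2)
  calc _ ≤ ENNReal.ofReal (50 * T ^ 2) * (ENNReal.ofReal (100 * K) + (ENNReal.ofReal (704 * K) + ENNReal.ofReal (256 * K))) := by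
        refine mul_le_mul_right ((lintegral_mono_set hsub).trans ((lintegral_union_le _ _ _).trans (add_le_add ?_
          ((lintegral_union_le _ _ _).trans (add_le_add ?_ ?_))))) _
        · exact lintegral_mollKernel_head_le hT hy hyT hσ hσ1
        · refine (lintegral_mollKernel_blocks_le hT hy hyT hσ hV1 hV hVT J).trans (ENNReal.ofReal_le_ofReal ?_)
          have h1 := sum_Icc_rpow_le (σ := σ) (κ := 0) (T := J) (by exact_mod_cast hJ1) le_rfl (by linarith)
          rw [Nat.floor_natCast] at h1
          simp only [mul_zero, Real.rpow_zero, one_mul] at h1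
          have h2 : Real.log J ≤ Real.log T := by
            refine Real.log_le_log (by exact_mod_cast hJ1) ?_
            rw [hJ]; push_cast
            exact le_trans (pow_le_pow_right₀ hy0 (by norm_num)) hyT
          have h3 : (V:ℝ) ^ (-2 * σ) ≤ 16 * T ^ (-2 * σ) := by
            calc (V:ℝ) ^ (-2 * σ) ≤ (T / 4) ^ (-2 * σ) :=
                  Real.rpow_le_rpow_of_nonpos (by positivity) (by linarith) (by linarith)
              _ = 4 ^ (2 * σ) * T ^ (-2 * σ) := by
                  rw [Real.div_rpow (by positivity) (by norm_num), show (-2 * σ) = -(2 * σ) by ring,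
                    Real.rpow_neg (by norm_num : (0:ℝ) ≤ 4), div_inv_eq_mul, mul_comm]
              _ ≤ 4 ^ (2:ℝ) * T ^ (-2 * σ) := by
                  gcongr
                  · norm_num
                  · linarith
              _ = _ := by norm_num
          calc _ ≤ 44 * (1 + Real.log T) ^ 3 * (16 * T ^ (-2 * σ)) * (1 + Real.log T) := by
                have h5 : ∑ j ∈ Finset.Icc 1 J, (j:ℝ) ^ (-2 * σ) ≤ 1 + Real.log T := by linarith
                gcongr
            _ = 704 * (T ^ (-2 * σ) * (1 + Real.log T) ^ 4) := by ring
            _ ≤ _ := by gcongr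
        · refine (lintegral_mollKernel_tail_le hT hy hσ hσ1 hX).trans (ENNReal.ofReal_le_ofReal ?_)
          nlinarith
    _ = ENNReal.ofReal (50 * T ^ 2 * (1060 * K)) := by
        rw [← ENNReal.ofReal_add (by positivity) (by positivity), ← ENNReal.ofReal_add (by positivity) (by positivity),
          ← ENNReal.ofReal_mul (by positivity)]
        congr 1; ring
    _ = _ := by
        congr 1
        rw [hK]; field_simp; ring

theorem HasDerivAt.im_comp_ofReal {h : ℂ → ℂ} {h' : ℂ} {x : ℝ} (hh : HasDerivAt h h' (x : ℂ)) :
    HasDerivAt (fun y : ℝ => (h y).im) h'.im x :=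
  Complex.imCLM.hasFDerivAt.comp_hasDerivAt x hh.comp_ofReal

theorem continuousOn_logDeriv {f : ℂ → ℂ} {U : Set ℂ} (hU : IsOpen U) (hf : DifferentiableOn ℂ f U)
    (h0 : ∀ z ∈ U, f z ≠ 0) : DifferentiableOn ℂ (logDeriv f) U :=
  (hf.deriv hU).div hf h0

theorem exists_log_on_ball {g : ℂ → ℂ} {c : ℂ} {r : ℝ} (hr : 0 < r) (hg : DifferentiableOn ℂ g (Metric.ball c r))
    (h0 : ∀ z ∈ Metric.ball c r, g z ≠ 0) :
    ∃ h : ℂ → ℂ, h c = 0 ∧ (∀ z ∈ Metric.ball c r, HasDerivAt h (logDeriv g z) z) ∧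
      ∀ z ∈ Metric.ball c r, g z = g c * Complex.exp (h z) := by
  obtain ⟨h, hc, hh⟩ := (continuousOn_logDeriv Metric.isOpen_ball hg h0).isExactOn_ball.with_val_at c 0
  refine ⟨h, hc, hh, fun z hz => ?_⟩
  have hd : ∀ w ∈ Metric.ball c r, HasDerivAt (fun w => g w * Complex.exp (-h w)) 0 w := by
    intro w hw
    have h1 := (hg.differentiableAt (Metric.isOpen_ball.mem_nhds hw)).hasDerivAt
    have h2 := h1.mul (hh w hw).neg.cexp
    refine h2.congr_deriv ?_
    have := h0 w hw
    rw [logDeriv_apply]; field_simp; simp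
  have hc' := Metric.isOpen_ball.is_const_of_deriv_eq_zero (convex_ball c r).isPreconnected
    (fun w hw => (hd w hw).differentiableAt.differentiableWithinAt) (fun w hw => (hd w hw).deriv) hz (Metric.mem_ball_self hr)
  simp only [hc, neg_zero, Complex.exp_zero, mul_one] at hc'
  rw [← hc', mul_assoc, ← Complex.exp_add]; simp

theorem ofReal_mem_ball_of_mem_Icc {a b r x : ℝ} (ha : -r < a) (hb : b < r) (hx : x ∈ Icc a b) :
    (x : ℂ) ∈ Metric.ball (0:ℂ) r := by
  rw [mem_ball_zero_iff, Complex.norm_real, Real.norm_eq_abs, abs_lt]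
  exact ⟨by linarith [hx.1], by linarith [hx.2]⟩

theorem abs_integral_im_logDeriv_le_of_ne_zero {g : ℂ → ℂ} {M a b : ℝ} (hg : DifferentiableOn ℂ g (Metric.ball 0 1))
    (hM : 1 ≤ M) (hgM : ∀ z ∈ Metric.closedBall (0:ℂ) (19 / 20), ‖g z‖ ≤ M) (h1 : 1 ≤ ‖g 0‖)
    (h0 : ∀ z ∈ Metric.closedBall (0:ℂ) (17 / 20), g z ≠ 0)
    (ha : -(4 / 5) ≤ a) (hab : a ≤ b) (hb : b ≤ 4 / 5) :
    |∫ x in a..b, (logDeriv g (x : ℂ)).im| ≤ 64 * (Real.log M + 1) := by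
  have hsub : Metric.ball (0:ℂ) (17 / 20) ⊆ Metric.ball 0 1 := Metric.ball_subset_ball (by norm_num)
  have h0' : ∀ z ∈ Metric.ball (0:ℂ) (17 / 20), g z ≠ 0 := fun z hz => h0 z (Metric.ball_subset_closedBall hz)
  obtain ⟨h, hc, hh, hexp⟩ := exists_log_on_ball (by norm_num) (hg.mono hsub) h0'
  have hlogM := Real.log_nonneg hM
  have hre : MapsTo h (Metric.ball 0 (17 / 20)) {z | z.re ≤ Real.log M + 1} := by
    intro z hz
    have e := hexp z hz
    have h2 : ‖g z‖ ≤ M := hgM z (Metric.closedBall_subset_closedBall (by norm_num) (Metric.ball_subset_closedBall hz))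
    rw [e, norm_mul, Complex.norm_exp] at h2
    have h3 : rexp (h z).re ≤ M := le_trans (le_mul_of_one_le_left (Real.exp_pos _).le h1) h2
    have := (Real.le_log_iff_exp_le (by linarith)).2 h3
    simp only [mem_setOf_eq]; linarith
  have hdiff : DifferentiableOn ℂ h (Metric.ball 0 (17 / 20)) := fun z hz =>
    (hh z hz).differentiableAt.differentiableWithinAt
  have hbd : ∀ x ∈ Icc a b, ‖h (x:ℂ)‖ ≤ 32 * (Real.log M + 1) := by
    intro x hx
    have hxb := ofReal_mem_ball_of_mem_Icc (r := 17 / 20) (by linarith) (by linarith) hx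
    refine (Complex.borelCaratheodory_zero (by linarith) hdiff hre (by norm_num) hxb hc).trans ?_
    have hx' : ‖(x:ℂ)‖ ≤ 4 / 5 := by
      rw [Complex.norm_real, Real.norm_eq_abs, abs_le]; constructor <;> linarith [hx.1, hx.2]
    rw [div_le_iff₀ (by linarith)]
    nlinarith [norm_nonneg (x:ℂ)]
  have hint : ∫ x in a..b, (logDeriv g (x : ℂ)).im = (h b).im - (h a).im := by
    refine intervalIntegral.integral_eq_sub_of_hasDerivAt (f := fun x : ℝ => (h x).im) (fun x hx => ?_) ?_
    · rw [uIcc_of_le hab] at hx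
      exact (hh _ (ofReal_mem_ball_of_mem_Icc (by linarith) (by linarith) hx)).im_comp_ofReal
    · apply ContinuousOn.intervalIntegrable
      rw [uIcc_of_le hab]
      refine Complex.continuous_im.comp_continuousOn ?_
      refine (continuousOn_logDeriv Metric.isOpen_ball (hg.mono hsub) h0').continuousOn.comp
        Complex.continuous_ofReal.continuousOn fun x hx => ?_
      exact ofReal_mem_ball_of_mem_Icc (by linarith) (by linarith) hx
  rw [hint]
  have h2 := (Complex.abs_im_le_norm _).trans (hbd b ⟨hab, le_rfl⟩)
  have h3 := (Complex.abs_im_le_norm _).trans (hbd a ⟨le_rfl, hab⟩)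
  rw [abs_le] at h2 h3 ⊢
  constructor <;> linarith [h2.1, h2.2, h3.1, h3.2]

theorem abs_integral_im_inv_sub_le {a b : ℝ} (ρ : ℂ) :
    |∫ x in a..b, (((x:ℂ) - ρ)⁻¹).im| ≤ π := by
  have e : ∀ x : ℝ, (((x:ℂ) - ρ)⁻¹).im = ρ.im / ((x - ρ.re) ^ 2 + ρ.im ^ 2) := by
    intro x
    rw [Complex.inv_im, Complex.normSq_apply]; simp; ring
  simp_rw [e]
  rcases eq_or_ne ρ.im 0 with h | h
  · simp [h, Real.pi_pos.le]
  · have e2 : ∀ x ∈ uIcc a b, HasDerivAt (fun x : ℝ => Real.arctan ((x - ρ.re) / ρ.im))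
        (ρ.im / ((x - ρ.re) ^ 2 + ρ.im ^ 2)) x := by
      intro x _
      have := (((hasDerivAt_id x).sub_const ρ.re).div_const ρ.im).arctan
      refine this.congr_deriv ?_
      have h2 : 0 < (x - ρ.re) ^ 2 + ρ.im ^ 2 := by positivity
      have h3 : 0 < 1 + ((x - ρ.re) / ρ.im) ^ 2 := by positivity
      simp only [id]
      field_simp
      ring
    have hc : Continuous fun x : ℝ => ρ.im / ((x - ρ.re) ^ 2 + ρ.im ^ 2) := by
      refine continuous_const.div (by fun_prop) fun x => ?_
      positivity
    rw [intervalIntegral.integral_eq_sub_of_hasDerivAt e2 (hc.intervalIntegrable _ _)]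
    have h1 := Real.arctan_lt_pi_div_two ((b - ρ.re) / ρ.im)
    have h2 := Real.neg_pi_div_two_lt_arctan ((b - ρ.re) / ρ.im)
    have h3 := Real.arctan_lt_pi_div_two ((a - ρ.re) / ρ.im)
    have h4 := Real.neg_pi_div_two_lt_arctan ((a - ρ.re) / ρ.im)
    rw [abs_le]; constructor <;> linarith

theorem norm_le_on_closedBall_of_sphere {g : ℂ → ℂ} {r M : ℝ} (hr : 0 < r) (hr1 : r < 1)
    (hg : DifferentiableOn ℂ g (Metric.ball 0 1))
    (hs : ∀ z ∈ Metric.sphere (0:ℂ) r, ‖g z‖ ≤ M) : ∀ z ∈ Metric.closedBall (0:ℂ) r, ‖g z‖ ≤ M := by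
  intro z hz
  have hcl : closure (Metric.ball (0:ℂ) r) = Metric.closedBall 0 r := closure_ball _ hr.ne'
  refine Complex.norm_le_of_forall_mem_frontier_norm_le (U := Metric.ball (0:ℂ) r) Metric.isBounded_ball ?_ ?_ (hcl ▸ hz)
  · refine (hg.mono ?_).diffContOnCl
    rw [hcl]; exact Metric.closedBall_subset_ball hr1
  · rw [frontier_ball _ hr.ne']; exact hs

theorem continuousOn_im_logDeriv_ofReal {g : ℂ → ℂ} {a b : ℝ} (hg : DifferentiableOn ℂ g (Metric.ball 0 1))
    (ha : -(4 / 5) ≤ a) (hb : b ≤ 4 / 5) (h0 : ∀ x ∈ Icc a b, g (x:ℂ) ≠ 0) :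
    ContinuousOn (fun x : ℝ => (logDeriv g (x:ℂ)).im) (Icc a b) := by
  have hm : MapsTo (fun x : ℝ => (x:ℂ)) (Icc a b) (Metric.ball 0 1) := fun x hx =>
    ofReal_mem_ball_of_mem_Icc (by linarith) (by linarith) hx
  refine Complex.continuous_im.comp_continuousOn ?_
  have h1 := (hg.deriv Metric.isOpen_ball).continuousOn.comp Complex.continuous_ofReal.continuousOn hm
  have h2 := hg.continuousOn.comp Complex.continuous_ofReal.continuousOn hm
  exact h1.div h2 h0

theorem norm_sq_sub_conj_mul {ρ z : ℂ} {r : ℝ} (hr : 0 ≤ r) (hz : ‖z‖ = r) :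
    ‖(r:ℂ) ^ 2 - (starRingEnd ℂ) ρ * z‖ = r * ‖z - ρ‖ := by
  have e : (r:ℂ) ^ 2 = (starRingEnd ℂ) z * z := by
    rw [Complex.conj_mul', hz]
  rw [e, ← sub_mul, ← map_sub, norm_mul, RCLike.norm_conj, hz, mul_comm]

theorem exists_divide_zero {g : ℂ → ℂ} {M a b : ℝ} (ha : -(4 / 5) ≤ a) (hab : a ≤ b) (hb : b ≤ 4 / 5)
    (hg : DifferentiableOn ℂ g (Metric.ball 0 1)) (hs : ∀ z ∈ Metric.sphere (0:ℂ) (19 / 20), ‖g z‖ ≤ M)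
    (h1 : 1 ≤ ‖g 0‖) (h0 : ∀ x ∈ Icc a b, g (x:ℂ) ≠ 0) {ρ : ℂ} (hρ : ρ ∈ Metric.closedBall (0:ℂ) (17 / 20))
    (hgρ : g ρ = 0) :
    ∃ k : ℂ → ℂ, DifferentiableOn ℂ k (Metric.ball 0 1) ∧ (∀ z ∈ Metric.sphere (0:ℂ) (19 / 20), ‖k z‖ ≤ M) ∧
      19 / 17 * ‖g 0‖ ≤ ‖k 0‖ ∧ (∀ x ∈ Icc a b, k (x:ℂ) ≠ 0) ∧
      |∫ x in a..b, (logDeriv g (x : ℂ)).im| ≤ |∫ x in a..b, (logDeriv k (x : ℂ)).im| + 11 := by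
  have hρn : ‖ρ‖ ≤ 17 / 20 := mem_closedBall_zero_iff.1 hρ
  have hρb : ρ ∈ Metric.ball (0:ℂ) 1 := Metric.closedBall_subset_ball (by norm_num) hρ
  have hρ0 : ρ ≠ 0 := by rintro rfl; rw [hgρ, norm_zero] at h1; linarith
  set D := dslope g ρ with hD
  have hDd : DifferentiableOn ℂ D (Metric.ball 0 1) :=
    (Complex.differentiableOn_dslope (Metric.isOpen_ball.mem_nhds hρb)).2 hg
  have hfac : ∀ z, g z = (z - ρ) * D z := by
    intro z
    have := sub_smul_dslope g ρ z
    rw [hgρ, sub_zero, smul_eq_mul] at this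
    exact this.symm
  set B : ℂ → ℂ := fun z => (((19 / 20 : ℝ) : ℂ) ^ 2 - (starRingEnd ℂ) ρ * z) / ((19 / 20 : ℝ) : ℂ) with hB
  have hBd : Differentiable ℂ B := by rw [hB]; fun_prop
  have hBn : ∀ z ∈ Metric.sphere (0:ℂ) (19 / 20), ‖B z‖ = ‖z - ρ‖ := by
    intro z hz
    rw [mem_sphere_zero_iff_norm] at hz
    rw [hB]; beta_reduce
    rw [norm_div, norm_sq_sub_conj_mul (by norm_num) hz, Complex.norm_real]
    norm_num
  have hlow : ∀ x ∈ Icc a b, 1 / 5 ≤ ‖((19 / 20 : ℝ) : ℂ) ^ 2 - (starRingEnd ℂ) ρ * x‖ := by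
    intro x hx
    have hx' : ‖(x:ℂ)‖ ≤ 4 / 5 := by
      rw [Complex.norm_real, Real.norm_eq_abs, abs_le]; constructor <;> linarith [hx.1, hx.2]
    have h2 := norm_sub_norm_le (((19 / 20 : ℝ) : ℂ) ^ 2) ((starRingEnd ℂ) ρ * x)
    have h3 : ‖((19 / 20 : ℝ) : ℂ) ^ 2‖ = 361 / 400 := by rw [norm_pow, Complex.norm_real]; norm_num
    rw [h3, norm_mul, RCLike.norm_conj] at h2
    have h4 : ‖ρ‖ * ‖(x:ℂ)‖ ≤ 17 / 20 * (4 / 5) := by gcongr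
    linarith
  have hBne : ∀ x ∈ Icc a b, B x ≠ 0 := by
    intro x hx h
    rw [hB] at h; beta_reduce at h
    have h5 := hlow x hx
    rw [div_eq_zero_iff] at h
    rcases h with h | h
    · rw [h, norm_zero] at h5; linarith
    · norm_num at h
  have hDne : ∀ x ∈ Icc a b, D x ≠ 0 := fun x hx h => h0 x hx (by rw [hfac, h, mul_zero])
  have hxρ : ∀ x ∈ Icc a b, (x:ℂ) - ρ ≠ 0 := fun x hx h => h0 x hx (by rw [hfac, h, zero_mul])
  have hkd : DifferentiableOn ℂ (fun z => B z * D z) (Metric.ball 0 1) := hBd.differentiableOn.mul hDd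
  have hkne : ∀ x ∈ Icc a b, B (x:ℂ) * D x ≠ 0 := fun x hx => mul_ne_zero (hBne x hx) (hDne x hx)
  refine ⟨fun z => B z * D z, hkd, fun z hz => ?_, ?_, hkne, ?_⟩
  · rw [norm_mul, hBn z hz, ← norm_mul, ← hfac]; exact hs z hz
  · have hn : 0 < ‖ρ‖ := norm_pos_iff.2 hρ0
    rw [hfac 0, norm_mul, norm_mul, zero_sub, norm_neg, ← mul_assoc]
    refine mul_le_mul_of_nonneg_right ?_ (norm_nonneg _)
    have : ‖B 0‖ = 19 / 20 := by simp [hB]; norm_num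
    rw [this]; linarith
  · have hlog : ∀ x ∈ Icc a b, (logDeriv g (x:ℂ)).im = (logDeriv (fun z => B z * D z) (x:ℂ)).im +
        ((((x:ℂ) - ρ)⁻¹).im + ((starRingEnd ℂ) ρ / (((19 / 20 : ℝ) : ℂ) ^ 2 - (starRingEnd ℂ) ρ * x)).im) := by
      intro x hx
      have hxb : (x:ℂ) ∈ Metric.ball (0:ℂ) 1 := ofReal_mem_ball_of_mem_Icc (by linarith) (by linarith) hx
      have hDx := hDd.differentiableAt (Metric.isOpen_ball.mem_nhds hxb)
      have e1 : logDeriv g (x:ℂ) = ((x:ℂ) - ρ)⁻¹ + logDeriv D x := by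
        have : g = fun z => (z - ρ) * D z := funext hfac
        rw [this, logDeriv_mul (f := fun z => z - ρ) (x:ℂ) (hxρ x hx) (hDne x hx) (by fun_prop) hDx, logDeriv_apply]
        have : deriv (fun z : ℂ => z - ρ) x = 1 := by simp
        rw [this, one_div]
      have e2 : logDeriv (fun z => B z * D z) (x:ℂ) =
          -((starRingEnd ℂ) ρ / (((19 / 20 : ℝ) : ℂ) ^ 2 - (starRingEnd ℂ) ρ * x)) + logDeriv D x := by
        rw [logDeriv_mul (x:ℂ) (hBne x hx) (hDne x hx) hBd.differentiableAt hDx, logDeriv_apply]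
        have h5 : HasDerivAt B ((-((starRingEnd ℂ) ρ)) / ((19 / 20 : ℝ) : ℂ)) (x:ℂ) := by
          have := (((hasDerivAt_id (x:ℂ)).const_mul ((starRingEnd ℂ) ρ)).const_sub
            (((19 / 20 : ℝ) : ℂ) ^ 2)).div_const ((19 / 20 : ℝ) : ℂ)
          simpa [hB] using this
        rw [h5.deriv, hB]; beta_reduce
        have h6 : ((19 / 20 : ℝ) : ℂ) ≠ 0 := by norm_num
        rw [div_div_div_cancel_right₀ h6, neg_div]
      rw [e1, e2]; simp only [Complex.add_im, Complex.neg_im]; ring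
    have hi1 : IntervalIntegrable (fun x : ℝ => (logDeriv (fun z => B z * D z) (x:ℂ)).im) volume a b :=
      (continuousOn_im_logDeriv_ofReal hkd ha hb hkne).intervalIntegrable_of_Icc hab
    have hi2 : IntervalIntegrable (fun x : ℝ => (((x:ℂ) - ρ)⁻¹).im) volume a b := by
      refine ContinuousOn.intervalIntegrable_of_Icc hab (Complex.continuous_im.comp_continuousOn ?_)
      exact ContinuousOn.inv₀ (by fun_prop) hxρ
    have hi3 : IntervalIntegrable (fun x : ℝ => ((starRingEnd ℂ) ρ /
        (((19 / 20 : ℝ) : ℂ) ^ 2 - (starRingEnd ℂ) ρ * x)).im) volume a b := by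
      refine ContinuousOn.intervalIntegrable_of_Icc hab (Complex.continuous_im.comp_continuousOn ?_)
      refine ContinuousOn.div (by fun_prop) (by fun_prop) fun x hx h => ?_
      have := hlow x hx
      rw [h, norm_zero] at this; linarith
    have hI : ∫ x in a..b, (logDeriv g (x : ℂ)).im = (∫ x in a..b, (logDeriv (fun z => B z * D z) (x : ℂ)).im) +
        ((∫ x in a..b, (((x:ℂ) - ρ)⁻¹).im) + ∫ x in a..b, ((starRingEnd ℂ) ρ /
        (((19 / 20 : ℝ) : ℂ) ^ 2 - (starRingEnd ℂ) ρ * x)).im) := by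
      rw [← intervalIntegral.integral_add hi2 hi3, ← intervalIntegral.integral_add hi1 (hi2.add hi3)]
      refine intervalIntegral.integral_congr fun x hx => ?_
      rw [uIcc_of_le hab] at hx
      exact hlog x hx
    have h7 : |∫ x in a..b, ((starRingEnd ℂ) ρ / (((19 / 20 : ℝ) : ℂ) ^ 2 - (starRingEnd ℂ) ρ * x)).im| ≤ 7 := by
      rw [← Real.norm_eq_abs]
      refine (intervalIntegral.norm_integral_le_of_norm_le_const (C := 17 / 4) fun x hx => ?_).trans ?_
      · rw [uIoc_of_le hab] at hx
        rw [Real.norm_eq_abs]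
        refine (Complex.abs_im_le_norm _).trans ?_
        rw [norm_div, RCLike.norm_conj]
        have h8 := hlow x (Ioc_subset_Icc_self hx)
        rw [div_le_iff₀ (by linarith)]
        linarith
      · rw [abs_of_nonneg (by linarith)]; linarith
    have h8 := abs_integral_im_inv_sub_le (a := a) (b := b) ρ
    rw [hI]
    have h9 := Real.pi_lt_four
    refine (abs_add_le _ _).trans ?_
    have h10 := abs_add_le (∫ x in a..b, (((x:ℂ) - ρ)⁻¹).im) (∫ x in a..b, ((starRingEnd ℂ) ρ /
        (((19 / 20 : ℝ) : ℂ) ^ 2 - (starRingEnd ℂ) ρ * x)).im)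
    linarith

theorem abs_integral_im_logDeriv_unit_le {M a b : ℝ} (hM : 1 ≤ M)
    (ha : -(4 / 5) ≤ a) (hab : a ≤ b) (hb : b ≤ 4 / 5) (n : ℕ) :
    ∀ g : ℂ → ℂ, DifferentiableOn ℂ g (Metric.ball 0 1) → (∀ z ∈ Metric.sphere (0:ℂ) (19 / 20), ‖g z‖ ≤ M) →
    1 ≤ ‖g 0‖ → M ≤ (19 / 17) ^ n * ‖g 0‖ → (∀ x ∈ Icc a b, g (x:ℂ) ≠ 0) →
    |∫ x in a..b, (logDeriv g (x : ℂ)).im| ≤ 11 * n + 64 * (Real.log M + 1) := by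
  induction n with
  | zero =>
    intro g hg hs h1 hn h0
    have hM' := norm_le_on_closedBall_of_sphere (by norm_num) (by norm_num) hg hs
    by_cases hz : ∀ z ∈ Metric.closedBall (0:ℂ) (17 / 20), g z ≠ 0
    · have := abs_integral_im_logDeriv_le_of_ne_zero hg hM hM' h1 hz ha hab hb
      simpa using this
    · push Not at hz
      obtain ⟨ρ, hρ, hgρ⟩ := hz
      obtain ⟨k, hk, hks, hk0, -, -⟩ := exists_divide_zero ha hab hb hg hs h1 h0 hρ hgρ
      have := norm_le_on_closedBall_of_sphere (by norm_num) (by norm_num) hk hks 0 (by simp; norm_num)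
      rw [pow_zero, one_mul] at hn
      linarith
  | succ n ih =>
    intro g hg hs h1 hn h0
    have hM' := norm_le_on_closedBall_of_sphere (by norm_num) (by norm_num) hg hs
    by_cases hz : ∀ z ∈ Metric.closedBall (0:ℂ) (17 / 20), g z ≠ 0
    · have := abs_integral_im_logDeriv_le_of_ne_zero hg hM hM' h1 hz ha hab hb
      push_cast
      linarith [n.cast_nonneg (α := ℝ)]
    · push Not at hz
      obtain ⟨ρ, hρ, hgρ⟩ := hz
      obtain ⟨k, hk, hks, hk0, hkne, hkI⟩ := exists_divide_zero ha hab hb hg hs h1 h0 hρ hgρ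
      have := ih k hk hks (by linarith) (hn.trans (by
        rw [pow_succ, mul_assoc]; gcongr)) hkne
      push_cast
      linarith

theorem abs_integral_im_logDeriv_unit_le' {f : ℂ → ℂ} {M a b : ℝ} 
    (ha : -(4 / 5) ≤ a) (hab : a ≤ b) (hb : b ≤ 4 / 5) (hf : DifferentiableOn ℂ f (Metric.ball 0 1))
    (hs : ∀ z ∈ Metric.closedBall (0:ℂ) (19 / 20), ‖f z‖ ≤ M) (h1 : f 0 = 1) (h0 : ∀ x ∈ Icc a b, f (x:ℂ) ≠ 0) :
    |∫ x in a..b, (logDeriv f (x : ℂ)).im| ≤ 200 * (1 + Real.log M) := by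
  have hM : 1 ≤ M := by have := hs 0 (by simp; norm_num); rwa [h1, norm_one] at this
  have hlogM := Real.log_nonneg hM
  have hlog : 1 / 10 ≤ Real.log (19 / 17) := by
    have := Real.one_sub_inv_le_log_of_pos (show (0:ℝ) < 19 / 17 by norm_num)
    norm_num at this; linarith
  set n := ⌈10 * Real.log M⌉₊ with hn
  have h2 : 10 * Real.log M ≤ n := Nat.le_ceil _
  have h3 : (n:ℝ) < 10 * Real.log M + 1 := Nat.ceil_lt_add_one (by linarith)
  have h4 : M ≤ (19 / 17 : ℝ) ^ n * ‖f 0‖ := by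
    rw [h1, norm_one, mul_one, ← Real.log_le_log_iff (by linarith) (by positivity), Real.log_pow]
    nlinarith
  have := abs_integral_im_logDeriv_unit_le hM ha hab hb n f hf
    (fun z hz => hs z (Metric.sphere_subset_closedBall hz)) (by rw [h1, norm_one]) h4 h0
  linarith

theorem abs_integral_im_logDeriv_le {f : ℂ → ℂ} {c : ℂ} {R A a b : ℝ} (hR : 0 < R)
    (hf : DiffContOnCl ℂ f (Metric.ball c R)) (hc : f c ≠ 0)
    (hA : ∫ θ in (0:ℝ)..2 * π, ‖f (circleMap c R θ)‖ ≤ 2 * π * A)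
    (ha : c.re - 4 / 5 * R ≤ a) (hab : a ≤ b) (hb : b ≤ c.re + 4 / 5 * R)
    (h0 : ∀ x ∈ Icc a b, f ((x:ℂ) + c.im * I) ≠ 0) :
    |∫ x in a..b, (logDeriv f ((x : ℂ) + c.im * I)).im| ≤ 200 * (1 + Real.log (20 * A / ‖f c‖)) := by
  have hfc : 0 < ‖f c‖ := norm_pos_iff.2 hc
  set F : ℂ → ℂ := fun z => f (c + R * z) / f c with hF
  have hmem : ∀ z ∈ Metric.ball (0:ℂ) 1, c + R * z ∈ Metric.ball c R := by
    intro z hz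
    rw [mem_ball_zero_iff] at hz
    rw [mem_ball_iff_norm, add_sub_cancel_left, norm_mul, Complex.norm_real, Real.norm_of_nonneg hR.le]
    nlinarith
  have hFd : DifferentiableOn ℂ F (Metric.ball 0 1) := by
    refine (hf.differentiableOn.comp (by fun_prop) hmem).div_const _
  have hbound : ∀ w ∈ Metric.ball c R, ‖w - c‖ ≤ 19 / 20 * R → ‖f w‖ ≤ 20 * A := by
    intro w hw hw2
    have h1 := hf.circleIntegral_sub_inv_smul hw
    have h2 : ‖∮ z in C(c, R), (z - w)⁻¹ • f z‖ ≤ 2 * π * (20 * A) := by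
      rw [circleIntegral]
      calc _ ≤ ∫ θ in (0:ℝ)..2 * π, ‖deriv (circleMap c R) θ • (circleMap c R θ - w)⁻¹ • f (circleMap c R θ)‖ :=
            intervalIntegral.norm_integral_le_integral_norm (by positivity)
        _ ≤ ∫ θ in (0:ℝ)..2 * π, 20 * ‖f (circleMap c R θ)‖ := by
            have hcf : Continuous fun θ : ℝ => f (circleMap c R θ) := by
              refine hf.continuousOn_ball.comp_continuous (continuous_circleMap c R) fun θ => ?_
              exact circleMap_mem_closedBall c hR.le θ
            have hne : ∀ θ, circleMap c R θ - w ≠ 0 := fun θ => sub_ne_zero.2 (circleMap_ne_mem_ball hw θ)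
            refine intervalIntegral.integral_mono_on (by positivity) ?_ ?_ fun θ _ => ?_
            · refine Continuous.intervalIntegrable ?_ _ _
              simp only [deriv_circleMap]
              refine (Continuous.smul ((continuous_circleMap 0 R).mul continuous_const) (Continuous.smul
                (((continuous_circleMap c R).sub continuous_const).inv₀ hne) hcf)).norm
            · exact (continuous_const.mul hcf.norm).intervalIntegrable _ _
            · rw [norm_smul, norm_smul, norm_inv, ← mul_assoc]
              refine mul_le_mul_of_nonneg_right ?_ (norm_nonneg _)
              have h5 : ‖deriv (circleMap c R) θ‖ = R := by simp [deriv_circleMap, abs_of_pos hR]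
              have h6 : R / 20 ≤ ‖circleMap c R θ - w‖ := by
                have h7 : ‖circleMap c R θ - c‖ = R := by simp [circleMap, abs_of_pos hR]
                have h8 := norm_sub_norm_le (circleMap c R θ - c) (w - c)
                rw [sub_sub_sub_cancel_right, h7] at h8
                linarith
              rw [h5, mul_inv_le_iff₀ (by linarith)]
              linarith
        _ ≤ _ := by
            rw [intervalIntegral.integral_const_mul]; nlinarith
    rw [h1, norm_smul] at h2
    have h3 : ‖(2 * π * I : ℂ)‖ = 2 * π := by simp [Real.pi_pos.le]
    rw [h3] at h2
    exact le_of_mul_le_mul_left h2 (by positivity)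
  have hFs : ∀ z ∈ Metric.closedBall (0:ℂ) (19 / 20), ‖F z‖ ≤ 20 * A / ‖f c‖ := by
    intro z hz
    rw [hF]; beta_reduce
    rw [norm_div]
    gcongr
    refine hbound _ (hmem z (Metric.closedBall_subset_ball (by norm_num) hz)) ?_
    rw [mem_closedBall_zero_iff] at hz
    rw [add_sub_cancel_left, norm_mul, Complex.norm_real, Real.norm_of_nonneg hR.le]
    nlinarith
  have hpt : ∀ u : ℝ, c + R * (u:ℂ) = ((R * u + c.re : ℝ) : ℂ) + c.im * I := by
    intro u
    conv_lhs => rw [← Complex.re_add_im c]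
    push_cast; ring
  have hFlog : ∀ u : ℝ, u ∈ Icc ((a - c.re) / R) ((b - c.re) / R) →
      logDeriv F u = R * logDeriv f (((R * u + c.re : ℝ) : ℂ) + c.im * I) := by
    intro u hu
    have hu' : (u:ℂ) ∈ Metric.ball (0:ℂ) 1 := by
      refine ofReal_mem_ball_of_mem_Icc ?_ ?_ hu
      · rw [lt_div_iff₀ hR]; linarith
      · rw [div_lt_iff₀ hR]; linarith
    have hd := hf.differentiableAt Metric.isOpen_ball (hmem _ hu')
    have h1 : HasDerivAt (fun z : ℂ => c + R * z) R (u:ℂ) := by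
      simpa using ((hasDerivAt_id (u:ℂ)).const_mul (R:ℂ)).const_add c
    have h2 := (hd.hasDerivAt.comp (u:ℂ) h1).div_const (f c)
    rw [logDeriv_apply, logDeriv_apply, ← hpt]
    have h3 : deriv F u = deriv f (c + R * u) * R / f c := h2.deriv
    rw [h3, hF]; beta_reduce
    field_simp
  have key := abs_integral_im_logDeriv_unit_le' (a := (a - c.re) / R) (b := (b - c.re) / R)
    (by rw [le_div_iff₀ hR]; linarith) (by gcongr) (by rw [div_le_iff₀ hR]; linarith) hFd hFs
    (by rw [hF]; simp [hc]) (fun u hu => by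
      rw [hF]; beta_reduce
      rw [hpt]
      refine div_ne_zero (h0 _ ⟨?_, ?_⟩) hc
      · have := hu.1; rw [div_le_iff₀ hR] at this; linarith
      · have := hu.2; rw [le_div_iff₀ hR] at this; linarith)
  have e : ∫ u in ((a - c.re) / R)..((b - c.re) / R), (logDeriv F (u:ℂ)).im =
      ∫ x in a..b, (logDeriv f ((x : ℂ) + c.im * I)).im := by
    have h1 : ∫ u in ((a - c.re) / R)..((b - c.re) / R), (logDeriv F (u:ℂ)).im =
        ∫ u in ((a - c.re) / R)..((b - c.re) / R), R * (logDeriv f (((R * u + c.re : ℝ) : ℂ) + c.im * I)).im := by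
      refine intervalIntegral.integral_congr fun u hu => ?_
      rw [uIcc_of_le (by gcongr)] at hu
      beta_reduce
      rw [hFlog u hu, Complex.im_ofReal_mul]
    rw [h1, intervalIntegral.integral_const_mul,
      intervalIntegral.integral_comp_mul_add (fun x : ℝ => (logDeriv f ((x : ℂ) + c.im * I)).im) hR.ne' c.re]
    rw [smul_eq_mul, mul_inv_cancel_left₀ hR.ne']
    congr 1 <;> field_simp <;> ring
  rwa [e] at key

theorem Complex.log_add_one_eq_log_add_log {z : ℂ} (hz : 0 < z.re) :
    Complex.log (z + 1) = Complex.log z + Complex.log (1 + z⁻¹) := by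
  have hz0 : z ≠ 0 := by rintro rfl; simp at hz
  have h1 : 0 < (1 + z⁻¹).re := by
    rw [Complex.add_re, Complex.one_re, Complex.inv_re]
    have : 0 < Complex.normSq z := Complex.normSq_pos.2 hz0
    positivity
  have h1' : (1 + z⁻¹) ≠ 0 := by intro h; rw [h] at h1; simp at h1
  rw [← (Complex.log_mul_eq_add_log_iff hz0 h1').2]
  · congr 1; field_simp
  · have h2 := abs_lt.1 (Complex.abs_arg_lt_pi_div_two_iff.2 (Or.inl hz))
    have h3 := abs_lt.1 (Complex.abs_arg_lt_pi_div_two_iff.2 (Or.inl h1))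
    constructor <;> linarith [h2.1, h2.2, h3.1, h3.2]

theorem norm_log_one_add_inv_sub_inv_le {z : ℂ} (hz : 2 ≤ ‖z‖) :
    ‖Complex.log (1 + z⁻¹) - z⁻¹‖ ≤ 1 / ‖z‖ ^ 2 := by
  have h1 : ‖z⁻¹‖ ≤ 1 / 2 := by rw [norm_inv, ← one_div]; gcongr
  refine (Complex.norm_log_one_add_sub_self_le (by linarith)).trans ?_
  have h2 : (1 - ‖z⁻¹‖)⁻¹ ≤ 2 := by
    rw [inv_le_comm₀ (by linarith) (by norm_num)]; linarith
  have h3 : ‖z⁻¹‖ ^ 2 = 1 / ‖z‖ ^ 2 := by rw [norm_inv]; simp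
  rw [← h3]
  nlinarith [sq_nonneg ‖z⁻¹‖]

/-- The Binet-type series whose value is the digamma function. -/
noncomputable def digammaSeries (z : ℂ) : ℂ :=
  Complex.log z + ∑' k : ℕ, (Complex.log (1 + (z + k)⁻¹) - (z + k)⁻¹)

theorem norm_add_natCast_sq_ge {z : ℂ} (hz : 0 < z.re) (k : ℕ) : (‖z‖ + k) ^ 2 / 2 ≤ ‖z + k‖ ^ 2 := by
  have e1 : ‖z + k‖ ^ 2 = ‖z‖ ^ 2 + 2 * k * z.re + k ^ 2 := by
    rw [Complex.sq_norm, Complex.sq_norm, Complex.normSq_apply, Complex.normSq_apply]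
    simp; ring
  rw [e1]
  have : 0 ≤ 2 * (k:ℝ) * z.re := by positivity
  nlinarith [sq_nonneg (‖z‖ - k)]

theorem two_le_norm_add_natCast {z : ℂ} (hz : 2 < z.re) (k : ℕ) : 2 ≤ ‖z + k‖ := by
  refine le_trans ?_ (Complex.re_le_norm _)
  simp only [Complex.add_re, Complex.natCast_re]
  linarith [k.cast_nonneg (α := ℝ)]

theorem sum_range_two_div_sq_le {a : ℝ} (ha : 2 ≤ a) (n : ℕ) :
    ∑ k ∈ Finset.range n, 2 / (a + k) ^ 2 ≤ 2 / (a - 1) - 2 / (a + n - 1) := by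
  induction n with
  | zero => simp
  | succ n ih =>
    rw [Finset.sum_range_succ]
    have hn := n.cast_nonneg (α := ℝ)
    have h1 : 0 < a + n - 1 := by linarith
    have h2 : 0 < a + n := by linarith
    have h3 : 2 / (a + n) ^ 2 ≤ 2 / (a + n - 1) - 2 / (a + (n + 1 : ℕ) - 1) := by
      push_cast
      rw [show a + ((n:ℝ) + 1) - 1 = a + n by ring, div_sub_div _ _ h1.ne' h2.ne', div_le_div_iff₀ (by positivity) (by positivity)]
      nlinarith
    linarith

theorem norm_digamma_term_le {z : ℂ} (hz : 2 < z.re) (k : ℕ) :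
    ‖Complex.log (1 + (z + k)⁻¹) - (z + k)⁻¹‖ ≤ 2 / (‖z‖ + k) ^ 2 := by
  refine (norm_log_one_add_inv_sub_inv_le (two_le_norm_add_natCast hz k)).trans ?_
  have h1 := norm_add_natCast_sq_ge (by linarith : 0 < z.re) k
  have h2 : 2 ≤ ‖z‖ := by linarith [Complex.re_le_norm z]
  have h3 : 0 < (‖z‖ + k) ^ 2 := by positivity
  rw [div_le_div_iff₀ (by linarith) h3]
  linarith

theorem summable_two_div_sq {a : ℝ} (ha : 2 ≤ a) : Summable fun k : ℕ => 2 / (a + k) ^ 2 := by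
  refine summable_of_sum_range_le (c := 2 / (a - 1)) (fun k => by positivity) fun n => ?_
  have h1 := sum_range_two_div_sq_le ha n
  have : 0 ≤ 2 / (a + n - 1) := div_nonneg (by norm_num) (by linarith [n.cast_nonneg (α := ℝ)])
  linarith

theorem summable_digamma_term {z : ℂ} (hz : 2 < z.re) :
    Summable fun k : ℕ => Complex.log (1 + (z + k)⁻¹) - (z + k)⁻¹ :=
  (summable_two_div_sq (by linarith [Complex.re_le_norm z])).of_norm_bounded (norm_digamma_term_le hz)

theorem norm_digammaSeries_sub_log_le {z : ℂ} (hz : 2 < z.re) :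
    ‖digammaSeries z - Complex.log z‖ ≤ 4 / ‖z‖ := by
  have h2 : 2 ≤ ‖z‖ := by linarith [Complex.re_le_norm z]
  rw [digammaSeries, add_sub_cancel_left]
  refine (tsum_of_norm_bounded (summable_two_div_sq h2).hasSum (norm_digamma_term_le hz)).trans ?_
  refine Real.tsum_le_of_sum_range_le (fun k => by positivity) fun n => ?_
  refine (sum_range_two_div_sq_le h2 n).trans ?_
  have : 0 ≤ 2 / (‖z‖ + n - 1) := div_nonneg (by norm_num) (by linarith [n.cast_nonneg (α := ℝ)])
  have : 2 / (‖z‖ - 1) ≤ 4 / ‖z‖ := by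
    rw [div_le_div_iff₀ (by linarith) (by linarith)]; linarith
  linarith

theorem differentiableOn_digammaSeries : DifferentiableOn ℂ digammaSeries {z | 2 < z.re} := by
  have hU : IsOpen {z : ℂ | 2 < z.re} := isOpen_lt continuous_const Complex.continuous_re
  refine DifferentiableOn.add ?_ ?_
  · intro z hz
    exact (Complex.differentiableAt_log (Or.inl (by have : 2 < z.re := hz; linarith))).differentiableWithinAt
  · refine differentiableOn_tsum_of_summable_norm (summable_two_div_sq le_rfl) (fun k => ?_) hU fun k z hz => ?_
    · intro z hz
      have hz' : 2 < z.re := hz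
      have h0 : 0 < (z + k).re := by
        simp only [Complex.add_re, Complex.natCast_re]; linarith [k.cast_nonneg (α := ℝ)]
      have h1 : z + k ≠ 0 := by intro h; rw [h] at h0; simp at h0
      have h2 : 1 + (z + k)⁻¹ ∈ Complex.slitPlane := by
        refine Or.inl ?_
        rw [Complex.add_re, Complex.one_re, Complex.inv_re]
        have : 0 < Complex.normSq (z + k) := Complex.normSq_pos.2 h1
        positivity
      have h3 : DifferentiableAt ℂ (fun z : ℂ => (z + k)⁻¹) z := DifferentiableAt.inv (by fun_prop) h1
      exact (((h3.const_add 1).clog h2).sub h3).differentiableWithinAt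
    · have hz' : 2 < z.re := hz
      refine (norm_digamma_term_le hz' k).trans ?_
      gcongr
      linarith [Complex.re_le_norm z]

theorem digammaSeries_add_one {z : ℂ} (hz : 2 < z.re) : digammaSeries (z + 1) = digammaSeries z + z⁻¹ := by
  rw [digammaSeries, digammaSeries, (summable_digamma_term hz).tsum_eq_zero_add, Complex.log_add_one_eq_log_add_log (by linarith)]
  have : ∀ k : ℕ, z + 1 + (k:ℂ) = z + ((k + 1 : ℕ) : ℂ) := fun k => by push_cast; ring
  simp_rw [this]
  simp only [Nat.cast_zero, add_zero]
  ring

theorem digamma_ofReal {x : ℝ} (hx : 0 < x) :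
    Complex.digamma x = ((deriv Real.Gamma x / Real.Gamma x : ℝ) : ℂ) := by
  have hm : ∀ m : ℕ, x ≠ -m := fun m h => by linarith [m.cast_nonneg (α := ℝ)]
  have h1 := (Real.differentiableAt_Gamma hm).hasDerivAt.ofReal_comp
  have h2 := (Complex.differentiableAt_Gamma (x:ℂ) (by
    intro m h; exact hm m (by exact_mod_cast h))).hasDerivAt.comp_ofReal
  simp_rw [Complex.Gamma_ofReal] at h2
  rw [Complex.digamma_def, logDeriv_apply, h2.unique h1, Complex.Gamma_ofReal]
  push_cast; rfl

theorem hasDerivAt_log_Gamma {x : ℝ} (hx : 0 < x) :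
    HasDerivAt (Real.log ∘ Real.Gamma) (deriv Real.Gamma x / Real.Gamma x) x :=
  (Real.differentiableAt_Gamma (fun m h => by linarith [m.cast_nonneg (α := ℝ)])).hasDerivAt.log
    (Real.Gamma_pos_of_pos hx).ne'

theorem slope_log_Gamma {x : ℝ} (hx : 0 < x) : slope (Real.log ∘ Real.Gamma) x (x + 1) = Real.log x := by
  rw [slope_def_field, Function.comp, Real.Gamma_add_one hx.ne', Real.log_mul hx.ne' (Real.Gamma_pos_of_pos hx).ne']
  simp

theorem norm_digamma_ofReal_sub_log_le {x : ℝ} (hx : 2 < x) :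
    ‖Complex.digamma x - Complex.log x‖ ≤ 1 / (x - 1) := by
  rw [digamma_ofReal (by linarith), ← Complex.ofReal_log (by linarith), ← Complex.ofReal_sub, Complex.norm_real, Real.norm_eq_abs]
  have h1 := Real.convexOn_log_Gamma.le_slope_of_hasDerivAt (x := x) (y := x + 1) (by simp; linarith)
    (by simp; linarith) (by linarith) (hasDerivAt_log_Gamma (by linarith))
  have h2 := Real.convexOn_log_Gamma.slope_le_of_hasDerivAt (x := x - 1) (y := x) (by simp; linarith)
    (by simp; linarith) (by linarith) (hasDerivAt_log_Gamma (by linarith))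
  rw [slope_log_Gamma (by linarith)] at h1
  have h3 := slope_log_Gamma (show 0 < x - 1 by linarith)
  rw [sub_add_cancel] at h3
  rw [h3] at h2
  have h4 : Real.log x - Real.log (x - 1) ≤ 1 / (x - 1) := by
    rw [← Real.log_div (by linarith) (by linarith)]
    refine (Real.log_le_sub_one_of_pos (div_pos (by linarith) (by linarith))).trans ?_
    have : 0 < x - 1 := by linarith
    rw [div_sub_one this.ne']; simp
  rw [abs_le]
  have : 0 ≤ 1 / (x - 1) := div_nonneg (by norm_num) (by linarith)
  constructor <;> linarith

theorem ne_neg_natCast_of_re_pos {z : ℂ} (hz : 0 < z.re) (m : ℕ) : z ≠ -m := by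
  rintro rfl
  simp at hz
  linarith [m.cast_nonneg (α := ℝ)]

theorem digamma_ofReal_eq_series {x : ℝ} (hx : 2 < x) : Complex.digamma x = digammaSeries x := by
  have hper : ∀ n : ℕ, Complex.digamma x - digammaSeries x =
      Complex.digamma ((x + n : ℝ) : ℂ) - digammaSeries ((x + n : ℝ) : ℂ) := by
    intro n
    induction n with
    | zero => simp
    | succ n ih =>
      have hn := n.cast_nonneg (α := ℝ)
      have e : ((x + (n + 1 : ℕ) : ℝ) : ℂ) = ((x + n : ℝ) : ℂ) + 1 := by push_cast; ring
      have hre : 2 < ((x + n : ℝ) : ℂ).re := by rw [Complex.ofReal_re]; linarith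
      rw [ih, e, Complex.digamma_apply_add_one _ (ne_neg_natCast_of_re_pos (by linarith)), digammaSeries_add_one hre]
      ring
  have hb : ∀ n : ℕ, ‖Complex.digamma x - digammaSeries x‖ ≤ 5 * (1 / ((n:ℝ) + 1)) := by
    intro n
    have hn := n.cast_nonneg (α := ℝ)
    rw [hper n]
    have hre : 2 < ((x + n : ℝ) : ℂ).re := by rw [Complex.ofReal_re]; linarith
    have h1 := norm_digamma_ofReal_sub_log_le (x := x + n) (by linarith)
    have h2 := norm_digammaSeries_sub_log_le hre
    have h3 := norm_sub_le (Complex.digamma ((x + n : ℝ) : ℂ) - Complex.log ((x + n : ℝ) : ℂ))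
      (digammaSeries ((x + n : ℝ) : ℂ) - Complex.log ((x + n : ℝ) : ℂ))
    rw [sub_sub_sub_cancel_right] at h3
    have h4 : 1 / (x + n - 1) ≤ 1 / ((n:ℝ) + 1) := one_div_le_one_div_of_le (by linarith) (by linarith)
    have h5 : 4 / ‖((x + n : ℝ) : ℂ)‖ ≤ 4 * (1 / ((n:ℝ) + 1)) := by
      rw [Complex.norm_real, Real.norm_of_nonneg (by linarith), mul_one_div]
      exact div_le_div_of_nonneg_left (by norm_num) (by linarith) (by linarith)
    linarith
  have hlim : Tendsto (fun n : ℕ => 5 * (1 / ((n:ℝ) + 1))) atTop (nhds (5 * 0)) :=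
    tendsto_one_div_add_atTop_nhds_zero_nat.const_mul 5
  rw [mul_zero] at hlim
  have := ge_of_tendsto hlim (Eventually.of_forall hb)
  rwa [norm_le_zero_iff, sub_eq_zero] at this

theorem differentiableAt_digamma {z : ℂ} (hz : 0 < z.re) : DifferentiableAt ℂ Complex.digamma z := by
  have hU : IsOpen {z : ℂ | 0 < z.re} := isOpen_lt continuous_const Complex.continuous_re
  have h1 : DifferentiableOn ℂ Complex.Gamma {z : ℂ | 0 < z.re} := fun w hw =>
    (Complex.differentiableAt_Gamma w (ne_neg_natCast_of_re_pos hw)).differentiableWithinAt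
  exact ((h1.deriv hU).div h1 fun w hw => Complex.Gamma_ne_zero_of_re_pos hw).differentiableAt (hU.mem_nhds hz)

theorem digamma_eq_series {z : ℂ} (hz : 2 < z.re) : Complex.digamma z = digammaSeries z := by
  have hU : IsOpen {z : ℂ | 2 < z.re} := isOpen_lt continuous_const Complex.continuous_re
  have hd : DifferentiableOn ℂ Complex.digamma {z : ℂ | 2 < z.re} := fun w hw =>
    (differentiableAt_digamma (lt_trans two_pos hw)).differentiableWithinAt
  refine (hd.analyticOnNhd hU).eqOn_of_preconnected_of_frequently_eq (differentiableOn_digammaSeries.analyticOnNhd hU)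
    (convex_halfSpace_re_gt 2).isPreconnected (z₀ := 3) (by norm_num) ?_ hz
  have ht : Tendsto (fun n : ℕ => ((3 + 1 / ((n:ℝ) + 1) : ℝ) : ℂ)) atTop (nhdsWithin 3 {3}ᶜ) := by
    refine tendsto_nhdsWithin_iff.2 ⟨?_, Eventually.of_forall fun n => ?_⟩
    · have h1 := (tendsto_one_div_add_atTop_nhds_zero_nat (𝕜 := ℝ)).const_add 3
      rw [add_zero] at h1
      exact (Complex.continuous_ofReal.tendsto _).comp h1
    · have : 0 < 1 / ((n:ℝ) + 1) := by positivity
      simp only [mem_compl_iff, mem_singleton_iff]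
      intro h
      have h' : (3 + 1 / ((n:ℝ) + 1) : ℝ) = 3 := by exact_mod_cast h
      linarith
  refine ht.frequently (Eventually.of_forall fun n => ?_).frequently
  have : 0 < 1 / ((n:ℝ) + 1) := by positivity
  exact digamma_ofReal_eq_series (by linarith)

theorem norm_digamma_sub_log_le {z : ℂ} (hz : 0 < z.re) (hz2 : 2 ≤ ‖z‖) :
    ‖Complex.digamma z - Complex.log z‖ ≤ 12 / ‖z‖ := by
  have key : ∀ w : ℂ, 0 < w.re → ‖z‖ ≤ ‖w‖ →
      ‖Complex.digamma w - Complex.log w‖ ≤ ‖Complex.digamma (w + 1) - Complex.log (w + 1)‖ + 1 / (2 * ‖z‖) := by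
    intro w hw hzw
    rw [Complex.digamma_apply_add_one w (ne_neg_natCast_of_re_pos hw), Complex.log_add_one_eq_log_add_log hw]
    have h1 := norm_log_one_add_inv_sub_inv_le (hz2.trans hzw)
    have e : Complex.digamma w - Complex.log w = Complex.digamma w + w⁻¹ - (Complex.log w + Complex.log (1 + w⁻¹)) +
      (Complex.log (1 + w⁻¹) - w⁻¹) := by ring
    have h2 := norm_add_le (Complex.digamma w + w⁻¹ - (Complex.log w + Complex.log (1 + w⁻¹))) (Complex.log (1 + w⁻¹) - w⁻¹)
    rw [← e] at h2
    have h3 : 1 / ‖w‖ ^ 2 ≤ 1 / (2 * ‖z‖) := by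
      refine one_div_le_one_div_of_le (by linarith) ?_
      nlinarith
    linarith
  have hn : ∀ w : ℂ, 0 < w.re → ‖w‖ ≤ ‖w + 1‖ := by
    intro w hw
    refine abs_le_of_sq_le_sq' ?_ (norm_nonneg _) |>.2
    rw [Complex.sq_norm, Complex.sq_norm, Complex.normSq_apply, Complex.normSq_apply]
    simp; nlinarith
  have hr1 : 0 < (z + 1).re := by simp; linarith
  have hr2 : 0 < (z + 1 + 1).re := by simp; linarith
  have n1 := hn z hz
  have n2 := hn _ hr1
  have n3 := hn _ hr2
  have k1 := key z hz le_rfl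
  have k2 := key _ hr1 n1
  have k3 := key _ hr2 (n1.trans n2)
  have h3 : 2 < (z + 1 + 1 + 1).re := by simp; linarith
  have k4 := norm_digammaSeries_sub_log_le h3
  rw [← digamma_eq_series h3] at k4
  have h5 : 4 / ‖z + 1 + 1 + 1‖ ≤ 4 / ‖z‖ := by gcongr; linarith
  have h6 : 12 / ‖z‖ = 4 / ‖z‖ + 16 * (1 / (2 * ‖z‖)) := by field_simp; norm_num
  have h7 : 0 ≤ 1 / (2 * ‖z‖) := by positivity
  linarith

/-- The imaginary part of the integral of `F` along the boundary of `[x₁, x₂] × [y₁, y₂]`. -/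
noncomputable def rectIm (F : ℂ → ℂ) (x₁ x₂ y₁ y₂ : ℝ) : ℝ :=
  (∫ x in x₁..x₂, (F (x + y₁ * I)).im) - (∫ x in x₁..x₂, (F (x + y₂ * I)).im) +
    (∫ y in y₁..y₂, (F (x₂ + y * I)).re) - ∫ y in y₁..y₂, (F (x₁ + y * I)).re

/-- The boundary of the rectangle `[x₁, x₂] × [y₁, y₂]`. -/
def rectBoundary (x₁ x₂ y₁ y₂ : ℝ) : Set ℂ :=
  {z | z.re ∈ Icc x₁ x₂ ∧ z.im ∈ Icc y₁ y₂ ∧ (z.re = x₁ ∨ z.re = x₂ ∨ z.im = y₁ ∨ z.im = y₂)}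

section
variable {F K : ℂ → ℂ} {x₁ x₂ y₁ y₂ : ℝ}

theorem horizontal_mem_rectBoundary {x y : ℝ} (hy : y₁ ≤ y₂) (hx : x ∈ Icc x₁ x₂) (h : y = y₁ ∨ y = y₂) :
    (x + y * I : ℂ) ∈ rectBoundary x₁ x₂ y₁ y₂ := by
  refine ⟨by simpa using hx, ?_, ?_⟩
  · rcases h with rfl | rfl <;> simpa using hy
  · simp only [Complex.add_im, Complex.ofReal_im, Complex.mul_im, Complex.ofReal_re, Complex.I_im, Complex.I_re]
    simp only [mul_one, mul_zero, add_zero, zero_add]; tauto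

theorem vertical_mem_rectBoundary {x y : ℝ} (hx : x₁ ≤ x₂) (hy : y ∈ Icc y₁ y₂) (h : x = x₁ ∨ x = x₂) :
    (x + y * I : ℂ) ∈ rectBoundary x₁ x₂ y₁ y₂ := by
  refine ⟨?_, by simpa using hy, ?_⟩
  · rcases h with rfl | rfl <;> simpa using hx
  · simp only [Complex.add_re, Complex.ofReal_im, Complex.mul_re, Complex.ofReal_re, Complex.I_im, Complex.I_re]
    simp only [mul_one, mul_zero, add_zero, sub_zero]; tauto

theorem intervalIntegrable_horizontal {y : ℝ} (hx : x₁ ≤ x₂) (hy : y₁ ≤ y₂)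
    (hF : ContinuousOn F (rectBoundary x₁ x₂ y₁ y₂)) (h : y = y₁ ∨ y = y₂) :
    IntervalIntegrable (fun x : ℝ => F (x + y * I)) volume x₁ x₂ :=
  (hF.comp (by fun_prop) fun _ hx' => horizontal_mem_rectBoundary hy hx' h).intervalIntegrable_of_Icc hx

theorem intervalIntegrable_vertical {x : ℝ} (hx : x₁ ≤ x₂) (hy : y₁ ≤ y₂)
    (hF : ContinuousOn F (rectBoundary x₁ x₂ y₁ y₂)) (h : x = x₁ ∨ x = x₂) :
    IntervalIntegrable (fun y : ℝ => F (x + y * I)) volume y₁ y₂ :=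
  (hF.comp (by fun_prop) fun _ hy' => vertical_mem_rectBoundary hx hy' h).intervalIntegrable_of_Icc hy

theorem IntervalIntegrable.complex_re {f : ℝ → ℂ} {a b : ℝ} (h : IntervalIntegrable f volume a b) :
    IntervalIntegrable (fun x => (f x).re) volume a b := ⟨h.1.re, h.2.re⟩

theorem IntervalIntegrable.complex_im {f : ℝ → ℂ} {a b : ℝ} (h : IntervalIntegrable f volume a b) :
    IntervalIntegrable (fun x => (f x).im) volume a b := ⟨h.1.im, h.2.im⟩

theorem intervalIntegral_re {f : ℝ → ℂ} {a b : ℝ} (h : IntervalIntegrable f volume a b) :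
    ∫ x in a..b, (f x).re = (∫ x in a..b, f x).re :=
  Complex.reCLM.intervalIntegral_comp_comm h

theorem intervalIntegral_im {f : ℝ → ℂ} {a b : ℝ} (h : IntervalIntegrable f volume a b) :
    ∫ x in a..b, (f x).im = (∫ x in a..b, f x).im :=
  Complex.imCLM.intervalIntegral_comp_comm h

theorem rectIm_eq (hx : x₁ ≤ x₂) (hy : y₁ ≤ y₂) (hF : ContinuousOn F (rectBoundary x₁ x₂ y₁ y₂)) :
    rectIm F x₁ x₂ y₁ y₂ = ((∫ x in x₁..x₂, F (x + y₁ * I)) - (∫ x in x₁..x₂, F (x + y₂ * I)) +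
      I • (∫ y in y₁..y₂, F (x₂ + y * I)) - I • ∫ y in y₁..y₂, F (x₁ + y * I)).im := by
  rw [rectIm, intervalIntegral_im (intervalIntegrable_horizontal hx hy hF (Or.inl rfl)),
    intervalIntegral_im (intervalIntegrable_horizontal hx hy hF (Or.inr rfl)),
    intervalIntegral_re (intervalIntegrable_vertical hx hy hF (Or.inl rfl)),
    intervalIntegral_re (intervalIntegrable_vertical hx hy hF (Or.inr rfl))]
  simp

theorem rectBoundary_subset (hx : x₁ ≤ x₂) (hy : y₁ ≤ y₂) :
    rectBoundary x₁ x₂ y₁ y₂ ⊆ Icc x₁ x₂ ×ℂ Icc y₁ y₂ := fun _ hz => ⟨hz.1, hz.2.1⟩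

theorem rectIm_eq_zero (hx : x₁ ≤ x₂) (hy : y₁ ≤ y₂) (hF : DifferentiableOn ℂ F (Icc x₁ x₂ ×ℂ Icc y₁ y₂)) :
    rectIm F x₁ x₂ y₁ y₂ = 0 := by
  rw [rectIm_eq hx hy (hF.continuousOn.mono (rectBoundary_subset hx hy))]
  have := Complex.integral_boundary_rect_eq_zero_of_differentiableOn F (x₁ + y₁ * I) (x₂ + y₂ * I)
  simp only [Complex.add_re, Complex.add_im, Complex.ofReal_im, Complex.mul_re, Complex.mul_im, Complex.ofReal_re, Complex.I_im, Complex.I_re,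
    mul_one, mul_zero, add_zero, sub_zero, zero_add, uIcc_of_le hx, uIcc_of_le hy] at this
  rw [this hF, Complex.zero_im]

theorem rectIm_congr (hx : x₁ ≤ x₂) (hy : y₁ ≤ y₂) (h : ∀ z ∈ rectBoundary x₁ x₂ y₁ y₂, F z = K z) :
    rectIm F x₁ x₂ y₁ y₂ = rectIm K x₁ x₂ y₁ y₂ := by
  rw [rectIm, rectIm]
  congr 1
  · congr 1
    · congr 1
      · refine intervalIntegral.integral_congr fun x hx' => ?_
        rw [uIcc_of_le hx] at hx'
        beta_reduce
        rw [h _ (horizontal_mem_rectBoundary hy hx' (Or.inl rfl))]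
      · refine intervalIntegral.integral_congr fun x hx' => ?_
        rw [uIcc_of_le hx] at hx'
        beta_reduce
        rw [h _ (horizontal_mem_rectBoundary hy hx' (Or.inr rfl))]
    · refine intervalIntegral.integral_congr fun x hx' => ?_
      rw [uIcc_of_le hy] at hx'
      beta_reduce
      rw [h _ (vertical_mem_rectBoundary hx hx' (Or.inr rfl))]
  · refine intervalIntegral.integral_congr fun x hx' => ?_
    rw [uIcc_of_le hy] at hx'
    beta_reduce
    rw [h _ (vertical_mem_rectBoundary hx hx' (Or.inl rfl))]

theorem rectIm_const_mul_add (hx : x₁ ≤ x₂) (hy : y₁ ≤ y₂) (hF : ContinuousOn F (rectBoundary x₁ x₂ y₁ y₂))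
    (hK : ContinuousOn K (rectBoundary x₁ x₂ y₁ y₂)) (m : ℝ) :
    rectIm (fun z => m * F z + K z) x₁ x₂ y₁ y₂ = m * rectIm F x₁ x₂ y₁ y₂ + rectIm K x₁ x₂ y₁ y₂ := by
  simp only [rectIm, Complex.add_im, Complex.add_re, Complex.re_ofReal_mul, Complex.im_ofReal_mul]
  have h1 := intervalIntegrable_horizontal hx hy hF (Or.inl rfl)
  have h2 := intervalIntegrable_horizontal hx hy hF (Or.inr rfl)
  have h3 := intervalIntegrable_vertical hx hy hF (Or.inl rfl)
  have h4 := intervalIntegrable_vertical hx hy hF (Or.inr rfl)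
  have k1 := intervalIntegrable_horizontal hx hy hK (Or.inl rfl)
  have k2 := intervalIntegrable_horizontal hx hy hK (Or.inr rfl)
  have k3 := intervalIntegrable_vertical hx hy hK (Or.inl rfl)
  have k4 := intervalIntegrable_vertical hx hy hK (Or.inr rfl)
  rw [intervalIntegral.integral_add (h1.complex_im.const_mul m) k1.complex_im,
    intervalIntegral.integral_add (h2.complex_im.const_mul m) k2.complex_im,
    intervalIntegral.integral_add (h3.complex_re.const_mul m) k3.complex_re,
    intervalIntegral.integral_add (h4.complex_re.const_mul m) k4.complex_re]
  simp only [intervalIntegral.integral_const_mul]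
  ring

theorem integral_div_sub_sq_add_sq {a b c d : ℝ} (hd : d ≠ 0) :
    ∫ x in a..b, d / ((x - c) ^ 2 + d ^ 2) = Real.arctan ((b - c) / d) - Real.arctan ((a - c) / d) := by
  have e2 : ∀ x ∈ uIcc a b, HasDerivAt (fun x : ℝ => Real.arctan ((x - c) / d)) (d / ((x - c) ^ 2 + d ^ 2)) x := by
    intro x _
    have := (((hasDerivAt_id x).sub_const c).div_const d).arctan
    refine this.congr_deriv ?_
    have h2 : 0 < (x - c) ^ 2 + d ^ 2 := by positivity
    have h3 : 0 < 1 + ((x - c) / d) ^ 2 := by positivity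
    simp only [id]
    field_simp
    ring
  refine intervalIntegral.integral_eq_sub_of_hasDerivAt e2 (Continuous.intervalIntegrable ?_ _ _)
  refine continuous_const.div (by fun_prop) fun x => ?_
  positivity

theorem arctan_div_add_arctan_div {a b : ℝ} (ha : 0 < a) (hb : 0 < b) :
    Real.arctan (a / b) + Real.arctan (b / a) = π / 2 := by
  have := Real.arctan_inv_of_pos (div_pos hb ha)
  rw [inv_div] at this
  linarith

theorem rectIm_inv_sub {ρ : ℂ} (hre : ρ.re ∈ Ioo x₁ x₂) (him : ρ.im ∈ Ioo y₁ y₂) :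
    rectIm (fun z => (z - ρ)⁻¹) x₁ x₂ y₁ y₂ = 2 * π := by
  have e1 : ∀ x y : ℝ, (((x:ℂ) + y * I - ρ)⁻¹).im = (ρ.im - y) / ((x - ρ.re) ^ 2 + (ρ.im - y) ^ 2) := by
    intro x y
    rw [Complex.inv_im, Complex.normSq_apply]; simp; ring
  have e2 : ∀ x y : ℝ, (((x:ℂ) + y * I - ρ)⁻¹).re = (x - ρ.re) / ((y - ρ.im) ^ 2 + (x - ρ.re) ^ 2) := by
    intro x y
    rw [Complex.inv_re, Complex.normSq_apply]; simp; ring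
  obtain ⟨hr1, hr2⟩ := hre
  obtain ⟨hi1, hi2⟩ := him
  rw [rectIm]
  simp_rw [e1, e2]
  rw [integral_div_sub_sq_add_sq (by linarith), integral_div_sub_sq_add_sq (by linarith), integral_div_sub_sq_add_sq (by linarith),
    integral_div_sub_sq_add_sq (by linarith)]
  have k1 := arctan_div_add_arctan_div (sub_pos.2 hr2) (sub_pos.2 hi1)
  have k2 := arctan_div_add_arctan_div (sub_pos.2 hr1) (sub_pos.2 hi1)
  have k3 := arctan_div_add_arctan_div (sub_pos.2 hr2) (sub_pos.2 hi2)
  have k4 := arctan_div_add_arctan_div (sub_pos.2 hr1) (sub_pos.2 hi2)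
  have s1 : (x₁ - ρ.re) / (ρ.im - y₁) = -((ρ.re - x₁) / (ρ.im - y₁)) := by rw [← neg_div, neg_sub]
  have s2 : (x₂ - ρ.re) / (ρ.im - y₂) = -((x₂ - ρ.re) / (y₂ - ρ.im)) := by rw [← div_neg, neg_sub]
  have s3 : (x₁ - ρ.re) / (ρ.im - y₂) = (ρ.re - x₁) / (y₂ - ρ.im) := by rw [← neg_div_neg_eq, neg_sub, neg_sub]
  have s4 : (y₁ - ρ.im) / (x₂ - ρ.re) = -((ρ.im - y₁) / (x₂ - ρ.re)) := by rw [← neg_div, neg_sub]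
  have s5 : (y₂ - ρ.im) / (x₁ - ρ.re) = -((y₂ - ρ.im) / (ρ.re - x₁)) := by rw [← div_neg, neg_sub]
  have s6 : (y₁ - ρ.im) / (x₁ - ρ.re) = (ρ.im - y₁) / (ρ.re - x₁) := by rw [← neg_div_neg_eq, neg_sub, neg_sub]
  rw [s1, s2, s3, s4, s5, s6]
  simp only [Real.arctan_neg]
  linarith

theorem exists_eq_pow_mul_of_analyticOrderAt {f : ℂ → ℂ} {U : Set ℂ} (hU : IsOpen U) (hf : DifferentiableOn ℂ f U)
    {ρ : ℂ} (hρ : ρ ∈ U) {m : ℕ} (hm : analyticOrderAt f ρ = m) :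
    ∃ g : ℂ → ℂ, DifferentiableOn ℂ g U ∧ g ρ ≠ 0 ∧ ∀ z ∈ U, f z = (z - ρ) ^ m * g z := by
  have hfa := hf.analyticOnNhd hU
  obtain ⟨h, hha, hh0, hhe⟩ := (hfa ρ hρ).analyticOrderAt_eq_natCast.1 hm
  set g : ℂ → ℂ := Function.update (fun z => f z / (z - ρ) ^ m) ρ (h ρ) with hg
  have hgne : ∀ z, z ≠ ρ → g z = f z / (z - ρ) ^ m := fun z hz => Function.update_of_ne hz _ _
  have hgρ : g ρ = h ρ := Function.update_self _ _ _
  refine ⟨g, fun z hz => ?_, by rwa [hgρ], fun z hz => ?_⟩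
  · rcases eq_or_ne z ρ with rfl | hne
    · have : g =ᶠ[nhds z] h := by
        filter_upwards [hhe] with w hw
        rcases eq_or_ne w z with rfl | hwz
        · exact hgρ
        · rw [hgne w hwz, hw, smul_eq_mul, mul_div_cancel_left₀ _ (pow_ne_zero _ (sub_ne_zero.2 hwz))]
      exact (hha.differentiableAt.congr_of_eventuallyEq this).differentiableWithinAt
    · have : g =ᶠ[nhds z] fun z => f z / (z - ρ) ^ m := by
        filter_upwards [isOpen_ne.mem_nhds hne] with w hw using hgne w hw
      refine (DifferentiableAt.congr_of_eventuallyEq ?_ this).differentiableWithinAt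
      exact (hf.differentiableAt (hU.mem_nhds hz)).div (by fun_prop) (pow_ne_zero _ (sub_ne_zero.2 hne))
  · rcases eq_or_ne z ρ with rfl | hne
    · have := hhe.self_of_nhds
      rw [this, hgρ, smul_eq_mul]
    · rw [hgne z hne, mul_div_cancel₀ _ (pow_ne_zero _ (sub_ne_zero.2 hne))]

theorem continuousOn_logDeriv_of_ne_zero {f : ℂ → ℂ} {U V : Set ℂ} (hU : IsOpen U) (hf : DifferentiableOn ℂ f U)
    (hV : V ⊆ U) (h0 : ∀ z ∈ V, f z ≠ 0) : DifferentiableOn ℂ (logDeriv f) V :=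
  ((hf.deriv hU).mono hV).div (hf.mono hV) h0

theorem rectIm_logDeriv {U : Set ℂ} (hU : IsOpen U) (hx : x₁ ≤ x₂) (hy : y₁ ≤ y₂)
    (hsub : Icc x₁ x₂ ×ℂ Icc y₁ y₂ ⊆ U) (m : ℂ → ℕ) (S : Finset ℂ)
    (hS : ∀ ρ ∈ S, ρ.re ∈ Ioo x₁ x₂ ∧ ρ.im ∈ Ioo y₁ y₂) :
    ∀ f : ℂ → ℂ, DifferentiableOn ℂ f U → (∀ z ∈ Icc x₁ x₂ ×ℂ Icc y₁ y₂, f z = 0 → z ∈ S) →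
    (∀ ρ ∈ S, analyticOrderAt f ρ = m ρ) →
    rectIm (logDeriv f) x₁ x₂ y₁ y₂ = 2 * π * ∑ ρ ∈ S, (m ρ : ℝ) := by
  induction S using Finset.induction_on with
  | empty =>
    intro f hf h0 _
    rw [rectIm_eq_zero hx hy]
    · simp
    · exact continuousOn_logDeriv_of_ne_zero hU hf hsub fun z hz h => by simpa using h0 z hz h
  | insert ρ S hρS ih =>
    intro f hf h0 hord
    obtain ⟨hρr, hρi⟩ := hS ρ (Finset.mem_insert_self _ _)
    have hρU : ρ ∈ U := hsub ⟨Ioo_subset_Icc_self hρr, Ioo_subset_Icc_self hρi⟩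
    obtain ⟨g, hg, hgρ, hfg⟩ := exists_eq_pow_mul_of_analyticOrderAt hU hf hρU (hord ρ (Finset.mem_insert_self _ _))
    have hfg' : ∀ z ∈ U, f =ᶠ[nhds z] fun z => (z - ρ) ^ m ρ * g z := fun z hz => by
      filter_upwards [hU.mem_nhds hz] with w hw using hfg w hw
    have hS' : ∀ ρ ∈ S, ρ.re ∈ Ioo x₁ x₂ ∧ ρ.im ∈ Ioo y₁ y₂ := fun w hw => hS w (Finset.mem_insert_of_mem hw)
    have key := ih hS' g hg (fun z hz hgz => by
      have := h0 z hz (by rw [hfg z (hsub hz), hgz, mul_zero])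
      rcases Finset.mem_insert.1 this with rfl | h
      · exact absurd hgz hgρ
      · exact h) (fun w hw => by
      have hwU : w ∈ U := hsub ⟨Ioo_subset_Icc_self (hS' w hw).1, Ioo_subset_Icc_self (hS' w hw).2⟩
      have hwρ : w ≠ ρ := fun h => hρS (h ▸ hw)
      rw [← hord w (Finset.mem_insert_of_mem hw), analyticOrderAt_congr (hfg' w hwU)]
      have a1 : AnalyticAt ℂ (fun z => (z - ρ) ^ m ρ) w := by fun_prop
      have := analyticOrderAt_mul a1 (hg.analyticOnNhd hU w hwU)
      have h2 : analyticOrderAt (fun z => (z - ρ) ^ m ρ) w = 0 :=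
        a1.analyticOrderAt_eq_zero.2 (pow_ne_zero _ (sub_ne_zero.2 hwρ))
      rw [h2, zero_add] at this
      exact this.symm)
    have hbne : ∀ z ∈ rectBoundary x₁ x₂ y₁ y₂, z ∉ (insert ρ S : Finset ℂ) := by
      intro z hz hzS
      obtain ⟨h1, h2⟩ := hS z hzS
      rcases hz.2.2 with h | h | h | h
      · exact h1.1.ne' h
      · exact h1.2.ne h
      · exact h2.1.ne' h
      · exact h2.2.ne h
    have hbU : rectBoundary x₁ x₂ y₁ y₂ ⊆ U := (rectBoundary_subset hx hy).trans hsub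
    have hfb : ∀ z ∈ rectBoundary x₁ x₂ y₁ y₂, f z ≠ 0 := fun z hz h => hbne z hz (h0 z (rectBoundary_subset hx hy hz) h)
    have hzρ : ∀ z ∈ rectBoundary x₁ x₂ y₁ y₂, z - ρ ≠ 0 := fun z hz h =>
      hbne z hz (by rw [sub_eq_zero.1 h]; exact Finset.mem_insert_self _ _)
    have hgb : ∀ z ∈ rectBoundary x₁ x₂ y₁ y₂, g z ≠ 0 := fun z hz h => hfb z hz (by rw [hfg z (hbU hz), h, mul_zero])
    have e : ∀ z ∈ rectBoundary x₁ x₂ y₁ y₂, logDeriv f z = ((m ρ : ℝ) : ℂ) * (z - ρ)⁻¹ + logDeriv g z := by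
      intro z hz
      rw [logDeriv_apply, (hfg' z (hbU hz)).deriv_eq, hfg z (hbU hz), ← logDeriv_apply (fun z => (z - ρ) ^ m ρ * g z),
        logDeriv_mul (f := fun z => (z - ρ) ^ m ρ) z (pow_ne_zero _ (hzρ z hz)) (hgb z hz) (by fun_prop)
          (hg.differentiableAt (hU.mem_nhds (hbU hz))),
        logDeriv_fun_pow (f := fun z => z - ρ) (by fun_prop), logDeriv_apply]
      simp
    rw [rectIm_congr hx hy e, rectIm_const_mul_add (F := fun z => (z - ρ)⁻¹) hx hy
      (ContinuousOn.inv₀ (by fun_prop) hzρ) (continuousOn_logDeriv_of_ne_zero hU hg hbU hgb).continuousOn,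
      rectIm_inv_sub hρr hρi, key, Finset.sum_insert hρS]
    ring
end

theorem finite_riemannZeta_zeros {K : Set ℂ} (hK : IsCompact K) : {z | z ∈ K ∧ riemannZeta z = 0}.Finite :=
  hK.inter_riemannZetaZeros_finite

theorem analyticAt_riemannZeta {s : ℂ} (hs : s ≠ 1) : AnalyticAt ℂ riemannZeta s := by
  have hU : IsOpen {z : ℂ | z ≠ 1} := isOpen_ne
  exact DifferentiableOn.analyticAt (s := {z : ℂ | z ≠ 1})
    (fun z hz => (differentiableAt_riemannZeta hz).differentiableWithinAt) (hU.mem_nhds hs)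

theorem analyticOrderAt_riemannZeta {ρ : ℂ} (hρ : ρ ≠ 1) : analyticOrderAt riemannZeta ρ = zetaMult ρ := by
  have htop : analyticOrderAt riemannZeta ρ ≠ ⊤ := by
    intro h
    rw [analyticOrderAt_eq_top] at h
    obtain ⟨r, hr, hr'⟩ := Metric.eventually_nhds_iff_ball.1 h
    have h1 := finite_riemannZeta_zeros (isCompact_closedBall ρ (r / 2))
    have h2 : Metric.closedBall ρ (r / 2) ⊆ {z | z ∈ Metric.closedBall ρ (r / 2) ∧ riemannZeta z = 0} :=
      fun z hz => ⟨hz, hr' z (Metric.closedBall_subset_ball (by linarith) hz)⟩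
    have h3 : (Metric.ball ρ (r / 2)).Infinite := infinite_of_mem_nhds ρ (Metric.ball_mem_nhds ρ (by linarith))
    exact h3 (h1.subset (Metric.ball_subset_closedBall.trans h2))
  obtain ⟨n, hn⟩ := ENat.ne_top_iff_exists.1 htop
  rw [← hn]
  have h1 := (analyticOrderAt_eq_nat_iff_iteratedDeriv_eq_zero (analyticAt_riemannZeta hρ)).1 hn.symm
  have h2 : zetaMult ρ = n := by
    refine le_antisymm (Nat.sInf_le h1.2) ?_
    refine le_csInf ⟨n, h1.2⟩ fun k hk => ?_
    by_contra hkn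
    exact hk (h1.1 k (by omega))
  rw [h2]

theorem completedRiemannZeta_eq_mul {s : ℂ} (hs : 0 < s.im) :
    completedRiemannZeta s = Gammaℝ s * riemannZeta s ∧ Gammaℝ s ≠ 0 := by
  have h0 : s ≠ 0 := by rintro rfl; simp at hs
  have h1 : Gammaℝ s ≠ 0 := by
    intro h
    obtain ⟨n, hn⟩ := Complex.Gammaℝ_eq_zero_iff.1 h
    rw [hn] at hs; simp at hs
  rw [riemannZeta_def_of_ne_zero h0]
  exact ⟨by field_simp, h1⟩

theorem conj_two : (starRingEnd ℂ) 2 = 2 := map_ofNat _ 2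

theorem Gammaℝ_conj (s : ℂ) : Gammaℝ ((starRingEnd ℂ) s) = (starRingEnd ℂ) (Gammaℝ s) := by
  rw [Complex.Gammaℝ_def, Complex.Gammaℝ_def, map_mul, ← Complex.Gamma_conj]
  have h2 : -(starRingEnd ℂ) s / 2 = (starRingEnd ℂ) (-s / 2) := by
    rw [map_div₀, map_neg, conj_two]
  rw [h2, Complex.cpow_conj _ _ (by rw [Complex.arg_ofReal_of_nonneg Real.pi_pos.le]; exact Real.pi_pos.ne)]
  simp [conj_two]

theorem completedRiemannZeta_one_sub_conj {s : ℂ} (hs : 0 < s.im) :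
    completedRiemannZeta (1 - (starRingEnd ℂ) s) = (starRingEnd ℂ) (completedRiemannZeta s) := by
  have h0 : s ≠ 0 := by rintro rfl; simp at hs
  have h0' : (starRingEnd ℂ) s ≠ 0 := by simpa using h0
  have h1 := (completedRiemannZeta_eq_mul hs).1
  have h2 := riemannZeta_def_of_ne_zero h0'
  have h3 : Gammaℝ ((starRingEnd ℂ) s) ≠ 0 := by
    rw [Gammaℝ_conj]; simpa using (completedRiemannZeta_eq_mul hs).2
  rw [completedRiemannZeta_one_sub, h1, map_mul, ← Gammaℝ_conj, ← riemannZeta_conj, h2]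
  field_simp

theorem differentiableAt_completedRiemannZeta_of_im_pos {s : ℂ} (hs : 0 < s.im) :
    DifferentiableAt ℂ completedRiemannZeta s :=
  differentiableAt_completedZeta (by rintro rfl; simp at hs) (by rintro rfl; simp at hs)

theorem logDeriv_completedRiemannZeta_one_sub_conj {s : ℂ} (hs : 0 < s.im) :
    logDeriv completedRiemannZeta (1 - (starRingEnd ℂ) s) = -(starRingEnd ℂ) (logDeriv completedRiemannZeta s) := by
  have hs' : 0 < (1 - (starRingEnd ℂ) s).im := by simpa using hs
  have hd := (differentiableAt_completedRiemannZeta_of_im_pos hs').hasDerivAt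
  have h1 : HasDerivAt (fun w => completedRiemannZeta (1 - w))
      (deriv completedRiemannZeta (1 - (starRingEnd ℂ) s) * -1) ((starRingEnd ℂ) s) :=
    HasDerivAt.comp ((starRingEnd ℂ) s) hd ((hasDerivAt_id _).const_sub 1)
  have h2 := h1.conj_conj
  rw [Complex.conj_conj] at h2
  have h3 : completedRiemannZeta =ᶠ[nhds s]
      ((starRingEnd ℂ) ∘ (fun w => completedRiemannZeta (1 - w)) ∘ (starRingEnd ℂ)) := by
    filter_upwards [(isOpen_lt continuous_const Complex.continuous_im).mem_nhds hs] with w hw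
    simp only [Function.comp]
    rw [completedRiemannZeta_one_sub_conj hw, Complex.conj_conj]
  have h4 := (h2.congr_of_eventuallyEq h3).deriv
  rw [logDeriv_apply, logDeriv_apply, h4, completedRiemannZeta_one_sub_conj hs]
  simp [neg_div]

theorem completedRiemannZeta_eq_zero_iff {s : ℂ} (hs : 0 < s.im) :
    completedRiemannZeta s = 0 ↔ IsNontrivialZero s := by
  obtain ⟨h1, h2⟩ := completedRiemannZeta_eq_mul hs
  constructor
  · intro h
    refine ⟨by rw [h1] at h; exact (mul_eq_zero.1 h).resolve_left h2, ?_, ?_⟩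
    · by_contra hre
      have hs' : 0 < (1 - (starRingEnd ℂ) s).im := by simpa using hs
      have h3 := completedRiemannZeta_one_sub_conj hs
      rw [h, map_zero, (completedRiemannZeta_eq_mul hs').1] at h3
      rcases mul_eq_zero.1 h3 with h4 | h4
      · exact (completedRiemannZeta_eq_mul hs').2 h4
      · refine riemannZeta_ne_zero_of_one_le_re ?_ h4
        simp; linarith
    · by_contra hre
      rw [h1] at h
      exact riemannZeta_ne_zero_of_one_le_re (not_lt.1 hre) ((mul_eq_zero.1 h).resolve_left h2)
  · intro h; rw [h1, h.1, mul_zero]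

theorem differentiableAt_Gammaℝ {s : ℂ} (hs : 0 < s.im ∨ 0 < s.re) : DifferentiableAt ℂ Gammaℝ s := by
  have h1 : DifferentiableAt ℂ (fun s : ℂ => (π : ℂ) ^ (-s / 2) * Complex.Gamma (s / 2)) s := by
    refine DifferentiableAt.mul ?_ ?_
    · refine DifferentiableAt.const_cpow (by fun_prop) (Or.inl ?_)
      exact_mod_cast Real.pi_ne_zero
    · refine DifferentiableAt.comp (g := Complex.Gamma) s (Complex.differentiableAt_Gamma _ fun m h => ?_) (by fun_prop)
      have h2 : s = -(2 * m) := by linear_combination 2 * h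
      rw [h2] at hs
      rcases hs with hs | hs
      · simp at hs
      · simp at hs; linarith [m.cast_nonneg (α := ℝ)]
  exact h1

theorem analyticOrderAt_completedRiemannZeta {ρ : ℂ} (hρ : 0 < ρ.im) :
    analyticOrderAt completedRiemannZeta ρ = zetaMult ρ := by
  have h1 : ρ ≠ 1 := by rintro rfl; simp at hρ
  have hU : IsOpen {z : ℂ | 0 < z.im} := isOpen_lt continuous_const Complex.continuous_im
  have hG : AnalyticAt ℂ Gammaℝ ρ := DifferentiableOn.analyticAt (s := {z : ℂ | 0 < z.im})
    (fun z hz => (differentiableAt_Gammaℝ (Or.inl hz)).differentiableWithinAt) (hU.mem_nhds hρ)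
  have h2 : completedRiemannZeta =ᶠ[nhds ρ] Gammaℝ * riemannZeta := by
    filter_upwards [hU.mem_nhds hρ] with w hw using (completedRiemannZeta_eq_mul hw).1
  rw [analyticOrderAt_congr h2, analyticOrderAt_mul hG (analyticAt_riemannZeta h1),
    hG.analyticOrderAt_eq_zero.2 (completedRiemannZeta_eq_mul hρ).2, zero_add, analyticOrderAt_riemannZeta h1]

theorem logDeriv_completedRiemannZeta {s : ℂ} (hs : 0 < s.im) (h0 : riemannZeta s ≠ 0) :
    logDeriv completedRiemannZeta s = logDeriv Gammaℝ s + logDeriv riemannZeta s := by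
  have hU : IsOpen {z : ℂ | 0 < z.im} := isOpen_lt continuous_const Complex.continuous_im
  have h2 : completedRiemannZeta =ᶠ[nhds s] fun z => Gammaℝ z * riemannZeta z := by
    filter_upwards [hU.mem_nhds hs] with w hw using (completedRiemannZeta_eq_mul hw).1
  rw [logDeriv_apply, h2.deriv_eq, h2.self_of_nhds, ← logDeriv_apply (fun z => Gammaℝ z * riemannZeta z),
    logDeriv_mul s (completedRiemannZeta_eq_mul hs).2 h0 (differentiableAt_Gammaℝ (Or.inl hs))
    (differentiableAt_riemannZeta (by rintro rfl; simp at hs))]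

/-- `x` is not the ordinate of a nontrivial zero. -/
def NonOrdinate (x : ℝ) : Prop := ∀ ρ, IsNontrivialZero ρ → ρ.im ≠ x

theorem NonOrdinate.riemannZeta_ne_zero {x σ : ℝ} (hx : NonOrdinate x) (hσ : 0 < σ) :
    riemannZeta (σ + x * I) ≠ 0 := by
  intro h
  rcases lt_or_ge σ 1 with h1 | h1
  · exact hx (σ + x * I) ⟨h, by simpa using hσ, by simpa using h1⟩ (by simp)
  · exact riemannZeta_ne_zero_of_one_le_re (by simpa using h1) h

theorem NonOrdinate.completedRiemannZeta_ne_zero {x σ : ℝ} (hx : NonOrdinate x) (hx0 : 0 < x) :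
    completedRiemannZeta (σ + x * I) ≠ 0 := by
  intro h
  exact hx _ ((completedRiemannZeta_eq_zero_iff (by simpa using hx0)).1 h) (by simp)

theorem continuousOn_logDeriv_horizontal {x : ℝ} (hx : NonOrdinate x) (hx0 : 0 < x) :
    Continuous fun σ : ℝ => logDeriv completedRiemannZeta (σ + x * I) := by
  have hU : IsOpen {z : ℂ | 0 < z.im} := isOpen_lt continuous_const Complex.continuous_im
  have hd : DifferentiableOn ℂ completedRiemannZeta {z : ℂ | 0 < z.im} := fun z hz =>
    (differentiableAt_completedRiemannZeta_of_im_pos hz).differentiableWithinAt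
  have hm : ∀ σ : ℝ, (σ + x * I : ℂ) ∈ {z : ℂ | 0 < z.im} := fun σ => by simpa using hx0
  exact ((hd.deriv hU).continuousOn.comp_continuous (by fun_prop) hm).div
    (hd.continuousOn.comp_continuous (by fun_prop) hm) fun σ => hx.completedRiemannZeta_ne_zero hx0

theorem integral_im_logDeriv_symm {x : ℝ} (hx : NonOrdinate x) (hx0 : 0 < x) :
    ∫ σ in (-1:ℝ)..2, (logDeriv completedRiemannZeta (σ + x * I)).im =
      2 * ∫ σ in (1 / 2 : ℝ)..2, (logDeriv completedRiemannZeta (σ + x * I)).im := by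
  have hc := Complex.continuous_im.comp (continuousOn_logDeriv_horizontal hx hx0)
  have h1 := intervalIntegral.integral_add_adjacent_intervals (a := -1) (b := 1 / 2) (c := 2)
    (hc.intervalIntegrable (μ := volume) _ _) (hc.intervalIntegrable (μ := volume) _ _)
  simp only [Function.comp] at h1
  have h2 : ∀ σ : ℝ, (logDeriv completedRiemannZeta ((1 - σ : ℝ) + x * I)).im =
      (logDeriv completedRiemannZeta (σ + x * I)).im := by
    intro σ
    have := logDeriv_completedRiemannZeta_one_sub_conj (s := σ + x * I) (by simpa using hx0)
    have e : 1 - (starRingEnd ℂ) (σ + x * I) = ((1 - σ : ℝ) : ℂ) + x * I := by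
      simp; ring
    rw [e] at this
    rw [this]; simp
  have h3 := intervalIntegral.integral_comp_sub_left (a := 1 / 2) (b := 2)
    (fun σ : ℝ => (logDeriv completedRiemannZeta (σ + x * I)).im) 1
  simp only [h2] at h3
  norm_num at h3 h1 ⊢
  linarith

/-- The argument principle for the zeta function. -/
theorem pi_mul_sum_zetaMult {a b : ℝ} (ha : NonOrdinate a) (hb : NonOrdinate b) (ha0 : 0 < a) (hab : a ≤ b)
    (S : Finset ℂ) (hS : ∀ ρ, ρ ∈ S ↔ IsNontrivialZero ρ ∧ a < ρ.im ∧ ρ.im < b) :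
    π * ∑ ρ ∈ S, (zetaMult ρ : ℝ) =
      (∫ σ in (1 / 2 : ℝ)..2, (logDeriv completedRiemannZeta (σ + a * I)).im) -
      (∫ σ in (1 / 2 : ℝ)..2, (logDeriv completedRiemannZeta (σ + b * I)).im) +
      ∫ y in a..b, (logDeriv completedRiemannZeta (2 + y * I)).re := by
  have hU : IsOpen {z : ℂ | 0 < z.im} := isOpen_lt continuous_const Complex.continuous_im
  have hd : DifferentiableOn ℂ completedRiemannZeta {z : ℂ | 0 < z.im} := fun z hz =>
    (differentiableAt_completedRiemannZeta_of_im_pos hz).differentiableWithinAt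
  have key := rectIm_logDeriv (x₁ := -1) (x₂ := 2) hU (by norm_num) hab (fun z hz => lt_of_lt_of_le ha0 hz.2.1) zetaMult S
    (fun ρ hρ => by
      obtain ⟨h1, h2, h3⟩ := (hS ρ).1 hρ
      exact ⟨⟨by linarith [h1.2.1], by linarith [h1.2.2]⟩, h2, h3⟩) completedRiemannZeta hd
    (fun z hz h => by
      have hz0 : 0 < z.im := lt_of_lt_of_le ha0 hz.2.1
      have hz1 := (completedRiemannZeta_eq_zero_iff hz0).1 h
      exact (hS z).2 ⟨hz1, lt_of_le_of_ne hz.2.1 (ha z hz1).symm, lt_of_le_of_ne hz.2.2 (hb z hz1)⟩)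
    (fun ρ hρ => analyticOrderAt_completedRiemannZeta (lt_trans ha0 ((hS ρ).1 hρ).2.1))
  have hside : ∀ y : ℝ, y ∈ uIcc a b → (logDeriv completedRiemannZeta (((-1 : ℝ) : ℂ) + y * I)).re =
      -(logDeriv completedRiemannZeta (2 + y * I)).re := by
    intro y hy
    rw [uIcc_of_le hab] at hy
    have := logDeriv_completedRiemannZeta_one_sub_conj (s := 2 + y * I) (by simpa using lt_of_lt_of_le ha0 hy.1)
    have e : 1 - (starRingEnd ℂ) (2 + y * I) = ((-1 : ℝ) : ℂ) + y * I := by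
      simp [conj_two]; ring
    rw [e] at this
    rw [this]; simp
  rw [rectIm, integral_im_logDeriv_symm ha ha0, integral_im_logDeriv_symm hb (by linarith),
    intervalIntegral.integral_congr hside, intervalIntegral.integral_neg] at key
  push_cast at key
  linarith

theorem logDeriv_Gammaℝ {s : ℂ} (hs : 0 < s.re) :
    logDeriv Gammaℝ s = -(Real.log π / 2 : ℝ) + Complex.digamma (s / 2) / 2 := by
  have hp : (π : ℂ) ≠ 0 := by exact_mod_cast Real.pi_ne_zero
  have h2 : 0 < (s / 2).re := by simpa using hs
  have hG : HasDerivAt Complex.Gamma (deriv Complex.Gamma (s / 2)) (s / 2) :=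
    (Complex.differentiableAt_Gamma _ (ne_neg_natCast_of_re_pos h2)).hasDerivAt
  have hG2 : HasDerivAt (fun s : ℂ => Complex.Gamma (s / 2)) (deriv Complex.Gamma (s / 2) * (1 / 2)) s :=
    HasDerivAt.comp s hG ((hasDerivAt_id s).div_const 2)
  have hP : HasDerivAt (fun s : ℂ => (π : ℂ) ^ (-s / 2)) ((π : ℂ) ^ (-s / 2) * Complex.log π * (-1 / 2)) s :=
    HasDerivAt.const_cpow ((hasDerivAt_id s).neg.div_const 2) (Or.inl hp)
  have h0 : Complex.Gamma (s / 2) ≠ 0 := Complex.Gamma_ne_zero_of_re_pos h2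
  have h1 : (π : ℂ) ^ (-s / 2) ≠ 0 := by simp [Complex.cpow_eq_zero_iff, hp]
  have hlog : Complex.log π = (Real.log π : ℂ) := (Complex.ofReal_log Real.pi_pos.le).symm
  have : Gammaℝ = fun s : ℂ => (π : ℂ) ^ (-s / 2) * Complex.Gamma (s / 2) := rfl
  rw [this, logDeriv_mul s h1 h0 hP.differentiableAt hG2.differentiableAt, logDeriv_apply, logDeriv_apply,
    hP.deriv, hG2.deriv, Complex.digamma_def, logDeriv_apply, hlog]
  push_cast
  field_simp

/-- The density of the smooth part of the zero counting function. -/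
noncomputable def zeroDensity (y : ℝ) : ℝ := (logDeriv Gammaℝ (2 + y * I)).re / π

theorem continuous_zeroDensity : Continuous zeroDensity := by
  have hU : IsOpen {z : ℂ | 0 < z.re} := isOpen_lt continuous_const Complex.continuous_re
  have hd : DifferentiableOn ℂ Gammaℝ {z : ℂ | 0 < z.re} := fun z hz =>
    (differentiableAt_Gammaℝ (Or.inr hz)).differentiableWithinAt
  have hm : ∀ y : ℝ, (2 + y * I : ℂ) ∈ {z : ℂ | 0 < z.re} := fun y => by simp
  have h : Continuous fun y : ℝ => logDeriv Gammaℝ (2 + y * I) :=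
    ((hd.deriv hU).continuousOn.comp_continuous (by fun_prop) hm).div
      (hd.continuousOn.comp_continuous (by fun_prop) hm) fun y => Complex.Gammaℝ_ne_zero_of_re_pos (hm y)
  exact (Complex.continuous_re.comp h).div_const _

theorem abs_zeroDensity_sub_le {y : ℝ} (hy : 4 ≤ y) :
    |zeroDensity y - Real.log (y / (2 * π)) / (2 * π)| ≤ 10 / y := by
  have hpi := Real.pi_pos
  set z : ℂ := (2 + y * I) / 2 with hz
  have hre : z.re = 1 := by simp [hz]
  have him : z.im = y / 2 := by simp [hz]
  have hzn : y / 2 ≤ ‖z‖ := by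
    rw [← him]; exact (le_abs_self _).trans (Complex.abs_im_le_norm z)
  have h1 := norm_digamma_sub_log_le (z := z) (by rw [hre]; norm_num) (by linarith)
  have h2 : |(Complex.digamma z).re - Real.log ‖z‖| ≤ 24 / y := by
    rw [← Complex.log_re, ← Complex.sub_re]
    refine (Complex.abs_re_le_norm _).trans (h1.trans ?_)
    rw [div_le_div_iff₀ (by linarith) (by linarith)]; linarith
  have hn : ‖z‖ ≤ y / 2 * (1 + 2 / y) := by
    refine (Complex.norm_le_abs_re_add_abs_im z).trans ?_
    rw [hre, him, abs_one, abs_of_nonneg (by linarith)]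
    apply le_of_eq; field_simp; ring
  have h3 : Real.log ‖z‖ - Real.log (y / 2) ≤ 2 / y := by
    rw [← Real.log_div (by linarith) (by linarith)]
    refine (Real.log_le_sub_one_of_pos (by apply div_pos <;> linarith)).trans ?_
    rw [sub_le_iff_le_add, div_le_iff₀ (by linarith)]; linarith
  have h4 : 0 ≤ Real.log ‖z‖ - Real.log (y / 2) := by
    have := Real.log_le_log (by linarith) hzn; linarith
  have h5 : Real.log (y / (2 * π)) = Real.log (y / 2) - Real.log π := by
    rw [← Real.log_div (by linarith) hpi.ne']; congr 1; field_simp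
  have h6 : zeroDensity y = (-(Real.log π / 2) + (Complex.digamma z).re / 2) / π := by
    rw [zeroDensity, logDeriv_Gammaℝ (by simp)]
    simp only [Complex.add_re, Complex.neg_re, Complex.ofReal_re, hz]
    congr 2
    simp
  rw [h6, h5]
  have h7 : (-(Real.log π / 2) + (Complex.digamma z).re / 2) / π - (Real.log (y / 2) - Real.log π) / (2 * π)
     = (((Complex.digamma z).re - Real.log ‖z‖) + (Real.log ‖z‖ - Real.log (y / 2))) / (2 * π) := by
    field_simp; ring
  rw [h7, abs_div, abs_of_pos (by positivity : 0 < 2 * π), div_le_iff₀ (by positivity)]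
  have h8 : |((Complex.digamma z).re - Real.log ‖z‖) + (Real.log ‖z‖ - Real.log (y / 2))| ≤ 26 / y := by
    have e : 26 / y = 24 / y + 2 / y := by ring
    rw [e]
    exact (abs_add_le _ _).trans (add_le_add h2 (by rw [abs_of_nonneg h4]; exact h3))
  refine h8.trans ?_
  rw [div_mul_eq_mul_div]
  have : (26 : ℝ) ≤ 10 * (2 * π) := by linarith [Real.pi_gt_three]
  gcongr

theorem abs_zeroDensity_le {y : ℝ} (hy : 4 ≤ y) : |zeroDensity y| ≤ 5 * Real.log y := by
  have h1 := abs_zeroDensity_sub_le hy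
  have hpi := Real.pi_gt_three
  have hl : 1 ≤ Real.log y := by
    rw [Real.le_log_iff_exp_le (by linarith)]; linarith [Real.exp_one_lt_d9]
  have h2 : 10 / y ≤ 5 / 2 := by rw [div_le_div_iff₀ (by linarith) (by norm_num)]; linarith
  have h3 : |Real.log (y / (2 * π)) / (2 * π)| ≤ Real.log y := by
    rw [abs_div, abs_of_pos (by linarith : 0 < 2 * π), Real.log_div (by linarith) (by linarith),
      div_le_iff₀ (by linarith)]
    have h4 : 0 ≤ Real.log (2 * π) := Real.log_nonneg (by linarith)
    have h5 : Real.log (2 * π) ≤ 3 := by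
      rw [Real.log_le_iff_le_exp (by linarith)]
      have e : Real.exp 3 = Real.exp 1 ^ 3 := by rw [← Real.exp_nat_mul]; norm_num
      rw [e]
      have : (2 : ℝ) ^ 3 ≤ Real.exp 1 ^ 3 := by gcongr; linarith [Real.exp_one_gt_d9]
      linarith [Real.pi_lt_d2]
    rw [abs_le]; constructor <;> nlinarith
  have h6 := abs_le.1 h1
  have h7 := abs_le.1 h3
  rw [abs_le]; constructor <;> linarith

theorem abs_integral_im_logDeriv_Gammaℝ_le {x : ℝ} (hx : 4 ≤ x) :
    |∫ σ in (1 / 2 : ℝ)..2, (logDeriv Gammaℝ (σ + x * I)).im| ≤ 15 := by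
  have h : ∀ σ ∈ uIoc (1 / 2 : ℝ) 2, ‖(logDeriv Gammaℝ (σ + x * I)).im‖ ≤ 10 := by
    intro σ hσ
    rw [uIoc_of_le (by norm_num)] at hσ
    set z : ℂ := (σ + x * I) / 2 with hz
    have hre : z.re = σ / 2 := by simp [hz]
    have him : z.im = x / 2 := by simp [hz]
    have hzn : x / 2 ≤ ‖z‖ := by
      rw [← him]; exact (le_abs_self _).trans (Complex.abs_im_le_norm z)
    have h1 := norm_digamma_sub_log_le (z := z) (by rw [hre]; linarith [hσ.1]) (by linarith)
    rw [logDeriv_Gammaℝ (by simp; linarith [hσ.1])]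
    have h2 : 12 / ‖z‖ ≤ 6 := by rw [div_le_iff₀ (by linarith)]; linarith
    have h3 : |(Complex.digamma z).im - (Complex.log z).im| ≤ 6 := by
      rw [← Complex.sub_im]; exact (Complex.abs_im_le_norm _).trans (h1.trans h2)
    have h4 : |(Complex.log z).im| ≤ 4 := by
      rw [Complex.log_im]; exact (Complex.abs_arg_le_pi z).trans (by linarith [Real.pi_lt_four])
    have h5 : (-((Real.log π / 2 : ℝ) : ℂ) + Complex.digamma z / 2).im = (Complex.digamma z).im / 2 := by
      simp
    rw [h5, Real.norm_eq_abs]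
    have h6 := abs_le.1 h3
    have h7 := abs_le.1 h4
    rw [abs_le]; constructor <;> linarith
  have := intervalIntegral.norm_integral_le_of_norm_le_const h
  rw [Real.norm_eq_abs] at this
  refine this.trans ?_
  norm_num

theorem norm_riemannZeta_sub_one_le {s : ℂ} (hs : 2 ≤ s.re) : ‖riemannZeta s - 1‖ ≤ 2 / 3 := by
  have h0 : 1 < s.re := by linarith
  have hz := zeta_eq_tsum_one_div_nat_add_one_cpow h0
  have hsum : Summable fun n : ℕ => 1 / ((n : ℂ) + 1) ^ s := by
    have := (summable_nat_add_iff 1).2 (Complex.summable_one_div_nat_cpow.2 h0)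
    simpa using this
  rw [hsum.tsum_eq_zero_add] at hz
  have h2 : HasSum (fun n : ℕ => 1 / ((n : ℝ)) ^ 2) (π ^ 2 / 6) := hasSum_zeta_two
  have h3 : HasSum (fun n : ℕ => 1 / (((n + 2 : ℕ) : ℝ)) ^ 2) (π ^ 2 / 6 - 1) := by
    have := (hasSum_nat_add_iff' 2).2 h2
    simpa [Finset.sum_range_succ] using this
  have h4 : riemannZeta s - 1 = ∑' n : ℕ, 1 / (((n + 1 : ℕ) : ℂ) + 1) ^ s := by
    rw [hz]; simp
  rw [h4]
  refine (tsum_of_norm_bounded h3 fun n => ?_).trans ?_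
  · have e : (((n + 1 : ℕ) : ℂ) + 1) = ((n + 2 : ℕ) : ℂ) := by push_cast; ring
    rw [e, norm_div, norm_one, Complex.norm_natCast_cpow_of_pos (by omega)]
    have h5 : (1 : ℝ) ≤ ((n + 2 : ℕ) : ℝ) := by push_cast; linarith [n.cast_nonneg (α := ℝ)]
    refine one_div_le_one_div_of_le (by positivity) ?_
    rw [← Real.rpow_natCast]
    exact Real.rpow_le_rpow_of_exponent_le h5 (by simpa using hs)
  · have := Real.pi_lt_d2
    have := Real.pi_pos
    nlinarith

theorem le_norm_riemannZeta {s : ℂ} (hs : 2 ≤ s.re) : 1 / 3 ≤ ‖riemannZeta s‖ := by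
  have h1 := norm_riemannZeta_sub_one_le hs
  have h2 := norm_sub_norm_le (1 : ℂ) (riemannZeta s)
  rw [norm_sub_rev, norm_one] at h2
  linarith

theorem abs_integral_re_logDeriv_riemannZeta_le (a b : ℝ) (hab : a ≤ b) :
    |∫ y in a..b, (logDeriv riemannZeta (2 + y * I)).re| ≤ 7 := by
  have hre : ∀ y : ℝ, (2 + y * I : ℂ).re = 2 := fun y => by simp
  have hne : ∀ y : ℝ, (2 + y * I : ℂ) ≠ 1 := fun y h => by
    have := congrArg Complex.re h; simp at this
  have hslit : ∀ y : ℝ, riemannZeta (2 + y * I) ∈ Complex.slitPlane := fun y =>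
    Complex.ball_one_subset_slitPlane (by
      rw [Metric.mem_ball, dist_eq_norm]
      exact (norm_riemannZeta_sub_one_le (hre y).ge).trans_lt (by norm_num))
  have hder : ∀ y : ℝ, HasDerivAt (fun y : ℝ => (Complex.log (riemannZeta (2 + y * I))).im)
      (logDeriv riemannZeta (2 + y * I)).re y := by
    intro y
    have h1 : HasDerivAt (fun y : ℝ => (2 + y * I : ℂ)) I y := by
      have := ((hasDerivAt_id (y : ℂ)).comp_ofReal.mul_const I).const_add (2 : ℂ)
      simpa using this
    have h2 := ((differentiableAt_riemannZeta (hne y)).hasDerivAt.comp y h1).clog_real (hslit y)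
    have h3 := Complex.imCLM.hasFDerivAt.comp_hasDerivAt y h2
    have e : (logDeriv riemannZeta (2 + y * I)).re =
        Complex.imCLM (deriv riemannZeta (2 + y * I) * I / riemannZeta (2 + y * I)) := by
      rw [logDeriv_apply, mul_div_right_comm, Complex.imCLM_apply]
      simp
    rw [e]
    exact h3
  have hcont : Continuous fun y : ℝ => (logDeriv riemannZeta (2 + y * I)).re := by
    have hU : IsOpen {z : ℂ | z ≠ 1} := isOpen_ne
    have hd : DifferentiableOn ℂ riemannZeta {z : ℂ | z ≠ 1} := fun z hz =>
      (differentiableAt_riemannZeta hz).differentiableWithinAt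
    exact Complex.continuous_re.comp (((hd.deriv hU).continuousOn.comp_continuous (by fun_prop) hne).div
      (hd.continuousOn.comp_continuous (by fun_prop) hne) fun y =>
        riemannZeta_ne_zero_of_one_le_re (by rw [hre]; norm_num))
  rw [intervalIntegral.integral_eq_sub_of_hasDerivAt (fun y _ => hder y) (hcont.intervalIntegrable _ _)]
  have h4 : ∀ z : ℂ, |(Complex.log z).im| ≤ 7 / 2 := fun z => by
    rw [Complex.log_im]; exact (Complex.abs_arg_le_pi z).trans (by linarith [Real.pi_lt_d2])
  have h5 := abs_le.1 (h4 (riemannZeta (2 + b * I)))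
  have h6 := abs_le.1 (h4 (riemannZeta (2 + a * I)))
  rw [abs_le]; constructor <;> linarith

theorem finite_nontrivialZeros (a b : ℝ) : {ρ : ℂ | IsNontrivialZero ρ ∧ a < ρ.im ∧ ρ.im ≤ b}.Finite := by
  have hK : IsCompact (Icc (0:ℝ) 1 ×ℂ Icc a b) := isCompact_Icc.reProdIm isCompact_Icc
  refine (finite_riemannZeta_zeros hK).subset fun ρ hρ => ⟨?_, hρ.1.1⟩
  rw [Complex.mem_reProdIm]
  exact ⟨⟨hρ.1.2.1.le, hρ.1.2.2.le⟩, hρ.2.1.le, hρ.2.2⟩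

theorem exists_nonOrdinate {a b : ℝ} (hab : a < b) : ∃ x, a < x ∧ x < b ∧ NonOrdinate x := by
  have h1 := (finite_nontrivialZeros a b).image Complex.im
  obtain ⟨x, hx, hx'⟩ := (Ioo_infinite hab).exists_notMem_finite h1
  refine ⟨x, hx.1, hx.2, fun ρ hρ h => hx' ⟨ρ, ⟨hρ, ?_, ?_⟩, h⟩⟩
  · rw [h]; exact hx.1
  · rw [h]; exact hx.2.le

/-- A height between `4` and `5` which is not the ordinate of a zero. -/
noncomputable def baseHeight : ℝ := Classical.choose (exists_nonOrdinate (a := 4) (b := 5) (by norm_num))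

theorem baseHeight_spec : 4 < baseHeight ∧ baseHeight < 5 ∧ NonOrdinate baseHeight :=
  Classical.choose_spec (exists_nonOrdinate (a := 4) (b := 5) (by norm_num))

/-- The nontrivial zeros with ordinates in `(baseHeight, x]`. -/
noncomputable def zerosUpTo (x : ℝ) : Finset ℂ := (finite_nontrivialZeros baseHeight x).toFinset

theorem mem_zerosUpTo {x : ℝ} {ρ : ℂ} :
    ρ ∈ zerosUpTo x ↔ IsNontrivialZero ρ ∧ baseHeight < ρ.im ∧ ρ.im ≤ x := by
  simp [zerosUpTo]

/-- The number of zeros with ordinates in `(baseHeight, x]`, with multiplicity. -/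
noncomputable def zeroCount (x : ℝ) : ℝ := ∑ ρ ∈ zerosUpTo x, (zetaMult ρ : ℝ)

/-- The smooth part of the zero counting function. -/
noncomputable def zeroMain (x : ℝ) : ℝ := ∫ y in baseHeight..max baseHeight x, zeroDensity y

/-- The remainder in the Riemann–von Mangoldt formula. -/
noncomputable def zeroError (x : ℝ) : ℝ := zeroCount x - zeroMain x

theorem zeroCount_mono : Monotone zeroCount := by
  intro x y hxy
  refine Finset.sum_le_sum_of_subset_of_nonneg (fun ρ hρ => ?_) fun _ _ _ => Nat.cast_nonneg _
  rw [mem_zerosUpTo] at hρ ⊢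
  exact ⟨hρ.1, hρ.2.1, hρ.2.2.trans hxy⟩

theorem zeroCount_nonneg (x : ℝ) : 0 ≤ zeroCount x := Finset.sum_nonneg fun _ _ => Nat.cast_nonneg _

theorem zeroCount_of_le {x : ℝ} (hx : x ≤ baseHeight) : zeroCount x = 0 := by
  refine Finset.sum_eq_zero fun ρ hρ => ?_
  rw [mem_zerosUpTo] at hρ
  linarith [hρ.2.1, hρ.2.2]

theorem zeroMain_of_le {x : ℝ} (hx : x ≤ baseHeight) : zeroMain x = 0 := by
  simp [zeroMain, max_eq_left hx]

theorem zeroError_of_le {x : ℝ} (hx : x ≤ baseHeight) : zeroError x = 0 := by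
  rw [zeroError, zeroCount_of_le hx, zeroMain_of_le hx, sub_zero]

theorem continuous_zeroMain : Continuous zeroMain := by
  have h := intervalIntegral.continuous_primitive (fun a b => continuous_zeroDensity.intervalIntegrable a b) (μ := volume)
    baseHeight
  exact h.comp (continuous_const.max continuous_id)

theorem measurable_zeroError : Measurable zeroError :=
  zeroCount_mono.measurable.sub continuous_zeroMain.measurable

theorem abs_zeroMain_sub_le {x y : ℝ} (hx : baseHeight ≤ x) (hxy : x ≤ y) :
    |zeroMain y - zeroMain x| ≤ 5 * Real.log y * (y - x) := by
  have hb := baseHeight_spec.1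
  have h1 : zeroMain y - zeroMain x = ∫ t in x..y, zeroDensity t := by
    rw [zeroMain, zeroMain, max_eq_right hx, max_eq_right (hx.trans hxy)]
    exact intervalIntegral.integral_interval_sub_left (continuous_zeroDensity.intervalIntegrable _ _)
      (continuous_zeroDensity.intervalIntegrable _ _)
  rw [h1, ← Real.norm_eq_abs]
  have := intervalIntegral.norm_integral_le_of_norm_le_const (a := x) (b := y) (f := zeroDensity)
    (C := 5 * Real.log y) (fun t ht => by
      rw [uIoc_of_le hxy] at ht
      have h4 : 4 ≤ t := by linarith [ht.1]
      refine (abs_zeroDensity_le h4).trans ?_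
      have := Real.log_le_log (by linarith) ht.2
      linarith)
  rwa [abs_of_nonneg (by linarith : 0 ≤ y - x)] at this

theorem continuousOn_logDeriv_riemannZeta_horizontal {x : ℝ} (hx : NonOrdinate x) (hx0 : 0 < x) :
    ContinuousOn (fun σ : ℝ => logDeriv riemannZeta (σ + x * I)) (Ioi 0) := by
  have hU : IsOpen {z : ℂ | z ≠ 1} := isOpen_ne
  have hd : DifferentiableOn ℂ riemannZeta {z : ℂ | z ≠ 1} := fun z hz =>
    (differentiableAt_riemannZeta hz).differentiableWithinAt
  have hm : MapsTo (fun σ : ℝ => (σ + x * I : ℂ)) (Ioi 0) {z : ℂ | z ≠ 1} := fun σ _ h => by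
    have := congrArg Complex.im h
    simp at this; linarith
  exact ((hd.deriv hU).continuousOn.comp (by fun_prop) hm).div
    (hd.continuousOn.comp (by fun_prop) hm) fun σ hσ => hx.riemannZeta_ne_zero hσ

theorem continuousOn_logDeriv_Gammaℝ_horizontal (x : ℝ) :
    ContinuousOn (fun σ : ℝ => logDeriv Gammaℝ (σ + x * I)) (Ioi 0) := by
  have hU : IsOpen {z : ℂ | 0 < z.re} := isOpen_lt continuous_const Complex.continuous_re
  have hd : DifferentiableOn ℂ Gammaℝ {z : ℂ | 0 < z.re} := fun z hz =>
    (differentiableAt_Gammaℝ (Or.inr hz)).differentiableWithinAt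
  have hm : MapsTo (fun σ : ℝ => (σ + x * I : ℂ)) (Ioi 0) {z : ℂ | 0 < z.re} := fun σ hσ => by simpa using hσ
  exact ((hd.deriv hU).continuousOn.comp (by fun_prop) hm).div
    (hd.continuousOn.comp (by fun_prop) hm) fun σ hσ => Complex.Gammaℝ_ne_zero_of_re_pos (hm hσ)

theorem exists_abs_zeroError_add_le : ∃ C : ℝ, ∀ x, baseHeight ≤ x → NonOrdinate x →
    |zeroError x + (∫ σ in (1 / 2 : ℝ)..2, (logDeriv riemannZeta (σ + x * I)).im) / π| ≤ C := by
  obtain ⟨hb4, -, hb⟩ := baseHeight_spec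
  set A := ∫ σ in (1 / 2 : ℝ)..2, (logDeriv completedRiemannZeta (σ + baseHeight * I)).im with hA
  refine ⟨(|A| + 22) / π, fun x hx hxn => ?_⟩
  have hx4 : 4 ≤ x := by linarith
  have hpi := Real.pi_pos
  have h1 := pi_mul_sum_zetaMult hb hxn (by linarith) hx (zerosUpTo x) (fun ρ => by
    rw [mem_zerosUpTo]
    constructor
    · rintro ⟨h1, h2, h3⟩
      exact ⟨h1, h2, lt_of_le_of_ne h3 (hxn ρ h1)⟩
    · rintro ⟨h1, h2, h3⟩
      exact ⟨h1, h2, h3.le⟩)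
  have hI : uIcc (1 / 2 : ℝ) 2 ⊆ Ioi 0 := by
    rw [uIcc_of_le (by norm_num)]
    intro σ hσ; exact lt_of_lt_of_le (by norm_num) hσ.1
  have hz := (Complex.continuous_im.comp_continuousOn
    ((continuousOn_logDeriv_riemannZeta_horizontal hxn (by linarith)).mono hI)).intervalIntegrable (μ := volume)
  have hg := (Complex.continuous_im.comp_continuousOn
    ((continuousOn_logDeriv_Gammaℝ_horizontal x).mono hI)).intervalIntegrable (μ := volume)
  have h2 : ∫ σ in (1 / 2 : ℝ)..2, (logDeriv completedRiemannZeta (σ + x * I)).im =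
      (∫ σ in (1 / 2 : ℝ)..2, (logDeriv Gammaℝ (σ + x * I)).im) +
      ∫ σ in (1 / 2 : ℝ)..2, (logDeriv riemannZeta (σ + x * I)).im := by
    refine Eq.trans ?_ (intervalIntegral.integral_add hg hz)
    refine intervalIntegral.integral_congr fun σ hσ => ?_
    rw [logDeriv_completedRiemannZeta (by simp; linarith) (hxn.riemannZeta_ne_zero (hI hσ)), Complex.add_im]
  have hre : ∀ y : ℝ, (2 + y * I : ℂ).re = 2 := fun y => by simp
  have hne : ∀ y : ℝ, (2 + y * I : ℂ) ≠ 1 := fun y h => by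
    have := congrArg Complex.re h; simp at this
  have hcont : Continuous fun y : ℝ => (logDeriv riemannZeta (2 + y * I)).re := by
    have hU : IsOpen {z : ℂ | z ≠ 1} := isOpen_ne
    have hd : DifferentiableOn ℂ riemannZeta {z : ℂ | z ≠ 1} := fun z hz =>
      (differentiableAt_riemannZeta hz).differentiableWithinAt
    exact Complex.continuous_re.comp (((hd.deriv hU).continuousOn.comp_continuous (by fun_prop) hne).div
      (hd.continuousOn.comp_continuous (by fun_prop) hne) fun y =>
        riemannZeta_ne_zero_of_one_le_re (by rw [hre]; norm_num))
  have h3 : ∫ y in baseHeight..x, (logDeriv completedRiemannZeta (2 + y * I)).re =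
      π * zeroMain x + ∫ y in baseHeight..x, (logDeriv riemannZeta (2 + y * I)).re := by
    rw [zeroMain, max_eq_right hx, ← intervalIntegral.integral_const_mul,
      ← intervalIntegral.integral_add ((continuous_zeroDensity.const_mul π).intervalIntegrable _ _)
        (hcont.intervalIntegrable _ _)]
    refine intervalIntegral.integral_congr fun y hy => ?_
    rw [uIcc_of_le hx] at hy
    rw [logDeriv_completedRiemannZeta (by simp; linarith [hy.1])
      (riemannZeta_ne_zero_of_one_le_re (by rw [hre]; norm_num)), Complex.add_re, zeroDensity]
    field_simp
  rw [h2, h3, ← hA] at h1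
  have h4 := abs_le.1 (abs_integral_im_logDeriv_Gammaℝ_le hx4)
  have h5 := abs_le.1 (abs_integral_re_logDeriv_riemannZeta_le baseHeight x hx)
  have h6 := abs_le.1 (le_refl |A|)
  have h7 : π * zeroCount x - π * zeroMain x = π * zeroError x := by rw [zeroError]; ring
  change π * zeroCount x = _ at h1
  have h8 : zeroError x + (∫ σ in (1 / 2 : ℝ)..2, (logDeriv riemannZeta (σ + x * I)).im) / π =
      (π * zeroError x + ∫ σ in (1 / 2 : ℝ)..2, (logDeriv riemannZeta (σ + x * I)).im) / π := by
    field_simp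
  rw [h8, abs_div, abs_of_pos hpi]
  refine div_le_div_of_nonneg_right ?_ hpi.le
  rw [abs_le]; constructor <;> linarith

theorem abs_integral_im_logDeriv_riemannZeta_le {x : ℝ} (hx : 4 ≤ x) (hxn : NonOrdinate x) :
    |∫ σ in (1 / 2 : ℝ)..2, (logDeriv riemannZeta (σ + x * I)).im| ≤ 3000 * Real.log x := by
  set c : ℂ := 2 + x * I with hc
  have hcre : c.re = 2 := by simp [hc]
  have hcim : c.im = x := by simp [hc]
  have hclose : ∀ z ∈ Metric.closedBall c (19 / 10 : ℝ), 1 / 10 ≤ z.re ∧ 2 ≤ z.im ∧ ‖z‖ ≤ 2 * x := by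
    intro z hz
    rw [Metric.mem_closedBall, dist_eq_norm] at hz
    have h1 := abs_le.1 ((Complex.abs_re_le_norm (z - c)).trans hz)
    have h2 := abs_le.1 ((Complex.abs_im_le_norm (z - c)).trans hz)
    rw [Complex.sub_re, hcre] at h1
    rw [Complex.sub_im, hcim] at h2
    refine ⟨by linarith, by linarith, ?_⟩
    have h3 : ‖c‖ ≤ 2 + x := by
      refine (norm_add_le _ _).trans ?_
      simp [abs_of_nonneg (by linarith : 0 ≤ x)]
    have h4 := norm_le_norm_add_norm_sub' z c
    linarith
  have hz1 : ∀ z : ℂ, 2 ≤ z.im → z ≠ 1 := by rintro z hz rfl; simp at hz; linarith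
  have hbd : ∀ z ∈ Metric.closedBall c (19 / 10 : ℝ), ‖riemannZeta z‖ ≤ 22 * x := by
    intro z hz
    obtain ⟨h1, h2, h3⟩ := hclose z hz
    refine (norm_riemannZeta_le (by linarith) (hz1 z h2)).trans ?_
    have h4 : 1 ≤ ‖z - 1‖ := by
      have := (le_abs_self _).trans (Complex.abs_im_le_norm (z - 1))
      simp at this; linarith
    have h5 : ‖z‖ / ‖z - 1‖ ≤ 2 * x := (div_le_self (norm_nonneg _) h4).trans h3
    have h6 : ‖z‖ / z.re ≤ 20 * x := by
      rw [div_le_iff₀ (by linarith)]; nlinarith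
    linarith
  have hdc : DiffContOnCl ℂ riemannZeta (Metric.ball c (19 / 10)) := by
    refine DifferentiableOn.diffContOnCl fun z hz => ?_
    exact (differentiableAt_riemannZeta (hz1 z (hclose z (Metric.closure_ball_subset_closedBall hz)).2.1)).differentiableWithinAt
  have hcn : 1 / 3 ≤ ‖riemannZeta c‖ := le_norm_riemannZeta hcre.ge
  have hc0 : riemannZeta c ≠ 0 := by rw [← norm_pos_iff]; linarith
  have hA : ∫ θ in (0:ℝ)..2 * π, ‖riemannZeta (circleMap c (19 / 10) θ)‖ ≤ 2 * π * (22 * x) := by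
    have := intervalIntegral.norm_integral_le_of_norm_le_const (a := 0) (b := 2 * π)
      (f := fun θ => ‖riemannZeta (circleMap c (19 / 10) θ)‖) (C := 22 * x) (fun θ _ => by
        rw [norm_norm]
        exact hbd _ (Metric.sphere_subset_closedBall (circleMap_mem_sphere _ (by norm_num) _)))
    rw [sub_zero, abs_of_pos Real.two_pi_pos] at this
    have h2 := (le_abs_self _).trans this
    linarith
  have key := abs_integral_im_logDeriv_le (f := riemannZeta) (c := c) (R := 19 / 10) (A := 22 * x) (a := 1 / 2) (b := 2)
    (by norm_num) hdc hc0 hA (by rw [hcre]; norm_num) (by norm_num) (by rw [hcre]; norm_num) (fun σ hσ => by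
      rw [hcim]; exact hxn.riemannZeta_ne_zero (lt_of_lt_of_le (by norm_num) hσ.1))
  rw [hcim] at key
  refine key.trans ?_
  have hl : 1 ≤ Real.log x := by
    rw [Real.le_log_iff_exp_le (by linarith)]; linarith [Real.exp_one_lt_d9]
  have h1 : 20 * (22 * x) / ‖riemannZeta c‖ ≤ 1320 * x := by
    rw [div_le_iff₀ (by linarith)]; nlinarith
  have h2 : Real.log (20 * (22 * x) / ‖riemannZeta c‖) ≤ Real.log (1320 * x) :=
    Real.log_le_log (by apply div_pos <;> linarith) h1
  have h3 : Real.log 1320 ≤ 8 := by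
    rw [Real.log_le_iff_le_exp (by norm_num)]
    have e : Real.exp 8 = Real.exp 1 ^ 8 := by rw [← Real.exp_nat_mul]; norm_num
    rw [e]
    have : (2.7 : ℝ) ^ 8 ≤ Real.exp 1 ^ 8 := by gcongr; linarith [Real.exp_one_gt_d9]
    refine le_trans (by norm_num) this
  rw [Real.log_mul (by norm_num) (by linarith)] at h2
  linarith

theorem exists_abs_zeroError_le : ∃ C : ℝ, 0 < C ∧ ∀ x, baseHeight ≤ x → |zeroError x| ≤ C * Real.log x := by
  obtain ⟨hb4, -, hb⟩ := baseHeight_spec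
  obtain ⟨C, hC⟩ := exists_abs_zeroError_add_le
  have hl : ∀ x, baseHeight ≤ x → 1 ≤ Real.log x := fun x hx => by
    rw [Real.le_log_iff_exp_le (by linarith)]; linarith [Real.exp_one_lt_d9]
  have h0 : ∀ x, baseHeight ≤ x → NonOrdinate x → |zeroError x| ≤ (|C| + 3000) * Real.log x := by
    intro x hx hxn
    have h1 := hC x hx hxn
    have h2 := abs_integral_im_logDeriv_riemannZeta_le (by linarith) hxn
    set J := ∫ σ in (1 / 2 : ℝ)..2, (logDeriv riemannZeta (σ + x * I)).im
    have h3 : |J / π| ≤ 3000 * Real.log x := by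
      rw [abs_div, abs_of_pos Real.pi_pos]
      exact (div_le_self (abs_nonneg _) (by linarith [Real.pi_gt_three])).trans h2
    have h4 := abs_le.1 (h1.trans (le_abs_self C))
    have h5 := abs_le.1 h3
    have h6 : |C| ≤ |C| * Real.log x := le_mul_of_one_le_right (abs_nonneg _) (hl x hx)
    rw [abs_le]; constructor <;> linarith
  refine ⟨2 * (|C| + 3000) + 10, by positivity, fun x hx => ?_⟩
  have hK : 0 ≤ |C| + 3000 := by positivity
  have hlx := hl x hx
  obtain ⟨y, hxy, hyx, hyn⟩ := exists_nonOrdinate (a := x) (b := x + 1) (by linarith)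
  have h1 := h0 y (by linarith) hyn
  have h2 := abs_zeroMain_sub_le hx hxy.le
  have h3 := zeroCount_mono hxy.le
  have hly : Real.log y ≤ 2 * Real.log x := by
    rw [← Real.log_rpow (by linarith)]
    exact Real.log_le_log (by linarith) (by norm_num; nlinarith)
  have hup : zeroError x ≤ (2 * (|C| + 3000) + 10) * Real.log x := by
    have h4 := (abs_le.1 h1).2
    have h5 := (abs_le.1 h2).2
    rw [zeroError] at h4 ⊢
    have h6 : 5 * Real.log y * (y - x) ≤ 5 * (2 * Real.log x) * 1 := by
      gcongr <;> linarith
    have h7 : (|C| + 3000) * Real.log y ≤ (|C| + 3000) * (2 * Real.log x) := by gcongr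
    linarith
  have hlow : -((2 * (|C| + 3000) + 10) * Real.log x) ≤ zeroError x := by
    rcases hx.eq_or_lt with h | h
    · rw [zeroError_of_le h.ge]
      have : 0 ≤ (2 * (|C| + 3000) + 10) * Real.log x := by positivity
      linarith
    obtain ⟨w, hw1, hw2, hwn⟩ := exists_nonOrdinate (a := max baseHeight (x - 1)) (b := x)
      (max_lt h (by linarith))
    have hw3 := (le_max_left _ _).trans_lt hw1
    have hw4 := (le_max_right _ _).trans_lt hw1
    have h4 := (abs_le.1 (h0 w hw3.le hwn)).1
    have h5 := (abs_le.1 (abs_zeroMain_sub_le hw3.le hw2.le)).2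
    have h6 : 5 * Real.log x * (x - w) ≤ 5 * Real.log x * 1 := by gcongr; linarith
    have h7 := zeroCount_mono hw2.le
    have h8 : (|C| + 3000) * Real.log w ≤ (|C| + 3000) * Real.log x :=
      mul_le_mul_of_nonneg_left (Real.log_le_log (by linarith) hw2.le) hK
    have h9 : 0 ≤ (|C| + 3000) * Real.log x := by positivity
    rw [zeroError] at h4 ⊢
    linarith
  rw [abs_le]; exact ⟨hlow, hup⟩

theorem exists_zeroCount_le : ∃ C : ℝ, 0 < C ∧ ∀ x, baseHeight ≤ x → zeroCount x ≤ C * (x * Real.log x) := by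
  obtain ⟨hb4, -, hb⟩ := baseHeight_spec
  obtain ⟨C, hC0, hC⟩ := exists_abs_zeroError_le
  refine ⟨C + 5, by linarith, fun x hx => ?_⟩
  have h1 := (abs_le.1 (hC x hx)).2
  have h2 := (abs_le.1 (abs_zeroMain_sub_le le_rfl hx)).2
  rw [zeroMain_of_le le_rfl] at h2
  rw [zeroError] at h1
  have hl : 0 ≤ Real.log x := Real.log_nonneg (by linarith)
  have h3 : C * Real.log x ≤ C * (x * Real.log x) := by
    refine mul_le_mul_of_nonneg_left ?_ hC0.le
    exact le_mul_of_one_le_left hl (by linarith)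
  nlinarith

theorem exists_exceptional_set {f : ℝ → ENNReal} (hf : Measurable f) {J : Set ℝ} (hJ : MeasurableSet J) {A ε : ℝ}
    (hε : 0 < ε) (h : ∫⁻ x in J, f x ≤ ENNReal.ofReal A) :
    ∃ S, MeasurableSet S ∧ volume S ≤ ENNReal.ofReal (A / ε) ∧ ∀ x ∈ J, x ∉ S → f x < ENNReal.ofReal ε := by
  have hS : MeasurableSet {x | ENNReal.ofReal ε ≤ f x} := measurableSet_le measurable_const hf
  refine ⟨J ∩ {x | ENNReal.ofReal ε ≤ f x}, hJ.inter hS, ?_, fun x hx hxS => ?_⟩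
  · have h1 := meas_ge_le_lintegral_div (μ := volume.restrict J) hf.aemeasurable
      (ε := ENNReal.ofReal ε) (by simpa using hε) ENNReal.ofReal_ne_top
    rw [Measure.restrict_apply hS, inter_comm] at h1
    rw [ENNReal.ofReal_div_of_pos hε]
    exact h1.trans (ENNReal.div_le_div_right h _)
  · by_contra hc
    exact hxS ⟨hx, not_lt.1 hc⟩

theorem measurable_riemannZeta : Measurable riemannZeta :=
  measurable_of_continuousOn_compl_singleton 1 fun _ hz =>
    (differentiableAt_riemannZeta hz).continuousAt.continuousWithinAt

theorem continuous_mollifier_vertical (y : ℕ) (σ : ℝ) :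
    Continuous fun t : ℝ => mollifier y ((σ : ℂ) + t * I) := by
  refine continuous_finsetSum _ fun n hn => ?_
  have hn0 : (n : ℂ) ≠ 0 := by
    have := (Finset.mem_Icc.1 hn).1
    exact_mod_cast (by omega : n ≠ 0)
  exact continuous_const.mul (Continuous.const_cpow (by fun_prop) (Or.inl hn0))

theorem lintegral_circle_zeta_sq_le {U r R κ : ℝ} (hU : 2 ≤ U) (hr : 0 ≤ r) (hR0 : 0 ≤ R) (hR : R ≤ r + κ) (hrR : r + R ≤ 1)
    (hR1 : R ≤ r + 1 / 4) (hκ : 0 ≤ κ) :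
    ∫⁻ x in Icc U (3 * U), (∫⁻ θ in Ioc 0 (2 * π), ‖riemannZeta (circleMap (((1 / 2 + r : ℝ) : ℂ) + x * I) R θ)‖ₑ ^ 2) ≤
      ENNReal.ofReal (2 * π * (5300 * (1 + Real.log (4 * U)) * (4 * U * (4 * U) ^ (2 * κ)))) := by
  have hmeas : Measurable (Function.uncurry fun x θ : ℝ =>
      ‖riemannZeta (circleMap (((1 / 2 + r : ℝ) : ℂ) + x * I) R θ)‖ₑ ^ 2) := by
    refine Measurable.pow_const (Measurable.enorm (measurable_riemannZeta.comp (Continuous.measurable ?_))) 2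
    unfold circleMap
    fun_prop
  rw [lintegral_lintegral_swap hmeas.aemeasurable]
  have hR' : R ≤ 1 := by linarith
  have h1 : ∀ θ : ℝ, ∫⁻ x in Icc U (3 * U), ‖riemannZeta (circleMap (((1 / 2 + r : ℝ) : ℂ) + x * I) R θ)‖ₑ ^ 2 ≤
      ENNReal.ofReal (5300 * (1 + Real.log (4 * U)) * (4 * U * (4 * U) ^ (2 * κ))) := by
    intro θ
    have hs := abs_le.1 (Real.abs_sin_le_one θ)
    have hcs := abs_le.1 (Real.abs_cos_le_one θ)
    set σ := 1 / 2 + r + R * Real.cos θ with hσ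
    set h := R * Real.sin θ with hh
    have hh1 : -1 ≤ h ∧ h ≤ 1 := by constructor <;> nlinarith
    have hc1 : -R ≤ R * Real.cos θ ∧ R * Real.cos θ ≤ R := by constructor <;> nlinarith
    have e : ∀ x : ℝ, circleMap (((1 / 2 + r : ℝ) : ℂ) + x * I) R θ = (σ : ℂ) + ((x + h : ℝ) : ℂ) * I := by
      intro x
      rw [circleMap, Complex.exp_mul_I, ← Complex.ofReal_cos, ← Complex.ofReal_sin, hσ, hh]
      push_cast; ring
    simp only [e]
    refine le_trans ?_ (lintegral_riemannZeta_sq_le (T := 4 * U) (κ := κ) (σ := σ) (by linarith) hκ (by linarith)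
      (by linarith) (by linarith))
    rw [← lintegral_indicator measurableSet_Icc, ← lintegral_indicator measurableSet_Icc,
      ← lintegral_add_right_eq_self ((Icc 1 (4 * U)).indicator _) h]
    refine lintegral_mono fun x => ?_
    by_cases hx : x ∈ Icc U (3 * U)
    · have hx' : x + h ∈ Icc 1 (4 * U) := ⟨by linarith [hx.1], by linarith [hx.2]⟩
      rw [indicator_of_mem hx, indicator_of_mem hx']
    · rw [indicator_of_notMem hx]; exact zero_le
  refine (lintegral_mono h1).trans ?_
  rw [lintegral_const, Measure.restrict_apply MeasurableSet.univ, univ_inter, Real.volume_Ioc, sub_zero, mul_comm,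
    ← ENNReal.ofReal_mul Real.two_pi_pos.le]

/-- Off an exceptional set of heights the variation of the argument of zeta near the critical line is small. -/
theorem exists_exceptional_disc {U r R w : ℝ} {y : ℕ} (hU : 2 ≤ U) (hr : 0 < r) (hr1 : r ≤ 9 / 20) (hrR : r ≤ R)
    (hR1 : R ≤ r + 1 / 10) (hR2 : r + R ≤ 1) (hw : 1 ≤ w) (hy : 1 ≤ y) (hyU : (y : ℝ) ^ 8 ≤ 4 * U) :
    ∃ S, MeasurableSet S ∧ volume S ≤ ENNReal.ofReal (10 ^ 7 * U * (1 + Real.log (4 * U)) ^ 4 *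
        (Real.exp (-w) * (4 * U) ^ (2 * (R - r)) + (y : ℝ) ^ (-(2 * r)))) ∧
      ∀ x ∈ Icc U (3 * U), x ∉ S → NonOrdinate x → ∀ a b, 1 / 2 + r - 4 / 5 * R ≤ a → a ≤ b → b ≤ 1 / 2 + r + 4 / 5 * R →
        |∫ σ in a..b, (logDeriv riemannZeta (σ + x * I)).im| ≤ 2000 * w := by
  have hl : 0 ≤ Real.log (4 * U) := Real.log_nonneg (by linarith)
  have hy1 : (1 : ℝ) ≤ y := by exact_mod_cast hy
  set T := 4 * U with hT
  set σ := 1 / 2 + r with hσ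
  have hpi := Real.pi_pos
  have hmeas : Measurable (Function.uncurry fun x θ : ℝ =>
      ‖riemannZeta (circleMap ((σ : ℂ) + x * I) R θ)‖ₑ ^ 2) := by
    refine Measurable.pow_const (Measurable.enorm (measurable_riemannZeta.comp (Continuous.measurable ?_))) 2
    unfold circleMap
    fun_prop
  obtain ⟨S₁, hS₁, hv₁, hg₁⟩ := exists_exceptional_set (J := Icc U (3 * U)) (ε := 2 * π * Real.exp w)
    (f := fun x => ∫⁻ θ in Ioc 0 (2 * π), ‖riemannZeta (circleMap ((σ : ℂ) + x * I) R θ)‖ₑ ^ 2)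
    hmeas.lintegral_prod_right' measurableSet_Icc (by positivity)
    (lintegral_circle_zeta_sq_le (κ := R - r) hU hr.le (by linarith) (by linarith) hR2 (by linarith) (by linarith))
  have hsub : Icc U (3 * U) ⊆ Icc (-T) T := Icc_subset_Icc (by linarith) (by linarith)
  have hcz : Measurable fun t : ℝ => riemannZeta ((σ : ℂ) + t * I) :=
    measurable_riemannZeta.comp (by fun_prop)
  obtain ⟨S₂, hS₂, hv₂, hg₂⟩ := exists_exceptional_set (J := Icc U (3 * U)) (ε := 1 / 4)
    (f := fun t => ‖riemannZeta ((σ:ℂ)+t*I) * mollifier y ((σ:ℂ)+t*I) - 1‖ₑ^2)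
    (((hcz.mul (continuous_mollifier_vertical y σ).measurable).sub_const 1).enorm.pow_const 2) measurableSet_Icc (by norm_num)
    ((lintegral_mono_set hsub).trans (lintegral_zeta_mollifier_sq_le (T := T) (by linarith) hy hyU
      (by linarith) (by linarith)))
  have hy8 : (y : ℝ) ≤ T / 2 := by
    rcases hy.eq_or_lt with h | h
    · rw [← h]; norm_num; linarith
    · have h2 : (2 : ℝ) ≤ y := by exact_mod_cast h
      have h3 : (2:ℝ) ^ 7 ≤ (y : ℝ) ^ 7 := by gcongr
      have h4 : (y : ℝ) ^ 8 = y ^ 7 * y := by ring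
      nlinarith
  obtain ⟨S₃, hS₃, hv₃, hg₃⟩ := exists_exceptional_set (J := Icc U (3 * U)) (ε := Real.exp (2 * w))
    (f := fun t => ‖mollifier y ((σ:ℂ)+t*I)‖ₑ^2)
    ((continuous_mollifier_vertical y σ).measurable.enorm.pow_const 2) measurableSet_Icc (by positivity)
    ((lintegral_mono_set hsub).trans (lintegral_dirichlet_poly_sq_le (mollCoeff y) (T := T) (fun n hn => mollCoeff_of_lt
      (by exact_mod_cast hn)) (abs_mollCoeff_le y) (by linarith) hy8
      (by linarith) (by linarith)))
  refine ⟨S₁ ∪ S₂ ∪ S₃, (hS₁.union hS₂).union hS₃, ?_, ?_⟩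
  · refine (measure_union_le _ _).trans ((add_le_add ((measure_union_le _ _).trans (add_le_add hv₁ hv₂)) hv₃).trans ?_)
    have hT0 : 0 < T := by linarith
    have hTp : 1 ≤ T ^ (2 * (R - r)) := Real.one_le_rpow (by linarith) (by linarith)
    rw [← ENNReal.ofReal_add (by positivity) (by positivity), ← ENNReal.ofReal_add (by positivity) (by positivity)]
    refine ENNReal.ofReal_le_ofReal ?_
    have e1 : 2 * π * (5300 * (1 + Real.log T) * (T * T ^ (2 * (R - r)))) / (2 * π * Real.exp w) =
        21200 * U * (1 + Real.log T) * (Real.exp (-w) * T ^ (2 * (R - r))) := by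
      rw [Real.exp_neg, hT]; field_simp; ring
    have e2 : 53000 * T * (y : ℝ) ^ (1 - 2 * σ) * (1 + Real.log T) ^ 4 / (1 / 4) =
        848000 * U * (1 + Real.log T) ^ 4 * (y : ℝ) ^ (-(2 * r)) := by
      rw [show 1 - 2 * σ = -(2 * r) by rw [hσ]; ring, hT]; ring
    have e3 : 500 * T * (1 + Real.log T) / Real.exp (2 * w) = 2000 * U * (1 + Real.log T) * Real.exp (-(2 * w)) := by
      rw [Real.exp_neg, hT]; field_simp; ring
    rw [e1, e2, e3]
    have hp : 1 + Real.log T ≤ (1 + Real.log T) ^ 4 := le_self_pow₀ (by linarith) (by norm_num)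
    have hx : Real.exp (-(2 * w)) ≤ Real.exp (-w) * T ^ (2 * (R - r)) :=
      (Real.exp_le_exp.2 (by linarith)).trans (le_mul_of_one_le_right (Real.exp_pos _).le hTp)
    set X := Real.exp (-w) * T ^ (2 * (R - r)) with hX
    have hX0 : 0 ≤ X := by positivity
    set Y := (y : ℝ) ^ (-(2 * r)) with hY
    have hY0 : 0 ≤ Y := by positivity
    set L := (1 + Real.log T) ^ 4 with hL
    have hL0 : 0 ≤ L := by positivity
    have f1 : 21200 * U * (1 + Real.log T) * X ≤ 21200 * U * L * X := by gcongr
    have f3 : 2000 * U * (1 + Real.log T) * Real.exp (-(2 * w)) ≤ 2000 * U * L * X := by gcongr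
    have g1 : 0 ≤ U * L * X := by positivity
    have g2 : 0 ≤ U * L * Y := by positivity
    nlinarith
  · intro x hx hxS hxn a b ha hab hb
    simp only [mem_union, not_or] at hxS
    obtain ⟨⟨hx1, hx2⟩, hx3⟩ := hxS
    have k1 := hg₁ x hx hx1
    have k2 := hg₂ x hx hx2
    have k3 := hg₃ x hx hx3
    set c : ℂ := (σ : ℂ) + x * I with hc
    have hcre : c.re = σ := by simp [hc]
    have hcim : c.im = x := by simp [hc]
    have hR0 : 0 < R := by linarith
    have hcl : ∀ z ∈ Metric.closedBall c R, z ≠ 1 := by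
      intro z hz h
      rw [h, Metric.mem_closedBall, dist_eq_norm] at hz
      have h2 := abs_le.1 ((Complex.abs_im_le_norm (1 - c)).trans hz)
      rw [Complex.sub_im, hcim] at h2
      simp at h2
      linarith [hx.1]
    have hdc : DiffContOnCl ℂ riemannZeta (Metric.ball c R) := by
      refine DifferentiableOn.diffContOnCl fun z hz => ?_
      exact (differentiableAt_riemannZeta (hcl z (Metric.closure_ball_subset_closedBall hz))).differentiableWithinAt
    have hcont : Continuous fun θ : ℝ => ‖riemannZeta (circleMap c R θ)‖ := by
      refine continuous_norm.comp (continuous_iff_continuousAt.2 fun θ => ?_)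
      exact ContinuousAt.comp (f := circleMap c R) (g := riemannZeta)
        (differentiableAt_riemannZeta (hcl _ (Metric.sphere_subset_closedBall
        (circleMap_mem_sphere _ hR0.le _)))).continuousAt (continuous_circleMap c R).continuousAt
    have hcont2 : Continuous fun θ : ℝ => ‖riemannZeta (circleMap c R θ)‖ ^ 2 := hcont.pow 2
    have m2 : ‖riemannZeta c * mollifier y c - 1‖ < 1 / 2 := by
      rw [← ofReal_norm_eq_enorm, ← ENNReal.ofReal_pow (norm_nonneg _), ENNReal.ofReal_lt_ofReal_iff (by norm_num)] at k2
      nlinarith [norm_nonneg (riemannZeta c * mollifier y c - 1)]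
    have m3 : ‖mollifier y c‖ < Real.exp w := by
      rw [← ofReal_norm_eq_enorm, ← ENNReal.ofReal_pow (norm_nonneg _), ENNReal.ofReal_lt_ofReal_iff (by positivity),
        show 2 * w = ((2 : ℕ) : ℝ) * w by norm_num, Real.exp_nat_mul] at k3
      exact lt_of_pow_lt_pow_left₀ 2 (by positivity) k3
    have hzc : 1 / (2 * Real.exp w) ≤ ‖riemannZeta c‖ := by
      have h1 : 1 / 2 ≤ ‖riemannZeta c * mollifier y c‖ := by
        have := norm_sub_norm_le (1 : ℂ) (riemannZeta c * mollifier y c)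
        rw [norm_sub_rev, norm_one] at this
        linarith
      rw [norm_mul] at h1
      rw [div_le_iff₀ (by positivity)]
      nlinarith [norm_nonneg (riemannZeta c)]
    have hc0 : riemannZeta c ≠ 0 := by
      rw [← norm_pos_iff]; exact lt_of_lt_of_le (by positivity) hzc
    have m1 : ∫ θ in (0:ℝ)..2 * π, ‖riemannZeta (circleMap c R θ)‖ ^ 2 ≤ 2 * π * Real.exp w := by
      rw [intervalIntegral.integral_of_le Real.two_pi_pos.le, integral_eq_lintegral_of_nonneg_ae
        (Eventually.of_forall fun _ => by positivity) hcont2.aestronglyMeasurable]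
      refine ENNReal.toReal_le_of_le_ofReal (by positivity) (le_trans (le_of_eq ?_) k1.le)
      refine lintegral_congr fun θ => ?_
      rw [← ofReal_norm_eq_enorm, ENNReal.ofReal_pow (norm_nonneg _)]
    have hA : ∫ θ in (0:ℝ)..2 * π, ‖riemannZeta (circleMap c R θ)‖ ≤ 2 * π * (1 + Real.exp w) := by
      have h1 : ∫ θ in (0:ℝ)..2 * π, ‖riemannZeta (circleMap c R θ)‖ ≤
          ∫ θ in (0:ℝ)..2 * π, (1 + ‖riemannZeta (circleMap c R θ)‖ ^ 2) :=
        intervalIntegral.integral_mono_on Real.two_pi_pos.le (hcont.intervalIntegrable _ _)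
          ((continuous_const.add hcont2).intervalIntegrable _ _) (fun θ _ => by
            nlinarith [sq_nonneg (‖riemannZeta (circleMap c R θ)‖ - 1)])
      rw [intervalIntegral.integral_add (continuous_const.intervalIntegrable _ _) (hcont2.intervalIntegrable _ _)] at h1
      simp only [intervalIntegral.integral_const, sub_zero, smul_eq_mul, mul_one] at h1
      linarith
    have key := abs_integral_im_logDeriv_le (f := riemannZeta) (c := c) (R := R) (a := a) (b := b)
      hR0 hdc hc0 hA (by rw [hcre]; linarith) hab (by rw [hcre]; linarith) (fun s hs => by
        rw [hcim]; exact hxn.riemannZeta_ne_zero (by linarith [hs.1]))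
    rw [hcim] at key
    refine key.trans ?_
    have hew : 1 ≤ Real.exp w := Real.one_le_exp (by linarith)
    have h1 : 20 * (1 + Real.exp w) / ‖riemannZeta c‖ ≤ Real.exp 5 * (Real.exp w * Real.exp w) := by
      have he5 : 80 ≤ Real.exp 5 := by
        have e : Real.exp 5 = Real.exp 1 ^ 5 := by rw [← Real.exp_nat_mul]; norm_num
        rw [e]
        have : (2.7 : ℝ) ^ 5 ≤ Real.exp 1 ^ 5 := by gcongr; linarith [Real.exp_one_gt_d9]
        refine le_trans (by norm_num) this
      have h2 : 20 * (1 + Real.exp w) / ‖riemannZeta c‖ ≤ 20 * (1 + Real.exp w) / (1 / (2 * Real.exp w)) :=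
        div_le_div_of_nonneg_left (by positivity) (by positivity) hzc
      have h3 : 20 * (1 + Real.exp w) / (1 / (2 * Real.exp w)) = 40 * (1 + Real.exp w) * Real.exp w := by
        field_simp; ring
      rw [h3] at h2
      refine h2.trans ?_
      nlinarith [mul_le_mul_of_nonneg_right he5 (by positivity : 0 ≤ Real.exp w * Real.exp w)]
    have h2 := Real.log_le_log (by positivity) h1
    rw [← Real.exp_add, ← Real.exp_add, Real.log_exp] at h2
    linarith

theorem exists_norm_riemannZeta_le_of_le_re : ∃ Z : ℝ, 0 < Z ∧ ∀ s : ℂ, 11 / 10 ≤ s.re → ‖riemannZeta s‖ ≤ Z := by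
  have hsum : Summable fun n : ℕ => 1 / (((n + 1 : ℕ) : ℝ)) ^ (11 / 10 : ℝ) :=
    (summable_nat_add_iff 1).2 (Real.summable_one_div_nat_rpow.2 (by norm_num))
  refine ⟨(∑' n : ℕ, 1 / (((n + 1 : ℕ) : ℝ)) ^ (11 / 10 : ℝ)) + 1, ?_, fun s hs => ?_⟩
  · have : 0 ≤ ∑' n : ℕ, 1 / (((n + 1 : ℕ) : ℝ)) ^ (11 / 10 : ℝ) := tsum_nonneg fun n => by positivity
    linarith
  · rw [zeta_eq_tsum_one_div_nat_add_one_cpow (by linarith)]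
    refine (tsum_of_norm_bounded hsum.hasSum fun n => ?_).trans (by linarith)
    have e : ((n : ℂ) + 1) = ((n + 1 : ℕ) : ℂ) := by push_cast; ring
    rw [e, norm_div, norm_one, Complex.norm_natCast_cpow_of_pos (by omega)]
    have h5 : (1 : ℝ) ≤ ((n + 1 : ℕ) : ℝ) := by push_cast; linarith [n.cast_nonneg (α := ℝ)]
    exact one_div_le_one_div_of_le (by positivity) (Real.rpow_le_rpow_of_exponent_le h5 hs)

theorem exists_abs_integral_im_logDeriv_right_le : ∃ C : ℝ, ∀ x, 2 ≤ x → NonOrdinate x →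
    |∫ σ in (13 / 10 : ℝ)..2, (logDeriv riemannZeta (σ + x * I)).im| ≤ C := by
  obtain ⟨Z, hZ0, hZ⟩ := exists_norm_riemannZeta_le_of_le_re
  refine ⟨200 * (1 + Real.log (60 * Z)), fun x hx hxn => ?_⟩
  set c : ℂ := 2 + x * I with hc
  have hcre : c.re = 2 := by simp [hc]
  have hcim : c.im = x := by simp [hc]
  have hcl : ∀ z ∈ Metric.closedBall c (9 / 10 : ℝ), 11 / 10 ≤ z.re := by
    intro z hz
    rw [Metric.mem_closedBall, dist_eq_norm] at hz
    have h1 := abs_le.1 ((Complex.abs_re_le_norm (z - c)).trans hz)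
    rw [Complex.sub_re, hcre] at h1
    linarith
  have hdc : DiffContOnCl ℂ riemannZeta (Metric.ball c (9 / 10)) := by
    refine DifferentiableOn.diffContOnCl fun z hz => ?_
    refine (differentiableAt_riemannZeta fun h => ?_).differentiableWithinAt
    have := hcl z (Metric.closure_ball_subset_closedBall hz)
    rw [h] at this; norm_num at this
  have hcn : 1 / 3 ≤ ‖riemannZeta c‖ := le_norm_riemannZeta hcre.ge
  have hc0 : riemannZeta c ≠ 0 := by rw [← norm_pos_iff]; linarith
  have hA : ∫ θ in (0:ℝ)..2 * π, ‖riemannZeta (circleMap c (9 / 10) θ)‖ ≤ 2 * π * Z := by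
    have := intervalIntegral.norm_integral_le_of_norm_le_const (a := 0) (b := 2 * π)
      (f := fun θ => ‖riemannZeta (circleMap c (9 / 10) θ)‖) (C := Z) (fun θ _ => by
        rw [norm_norm]
        exact hZ _ (hcl _ (Metric.sphere_subset_closedBall (circleMap_mem_sphere _ (by norm_num) _))))
    rw [sub_zero, abs_of_pos Real.two_pi_pos] at this
    have h2 := (le_abs_self _).trans this
    linarith
  have key := abs_integral_im_logDeriv_le (f := riemannZeta) (c := c) (R := 9 / 10) (A := Z) (a := 13 / 10) (b := 2)
    (by norm_num) hdc hc0 hA (by rw [hcre]; norm_num) (by norm_num) (by rw [hcre]; norm_num) (fun σ hσ => by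
      rw [hcim]; exact hxn.riemannZeta_ne_zero (lt_of_lt_of_le (by norm_num) hσ.1))
  rw [hcim] at key
  refine key.trans ?_
  have h1 : 20 * Z / ‖riemannZeta c‖ ≤ 60 * Z := by
    rw [div_le_iff₀ (by linarith)]; nlinarith
  have h2 := Real.log_le_log (by apply div_pos <;> linarith) h1
  linarith

theorem exists_exceptional_disc_exp {U r R w : ℝ} (hU : 2 ≤ U) (hr : 0 < r) (hr1 : r ≤ 9 / 20) (hrR : r ≤ R)
    (hR1 : R ≤ r + 1 / 10) (hR2 : r + R ≤ 1) (hw : 1 ≤ w) (hwr : w ≤ 5 * r * Real.log (4 * U))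
    (hwR : (R - r) * Real.log (4 * U) ≤ w / 4) :
    ∃ S, MeasurableSet S ∧ volume S ≤ ENNReal.ofReal (3 * 10 ^ 7 * U * (1 + Real.log (4 * U)) ^ 4 * Real.exp (-(w / 20))) ∧
      ∀ x ∈ Icc U (3 * U), x ∉ S → NonOrdinate x → ∀ a b, 1 / 2 + r - 4 / 5 * R ≤ a → a ≤ b → b ≤ 1 / 2 + r + 4 / 5 * R →
        |∫ σ in a..b, (logDeriv riemannZeta (σ + x * I)).im| ≤ 2000 * w := by
  set T := 4 * U with hT
  have hT0 : 1 ≤ T := by linarith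
  have hTp : 0 < T := by linarith
  have hl : 0 ≤ Real.log T := Real.log_nonneg hT0
  set t := T ^ (1 / 8 : ℝ) with ht
  have ht1 : 1 ≤ t := Real.one_le_rpow hT0 (by norm_num)
  have hfl : 1 ≤ ⌊t⌋₊ := Nat.le_floor (by simpa using ht1)
  have hfl2 : t / 2 ≤ (⌊t⌋₊ : ℝ) := by
    have h1 := Nat.lt_floor_add_one t
    have h2 : (1 : ℝ) ≤ (⌊t⌋₊ : ℝ) := by exact_mod_cast hfl
    linarith
  have hy8 : ((⌊t⌋₊ : ℕ) : ℝ) ^ 8 ≤ T := by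
    calc ((⌊t⌋₊ : ℕ) : ℝ) ^ 8 ≤ t ^ 8 := by gcongr; exact Nat.floor_le (by linarith)
      _ = T := by rw [ht, ← Real.rpow_natCast, ← Real.rpow_mul hTp.le]; norm_num
  obtain ⟨S, hS, hv, hg⟩ := exists_exceptional_disc hU hr hr1 hrR hR1 hR2 hw hfl hy8
  refine ⟨S, hS, hv.trans (ENNReal.ofReal_le_ofReal ?_), hg⟩
  have h1 : Real.exp (-w) * T ^ (2 * (R - r)) ≤ Real.exp (-(w / 20)) := by
    rw [Real.rpow_def_of_pos hTp, ← Real.exp_add, Real.exp_le_exp]; nlinarith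
  have h2 : ((⌊t⌋₊ : ℕ) : ℝ) ^ (-(2 * r)) ≤ 2 * Real.exp (-(w / 20)) := by
    calc ((⌊t⌋₊ : ℕ) : ℝ) ^ (-(2 * r)) ≤ (t / 2) ^ (-(2 * r)) :=
          Real.rpow_le_rpow_of_nonpos (by positivity) hfl2 (by linarith)
      _ = 2 ^ (2 * r) * T ^ (-(r / 4)) := by
          rw [Real.div_rpow (by positivity) (by norm_num), ht, ← Real.rpow_mul hTp.le, Real.rpow_neg (by norm_num : (0:ℝ) ≤ 2),
            div_inv_eq_mul, mul_comm]
          congr 2; ring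
      _ ≤ 2 * Real.exp (-(w / 20)) := by
          gcongr
          · calc (2:ℝ) ^ (2 * r) ≤ 2 ^ (1:ℝ) := Real.rpow_le_rpow_of_exponent_le (by norm_num) (by linarith)
              _ = 2 := by norm_num
          · rw [Real.rpow_def_of_pos hTp, Real.exp_le_exp]; nlinarith
  have hE : Real.exp (-w) * T ^ (2 * (R - r)) + ((⌊t⌋₊ : ℕ) : ℝ) ^ (-(2 * r)) ≤ 3 * Real.exp (-(w / 20)) := by linarith
  calc 10 ^ 7 * U * (1 + Real.log T) ^ 4 * (Real.exp (-w) * T ^ (2 * (R - r)) + ((⌊t⌋₊ : ℕ) : ℝ) ^ (-(2 * r)))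
      ≤ 10 ^ 7 * U * (1 + Real.log T) ^ 4 * (3 * Real.exp (-(w / 20))) := by gcongr
    _ = _ := by ring

theorem exists_exceptional_arg : ∃ C : ℝ, 0 ≤ C ∧ ∀ (U w : ℝ) (n : ℕ), 2 ≤ U → 1 ≤ w →
    w / Real.log (4 * U) ≤ 9 / 20 * (1 / 5) ^ n → 9 / 20 * (1 / 5) ^ (n + 1) ≤ w / Real.log (4 * U) →
    ∃ S, MeasurableSet S ∧ volume S ≤ ENNReal.ofReal ((n + 2) * (3 * 10 ^ 7 * U * (1 + Real.log (4 * U)) ^ 4 * Real.exp (-(w / 20)))) ∧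
      ∀ x ∈ Icc U (3 * U), x ∉ S → NonOrdinate x →
        |∫ σ in (1 / 2 : ℝ)..2, (logDeriv riemannZeta (σ + x * I)).im| ≤ C + (n + 3) * (2000 * w) := by
  obtain ⟨C, hC⟩ := exists_abs_integral_im_logDeriv_right_le
  refine ⟨|C|, abs_nonneg _, fun U w n hU hw hn1 hn2 => ?_⟩
  set ℓ := Real.log (4 * U) with hℓ
  have hℓ0 : 0 < ℓ := Real.log_pos (by linarith)
  set r : ℕ → ℝ := fun k => 9 / 20 * (1 / 5) ^ k with hr
  have hr0 : ∀ k, 0 < r k := fun k => by simp only [hr]; positivity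
  have hrs : ∀ k, r (k + 1) = r k / 5 := fun k => by simp only [hr, pow_succ]; ring
  have hr1 : ∀ k, r k ≤ 9 / 20 := fun k => by
    have : (1 / 5 : ℝ) ^ k ≤ 1 := pow_le_one₀ (by norm_num) (by norm_num)
    simp only [hr]; linarith
  have hrn : ∀ k, k ≤ n → r n ≤ r k := fun k hk => by
    have : (1 / 5 : ℝ) ^ n ≤ (1 / 5) ^ k := pow_le_pow_of_le_one (by norm_num) (by norm_num) hk
    simp only [hr]; linarith
  have hwn : w ≤ r n * ℓ := (div_le_iff₀ hℓ0).1 hn1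
  have hwn' : r (n + 1) * ℓ ≤ w := (le_div_iff₀ hℓ0).1 hn2
  have hd : ∀ k, k ≤ n → ∃ S, MeasurableSet S ∧ volume S ≤ ENNReal.ofReal (3 * 10 ^ 7 * U * (1 + ℓ) ^ 4 * Real.exp (-(w / 20))) ∧
      ∀ x ∈ Icc U (3 * U), x ∉ S → NonOrdinate x → ∀ a b, 1 / 2 + r k - 4 / 5 * r k ≤ a → a ≤ b → b ≤ 1 / 2 + r k + 4 / 5 * r k →
        |∫ σ in a..b, (logDeriv riemannZeta (σ + x * I)).im| ≤ 2000 * w := fun k hk =>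
    exists_exceptional_disc_exp hU (hr0 k) (hr1 k) le_rfl (by linarith) (by linarith [hr1 k]) hw (by
      have : r n * ℓ ≤ r k * ℓ := mul_le_mul_of_nonneg_right (hrn k hk) hℓ0.le
      have : 0 ≤ r k * ℓ := mul_nonneg (hr0 k).le hℓ0.le
      rw [← hℓ]; nlinarith) (by simp; linarith)
  choose! S hS hv hg using hd
  have hrl := hrs n
  obtain ⟨S', hS', hv', hg'⟩ := exists_exceptional_disc_exp (R := 5 / 4 * r (n + 1)) hU (hr0 (n + 1)) (hr1 (n + 1))
    (by linarith [hr0 (n + 1)]) (by linarith [hr1 n]) (by linarith [hr1 n]) hw (by rw [← hℓ]; nlinarith)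
    (by rw [← hℓ]; nlinarith)
  rw [← hℓ] at hv'
  set D := 3 * 10 ^ 7 * U * (1 + ℓ) ^ 4 * Real.exp (-(w / 20)) with hD
  have hD0 : 0 ≤ D := by positivity
  refine ⟨(⋃ k ∈ Finset.range (n + 1), S k) ∪ S', ?_, ?_, ?_⟩
  · exact (Finset.measurableSet_biUnion _ fun k hk => hS k (by simpa [Nat.lt_succ_iff] using hk)).union hS'
  · refine (measure_union_le _ _).trans ?_
    refine (add_le_add ((measure_biUnion_finset_le _ _).trans (Finset.sum_le_sum fun k hk =>
      hv k (by simpa [Nat.lt_succ_iff] using hk))) hv').trans ?_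
    rw [Finset.sum_const, Finset.card_range, nsmul_eq_mul, ← ENNReal.ofReal_natCast, ← ENNReal.ofReal_mul (by positivity),
      ← ENNReal.ofReal_add (by positivity) hD0]
    refine ENNReal.ofReal_le_ofReal (le_of_eq ?_)
    push_cast; ring
  · intro x hx hxS hxn
    simp only [mem_union, mem_iUnion, not_or, not_exists, Finset.mem_range, Nat.lt_succ_iff] at hxS
    have hint : ∀ a b : ℝ, 0 < a → 0 < b → IntervalIntegrable (fun σ : ℝ => (logDeriv riemannZeta (σ + x * I)).im) volume a b := by
      intro a b ha hb
      refine (Complex.continuous_im.comp_continuousOn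
        ((continuousOn_logDeriv_riemannZeta_horizontal hxn (by linarith [hx.1])).mono ?_)).intervalIntegrable
      intro σ hσ
      exact lt_of_lt_of_le (lt_min ha hb) hσ.1
    set J : ℝ → ℝ → ℝ := fun a b => ∫ σ in a..b, (logDeriv riemannZeta (σ + x * I)).im with hJ
    have hadd : ∀ a b c : ℝ, 0 < a → 0 < b → 0 < c → J a c = J a b + J b c := fun a b c ha hb hc =>
      (intervalIntegral.integral_add_adjacent_intervals (hint a b ha hb) (hint b c hb hc)).symm
    have hchain : ∀ m, m ≤ n + 1 → |J (1 / 2 + r m) (1 / 2 + r 0)| ≤ m * (2000 * w) := by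
      intro m
      induction m with
      | zero => intro _; simp [hJ]
      | succ m ih =>
        intro hm
        have h1 := ih (by omega)
        have h2 := hg m (by omega) x hx (hxS.1 m (by omega)) hxn (1 / 2 + r (m + 1)) (1 / 2 + r m)
          (by rw [hrs]; linarith) (by rw [hrs]; linarith [hr0 m]) (by linarith [hr0 m])
        rw [hadd _ (1 / 2 + r m) _ (by linarith [hr0 (m + 1)]) (by linarith [hr0 m]) (by linarith [hr0 0])]
        refine (abs_add_le _ _).trans ?_
        push_cast
        have h3 : |J (1 / 2 + r (m + 1)) (1 / 2 + r m)| ≤ 2000 * w := h2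
        linarith
    have hr00 : r 0 = 9 / 20 := by simp [hr]
    have h1 := hchain (n + 1) le_rfl
    have h2 : |J (1 / 2 + r 0) (13 / 10)| ≤ 2000 * w := hg 0 (by omega) x hx (hxS.1 0 (by omega)) hxn _ _
      (by rw [hr00]; norm_num) (by rw [hr00]; norm_num) (by rw [hr00]; norm_num)
    have h3 : |J (13 / 10) 2| ≤ C := hC x (by linarith [hx.1]) hxn
    have h4 : |J (1 / 2) (1 / 2 + r (n + 1))| ≤ 2000 * w := hg' x hx hxS.2 hxn _ _
      (by linarith) (by linarith [hr0 (n + 1)]) (by linarith [hr0 (n + 1)])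
    change |J (1 / 2) 2| ≤ _
    rw [hadd _ (1 / 2 + r (n + 1)) _ (by norm_num) (by linarith [hr0 (n + 1)]) (by norm_num),
      hadd _ (1 / 2 + r 0) 2 (by linarith [hr0 (n + 1)]) (by linarith [hr0 0]) (by norm_num),
      hadd _ (13 / 10) 2 (by linarith [hr0 0]) (by norm_num) (by norm_num)]
    have h5 := le_abs_self C
    push_cast at h1
    rw [abs_le] at *
    constructor <;> linarith

theorem pow_mul_exp_neg_div_le {w : ℝ} (hw : 0 ≤ w) (N : ℕ) :
    w ^ N * Real.exp (-(w / 20)) ≤ N.factorial * 20 ^ N := by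
  have h := Real.pow_div_factorial_le_exp (w / 20) (by positivity) N
  rw [div_pow, div_div, div_le_iff₀ (by positivity)] at h
  rw [Real.exp_neg, ← div_eq_mul_inv, div_le_iff₀ (Real.exp_pos _)]
  linarith

theorem exists_scale {p : ℕ} (hp : 1 ≤ p) {ℓ : ℝ} (hℓ : 3 ^ (2 * p) ≤ ℓ) : ∃ (w : ℝ) (n : ℕ), 3 ≤ w ∧ w ^ (2 * p) = ℓ ∧
    w / ℓ ≤ 9 / 20 * (1 / 5) ^ n ∧ 9 / 20 * (1 / 5) ^ (n + 1) ≤ w / ℓ ∧ (n : ℝ) ≤ 2 * p * w := by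
  have hℓ0 : 0 < ℓ := lt_of_lt_of_le (by positivity) hℓ
  have hp0 : 2 * p ≠ 0 := by omega
  set w := ℓ ^ (((2 * p : ℕ) : ℝ)⁻¹) with hw
  have hwp : w ^ (2 * p) = ℓ := Real.rpow_inv_natCast_pow hℓ0.le hp0
  have hw0 : 0 ≤ w := by positivity
  have hw3 : 3 ≤ w := le_of_pow_le_pow_left₀ hp0 hw0 (by rw [hwp]; exact hℓ)
  have hw2 : w ^ 2 ≤ ℓ := by rw [← hwp]; exact pow_le_pow_right₀ (by linarith) (by omega)
  obtain ⟨n, hn1, hn2⟩ := exists_nat_pow_near_of_lt_one (x := w / ℓ / (9 / 20)) (y := 1 / 5) (by positivity)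
    (by rw [div_le_one (by norm_num), div_le_iff₀ hℓ0]; nlinarith) (by norm_num) (by norm_num)
  rw [lt_div_iff₀ (by norm_num)] at hn1
  rw [div_le_iff₀ (by norm_num)] at hn2
  refine ⟨w, n, hw3, hwp, by linarith, by linarith, ?_⟩
  have h5 : (5 : ℝ) ^ n ≤ w ^ (2 * p) := by
    rw [hwp]
    rw [div_le_iff₀ hℓ0, one_div, inv_pow, mul_assoc, inv_mul_eq_div, le_div_iff₀ (by positivity)] at hn2
    have : 0 < (5 : ℝ) ^ n := by positivity
    nlinarith
  have h6 := Real.log_le_log (by positivity) h5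
  rw [Real.log_pow, Real.log_pow] at h6
  have h7 : 1 ≤ Real.log 5 := by
    rw [Real.le_log_iff_exp_le (by norm_num)]; linarith [Real.exp_one_lt_d9]
  have h8 : Real.log w ≤ w := (Real.log_le_sub_one_of_pos (by linarith)).trans (by linarith)
  push_cast at h6
  calc (n : ℝ) ≤ n * Real.log 5 := le_mul_of_one_le_right (Nat.cast_nonneg _) h7
    _ ≤ 2 * p * Real.log w := h6
    _ ≤ 2 * p * w := by gcongr

/-- Moments of the remainder in the Riemann–von Mangoldt formula. -/
theorem exists_lintegral_zeroError_pow_le {p : ℕ} (hp : 1 ≤ p) : ∃ C : ℝ, 0 ≤ C ∧ ∀ U : ℝ, 2 ≤ U →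
    ∫⁻ x in Icc U (3 * U), ‖zeroError x‖ₑ ^ p ≤ ENNReal.ofReal (C * (U * Real.log U)) := by
  obtain ⟨C₁, hC₁, hE₁⟩ := exists_abs_zeroError_le
  obtain ⟨C₂, hE₂⟩ := exists_abs_zeroError_add_le
  obtain ⟨C₃, hC₃, hE₃⟩ := exists_exceptional_arg
  have hb4 := baseHeight_spec.1
  set C₄ := |C₂| + C₃ + (2 * p + 3) * 2000 with hC₄
  have hC₄0 : 0 ≤ C₄ := by positivity
  set N := 2 * p * p + 8 * p + 1 with hN
  set C₅ : ℝ := C₁ ^ p * (2 * p + 2) * (3 * 10 ^ 7) * 16 * (N.factorial * 20 ^ N) with hC₅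
  have hC₅0 : 0 ≤ C₅ := by positivity
  refine ⟨4 * (C₁ * 3 ^ (2 * p)) ^ p + 6 * C₄ ^ p + 2 * C₅, by positivity, fun U hU => ?_⟩
  set ℓ := Real.log (4 * U) with hℓ
  have hlU : 1 / 2 ≤ Real.log U := by
    have := Real.log_le_log (by norm_num) hU
    linarith [Real.log_two_gt_d9]
  have hℓU : ℓ ≤ 3 * Real.log U := by
    have h4 : Real.log 4 = 2 * Real.log 2 := by
      rw [show (4:ℝ) = 2 ^ 2 by norm_num, Real.log_pow]; norm_num
    have := Real.log_le_log (by norm_num) hU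
    rw [hℓ, Real.log_mul (by norm_num) (by linarith)]; linarith
  have hℓ1 : 1 ≤ ℓ := by
    rw [hℓ, Real.le_log_iff_exp_le (by linarith)]; linarith [Real.exp_one_lt_d9]
  have hub : ∀ x ∈ Icc U (3 * U), |zeroError x| ≤ C₁ * ℓ := by
    intro x hx
    rcases le_total x baseHeight with h | h
    · rw [zeroError_of_le h, abs_zero]; positivity
    · refine (hE₁ x h).trans ?_
      have := Real.log_le_log (by linarith) (by linarith [hx.2] : x ≤ 4 * U)
      gcongr
  have hpow : ∀ {x B : ℝ}, |zeroError x| ≤ B → ‖zeroError x‖ₑ ^ p ≤ ENNReal.ofReal (B ^ p) := by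
    intro x B h
    rw [← ofReal_norm_eq_enorm, ← ENNReal.ofReal_pow (norm_nonneg _)]
    exact ENNReal.ofReal_le_ofReal (pow_le_pow_left₀ (norm_nonneg _) h p)
  have hvol : volume (Icc U (3 * U)) = ENNReal.ofReal (2 * U) := by
    rw [Real.volume_Icc]; congr 1; ring
  have hUl : 0 ≤ U * Real.log U := by positivity
  rcases lt_or_ge ℓ (3 ^ (2 * p)) with hsm | hlg
  · have h1 : ∫⁻ x in Icc U (3 * U), ‖zeroError x‖ₑ ^ p ≤
        ∫⁻ x in Icc U (3 * U), ENNReal.ofReal ((C₁ * 3 ^ (2 * p)) ^ p) :=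
      setLIntegral_mono measurable_const fun x hx => hpow ((hub x hx).trans (by gcongr))
    refine h1.trans ?_
    rw [setLIntegral_const, hvol, ← ENNReal.ofReal_mul (by positivity)]
    refine ENNReal.ofReal_le_ofReal ?_
    set A := (C₁ * 3 ^ (2 * p)) ^ p with hA
    have hA0 : 0 ≤ A := by positivity
    have h2 : A * (2 * U) ≤ 4 * A * (U * Real.log U) := by nlinarith [mul_nonneg hA0 (by linarith : 0 ≤ U)]
    have h3 : 0 ≤ (6 * C₄ ^ p + 2 * C₅) * (U * Real.log U) := by positivity
    linarith
  · obtain ⟨w, n, hw3, hwp, hn1, hn2, hnw⟩ := exists_scale hp hlg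
    obtain ⟨S, hS, hvS, hgood⟩ := hE₃ U w n hU (by linarith) hn1 hn2
    have hF := (finite_nontrivialZeros (U - 1) (3 * U)).image Complex.im
    set F := Complex.im '' {ρ : ℂ | IsNontrivialZero ρ ∧ U - 1 < ρ.im ∧ ρ.im ≤ 3 * U} with hFdef
    have hF0 : volume F = 0 := hF.measure_zero _
    have hpt : ∀ x ∈ Icc U (3 * U), ‖zeroError x‖ₑ ^ p ≤ ENNReal.ofReal (C₄ ^ p * ℓ) +
        (S ∪ F).indicator (fun _ => ENNReal.ofReal ((C₁ * ℓ) ^ p)) x := by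
      intro x hx
      by_cases hxS : x ∈ S ∪ F
      · rw [indicator_of_mem hxS]
        exact (hpow (hub x hx)).trans le_add_self
      · refine le_trans ?_ le_self_add
        simp only [mem_union, not_or] at hxS
        have hxn : NonOrdinate x := fun ρ hρ h => hxS.2 ⟨ρ, ⟨hρ, by rw [h]; linarith [hx.1], by rw [h]; exact hx.2⟩, h⟩
        have h1 := hgood x hx hxS.1 hxn
        have hbound : |zeroError x| ≤ C₄ * w ^ 2 := by
          rcases le_total x baseHeight with h | h
          · rw [zeroError_of_le h, abs_zero]; positivity
          have h2 := hE₂ x h hxn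
          set J := ∫ σ in (1 / 2 : ℝ)..2, (logDeriv riemannZeta (σ + x * I)).im
          have h3 : |J / π| ≤ |J| := by
            rw [abs_div, abs_of_pos Real.pi_pos]
            exact div_le_self (abs_nonneg _) (by linarith [Real.pi_gt_three])
          have h4 := abs_le.1 (h2.trans (le_abs_self C₂))
          have h5 := abs_le.1 (h3.trans h1)
          have h6 : |zeroError x| ≤ |C₂| + (C₃ + (n + 3) * (2000 * w)) := by
            rw [abs_le]; constructor <;> linarith
          refine h6.trans ?_
          have hw2 : 1 ≤ w ^ 2 := by nlinarith
          have h7 : ((n : ℝ) + 3) * (2000 * w) ≤ (2 * p * w + 3 * w) * (2000 * w) := by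
            gcongr; linarith
          have h8 : |C₂| ≤ |C₂| * w ^ 2 := le_mul_of_one_le_right (abs_nonneg _) hw2
          have h9 : C₃ ≤ C₃ * w ^ 2 := le_mul_of_one_le_right hC₃ hw2
          rw [hC₄]; nlinarith
        refine (hpow hbound).trans (ENNReal.ofReal_le_ofReal (le_of_eq ?_))
        rw [mul_pow, ← pow_mul, hwp]
    have hvSF : volume (S ∪ F) ≤ ENNReal.ofReal ((n + 2) * (3 * 10 ^ 7 * U * (1 + ℓ) ^ 4 * Real.exp (-(w / 20)))) :=
      (measure_union_le _ _).trans (by rw [hF0, add_zero]; exact hvS)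
    have hSF : MeasurableSet (S ∪ F) := hS.union hF.measurableSet
    refine (setLIntegral_mono (measurable_const.add (measurable_const.indicator hSF)) hpt).trans ?_
    simp only [Pi.add_apply]
    rw [lintegral_add_left measurable_const, setLIntegral_const, hvol, ← ENNReal.ofReal_mul (by positivity)]
    have h2 : ∫⁻ x in Icc U (3 * U), (S ∪ F).indicator (fun _ => ENNReal.ofReal ((C₁ * ℓ) ^ p)) x ≤
        ENNReal.ofReal (C₅ * U) := by
      refine (setLIntegral_le_lintegral _ _).trans ?_
      rw [lintegral_indicator_const hSF]
      refine (mul_le_mul_right hvSF _).trans ?_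
      rw [← ENNReal.ofReal_mul (by positivity)]
      refine ENNReal.ofReal_le_ofReal ?_
      have h3 := pow_mul_exp_neg_div_le (by linarith : 0 ≤ w) N
      have h4 : (n : ℝ) + 2 ≤ (2 * p + 2) * w := by linarith
      have h5 : (1 + ℓ) ^ 4 ≤ 16 * w ^ (8 * p) := by
        calc (1 + ℓ) ^ 4 ≤ (2 * ℓ) ^ 4 := by gcongr; linarith
          _ = 16 * w ^ (8 * p) := by rw [← hwp, mul_pow, ← pow_mul]; norm_num; congr 1; ring
      have h6 : (C₁ * ℓ) ^ p = C₁ ^ p * w ^ (2 * p * p) := by rw [mul_pow, ← hwp, ← pow_mul]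
      calc (C₁ * ℓ) ^ p * ((n + 2) * (3 * 10 ^ 7 * U * (1 + ℓ) ^ 4 * Real.exp (-(w / 20))))
          ≤ (C₁ ^ p * w ^ (2 * p * p)) * (((2 * p + 2) * w) * (3 * 10 ^ 7 * U * (16 * w ^ (8 * p)) * Real.exp (-(w / 20)))) := by
            rw [h6]; gcongr
        _ = C₁ ^ p * (2 * p + 2) * (3 * 10 ^ 7) * 16 * U * (w ^ N * Real.exp (-(w / 20))) := by
            rw [hN, pow_add, pow_add]; ring
        _ ≤ C₁ ^ p * (2 * p + 2) * (3 * 10 ^ 7) * 16 * U * (N.factorial * 20 ^ N) := by gcongr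
        _ = C₅ * U := by rw [hC₅]; ring
    refine (add_le_add le_rfl h2).trans ?_
    rw [← ENNReal.ofReal_add (by positivity) (by positivity)]
    refine ENNReal.ofReal_le_ofReal ?_
    have g0 : 0 ≤ (C₁ * 3 ^ (2 * p)) ^ p * (U * Real.log U) := by positivity
    have g1 : C₄ ^ p * ℓ * (2 * U) ≤ C₄ ^ p * (3 * Real.log U) * (2 * U) := by gcongr
    have g2 : C₅ * U ≤ 2 * C₅ * (U * Real.log U) := by
      nlinarith [mul_nonneg hC₅0 (by linarith : 0 ≤ U)]
    nlinarith

theorem hasSum_subtype_ite_mem {α β : Type*} [AddCommMonoid β] [TopologicalSpace β] [DecidableEq α]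
    {P : α → Prop} {t : Finset α} (ht : ∀ a ∈ t, P a) (g : α → β) :
    HasSum (fun a : {a // P a} => if a.1 ∈ t then g a.1 else 0) (∑ a ∈ t, g a) := by
  have h1 : HasSum (fun a : α => if a ∈ t then g a else 0) (∑ a ∈ t, if a ∈ t then g a else 0) :=
    hasSum_sum_of_ne_finset_zero fun b hb => if_neg hb
  rw [Finset.sum_congr rfl fun a ha => if_pos ha] at h1
  have h2 : Function.support (fun a : α => if a ∈ t then g a else 0) ⊆ {a | P a} := fun a ha => by
    by_contra h
    exact ha (if_neg fun hm => h (ht a hm))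
  exact (hasSum_subtype_iff_of_support_subset h2).2 h1

theorem countable_nontrivialZeros_im_pos : {ρ : ℂ | IsNontrivialZero ρ ∧ 0 < ρ.im}.Countable := by
  refine (countable_iUnion fun n : ℕ => (finite_nontrivialZeros 0 n).countable).mono fun ρ hρ => ?_
  obtain ⟨n, hn⟩ := exists_nat_ge ρ.im
  exact mem_iUnion.2 ⟨n, hρ.1, hρ.2, hn⟩

/-- The nontrivial zeros with ordinates in `(0, baseHeight]`. -/
noncomputable def lowZeros : Finset ℂ := (finite_nontrivialZeros 0 baseHeight).toFinset

theorem mem_lowZeros {ρ : ℂ} : ρ ∈ lowZeros ↔ IsNontrivialZero ρ ∧ 0 < ρ.im ∧ ρ.im ≤ baseHeight := by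
  simp [lowZeros]

theorem baseHeight_pos : 0 < baseHeight := by linarith [baseHeight_spec.1]

theorem log_le_const_mul_rpow {x ε : ℝ} (hx : 0 ≤ x) (hε : 0 < ε) : Real.log x ≤ ε⁻¹ * x ^ ε := by
  have := Real.log_le_rpow_div hx hε
  rwa [div_eq_inv_mul] at this

theorem exists_zeroCount_le_rpow {ε : ℝ} (hε : 0 < ε) :
    ∃ C, ∀ x, baseHeight < x → ‖(zeroCount x : ℂ)‖ ≤ C * x ^ (1 + ε) := by
  obtain ⟨C, hC, h⟩ := exists_zeroCount_le
  refine ⟨C * ε⁻¹, fun x hx => ?_⟩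
  have hx0 := baseHeight_pos.trans hx
  rw [Complex.norm_real, Real.norm_of_nonneg (zeroCount_nonneg x)]
  refine (h x hx.le).trans ?_
  rw [Real.rpow_add hx0, Real.rpow_one, mul_assoc]
  refine mul_le_mul_of_nonneg_left ?_ hC.le
  calc x * Real.log x ≤ x * (ε⁻¹ * x ^ ε) := by gcongr; exact log_le_const_mul_rpow hx0.le hε
    _ = _ := by ring

theorem exists_zeroError_le_rpow {ε : ℝ} (hε : 0 < ε) :
    ∃ C, ∀ x, baseHeight < x → ‖(zeroError x : ℂ)‖ ≤ C * x ^ ε := by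
  obtain ⟨C, hC, h⟩ := exists_abs_zeroError_le
  refine ⟨C * ε⁻¹, fun x hx => ?_⟩
  have hx0 := baseHeight_pos.trans hx
  rw [Complex.norm_real, Real.norm_eq_abs]
  refine (h x hx.le).trans ?_
  rw [mul_assoc]
  gcongr
  exact log_le_const_mul_rpow hx0.le hε

theorem measurable_ofReal_zeroCount : Measurable fun x => (zeroCount x : ℂ) :=
  Complex.measurable_ofReal.comp zeroCount_mono.measurable

theorem measurable_ofReal_zeroError : Measurable fun x => (zeroError x : ℂ) :=
  Complex.measurable_ofReal.comp measurable_zeroError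

theorem integrableOn_zeroCount_mul_cpow {s : ℂ} (hs : 1 < s.re) :
    IntegrableOn (fun x : ℝ => (zeroCount x : ℂ) * (x : ℂ) ^ (-s - 1)) (Ioi baseHeight) := by
  obtain ⟨C, hC⟩ := exists_zeroCount_le_rpow (ε := (s.re - 1) / 2) (by linarith)
  exact integrableOn_Ioi_mul_cpow measurable_ofReal_zeroCount baseHeight_pos hC (by linarith)

theorem integrableOn_zeroError_mul_cpow {s : ℂ} (hs : 0 < s.re) :
    IntegrableOn (fun x : ℝ => (zeroError x : ℂ) * (x : ℂ) ^ (-s - 1)) (Ioi baseHeight) := by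
  obtain ⟨C, hC⟩ := exists_zeroError_le_rpow (ε := s.re / 2) (by linarith)
  exact integrableOn_Ioi_mul_cpow measurable_ofReal_zeroError baseHeight_pos hC (by linarith)

theorem differentiableAt_integral_zeroError {s : ℂ} (hs : 0 < s.re) :
    DifferentiableAt ℂ
      (fun s : ℂ => ∫ x in Ioi baseHeight, (zeroError x : ℂ) * (x : ℂ) ^ (-s - 1)) s := by
  obtain ⟨C, hC⟩ := exists_zeroError_le_rpow (ε := s.re / 2) (by linarith)
  exact differentiableAt_integral_Ioi_mul_cpow measurable_ofReal_zeroError baseHeight_pos hC (by linarith)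

theorem integral_ite_mem_zerosUpTo {ρ : ℂ} (hρ : IsNontrivialZero ρ) {s : ℂ} (hs : 0 < s.re) :
    ∫ x in Ioi baseHeight, (if ρ ∈ zerosUpTo x then (zetaMult ρ : ℂ) * (s * (x : ℂ) ^ (-s - 1)) else 0) =
      if ρ ∈ lowZeros ∨ ρ.im ≤ 0 then 0 else (zetaMult ρ : ℂ) * (ρ.im : ℂ) ^ (-s) := by
  have hs0 : s ≠ 0 := by rintro rfl; simp at hs
  rcases le_or_gt ρ.im baseHeight with h | h
  · rw [if_pos (by rw [mem_lowZeros]; by_cases h' : 0 < ρ.im; exacts [Or.inl ⟨hρ, h', h⟩, Or.inr (not_lt.1 h')])]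
    rw [setIntegral_congr_fun (g := fun _ => 0) measurableSet_Ioi fun x _ => if_neg (by
      rw [mem_zerosUpTo]; rintro ⟨-, h', -⟩; linarith)]
    simp
  · rw [if_neg (by rw [mem_lowZeros]; rintro (⟨-, -, h'⟩ | h') <;> linarith [baseHeight_pos])]
    rw [setIntegral_congr_fun (g := (Ici ρ.im).indicator fun x : ℝ => (zetaMult ρ : ℂ) * (s * (x : ℂ) ^ (-s - 1)))
      measurableSet_Ioi fun x _ => by
        simp only [indicator, mem_Ici, mem_zerosUpTo, hρ, h, true_and]]
    rw [setIntegral_indicator measurableSet_Ici, inter_eq_right.2 (Ici_subset_Ioi.2 h),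
      integral_Ici_eq_integral_Ioi, integral_const_mul, integral_const_mul,
      integral_Ioi_cpow_of_lt (by simp; linarith) (baseHeight_pos.trans h), sub_add_cancel]
    congr 1
    field_simp

theorem hasSum_high_zeros {s : ℂ} (hs : 1 < s.re) :
    HasSum (fun ρ : {ρ : ℂ // IsNontrivialZero ρ ∧ 0 < ρ.im} =>
      if ρ.1 ∈ lowZeros ∨ ρ.1.im ≤ 0 then 0 else (zetaMult ρ.1 : ℂ) * (ρ.1.im : ℂ) ^ (-s))
      (s * ∫ x in Ioi baseHeight, (zeroCount x : ℂ) * (x : ℂ) ^ (-s - 1)) := by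
  have : Countable {ρ : ℂ // IsNontrivialZero ρ ∧ 0 < ρ.im} := countable_nontrivialZeros_im_pos
  have hmem : ∀ x, ∀ ρ ∈ zerosUpTo x, IsNontrivialZero ρ ∧ 0 < ρ.im := fun x ρ hρ => by
    rw [mem_zerosUpTo] at hρ; exact ⟨hρ.1, baseHeight_pos.trans hρ.2.1⟩
  have hb : ∀ x : ℝ, HasSum (fun ρ : {ρ : ℂ // IsNontrivialZero ρ ∧ 0 < ρ.im} =>
      if ρ.1 ∈ zerosUpTo x then (zetaMult ρ.1 : ℝ) * (‖s‖ * x ^ (-s.re - 1)) else 0)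
      (zeroCount x * (‖s‖ * x ^ (-s.re - 1))) := fun x => by
    rw [zeroCount, Finset.sum_mul]
    exact hasSum_subtype_ite_mem (hmem x) fun ρ => (zetaMult ρ : ℝ) * (‖s‖ * x ^ (-s.re - 1))
  have key := hasSum_integral_of_dominated_convergence (μ := volume.restrict (Ioi baseHeight))
    (F := fun (ρ : {ρ : ℂ // IsNontrivialZero ρ ∧ 0 < ρ.im}) (x : ℝ) =>
      if ρ.1 ∈ zerosUpTo x then (zetaMult ρ.1 : ℂ) * (s * (x : ℂ) ^ (-s - 1)) else 0)
    (f := fun x => s * ((zeroCount x : ℂ) * (x : ℂ) ^ (-s - 1)))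
    (fun ρ x => if ρ.1 ∈ zerosUpTo x then (zetaMult ρ.1 : ℝ) * (‖s‖ * x ^ (-s.re - 1)) else 0)
    (fun ρ => ?_) (fun ρ => ?_) (Eventually.of_forall fun x => (hb x).summable) ?_ ?_
  · rw [integral_const_mul] at key
    have e : ∀ ρ : {ρ : ℂ // IsNontrivialZero ρ ∧ 0 < ρ.im}, _ = _ := fun ρ =>
      integral_ite_mem_zerosUpTo ρ.2.1 (s := s) (by linarith)
    simpa only [e] using key
  · refine Measurable.aestronglyMeasurable (Measurable.ite ?_ ?_ measurable_const)
    · simp only [mem_zerosUpTo]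
      exact (MeasurableSet.const _).inter ((MeasurableSet.const _).inter measurableSet_Ici)
    · exact (measurable_const.mul (measurable_const.mul (measurable_cpow_const_ofReal _)))
  · filter_upwards [ae_restrict_mem measurableSet_Ioi] with x hx
    have hx0 : 0 < x := baseHeight_pos.trans hx
    split_ifs
    · rw [norm_mul, norm_mul_cpow_neg_sub_one hx0]; simp
    · simp
  · simp only [(hb _).tsum_eq]
    refine (((integrableOn_zeroCount_mul_cpow hs).norm.const_mul ‖s‖).congr ?_)
    filter_upwards [ae_restrict_mem measurableSet_Ioi] with x hx
    have hx0 : 0 < x := baseHeight_pos.trans hx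
    rw [norm_mul_cpow_neg_sub_one hx0, Complex.norm_real, Real.norm_of_nonneg (zeroCount_nonneg x)]
    ring
  · refine Eventually.of_forall fun x => ?_
    have h1 : s * ((zeroCount x : ℂ) * (x : ℂ) ^ (-s - 1)) =
        ∑ ρ ∈ zerosUpTo x, (zetaMult ρ : ℂ) * (s * (x : ℂ) ^ (-s - 1)) := by
      rw [← Finset.sum_mul, zeroCount]; push_cast; ring
    simp only [h1]
    exact hasSum_subtype_ite_mem (hmem x) fun ρ => (zetaMult ρ : ℂ) * (s * (x : ℂ) ^ (-s - 1))

theorem tsum_zetaMult_eq {s : ℂ} (hs : 1 < s.re) :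
    ∑' ρ : {ρ : ℂ // IsNontrivialZero ρ ∧ 0 < ρ.im}, (zetaMult ρ.1 : ℂ) * (ρ.1.im : ℂ) ^ (-s) =
      ∑ ρ ∈ lowZeros, (zetaMult ρ : ℂ) * (ρ.im : ℂ) ^ (-s) +
        s * ∫ x in Ioi baseHeight, (zeroCount x : ℂ) * (x : ℂ) ^ (-s - 1) := by
  have h1 := hasSum_subtype_ite_mem (P := fun ρ : ℂ => IsNontrivialZero ρ ∧ 0 < ρ.im) (t := lowZeros)
    (fun ρ hρ => by rw [mem_lowZeros] at hρ; exact ⟨hρ.1, hρ.2.1⟩)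
    fun ρ : ℂ => (zetaMult ρ : ℂ) * (ρ.im : ℂ) ^ (-s)
  rw [← (h1.add (hasSum_high_zeros hs)).tsum_eq]
  refine tsum_congr fun ρ => ?_
  by_cases h : ρ.1 ∈ lowZeros
  · simp [h]
  · simp [h, not_le.2 ρ.2.2]

theorem hasDerivAt_zeroMain {x : ℝ} (hx : baseHeight < x) : HasDerivAt zeroMain (zeroDensity x) x := by
  have h1 : HasDerivAt (fun u => ∫ y in baseHeight..u, zeroDensity y) (zeroDensity x) x :=
    intervalIntegral.integral_hasDerivAt_right (continuous_zeroDensity.intervalIntegrable _ _)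
      (continuous_zeroDensity.stronglyMeasurableAtFilter _ _) continuous_zeroDensity.continuousAt
  refine h1.congr_of_eventuallyEq ?_
  filter_upwards [Ioi_mem_nhds hx] with u hu
  rw [zeroMain, max_eq_right (le_of_lt hu)]

theorem norm_zeroMain_le_rpow {ε x : ℝ} (hε : 0 < ε) (hx : baseHeight < x) :
    ‖(zeroMain x : ℂ)‖ ≤ 5 * ε⁻¹ * x ^ (1 + ε) := by
  have hx0 := baseHeight_pos.trans hx
  have h1 := abs_zeroMain_sub_le le_rfl hx.le
  rw [zeroMain_of_le le_rfl, sub_zero] at h1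
  rw [Complex.norm_real, Real.norm_eq_abs, Real.rpow_add hx0, Real.rpow_one]
  have h2 : 0 ≤ Real.log x := Real.log_nonneg (by linarith [baseHeight_spec.1])
  calc |zeroMain x| ≤ 5 * Real.log x * (x - baseHeight) := h1
    _ ≤ 5 * Real.log x * x := by gcongr; linarith [baseHeight_pos]
    _ ≤ 5 * (ε⁻¹ * x ^ ε) * x := by gcongr; exact log_le_const_mul_rpow hx0.le hε
    _ = _ := by ring

theorem integrableOn_zeroMain_mul_cpow {s : ℂ} (hs : 1 < s.re) :
    IntegrableOn (fun x : ℝ => (zeroMain x : ℂ) * (x : ℂ) ^ (-s - 1)) (Ioi baseHeight) :=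
  integrableOn_Ioi_mul_cpow (Complex.measurable_ofReal.comp continuous_zeroMain.measurable) baseHeight_pos
    (fun _ hx => norm_zeroMain_le_rpow (ε := (s.re - 1) / 2) (by linarith) hx) (by linarith)

theorem cpow_neg_eq_mul_cpow {x : ℝ} (hx : 0 < x) (s : ℂ) : (x : ℂ) ^ (-s) = x * (x : ℂ) ^ (-s - 1) := by
  rw [Complex.cpow_sub _ _ (by exact_mod_cast hx.ne'), Complex.cpow_one]
  field_simp [(by exact_mod_cast hx.ne' : (x : ℂ) ≠ 0)]

theorem integrableOn_mul_cpow_neg_of_le_log {f : ℝ → ℝ} (hf : Measurable f) {B : ℝ}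
    (hB : ∀ x, baseHeight < x → |f x| ≤ B * Real.log x) {s : ℂ} (hs : 1 < s.re) :
    IntegrableOn (fun x : ℝ => (f x : ℂ) * (x : ℂ) ^ (-s)) (Ioi baseHeight) := by
  have h1 : IntegrableOn (fun x : ℝ => ((f x : ℂ) * x) * (x : ℂ) ^ (-s - 1)) (Ioi baseHeight) := by
    refine integrableOn_Ioi_mul_cpow (f := fun x => (f x : ℂ) * x) (a := 1 + (s.re - 1) / 2) (B := |B| * ((s.re - 1) / 2)⁻¹)
      ((Complex.measurable_ofReal.comp hf).mul Complex.measurable_ofReal) baseHeight_pos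
      (fun x hx => ?_) (by linarith)
    have hx0 := baseHeight_pos.trans hx
    rw [norm_mul, Complex.norm_real, Complex.norm_real, Real.norm_eq_abs, Real.norm_of_nonneg hx0.le,
      Real.rpow_add hx0, Real.rpow_one]
    have h2 : 0 ≤ Real.log x := Real.log_nonneg (by linarith [baseHeight_spec.1])
    have h3 := log_le_const_mul_rpow hx0.le (by linarith : 0 < (s.re - 1) / 2)
    calc |f x| * x ≤ (|B| * Real.log x) * x := by
          gcongr; exact (hB x hx).trans (mul_le_mul_of_nonneg_right (le_abs_self B) h2)
      _ ≤ (|B| * (((s.re - 1) / 2)⁻¹ * x ^ ((s.re - 1) / 2))) * x := by gcongr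
      _ = _ := by ring
  refine h1.congr_fun (fun x hx => ?_) measurableSet_Ioi
  simp only [cpow_neg_eq_mul_cpow (baseHeight_pos.trans hx) s]; ring

theorem hasDerivAt_ofReal_cpow_neg {x : ℝ} (hx : 0 < x) (s : ℂ) :
    HasDerivAt (fun y : ℝ => (y : ℂ) ^ (-s)) (-s * (x : ℂ) ^ (-s - 1)) x := by
  have h1 : HasDerivAt (fun z : ℂ => z ^ (-s)) (-s * (x : ℂ) ^ (-s - 1)) (x : ℂ) := by
    simpa using (hasDerivAt_id (x : ℂ)).cpow_const (c := -s) (Or.inl (by simpa using hx))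
  exact h1.comp_ofReal

theorem tendsto_zero_of_norm_le_rpow_neg {f : ℝ → ℂ} {B a c : ℝ} (ha : 0 < a)
    (h : ∀ x, c < x → ‖f x‖ ≤ B * x ^ (-a)) : Tendsto f atTop (nhds 0) := by
  refine squeeze_zero_norm' (a := fun x => B * x ^ (-a)) ?_ ?_
  · filter_upwards [eventually_gt_atTop c] with x hx using h x hx
  · simpa using (tendsto_rpow_neg_atTop ha).const_mul B

theorem mul_integral_zeroMain {s : ℂ} (hs : 1 < s.re) :
    s * ∫ x in Ioi baseHeight, (zeroMain x : ℂ) * (x : ℂ) ^ (-s - 1) =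
      ∫ x in Ioi baseHeight, (zeroDensity x : ℂ) * (x : ℂ) ^ (-s) := by
  have hi1 : IntegrableOn (fun x : ℝ => (zeroDensity x : ℂ) * (x : ℂ) ^ (-s)) (Ioi baseHeight) :=
    integrableOn_mul_cpow_neg_of_le_log continuous_zeroDensity.measurable
      (fun x hx => abs_zeroDensity_le (by linarith [baseHeight_spec.1])) hs
  have hi2 := (integrableOn_zeroMain_mul_cpow hs).const_mul (-s)
  have key := integral_Ioi_of_hasDerivAt_of_tendsto (a := baseHeight) (m := 0)
    (f := fun x : ℝ => (zeroMain x : ℂ) * (x : ℂ) ^ (-s))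
    (f' := fun x : ℝ => (zeroDensity x : ℂ) * (x : ℂ) ^ (-s) + -s * ((zeroMain x : ℂ) * (x : ℂ) ^ (-s - 1)))
    ?_ (fun x hx => ?_) (hi1.add hi2) ?_
  · rw [integral_add hi1 hi2, integral_const_mul, zeroMain_of_le le_rfl] at key
    simp only [Complex.ofReal_zero, zero_mul, sub_zero] at key
    linear_combination -key
  · exact ((Complex.continuous_ofReal.comp continuous_zeroMain).continuousAt.mul
      (hasDerivAt_ofReal_cpow_neg baseHeight_pos s).continuousAt).continuousWithinAt
  · have h := (hasDerivAt_zeroMain hx).ofReal_comp.mul (hasDerivAt_ofReal_cpow_neg (baseHeight_pos.trans hx) s)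
    refine h.congr_deriv ?_
    ring
  · refine tendsto_zero_of_norm_le_rpow_neg (a := (s.re - 1) / 2) (c := baseHeight)
      (B := 5 * ((s.re - 1) / 2)⁻¹) (by linarith) fun x hx => ?_
    have hx0 := baseHeight_pos.trans hx
    rw [norm_mul, Complex.norm_cpow_eq_rpow_re_of_pos hx0]
    refine (mul_le_mul_of_nonneg_right (norm_zeroMain_le_rpow (ε := (s.re - 1) / 2) (by linarith) hx)
      (by positivity)).trans (le_of_eq ?_)
    rw [mul_assoc, ← Real.rpow_add hx0]
    congr 2
    simp; ring

/-- The analytic continuation of `∫ log (x / 2π) x⁻ˢ dx` over `(baseHeight, ∞)`. -/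
noncomputable def logTerm (s : ℂ) : ℂ :=
  (baseHeight : ℂ) ^ (1 - s) * (1 / (1 - s) ^ 2 - (Real.log (baseHeight / (2 * π)) : ℂ) / (1 - s))

theorem abs_log_div_two_pi_le {x : ℝ} (hx : baseHeight < x) : |Real.log (x / (2 * π))| ≤ 3 * Real.log x := by
  have h4 := baseHeight_spec.1
  have hx0 := baseHeight_pos.trans hx
  rw [Real.log_div hx0.ne' (by positivity)]
  have h1 : Real.log (2 * π) ≤ Real.log (4 ^ 2) := Real.log_le_log (by positivity) (by linarith [Real.pi_lt_four])
  rw [Real.log_pow] at h1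
  have h2 : Real.log 4 ≤ Real.log x := Real.log_le_log (by norm_num) (by linarith)
  have h3 : 0 ≤ Real.log (2 * π) := Real.log_nonneg (by linarith [Real.pi_gt_three])
  have h5 : 0 ≤ Real.log x := Real.log_nonneg (by linarith)
  push_cast at h1
  rw [abs_le]; constructor <;> linarith

theorem integral_log_mul_cpow {s : ℂ} (hs : 1 < s.re) :
    ∫ x in Ioi baseHeight, (Real.log (x / (2 * π)) : ℂ) * (x : ℂ) ^ (-s) = logTerm s := by
  have hs1 : 1 - s ≠ 0 := by
    intro h
    rw [sub_eq_zero] at h; rw [← h] at hs; simp at hs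
  have hmeas : Measurable fun x : ℝ => Real.log (x / (2 * π)) := by fun_prop
  have hder : ∀ x ∈ Ici baseHeight, HasDerivAt
      (fun x : ℝ => (x : ℂ) ^ (-(s - 1)) * ((Real.log (x / (2 * π)) : ℂ) / (1 - s) - 1 / (1 - s) ^ 2))
      ((Real.log (x / (2 * π)) : ℂ) * (x : ℂ) ^ (-s)) x := by
    intro x hx
    have hx0 : 0 < x := baseHeight_pos.trans_le hx
    have hxc : (x : ℂ) ≠ 0 := by exact_mod_cast hx0.ne'
    have h1 : HasDerivAt (fun x : ℝ => Real.log (x / (2 * π))) (1 / x) x := by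
      refine (((hasDerivAt_id x).div_const (2 * π)).log (by simp only [id]; positivity)).congr_deriv ?_
      simp only [id]; field_simp
    have h := (hasDerivAt_ofReal_cpow_neg hx0 (s - 1)).mul
      ((h1.ofReal_comp.div_const (1 - s)).sub_const (1 / (1 - s) ^ 2))
    refine h.congr_deriv ?_
    rw [show -(s - 1) - 1 = -s by ring, show -(s - 1) = -s + 1 by ring, Complex.cpow_add _ _ hxc, Complex.cpow_one]
    push_cast
    field_simp
    ring
  have key := integral_Ioi_of_hasDerivAt_of_tendsto' hder
    (integrableOn_mul_cpow_neg_of_le_log hmeas (fun x hx => abs_log_div_two_pi_le hx) hs)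
    (m := 0) ?_
  · rw [key, logTerm, show -(s - 1) = 1 - s by ring]; ring
  · set ε := (s.re - 1) / 2 with hε
    have hε0 : 0 < ε := by linarith
    refine tendsto_zero_of_norm_le_rpow_neg (a := ε) (c := baseHeight)
      (B := 3 * ε⁻¹ / ‖1 - s‖ + 1 / ‖1 - s‖ ^ 2) hε0 fun x hx => ?_
    have hx0 := baseHeight_pos.trans hx
    have hx1 : 1 ≤ x ^ ε := Real.one_le_rpow (by linarith [baseHeight_spec.1]) hε0.le
    rw [norm_mul, Complex.norm_cpow_eq_rpow_re_of_pos hx0]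
    have h1 : ‖(Real.log (x / (2 * π)) : ℂ) / (1 - s) - 1 / (1 - s) ^ 2‖ ≤
        (3 * ε⁻¹ / ‖1 - s‖ + 1 / ‖1 - s‖ ^ 2) * x ^ ε := by
      refine (norm_sub_le _ _).trans ?_
      rw [norm_div, norm_div, norm_pow, Complex.norm_real, Real.norm_eq_abs, norm_one, add_mul]
      refine add_le_add ?_ (le_mul_of_one_le_right (by positivity) hx1)
      rw [div_mul_eq_mul_div]
      gcongr
      refine (abs_log_div_two_pi_le hx).trans ?_
      rw [mul_assoc]; gcongr
      exact log_le_const_mul_rpow hx0.le hε0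
    refine (mul_le_mul_of_nonneg_left h1 (by positivity)).trans (le_of_eq ?_)
    rw [mul_comm, mul_assoc, ← Real.rpow_add hx0]
    congr 2
    simp only [Complex.neg_re, Complex.sub_re, Complex.one_re, hε]; ring

/-- The difference between the density of zeros and its leading term, multiplied by `x`. -/
noncomputable def densityError (x : ℝ) : ℝ := (zeroDensity x - Real.log (x / (2 * π)) / (2 * π)) * x

theorem measurable_ofReal_densityError : Measurable fun x => (densityError x : ℂ) := by
  have := continuous_zeroDensity.measurable
  unfold densityError
  fun_prop

theorem norm_densityError_le {x : ℝ} (hx : baseHeight < x) : ‖(densityError x : ℂ)‖ ≤ 10 * x ^ (0:ℝ) := by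
  have hx0 := baseHeight_pos.trans hx
  have h := abs_zeroDensity_sub_le (y := x) (by linarith [baseHeight_spec.1])
  rw [Complex.norm_real, Real.norm_eq_abs, densityError, abs_mul, abs_of_pos hx0, Real.rpow_zero, mul_one]
  rwa [le_div_iff₀ hx0] at h

theorem integral_zeroDensity_mul_cpow {s : ℂ} (hs : 1 < s.re) :
    ∫ x in Ioi baseHeight, (zeroDensity x : ℂ) * (x : ℂ) ^ (-s) =
      logTerm s / (2 * π) + ∫ x in Ioi baseHeight, (densityError x : ℂ) * (x : ℂ) ^ (-s - 1) := by
  have hmeas : Measurable fun x : ℝ => Real.log (x / (2 * π)) := by fun_prop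
  have hi1 := (integrableOn_mul_cpow_neg_of_le_log hmeas (fun x hx => abs_log_div_two_pi_le hx) hs).div_const
    (2 * π : ℂ)
  have hi2 := integrableOn_Ioi_mul_cpow measurable_ofReal_densityError baseHeight_pos
    (fun _ hx => norm_densityError_le hx) (by linarith : 0 < s.re)
  rw [← integral_log_mul_cpow hs, ← integral_div, ← integral_add hi1 hi2]
  refine setIntegral_congr_fun measurableSet_Ioi fun x hx => ?_
  simp only [cpow_neg_eq_mul_cpow (baseHeight_pos.trans hx) s, densityError]
  push_cast
  ring

/-- Away from the pole, the ordinate zeta function minus the Mellin transform of `zeroError`. -/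
noncomputable def regularPart (s : ℂ) : ℂ :=
  ∑ ρ ∈ lowZeros, (zetaMult ρ : ℂ) * (ρ.im : ℂ) ^ (-s) +
    (logTerm s / (2 * π) + ∫ x in Ioi baseHeight, (densityError x : ℂ) * (x : ℂ) ^ (-s - 1))

theorem tsum_zetaMult_eq_regularPart {s : ℂ} (hs : 1 < s.re) :
    ∑' ρ : {ρ : ℂ // IsNontrivialZero ρ ∧ 0 < ρ.im}, (zetaMult ρ.1 : ℂ) * (ρ.1.im : ℂ) ^ (-s) =
      regularPart s + s * ∫ x in Ioi baseHeight, (zeroError x : ℂ) * (x : ℂ) ^ (-s - 1) := by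
  have h1 : ∫ x in Ioi baseHeight, (zeroCount x : ℂ) * (x : ℂ) ^ (-s - 1) =
      (∫ x in Ioi baseHeight, (zeroMain x : ℂ) * (x : ℂ) ^ (-s - 1)) +
        ∫ x in Ioi baseHeight, (zeroError x : ℂ) * (x : ℂ) ^ (-s - 1) := by
    rw [← integral_add (integrableOn_zeroMain_mul_cpow hs) (integrableOn_zeroError_mul_cpow (by linarith))]
    refine setIntegral_congr_fun measurableSet_Ioi fun x _ => ?_
    simp only [zeroError]
    push_cast
    ring
  rw [tsum_zetaMult_eq hs, h1, mul_add, mul_integral_zeroMain hs, integral_zeroDensity_mul_cpow hs, regularPart]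
  ring

theorem differentiableAt_regularPart {s : ℂ} (hs : 0 < s.re) (hs1 : s ≠ 1) :
    DifferentiableAt ℂ regularPart s := by
  have hs1' : 1 - s ≠ 0 := sub_ne_zero.2 hs1.symm
  have hb : (baseHeight : ℂ) ≠ 0 := by exact_mod_cast baseHeight_pos.ne'
  have h1 : DifferentiableAt ℂ (fun s : ℂ => ∑ ρ ∈ lowZeros, (zetaMult ρ : ℂ) * (ρ.im : ℂ) ^ (-s)) s := by
    refine DifferentiableAt.fun_sum fun ρ hρ => ?_
    rw [mem_lowZeros] at hρ
    have : (ρ.im : ℂ) ≠ 0 := by exact_mod_cast hρ.2.1.ne'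
    exact (differentiableAt_id.neg.const_cpow (Or.inl this)).const_mul _
  have h2 : DifferentiableAt ℂ logTerm s := by
    unfold logTerm
    have h3 : DifferentiableAt ℂ (fun s : ℂ => 1 - s) s := by fun_prop
    exact (h3.const_cpow (Or.inl hb)).mul (((differentiableAt_const _).div (h3.pow 2) (pow_ne_zero 2 hs1')).sub
      ((differentiableAt_const _).div h3 hs1'))
  exact h1.add ((h2.div_const _).add (differentiableAt_integral_Ioi_mul_cpow measurable_ofReal_densityError
    baseHeight_pos (fun _ hx => norm_densityError_le hx) hs))

theorem eq_regularPart_add {G : ℂ → ℂ}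
    (hGser : ∀ s : ℂ, 1 < s.re → G s = ∑' ρ : {ρ : ℂ // IsNontrivialZero ρ ∧ 0 < ρ.im},
      (zetaMult ρ.1 : ℂ) * (ρ.1.im : ℂ) ^ (-s))
    (hGan : ∀ s : ℂ, -1 < s.re → s ≠ 1 → DifferentiableAt ℂ G s) {s : ℂ} (hs : 0 < s.re) (hs' : 0 < s.im) :
    G s = regularPart s + s * ∫ x in Ioi baseHeight, (zeroError x : ℂ) * (x : ℂ) ^ (-s - 1) := by
  set U : Set ℂ := {z | 0 < z.re} ∩ {z | 0 < z.im} with hU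
  have hUo : IsOpen U := (isOpen_lt continuous_const Complex.continuous_re).inter
    (isOpen_lt continuous_const Complex.continuous_im)
  have hUc : Convex ℝ U := (convex_halfSpace_re_gt 0).inter (convex_halfSpace_im_gt 0)
  have hne : ∀ z ∈ U, z ≠ 1 := by
    rintro z ⟨-, hz⟩ rfl
    simp at hz
  have hG : AnalyticOnNhd ℂ G U := DifferentiableOn.analyticOnNhd (fun z hz =>
    (hGan z (by linarith [show 0 < z.re from hz.1]) (hne z hz)).differentiableWithinAt) hUo
  have hR : AnalyticOnNhd ℂ (fun s : ℂ => regularPart s +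
      s * ∫ x in Ioi baseHeight, (zeroError x : ℂ) * (x : ℂ) ^ (-s - 1)) U :=
    DifferentiableOn.analyticOnNhd (fun z hz => ((differentiableAt_regularPart hz.1 (hne z hz)).add
      (differentiableAt_id.mul (differentiableAt_integral_zeroError hz.1))).differentiableWithinAt) hUo
  refine hG.eqOn_of_preconnected_of_eventuallyEq hR hUc.isPreconnected (z₀ := 2 + I) ⟨?_, ?_⟩ ?_ ⟨hs, hs'⟩
  · simp
  · simp
  · filter_upwards [(isOpen_lt continuous_const Complex.continuous_re).mem_nhds
      (show (1:ℝ) < (2 + I : ℂ).re by simp)] with z hz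
    rw [hGser z hz, tsum_zetaMult_eq_regularPart hz]

theorem exists_norm_regularPart_le {σ : ℝ} (hσ : 0 < σ) :
    ∃ A, ∀ t : ℝ, 1 ≤ t → ‖regularPart (σ + t * I)‖ ≤ A := by
  refine ⟨∑ ρ ∈ lowZeros, (zetaMult ρ : ℝ) * ρ.im ^ (-σ) +
    (baseHeight ^ (1 - σ) * (1 + |Real.log (baseHeight / (2 * π))|) / (2 * π) +
      ∫ x in Ioi baseHeight, ‖(densityError x : ℂ)‖ * x ^ (-σ - 1)), fun t ht => ?_⟩
  set s : ℂ := σ + t * I with hs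
  have hre : s.re = σ := by simp [hs]
  have h1 : 1 ≤ ‖1 - s‖ := by
    refine le_trans ?_ (Complex.abs_im_le_norm _)
    have : (1 - s).im = -t := by simp [hs]
    rw [this, abs_neg]; exact ht.trans (le_abs_self t)
  refine (norm_add_le _ _).trans (add_le_add ?_ ((norm_add_le _ _).trans (add_le_add ?_ ?_)))
  · refine (norm_sum_le _ _).trans (Finset.sum_le_sum fun ρ hρ => ?_)
    rw [mem_lowZeros] at hρ
    rw [norm_mul, Complex.norm_cpow_eq_rpow_re_of_pos hρ.2.1, Complex.neg_re, hre, Complex.norm_natCast]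
  · have h2 : ‖(2 * π : ℂ)‖ = 2 * π := by
      rw [show (2 * π : ℂ) = ((2 * π : ℝ) : ℂ) by push_cast; rfl, Complex.norm_real, Real.norm_of_nonneg (by positivity)]
    rw [norm_div, h2, logTerm, norm_mul, Complex.norm_cpow_eq_rpow_re_of_pos baseHeight_pos, Complex.sub_re, hre,
      Complex.one_re]
    have := baseHeight_pos
    gcongr
    refine (norm_sub_le _ _).trans ?_
    rw [norm_div, norm_div, norm_pow, norm_one, Complex.norm_real, Real.norm_eq_abs]
    exact add_le_add ((div_le_one (by positivity)).2 (one_le_pow₀ h1)) (div_le_self (abs_nonneg _) h1)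
  · refine (norm_integral_le_integral_norm _).trans (le_of_eq ?_)
    refine setIntegral_congr_fun measurableSet_Ioi fun x hx => ?_
    simp only [norm_mul_cpow_neg_sub_one (baseHeight_pos.trans hx), hre]

theorem one_add_log_mul_le {U c : ℝ} (hU : 1 ≤ U) (hc : 1 ≤ c) (hc' : c ≤ 5) :
    1 + Real.log (c * U) ≤ 3 * (1 + Real.log U) := by
  rw [Real.log_mul (by linarith) (by linarith)]
  have h1 : Real.log c ≤ 2 := by
    rw [Real.log_le_iff_le_exp (by linarith)]
    have := Real.add_one_le_exp (1:ℝ)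
    rw [show (2:ℝ) = 1 + 1 by norm_num, Real.exp_add]
    nlinarith [Real.exp_one_gt_d9]
  linarith [Real.log_nonneg hU]

theorem exists_lintegral_zeroError_pow_le' {p : ℕ} (hp : 1 ≤ p) : ∃ C, 0 ≤ C ∧ ∀ U, 1 ≤ U →
    ∫⁻ x in Icc U (2 * U), ‖zeroError x‖ₑ ^ p ≤ ENNReal.ofReal (C * (U * (1 + Real.log U))) := by
  obtain ⟨C, hC, h⟩ := exists_lintegral_zeroError_pow_le hp
  refine ⟨C, hC, fun U hU => ?_⟩
  rcases le_or_gt 2 U with h2 | h2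
  · refine (lintegral_mono_set (Icc_subset_Icc_right (by linarith))).trans ((h U h2).trans
      (ENNReal.ofReal_le_ofReal ?_))
    gcongr
    linarith
  · rw [setLIntegral_congr_fun (g := fun _ => 0) measurableSet_Icc fun x hx => by
      simp only []
      rw [zeroError_of_le (by linarith [hx.2, baseHeight_spec.1])]
      simp; omega]
    simp

theorem setLIntegral_Icc_comp_mul_le {f : ℝ → ENNReal} (hf : Measurable f) {c : ℝ} (hc : 1 ≤ c) (a b : ℝ) :
    ∫⁻ x in Icc a b, f (c * x) ≤ ∫⁻ x in Icc (c * a) (c * b), f x := by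
  have hc0 : 0 < c := by linarith
  have h1 : ∫⁻ x in Icc a b, f (c * x) = ∫⁻ x, (Icc (c * a) (c * b)).indicator f (c * x) := by
    rw [← lintegral_indicator measurableSet_Icc]
    refine lintegral_congr fun x => ?_
    simp only [indicator, mem_Icc, mul_le_mul_iff_right₀ hc0]
  rw [h1, ← lintegral_indicator measurableSet_Icc]
  have h2 := Real.map_volume_mul_left hc0.ne'
  rw [← lintegral_map (g := fun x => c * x) (hf.indicator measurableSet_Icc) (measurable_const_mul c), h2,
    lintegral_smul_measure, smul_eq_mul]
  refine mul_le_of_le_one_left zero_le (ENNReal.ofReal_le_one.2 ?_)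
  rw [abs_of_pos (inv_pos.2 hc0)]
  exact inv_le_one_of_one_le₀ hc

theorem enorm_sub_pow_le (a b : ℝ) (p : ℕ) : ‖a - b‖ₑ ^ p ≤ 2 ^ p * (‖a‖ₑ ^ p + ‖b‖ₑ ^ p) := by
  have h1 : ‖a - b‖ₑ ≤ 2 * max ‖a‖ₑ ‖b‖ₑ := by
    refine (enorm_sub_le).trans ?_
    rw [two_mul]
    exact add_le_add (le_max_left _ _) (le_max_right _ _)
  refine (pow_le_pow_left' h1 p).trans ?_
  rw [mul_pow]
  gcongr
  rcases max_cases ‖a‖ₑ ‖b‖ₑ with ⟨h, -⟩ | ⟨h, -⟩ <;> rw [h]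
  · exact le_self_add
  · exact le_add_self

theorem exists_lintegral_zeroError_sub_pow_le {p : ℕ} (hp : 1 ≤ p) : ∃ C, 0 ≤ C ∧ ∀ T U, 2 ≤ T → 1 ≤ U →
    ∫⁻ x in Icc U (2 * U), ‖zeroError (rexp (1 / T) * x) - zeroError x‖ₑ ^ p ≤
      ENNReal.ofReal (C * (U * (1 + Real.log U))) := by
  obtain ⟨C, hC, h⟩ := exists_lintegral_zeroError_pow_le' hp
  refine ⟨2 ^ p * (7 * C), by positivity, fun T U hT hU => ?_⟩
  have hl := one_lt_exp_inv (T := T) (by linarith)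
  have hl2 := exp_inv_le_two hT
  set c := rexp (1 / T) with hc
  have hmeas : Measurable fun x => ‖zeroError x‖ₑ ^ p := measurable_zeroError.enorm.pow_const p
  have hlog : 0 ≤ Real.log U := Real.log_nonneg hU
  have h1 : ∫⁻ x in Icc U (2 * U), ‖zeroError (c * x)‖ₑ ^ p ≤
      ENNReal.ofReal (6 * C * (U * (1 + Real.log U))) := by
    refine (setLIntegral_Icc_comp_mul_le hmeas hl.le U (2 * U)).trans ?_
    rw [show c * (2 * U) = 2 * (c * U) by ring]
    refine (h (c * U) (by nlinarith)).trans (ENNReal.ofReal_le_ofReal ?_)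
    have h2 := one_add_log_mul_le hU hl.le (by linarith)
    have h3 : 0 ≤ Real.log (c * U) := Real.log_nonneg (by nlinarith)
    calc C * (c * U * (1 + Real.log (c * U))) ≤ C * (2 * U * (3 * (1 + Real.log U))) := by gcongr
      _ = _ := by ring
  calc ∫⁻ x in Icc U (2 * U), ‖zeroError (c * x) - zeroError x‖ₑ ^ p
      ≤ ∫⁻ x in Icc U (2 * U), 2 ^ p * (‖zeroError (c * x)‖ₑ ^ p + ‖zeroError x‖ₑ ^ p) :=
        lintegral_mono fun x => enorm_sub_pow_le _ _ p
    _ = 2 ^ p * ((∫⁻ x in Icc U (2 * U), ‖zeroError (c * x)‖ₑ ^ p) +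
          ∫⁻ x in Icc U (2 * U), ‖zeroError x‖ₑ ^ p) := by
        rw [lintegral_const_mul' _ _ (by finiteness), lintegral_add_right _ hmeas]
    _ ≤ ENNReal.ofReal (2 ^ p) * (ENNReal.ofReal (6 * C * (U * (1 + Real.log U))) +
          ENNReal.ofReal (C * (U * (1 + Real.log U)))) := by
        rw [ENNReal.ofReal_pow (by norm_num), ENNReal.ofReal_ofNat]
        gcongr
        exact h U hU
    _ = _ := by
        rw [← ENNReal.ofReal_add (by positivity) (by positivity), ← ENNReal.ofReal_mul (by positivity)]
        congr 1
        ring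

theorem abs_zeroMain_mul_sub_le {c x : ℝ} (hc : 1 ≤ c) (hx : 1 ≤ x) :
    |zeroMain (c * x) - zeroMain x| ≤ 5 * Real.log (c * x) * ((c - 1) * x) := by
  have hcx : x ≤ c * x := by nlinarith
  have hlog : 0 ≤ Real.log (c * x) := Real.log_nonneg (by linarith)
  have h0 : 0 ≤ (c - 1) * x := mul_nonneg (by linarith) (by linarith)
  rcases le_total baseHeight x with h | h
  · refine (abs_zeroMain_sub_le h hcx).trans (le_of_eq (by ring))
  · rcases le_total (c * x) baseHeight with h' | h'
    · rw [zeroMain_of_le h, zeroMain_of_le h', sub_zero, abs_zero]; positivity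
    · have h1 := abs_zeroMain_sub_le le_rfl h'
      rw [zeroMain_of_le le_rfl] at h1
      rw [zeroMain_of_le h]
      refine h1.trans ?_
      gcongr
      linarith

theorem integral_comp_mul_sub_le {f : ℝ → ℝ} (hf : Monotone f) (hf0 : ∀ x, 0 ≤ f x) {c U : ℝ} (hc : 1 ≤ c)
    (hU : 0 ≤ U) :
    ∫ x in U..(2 * U), (f (c * x) - f x) ≤ 2 * (c - 1) * U * f (2 * c * U) := by
  have hc0 : 0 < c := by linarith
  have hi : ∀ a b, IntervalIntegrable f volume a b := fun a b => hf.intervalIntegrable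
  have hfc : Monotone fun x => f (c * x) := fun x y h => hf (by gcongr)
  rw [intervalIntegral.integral_sub hfc.intervalIntegrable (hi _ _), intervalIntegral.integral_comp_mul_left _ hc0.ne',
    smul_eq_mul]
  have h1 : 0 ≤ ∫ x in (c * U)..(c * (2 * U)), f x :=
    intervalIntegral.integral_nonneg (by nlinarith) fun x _ => hf0 x
  have h2 : c⁻¹ * ∫ x in (c * U)..(c * (2 * U)), f x ≤ ∫ x in (c * U)..(c * (2 * U)), f x :=
    mul_le_of_le_one_left h1 (inv_le_one_of_one_le₀ hc)
  have h3 := intervalIntegral.integral_add_adjacent_intervals (hi U (c * U)) (hi (c * U) (c * (2 * U)))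
  have h4 := intervalIntegral.integral_add_adjacent_intervals (hi U (2 * U)) (hi (2 * U) (c * (2 * U)))
  have h5 : 0 ≤ ∫ x in U..(c * U), f x := intervalIntegral.integral_nonneg (by nlinarith) fun x _ => hf0 x
  have h6 : ∫ x in (2 * U)..(c * (2 * U)), f x ≤ ∫ x in (2 * U)..(c * (2 * U)), f (2 * c * U) :=
    intervalIntegral.integral_mono_on (by nlinarith) (hi _ _) intervalIntegrable_const fun x hx =>
      hf (by linarith [hx.2])
  rw [intervalIntegral.integral_const, smul_eq_mul] at h6
  nlinarith

theorem exists_lintegral_zeroError_sub_le : ∃ C, 0 ≤ C ∧ ∀ T U, 2 ≤ T → 1 ≤ U →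
    ∫⁻ x in Icc U (2 * U), ‖zeroError (rexp (1 / T) * x) - zeroError x‖ₑ ≤
      ENNReal.ofReal (C * (U * (1 + Real.log U)) * (U / T)) := by
  obtain ⟨C, hC, h⟩ := exists_zeroCount_le
  refine ⟨60 * C + 60, by positivity, fun T U hT hU => ?_⟩
  have hl := one_lt_exp_inv (T := T) (by linarith)
  have hl2 := exp_inv_le_two hT
  have hl3 := exp_inv_sub_one_le hT
  set c := rexp (1 / T) with hc
  have hlog : 0 ≤ Real.log U := Real.log_nonneg hU
  have hT0 : 0 < T := by linarith
  have hlog5 : 1 + Real.log (5 * U) ≤ 3 * (1 + Real.log U) := one_add_log_mul_le hU (by norm_num) le_rfl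
  set D := 5 * Real.log (5 * U) * (2 / T * (2 * U)) with hD
  have hlog5' : 0 ≤ Real.log (5 * U) := Real.log_nonneg (by linarith)
  have hD0 : 0 ≤ D := by positivity
  have hcmono : Monotone fun x => zeroCount (c * x) := fun x y h => zeroCount_mono (by gcongr)
  have hpt : ∀ x ∈ Icc U (2 * U), ‖zeroError (c * x) - zeroError x‖ₑ ≤
      ENNReal.ofReal (zeroCount (c * x) - zeroCount x + D) := by
    intro x hx
    have hx1 : 1 ≤ x := hU.trans hx.1
    rw [← ofReal_norm_eq_enorm, Real.norm_eq_abs]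
    refine ENNReal.ofReal_le_ofReal ?_
    have h1 := abs_zeroMain_mul_sub_le hl.le hx1
    have h2 : 5 * Real.log (c * x) * ((c - 1) * x) ≤ D := by
      have : Real.log (c * x) ≤ Real.log (5 * U) := Real.log_le_log (by positivity) (by nlinarith [hx.2])
      have h3 : 0 ≤ Real.log (c * x) := Real.log_nonneg (by nlinarith)
      rw [hD]
      have h4 : (c - 1) * x ≤ 2 / T * (2 * U) := mul_le_mul hl3 hx.2 (by linarith) (by positivity)
      have h5 : 0 ≤ (c - 1) * x := mul_nonneg (by linarith) (by linarith)
      gcongr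
    have h3 : zeroCount x ≤ zeroCount (c * x) := zeroCount_mono (by nlinarith)
    have h4 := abs_le.1 (h1.trans h2)
    simp only [zeroError]
    rw [abs_le]; constructor <;> linarith
  have hle : U ≤ 2 * U := by linarith
  have hii : IntervalIntegrable (fun x => zeroCount (c * x) - zeroCount x) volume U (2 * U) :=
    hcmono.intervalIntegrable.sub zeroCount_mono.intervalIntegrable
  have hii' : IntervalIntegrable (fun x => zeroCount (c * x) - zeroCount x + D) volume U (2 * U) :=
    hii.add intervalIntegrable_const
  have hm : Measurable fun x => ENNReal.ofReal (zeroCount (c * x) - zeroCount x + D) :=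
    ((hcmono.measurable.sub zeroCount_mono.measurable).add_const D).ennreal_ofReal
  refine (setLIntegral_mono hm hpt).trans ?_
  rw [Measure.restrict_congr_set Ioc_ae_eq_Icc.symm, ← ofReal_integral_eq_lintegral_ofReal
    ((intervalIntegrable_iff_integrableOn_Ioc_of_le hle).1 hii') ?_, ← intervalIntegral.integral_of_le hle]
  swap
  · filter_upwards [ae_restrict_mem measurableSet_Ioc] with x hx
    have h3 : zeroCount x ≤ zeroCount (c * x) := zeroCount_mono (by nlinarith [hx.1])
    simp only [Pi.zero_apply]
    linarith
  refine ENNReal.ofReal_le_ofReal ?_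
  rw [intervalIntegral.integral_add hii intervalIntegrable_const, intervalIntegral.integral_const, smul_eq_mul]
  have h1 := integral_comp_mul_sub_le zeroCount_mono zeroCount_nonneg hl.le (by linarith : 0 ≤ U)
  have h2 : zeroCount (2 * c * U) ≤ C * (5 * U * (3 * (1 + Real.log U))) := by
    refine (zeroCount_mono (by nlinarith : 2 * c * U ≤ 5 * U)).trans ((h _ (by linarith [baseHeight_spec.2.1])).trans ?_)
    gcongr
    linarith
  have h3 : 2 * (c - 1) * U * zeroCount (2 * c * U) ≤ 2 * (2 / T) * U * (C * (5 * U * (3 * (1 + Real.log U)))) := by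
    have := zeroCount_nonneg (2 * c * U)
    gcongr
  have h4 : D ≤ 5 * (3 * (1 + Real.log U)) * (2 / T * (2 * U)) := by
    rw [hD]; gcongr; linarith
  have h5 : (2 * U - U) * D ≤ U * (5 * (3 * (1 + Real.log U)) * (2 / T * (2 * U))) := by
    rw [show 2 * U - U = U by ring]; gcongr
  calc _ ≤ 2 * (2 / T) * U * (C * (5 * U * (3 * (1 + Real.log U)))) +
        U * (5 * (3 * (1 + Real.log U)) * (2 / T * (2 * U))) := by linarith
    _ = (60 * C + 60) * (U * (1 + Real.log U)) * (U / T) := by field_simp; ring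

theorem sq_le_mul_add_mul_pow {y V : ℝ} (hy : 0 ≤ y) (hV : 0 < V) (m : ℕ) :
    y ^ 2 ≤ V * y + V⁻¹ ^ m * y ^ (m + 2) := by
  rcases le_total y V with h | h
  · have : 0 ≤ V⁻¹ ^ m * y ^ (m + 2) := by positivity
    nlinarith
  · have h1 : 1 ≤ (V⁻¹ * y) ^ m := one_le_pow₀ (by rw [inv_mul_eq_div, one_le_div hV]; exact h)
    have h2 : V⁻¹ ^ m * y ^ (m + 2) = (V⁻¹ * y) ^ m * y ^ 2 := by rw [mul_pow, pow_add]; ring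
    rw [h2]
    nlinarith [mul_nonneg hV.le hy, sq_nonneg y]

theorem exists_lintegral_zeroError_sub_sq_le (m : ℕ) : ∃ C, 0 ≤ C ∧ ∀ T U, 2 ≤ T → 1 ≤ U → U ≤ T →
    ∫⁻ x in Icc U (2 * U), ‖zeroError (rexp (1 / T) * x) - zeroError x‖ₑ ^ 2 ≤
      ENNReal.ofReal (C * (U * (1 + Real.log U)) * (U / T) ^ ((m : ℝ) / (m + 1))) := by
  obtain ⟨C₁, hC₁, h₁⟩ := exists_lintegral_zeroError_sub_le
  obtain ⟨C₂, hC₂, h₂⟩ := exists_lintegral_zeroError_sub_pow_le (p := m + 2) (by omega)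
  refine ⟨C₁ + C₂, by positivity, fun T U hT hU hUT => ?_⟩
  have hT0 : 0 < T := by linarith
  have hU0 : 0 < U := by linarith
  have hlog : 0 ≤ Real.log U := Real.log_nonneg hU
  set v := U / T with hv
  have hv0 : 0 < v := by positivity
  set V := v ^ (-(1 / ((m : ℝ) + 1))) with hV
  have hV0 : 0 < V := by positivity
  have hV1 : V * v = v ^ ((m : ℝ) / (m + 1)) := by
    rw [hV, ← Real.rpow_add_one hv0.ne']; congr 1; field_simp; ring
  have hV2 : V⁻¹ ^ m = v ^ ((m : ℝ) / (m + 1)) := by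
    rw [hV, ← Real.rpow_neg hv0.le, neg_neg, ← Real.rpow_natCast, ← Real.rpow_mul hv0.le]; congr 1; field_simp
  set f : ℝ → ℝ := fun x => zeroError (rexp (1 / T) * x) - zeroError x with hf
  have hfm : Measurable f := (measurable_zeroError.comp (measurable_const_mul _)).sub measurable_zeroError
  have hpt : ∀ x, ‖f x‖ₑ ^ 2 ≤ ENNReal.ofReal V * ‖f x‖ₑ + ENNReal.ofReal (V⁻¹ ^ m) * ‖f x‖ₑ ^ (m + 2) := by
    intro x
    rw [← ofReal_norm_eq_enorm, ← ENNReal.ofReal_pow (norm_nonneg _), ← ENNReal.ofReal_pow (norm_nonneg _),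
      ← ENNReal.ofReal_mul (by positivity), ← ENNReal.ofReal_mul (by positivity),
      ← ENNReal.ofReal_add (by positivity) (by positivity)]
    exact ENNReal.ofReal_le_ofReal (sq_le_mul_add_mul_pow (norm_nonneg _) hV0 m)
  have e1 := h₁ T U hT hU
  have e2 := h₂ T U hT hU
  calc ∫⁻ x in Icc U (2 * U), ‖f x‖ₑ ^ 2
      ≤ ∫⁻ x in Icc U (2 * U), (ENNReal.ofReal V * ‖f x‖ₑ + ENNReal.ofReal (V⁻¹ ^ m) * ‖f x‖ₑ ^ (m + 2)) :=
        lintegral_mono hpt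
    _ = ENNReal.ofReal V * (∫⁻ x in Icc U (2 * U), ‖f x‖ₑ) +
          ENNReal.ofReal (V⁻¹ ^ m) * (∫⁻ x in Icc U (2 * U), ‖f x‖ₑ ^ (m + 2)) := by
        rw [lintegral_add_left (hfm.enorm.const_mul _), lintegral_const_mul' _ _ ENNReal.ofReal_ne_top,
          lintegral_const_mul' _ _ ENNReal.ofReal_ne_top]
    _ ≤ ENNReal.ofReal V * ENNReal.ofReal (C₁ * (U * (1 + Real.log U)) * v) +
          ENNReal.ofReal (V⁻¹ ^ m) * ENNReal.ofReal (C₂ * (U * (1 + Real.log U))) := by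
        gcongr
    _ = _ := by
        rw [← ENNReal.ofReal_mul (by positivity), ← ENNReal.ofReal_mul (by positivity),
          ← ENNReal.ofReal_add (by positivity) (by positivity), hV2, ← hV1]
        congr 1
        ring

theorem setLIntegral_Icc_mul_rpow_le {f : ℝ → ENNReal} {σ U : ℝ} (hσ : 0 < σ) (hU : 0 < U) :
    ∫⁻ x in Icc U (2 * U), f x * ENNReal.ofReal (x ^ (-2 * σ - 1)) ≤
      (∫⁻ x in Icc U (2 * U), f x) * ENNReal.ofReal (U ^ (-2 * σ - 1)) := by
  rw [← lintegral_mul_const' _ _ ENNReal.ofReal_ne_top]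
  refine setLIntegral_mono' measurableSet_Icc fun x hx => ?_
  exact mul_le_mul_right (ENNReal.ofReal_le_ofReal (Real.rpow_le_rpow_of_nonpos hU hx.1 (by linarith))) _

theorem lintegral_Ioi_le_tsum_dyadic (f : ℝ → ENNReal) {T : ℝ} (hT : 0 < T) :
    ∫⁻ x in Ioi 0, f x ≤ (∑' k : ℕ, ∫⁻ x in Icc (T * 2 ^ k) (2 * (T * 2 ^ k)), f x) +
      ∑' k : ℕ, ∫⁻ x in Icc (T * (1 / 2) ^ (k + 1)) (2 * (T * (1 / 2) ^ (k + 1))), f x := by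
  have hsub : Ioi (0:ℝ) ⊆ (⋃ k : ℕ, Icc (T * 2 ^ k) (2 * (T * 2 ^ k))) ∪
      ⋃ k : ℕ, Icc (T * (1 / 2) ^ (k + 1)) (2 * (T * (1 / 2) ^ (k + 1))) := by
    intro x hx
    have hx0 : 0 < x := hx
    rcases le_total T x with h | h
    · left
      obtain ⟨k, hk1, hk2⟩ := exists_nat_pow_near (x := x / T) (y := 2) ((one_le_div hT).2 h) (by norm_num)
      rw [le_div_iff₀ hT] at hk1
      rw [div_lt_iff₀ hT, pow_succ] at hk2
      exact mem_iUnion.2 ⟨k, by linarith, by linarith⟩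
    · right
      obtain ⟨k, hk1, hk2⟩ := exists_nat_pow_near_of_lt_one (x := x / T) (y := 1 / 2) (div_pos hx0 hT)
        ((div_le_one hT).2 h) (by norm_num) (by norm_num)
      rw [lt_div_iff₀ hT] at hk1
      rw [div_le_iff₀ hT] at hk2
      refine mem_iUnion.2 ⟨k, by linarith, ?_⟩
      rw [pow_succ]; linarith
  refine (lintegral_mono_set hsub).trans ((lintegral_union_le _ _ _).trans (add_le_add ?_ ?_)) <;>
  exact lintegral_iUnion_le _ _

theorem tsum_ofReal_const_mul_rpow_le {K δ : ℝ} (hK : 0 ≤ K) (hδ : 0 < δ) :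
    ∑' k : ℕ, ENNReal.ofReal (K * ((1 / 2 : ℝ) ^ k) ^ δ) ≤ ENNReal.ofReal (K * (1 - (1 / 2 : ℝ) ^ δ)⁻¹) := by
  have h1 : (1 / 2 : ℝ) ^ δ < 1 := Real.rpow_lt_one (by norm_num) (by norm_num) hδ
  have h0 : 0 ≤ (1 / 2 : ℝ) ^ δ := by positivity
  have h2 : ∀ k : ℕ, ((1 / 2 : ℝ) ^ k) ^ δ = ((1 / 2 : ℝ) ^ δ) ^ k := fun k => by
    rw [← Real.rpow_natCast, ← Real.rpow_natCast, ← Real.rpow_mul (by norm_num), ← Real.rpow_mul (by norm_num),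
      mul_comm]
  simp only [h2]
  rw [← ENNReal.ofReal_tsum_of_nonneg (fun k => by positivity) ((summable_geometric_of_lt_one h0 h1).mul_left K),
    tsum_mul_left, tsum_geometric_of_lt_one h0 h1]

theorem half_le_log {T : ℝ} (hT : 2 ≤ T) : 1 / 2 ≤ Real.log T := by
  have := Real.log_le_log (by norm_num) hT
  linarith [Real.log_two_gt_d9]

theorem exists_lintegral_zeroError_sub_weighted_le {σ : ℝ} (hσ : 0 < σ) (hσ2 : σ < 1 / 2) :
    ∃ C, 0 ≤ C ∧ ∀ T, 2 ≤ T →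
      ∫⁻ x in Ioi 0, ‖zeroError (rexp (1 / T) * x) - zeroError x‖ₑ ^ 2 * ENNReal.ofReal (x ^ (-2 * σ - 1)) ≤
        ENNReal.ofReal (C * (T ^ (-2 * σ) * Real.log T)) := by
  obtain ⟨m, hm⟩ := exists_nat_gt (1 / (1 - 2 * σ))
  have hm1 : 2 * σ < (m : ℝ) / (m + 1) := by
    rw [div_lt_iff₀ (by linarith)] at hm
    rw [lt_div_iff₀ (by positivity)]
    nlinarith
  set θ := (m : ℝ) / (m + 1) with hθ
  obtain ⟨C₁, hC₁, h₁⟩ := exists_lintegral_zeroError_sub_sq_le m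
  obtain ⟨C₂, hC₂, h₂⟩ := exists_lintegral_zeroError_sub_pow_le (p := 2) (by omega)
  set R₁ := (1 - (1 / 2 : ℝ) ^ (θ - 2 * σ))⁻¹ with hR₁
  set R₂ := (1 - (1 / 2 : ℝ) ^ σ)⁻¹ with hR₂
  have hR : ∀ {δ : ℝ}, 0 < δ → 0 ≤ (1 - (1 / 2 : ℝ) ^ δ)⁻¹ := fun hδ =>
    inv_nonneg.2 (sub_nonneg.2 (Real.rpow_lt_one (by norm_num) (by norm_num) hδ).le)
  have hR₁0 : 0 ≤ R₁ := hR (by linarith)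
  have hR₂0 : 0 ≤ R₂ := hR hσ
  refine ⟨C₂ * (3 + 2 * σ⁻¹) * R₂ + C₁ * 3 * R₁, by positivity, fun T hT => ?_⟩
  have hT0 : 0 < T := by linarith
  have hlT := half_le_log hT
  have hlT0 : 0 < Real.log T := by linarith
  set f : ℝ → ENNReal := fun x => ‖zeroError (rexp (1 / T) * x) - zeroError x‖ₑ ^ 2 with hf
  have hlarge : ∀ y : ℝ, 1 ≤ y → ∫⁻ x in Icc (T * y) (2 * (T * y)), f x * ENNReal.ofReal (x ^ (-2 * σ - 1)) ≤
      ENNReal.ofReal (C₂ * (3 + 2 * σ⁻¹) * (T ^ (-2 * σ) * Real.log T) * y⁻¹ ^ σ) := by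
    intro y hy
    have hy0 : 0 < y := by linarith
    have hU0 : 0 < T * y := by positivity
    have hU1 : 1 ≤ T * y := by nlinarith
    refine (setLIntegral_Icc_mul_rpow_le hσ hU0).trans ?_
    refine (mul_le_mul_left (h₂ T _ hT hU1) _).trans ?_
    rw [← ENNReal.ofReal_mul (by have := Real.log_nonneg hU1; positivity)]
    refine ENNReal.ofReal_le_ofReal ?_
    have hlog : 1 + Real.log (T * y) ≤ (3 + 2 * σ⁻¹) * Real.log T * y ^ σ := by
      rw [Real.log_mul hT0.ne' hy0.ne']
      have a1 := log_le_const_mul_rpow hy0.le hσ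
      have a2 : 1 ≤ y ^ σ := Real.one_le_rpow hy hσ.le
      have a3 : 0 < σ⁻¹ := by positivity
      have a4 : σ⁻¹ * y ^ σ ≤ 2 * σ⁻¹ * Real.log T * y ^ σ := by
        have : 0 ≤ σ⁻¹ * y ^ σ := by positivity
        nlinarith
      nlinarith
    have e1 : (T * y) * (T * y) ^ (-2 * σ - 1) = T ^ (-2 * σ) * (y⁻¹ ^ σ * y⁻¹ ^ σ) := by
      rw [Real.rpow_sub_one hU0.ne', mul_div_cancel₀ _ hU0.ne', Real.mul_rpow hT0.le hy0.le,
        Real.inv_rpow hy0.le, ← Real.rpow_neg hy0.le, ← Real.rpow_add hy0]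
      congr 2; ring
    have e2 : y ^ σ * y⁻¹ ^ σ = 1 := by
      rw [Real.inv_rpow hy0.le, mul_inv_cancel₀ (by positivity)]
    calc C₂ * (T * y * (1 + Real.log (T * y))) * (T * y) ^ (-2 * σ - 1)
        = C₂ * (1 + Real.log (T * y)) * ((T * y) * (T * y) ^ (-2 * σ - 1)) := by ring
      _ ≤ C₂ * ((3 + 2 * σ⁻¹) * Real.log T * y ^ σ) * ((T * y) * (T * y) ^ (-2 * σ - 1)) := by gcongr
      _ = C₂ * (3 + 2 * σ⁻¹) * (T ^ (-2 * σ) * Real.log T) * y⁻¹ ^ σ * (y ^ σ * y⁻¹ ^ σ) := by rw [e1]; ring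
      _ = _ := by rw [e2, mul_one]
  have hsmall : ∀ y : ℝ, 0 < y → y ≤ 1 →
      ∫⁻ x in Icc (T * y) (2 * (T * y)), f x * ENNReal.ofReal (x ^ (-2 * σ - 1)) ≤
      ENNReal.ofReal (C₁ * 3 * (T ^ (-2 * σ) * Real.log T) * y ^ (θ - 2 * σ)) := by
    intro y hy0 hy
    have hU0 : 0 < T * y := by positivity
    rcases le_or_gt 1 (T * y) with hU1 | hU1
    · have hUT : T * y ≤ T := by nlinarith
      refine (setLIntegral_Icc_mul_rpow_le hσ hU0).trans ?_
      refine (mul_le_mul_left (h₁ T _ hT hU1 hUT) _).trans ?_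
      rw [← ENNReal.ofReal_mul (by have := Real.log_nonneg hU1; positivity)]
      refine ENNReal.ofReal_le_ofReal ?_
      have hlog : 1 + Real.log (T * y) ≤ 3 * Real.log T := by
        linarith [Real.log_le_log hU0 hUT]
      have e1 : (T * y) * (T * y) ^ (-2 * σ - 1) = T ^ (-2 * σ) * y ^ (-2 * σ) := by
        rw [Real.rpow_sub_one hU0.ne', mul_div_cancel₀ _ hU0.ne', Real.mul_rpow hT0.le hy0.le]
      have e2 : y ^ (-2 * σ) * y ^ θ = y ^ (θ - 2 * σ) := by
        rw [← Real.rpow_add hy0]; congr 1; ring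
      rw [mul_div_cancel_left₀ y hT0.ne']
      calc C₁ * (T * y * (1 + Real.log (T * y))) * y ^ θ * (T * y) ^ (-2 * σ - 1)
          = C₁ * (1 + Real.log (T * y)) * y ^ θ * ((T * y) * (T * y) ^ (-2 * σ - 1)) := by ring
        _ ≤ C₁ * (3 * Real.log T) * y ^ θ * ((T * y) * (T * y) ^ (-2 * σ - 1)) := by gcongr
        _ = C₁ * 3 * (T ^ (-2 * σ) * Real.log T) * (y ^ (-2 * σ) * y ^ θ) := by rw [e1]; ring
        _ = _ := by rw [e2]
    · rw [setLIntegral_congr_fun (g := fun _ => 0) measurableSet_Icc fun x hx => by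
        have hl2 := exp_inv_le_two hT
        have hb := baseHeight_spec.1
        have hx2 : x ≤ 2 := by linarith [hx.2]
        have hx0 : 0 ≤ x := hU0.le.trans hx.1
        simp only [hf]
        rw [zeroError_of_le (x := x) (by linarith), zeroError_of_le (x := rexp (1 / T) * x) (by nlinarith)]
        simp]
      simp
  refine (lintegral_Ioi_le_tsum_dyadic _ hT0).trans ?_
  have s1 : ∑' k : ℕ, ∫⁻ x in Icc (T * 2 ^ k) (2 * (T * 2 ^ k)), f x * ENNReal.ofReal (x ^ (-2 * σ - 1)) ≤
      ENNReal.ofReal (C₂ * (3 + 2 * σ⁻¹) * (T ^ (-2 * σ) * Real.log T) * R₂) := by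
    refine le_trans (ENNReal.tsum_le_tsum fun k => (hlarge (2 ^ k) (one_le_pow₀ (by norm_num))).trans (le_of_eq ?_))
      (tsum_ofReal_const_mul_rpow_le (by positivity) hσ)
    rw [one_div, inv_pow]
  have s2 : ∑' k : ℕ, ∫⁻ x in Icc (T * (1 / 2) ^ (k + 1)) (2 * (T * (1 / 2) ^ (k + 1))),
      f x * ENNReal.ofReal (x ^ (-2 * σ - 1)) ≤
      ENNReal.ofReal (C₁ * 3 * (T ^ (-2 * σ) * Real.log T) * R₁) := by
    refine le_trans (ENNReal.tsum_le_tsum fun k => (hsmall ((1 / 2) ^ (k + 1)) (by positivity)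
      (pow_le_one₀ (by norm_num) (by norm_num))).trans (ENNReal.ofReal_le_ofReal ?_))
      (tsum_ofReal_const_mul_rpow_le (by positivity) (by linarith))
    refine mul_le_mul_of_nonneg_left (Real.rpow_le_rpow (by positivity)
      (pow_le_pow_of_le_one (by norm_num) (by norm_num) (by omega)) (by linarith)) (by positivity)
  refine (add_le_add s1 s2).trans (le_of_eq ?_)
  rw [← ENNReal.ofReal_add (by positivity) (by positivity)]
  congr 1
  ring

theorem integral_Ioi_zero_zeroError (s : ℂ) :
    ∫ x in Ioi (0:ℝ), (zeroError x : ℂ) * (x : ℂ) ^ (-s - 1) =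
      ∫ x in Ioi baseHeight, (zeroError x : ℂ) * (x : ℂ) ^ (-s - 1) := by
  refine setIntegral_eq_of_subset_of_forall_diff_eq_zero measurableSet_Ioi
    (Ioi_subset_Ioi baseHeight_pos.le) fun x hx => ?_
  rw [zeroError_of_le (not_lt.1 hx.2)]
  simp

theorem integrableOn_Ioi_zero_zeroError {σ : ℝ} (hσ : 0 < σ) :
    IntegrableOn (fun x : ℝ => ‖(zeroError x : ℂ)‖ * x ^ (-σ - 1)) (Ioi 0) := by
  rw [← Ioc_union_Ioi_eq_Ioi baseHeight_pos.le]
  refine IntegrableOn.union ?_ ?_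
  · refine integrableOn_zero.congr_fun (fun x hx => ?_) measurableSet_Ioc
    rw [zeroError_of_le hx.2]; simp
  · have h1 : IntegrableOn (fun x : ℝ => ‖(zeroError x : ℂ) * (x : ℂ) ^ (-(σ : ℂ) - 1)‖) (Ioi baseHeight) :=
      (integrableOn_zeroError_mul_cpow (s := σ) (by simpa using hσ)).norm
    refine h1.congr_fun (fun x hx => ?_) measurableSet_Ioi
    simp only [norm_mul_cpow_neg_sub_one (baseHeight_pos.trans hx), Complex.ofReal_re]

theorem statement7
    (G : ℂ → ℂ)
    (hGser : ∀ s : ℂ, 1 < s.re →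
      G s = ∑' ρ : {ρ : ℂ // IsNontrivialZero ρ ∧ 0 < ρ.im},
        (zetaMult ρ.1 : ℂ) * (ρ.1.im : ℂ) ^ (-s))
    (hGan : ∀ s : ℂ, -1 < s.re → s ≠ 1 → DifferentiableAt ℂ G s)
    : ∀ σ : ℝ, 0 < σ → σ < 1/2 → ∃ C : ℝ, ∀ T : ℝ, 2 ≤ T →
      (∫ t in (1:ℝ)..T, ‖G (σ + t * I)‖ ^ 2) ≤ C * T ^ (2 - 2 * σ) * Real.log T := by
  intro σ hσ hσ2
  obtain ⟨A, hA⟩ := exists_norm_regularPart_le hσ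
  obtain ⟨K, hK, h⟩ := exists_lintegral_zeroError_sub_weighted_le hσ hσ2
  refine ⟨4 * A ^ 2 + 100 * K, fun T hT => ?_⟩
  have hT0 : 0 < T := by linarith
  have hlT := half_le_log hT
  set H : ℝ → ℂ := fun t => ((σ : ℂ) + t * I) * ∫ x in Ioi (0:ℝ), (zeroError x : ℂ) * (x : ℂ) ^ (-((σ : ℂ) + t * I) - 1)
    with hH
  have hpt : ∀ t ∈ Ioc 1 T, ‖‖G (σ + t * I)‖ ^ 2‖ₑ ≤ ENNReal.ofReal (2 * A ^ 2) + 2 * ‖H t‖ₑ ^ 2 := by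
    intro t ht
    have h1 : G (σ + t * I) = regularPart (σ + t * I) + H t := by
      rw [eq_regularPart_add hGser hGan (by simpa using hσ) (by simpa using by linarith [ht.1]),
        ← integral_Ioi_zero_zeroError]
    have h2 := hA t ht.1.le
    have h3 : ‖G (σ + t * I)‖ ^ 2 ≤ 2 * A ^ 2 + 2 * ‖H t‖ ^ 2 := by
      have h4 : ‖G (σ + t * I)‖ ≤ A + ‖H t‖ := by
        rw [h1]; exact (norm_add_le _ _).trans (by gcongr)
      have h5 := pow_le_pow_left₀ (norm_nonneg _) h4 2
      nlinarith [sq_nonneg (A - ‖H t‖)]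
    rw [Real.enorm_of_nonneg (by positivity)]
    refine (ENNReal.ofReal_le_ofReal h3).trans (le_of_eq ?_)
    rw [ENNReal.ofReal_add (by positivity) (by positivity), ENNReal.ofReal_mul (by norm_num : (0:ℝ) ≤ 2) (q := ‖H t‖ ^ 2),
      ENNReal.ofReal_pow (norm_nonneg _), ofReal_norm_eq_enorm, ENNReal.ofReal_ofNat]
  have hP := lintegral_mellin_sq_le_difference (f := fun x => (zeroError x : ℂ)) hσ.le hT0
    (integrableOn_Ioi_zero_zeroError hσ) measurable_ofReal_zeroError
  have hdiff : ∀ x : ℝ, ‖(zeroError (rexp (1 / T) * x) : ℂ) - (zeroError x : ℂ)‖ₑ =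
      ‖zeroError (rexp (1 / T) * x) - zeroError x‖ₑ := fun x => by
    rw [← Complex.ofReal_sub, ← ofReal_norm_eq_enorm, Complex.norm_real, ofReal_norm_eq_enorm]
  simp only [hdiff] at hP
  have hHint : ∫⁻ t in Ioc 1 T, ‖H t‖ₑ ^ 2 ≤ ENNReal.ofReal (50 * T ^ 2 * (K * (T ^ (-2 * σ) * Real.log T))) := by
    refine (lintegral_mono_set (fun t ht => ⟨by linarith [ht.1], ht.2⟩ : Ioc 1 T ⊆ Icc (-T) T)).trans (hP.trans ?_)
    rw [ENNReal.ofReal_mul (by positivity : 0 ≤ 50 * T ^ 2)]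
    exact mul_le_mul_right (h T hT) _
  have hmain : ∫⁻ t in Ioc 1 T, ‖‖G (σ + t * I)‖ ^ 2‖ₑ ≤
      ENNReal.ofReal (2 * A ^ 2 * T + 2 * (50 * T ^ 2 * (K * (T ^ (-2 * σ) * Real.log T)))) := by
    refine (setLIntegral_mono' measurableSet_Ioc hpt).trans ?_
    rw [lintegral_add_left measurable_const, setLIntegral_const, Real.volume_Ioc,
      lintegral_const_mul' _ _ (by finiteness), ENNReal.ofReal_add (by positivity) (by positivity)]
    refine add_le_add ?_ ?_
    · rw [← ENNReal.ofReal_mul (by positivity)]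
      refine ENNReal.ofReal_le_ofReal ?_
      gcongr
      linarith
    · rw [ENNReal.ofReal_mul (by norm_num : (0:ℝ) ≤ 2), ENNReal.ofReal_ofNat]
      gcongr
  rw [intervalIntegral.integral_of_le (by linarith)]
  have hfin := (enorm_integral_le_lintegral_enorm _).trans hmain
  rw [Real.enorm_of_nonneg (integral_nonneg fun t => by positivity)] at hfin
  refine ((ENNReal.ofReal_le_ofReal_iff (by positivity)).1 hfin).trans ?_
  have e1 : T ^ 2 * T ^ (-2 * σ) = T ^ (2 - 2 * σ) := by
    rw [← Real.rpow_natCast, ← Real.rpow_add hT0]; congr 1; push_cast; ring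
  have e2 : T ≤ T ^ (2 - 2 * σ) := by
    conv_lhs => rw [← Real.rpow_one T]
    exact Real.rpow_le_rpow_of_exponent_le (by linarith) (by linarith)
  have e3 : T ≤ 2 * (T ^ (2 - 2 * σ) * Real.log T) := by
    have : 0 ≤ T ^ (2 - 2 * σ) := by positivity
    nlinarith
  calc 2 * A ^ 2 * T + 2 * (50 * T ^ 2 * (K * (T ^ (-2 * σ) * Real.log T)))
      ≤ 2 * A ^ 2 * (2 * (T ^ (2 - 2 * σ) * Real.log T)) + 100 * K * (T ^ 2 * T ^ (-2 * σ)) * Real.log T := by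
        have : 2 * A ^ 2 * T ≤ 2 * A ^ 2 * (2 * (T ^ (2 - 2 * σ) * Real.log T)) := by gcongr
        linarith
    _ = _ := by rw [e1]; ring
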